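/- There exists an absolute constant c_e > 0 such that for every dimension d ≥ 2 the following holds. Let B ⊆ ℝ^d be a centrally symmetric convex body in isotropic position, i.e., ∫_B x dλ_d(x) = 0 and (1/λ_d(B))·∫_B ⟨x,u⟩² dλ_d(x) = 1 for every unit vector u. Let E ⊆ ℝ^d be a convex body with 0 < λ_d(E ∩ B) < λ_d(B), and set μ := λ_d(E ∩ B)/λ_d(B) and β := H^{d−1}(∂E ∩ int(B)) / H^{d−1}(∂B), where H^{d−1} is (d−1)-dimensional Hausdorff measure and ∂ denotes the topological frontier. Then β ≥ (c_e/(d·√(log d))) · min(μ, 1 − μ). -/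

import Mathlib

open Set MeasureTheory Metric
open scoped Pointwise RealInnerProductSpace ENNReal

noncomputable section

abbrev Euc (d : ℕ) := EuclideanSpace ℝ (Fin d)

/-- A convex body: a compact convex set with nonempty interior. -/
def IsConvexBody {d : ℕ} (K : Set (Euc d)) : Prop :=
  IsCompact K ∧ Convex ℝ K ∧ (interior K).Nonempty

/-- The polar of a set. -/
def polarSet {d : ℕ} (S : Set (Euc d)) : Set (Euc d) :=
  {y | ∀ x ∈ S, ⟪x, y⟫ ≤ 1}

/-- The Hilbert distance with respect to the body `K`. -/
def hilbertDist {d : ℕ} (K : Set (Euc d)) (x y : Euc d) : ℝ :=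
  -(1 / 2) * Real.log ((1 - gauge ((fun k => k - x) '' K) (y - x)) *
    (1 - gauge ((fun k => k - y) '' K) (x - y)))

/-- The Hilbert ball of radius `r` centered at `x`. -/
def hilbertBall {d : ℕ} (K : Set (Euc d)) (x : Euc d) (r : ℝ) : Set (Euc d) :=
  {y ∈ interior K | hilbertDist K x y ≤ r}

/-- The Hilbert covering number of `U` at scale `α` in the geometry induced by `K`. -/
def hilbertCov {d : ℕ} (K U : Set (Euc d)) (α : ℝ) : ℕ :=
  sInf {m : ℕ | ∃ x : Fin m → Euc d, (∀ i, x i ∈ interior K) ∧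
    U ⊆ ⋃ i, hilbertBall K (x i) α}

/-- The translative covering number of `U` by translates of `α • D`. -/
def transCov {d : ℕ} (D U : Set (Euc d)) (α : ℝ) : ℕ :=
  sInf {m : ℕ | ∃ x : Fin m → Euc d, U ⊆ ⋃ i, x i +ᵥ α • D}

/-- The Hilbert `α`-expansion of `G` in `K`. -/
def hilbertExpand {d : ℕ} (K G : Set (Euc d)) (α : ℝ) : Set (Euc d) :=
  {x ∈ interior K | sInf (hilbertDist K x '' G) ≤ α}

/-- The Lebesgue volume of the Euclidean unit ball in `ℝ^d`. -/
def ωd (d : ℕ) : ℝ := (volume (ball (0 : Euc d) 1)).toReal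

/-- The Hilbert Finsler unit ball at `y` in the geometry induced by `K`. -/
def finslerBall {d : ℕ} (K : Set (Euc d)) (y : Euc d) : Set (Euc d) :=
  {v | gauge ((fun k => k - y) '' K) v + gauge ((fun k => k - y) '' K) (-v) ≤ 2}

/-- The Hilbert Holmes–Thompson volume of `U` in the geometry induced by `K`. -/
def volH {d : ℕ} (K U : Set (Euc d)) : ℝ :=
  (1 / ωd d) * ∫ y in U, (volume (polarSet (finslerBall K y))).toReal

/-- The recentered Macbeath region `A(x) := (K ∩ (2x − K)) − x`. -/
def macbeathA {d : ℕ} (K : Set (Euc d)) (x : Euc d) : Set (Euc d) :=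
  (fun k => k - x) '' (K ∩ ((fun k => (2 : ℝ) • x - k) '' K))

section
set_option linter.all false

theorem pl_sum1 {A B M : Set ℝ} {θ : ℝ} (h0 : 0 < θ) (h1 : θ < 1) (hA : MeasurableSet A)
    (hB : MeasurableSet B) (hAn : A.Nonempty) (hBn : B.Nonempty)
    (hM : ∀ x ∈ A, ∀ y ∈ B, (1 - θ) * x + θ * y ∈ M) :
    ENNReal.ofReal (1 - θ) * volume A + ENNReal.ofReal θ * volume B ≤ volume M := by
  have sc : ∀ (a c : ℝ) (S : Set ℝ), 0 < a → volume ((fun x => a * x + c) '' S) = ENNReal.ofReal a * volume S := by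
    intro a c S ha
    have : (fun x => a * x + c) '' S = (fun x => x + c) '' ((fun x => a • x) '' S) := by
      rw [image_image]; simp
    rw [this, image_add_right, measure_preimage_add_right]
    have := Measure.addHaar_smul (volume : Measure ℝ) a S
    simp only [Module.finrank_self, pow_one, abs_of_pos ha] at this
    exact this
  -- compact nonempty case
  have key : ∀ K ⊆ A, ∀ L ⊆ B, IsCompact K → IsCompact L → K.Nonempty → L.Nonempty →
      ENNReal.ofReal (1 - θ) * volume K + ENNReal.ofReal θ * volume L ≤ volume M := by
    intro K hK L hL hKc hLc hKn hLn
    obtain ⟨a, haK, ha⟩ := hKc.exists_isGreatest hKn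
    obtain ⟨b, hbL, hb⟩ := hLc.exists_isLeast hLn
    set S := (fun x => (1 - θ) * x + θ * b) '' K
    set T := (fun y => θ * y + (1 - θ) * a) '' L
    have hS : MeasurableSet S := (hKc.image (by fun_prop)).measurableSet
    have hd : volume (S ∩ T) = 0 := by
      refine measure_mono_null (t := {(1 - θ) * a + θ * b}) ?_ (by simp)
      rintro z ⟨⟨x, hx, rfl⟩, ⟨y, hy, hxy⟩⟩
      have := ha hx
      have := hb hy
      simp only [mem_singleton_iff]
      simp only at hxy
      have e1 := mul_le_mul_of_nonneg_left (ha hx) (by linarith : 0 ≤ 1 - θ)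
      have e2 := mul_le_mul_of_nonneg_left (hb hy) h0.le
      linarith
    have hsub : S ∪ T ⊆ M := by
      rintro z (⟨x, hx, rfl⟩ | ⟨y, hy, rfl⟩)
      · exact hM x (hK hx) b (hL hbL)
      · have := hM a (hK haK) y (hL hy)
        simp only
        rwa [add_comm]
    have hun : volume (S ∪ T) = volume S + volume T := by
      have := measure_union_add_inter (μ := volume) T hS
      rw [inter_comm, hd, add_zero, union_comm, add_comm] at this
      exact this
    rw [← sc (1 - θ) (θ * b) K (by linarith), ← sc θ ((1 - θ) * a) L h0, ← hun]
    exact measure_mono hsub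
  have key2 : ∀ L ⊆ B, IsCompact L → L.Nonempty →
      ENNReal.ofReal (1 - θ) * volume A + ENNReal.ofReal θ * volume L ≤ volume M := by
    intro L hL hLc hLn
    rw [hA.measure_eq_iSup_isCompact, ENNReal.mul_iSup, ENNReal.iSup_add]
    refine iSup_le fun K => ?_
    simp only [ENNReal.mul_iSup]
    obtain ⟨x, hx⟩ := hAn
    by_cases hKA : K ⊆ A
    swap
    · have := key {x} (by simpa using hx) L hL isCompact_singleton hLc (by simp) hLn
      simpa [hKA] using this
    by_cases hKc : IsCompact K
    swap
    · have := key {x} (by simpa using hx) L hL isCompact_singleton hLc (by simp) hLn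
      simpa [hKc] using this
    simp only [hKA, hKc, iSup_pos]
    refine le_trans ?_ (key (insert x K) (insert_subset hx hKA) L hL (hKc.insert x) hLc (by simp) hLn)
    gcongr
    simp
  obtain ⟨y, hy⟩ := hBn
  rw [hB.measure_eq_iSup_isCompact, ENNReal.mul_iSup, ENNReal.add_iSup]
  refine iSup_le fun K => ?_
  simp only [ENNReal.mul_iSup]
  by_cases hKA : K ⊆ B
  swap
  · have := key2 {y} (by simpa using hy) isCompact_singleton (by simp)
    simpa [hKA] using this
  by_cases hKc : IsCompact K
  swap
  · have := key2 {y} (by simpa using hy) isCompact_singleton (by simp)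
    simpa [hKc] using this
  simp only [hKA, hKc, iSup_pos]
  refine le_trans ?_ (key2 (insert y K) (insert_subset hy hKA) (hKc.insert y) (by simp))
  gcongr
  simp

/-- normalised one-dimensional PL -/
theorem pl_one_norm {f g h : ℝ → ℝ} {θ : ℝ} (h0 : 0 < θ) (h1 : θ < 1)
    (hf : Measurable f) (hg : Measurable g) (hh : Measurable h)
    (f0 : ∀ x, 0 ≤ f x) (g0 : ∀ x, 0 ≤ g x) (k0 : ∀ x, 0 ≤ h x)
    (f1 : ∀ x, f x ≤ 1) (g1 : ∀ x, g x ≤ 1)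
    (fs : ∀ t < 1, ∃ x, t < f x) (gs : ∀ t < 1, ∃ x, t < g x)
    (H : ∀ x y, f x ^ (1 - θ) * g y ^ θ ≤ h ((1 - θ) * x + θ * y)) :
    ENNReal.ofReal (1 - θ) * (∫⁻ x, ENNReal.ofReal (f x)) + ENNReal.ofReal θ * (∫⁻ x, ENNReal.ofReal (g x)) ≤
      ∫⁻ x, ENNReal.ofReal (h x) := by
  have lc : ∀ (f : ℝ → ℝ), Measurable f → (∀ x, 0 ≤ f x) → (∀ x, f x ≤ 1) →
      ∫⁻ x, ENNReal.ofReal (f x) = ∫⁻ t in Ioo (0:ℝ) 1, volume {a | t < f a} := by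
    intro f hf f0 f1
    rw [lintegral_eq_lintegral_meas_lt _ (Filter.Eventually.of_forall f0) hf.aemeasurable]
    rw [← Ioo_union_Ici_eq_Ioi (show (0:ℝ) < 1 by norm_num), lintegral_union measurableSet_Ici
      (by rw [Set.disjoint_left]; intro x hx hx'; exact absurd hx.2 (not_lt.2 hx'))]
    have : ∫⁻ t in Ici (1:ℝ), volume {a | t < f a} = 0 := by
      rw [setLIntegral_congr_fun (g := fun _ => 0) measurableSet_Ici]
      · simp
      · intro t ht
        have : {a | t < f a} = ∅ := by
          ext a; simp; exact (f1 a).trans ht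
        simp [this]
    rw [this, add_zero]
  have mono : ∀ f : ℝ → ℝ, Measurable fun t : ℝ => volume {a | t < f a} := by
    intro f
    refine Antitone.measurable fun s t hst => measure_mono fun a (ha : t < f a) => lt_of_le_of_lt hst ha
  rw [lc f hf f0 f1, lc g hg g0 g1, lintegral_eq_lintegral_meas_lt _ (Filter.Eventually.of_forall k0) hh.aemeasurable,
    ← lintegral_const_mul _ (mono f), ← lintegral_const_mul _ (mono g), ← lintegral_add_left ((mono f).const_mul _)]
  refine le_trans (setLIntegral_mono' measurableSet_Ioo ?_) (lintegral_mono_set Ioo_subset_Ioi_self)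
  intro t ht
  refine pl_sum1 h0 h1 (measurableSet_lt measurable_const hf) (measurableSet_lt measurable_const hg)
    (fs t ht.2) (gs t ht.2) ?_
  intro x hx y hy
  refine lt_of_lt_of_le ?_ (H x y)
  calc t = t ^ (1 - θ) * t ^ θ := by rw [← Real.rpow_add ht.1]; simp
    _ < f x ^ (1 - θ) * g y ^ θ := by
        refine mul_lt_mul'' (Real.rpow_lt_rpow ht.1.le hx (by linarith)) (Real.rpow_lt_rpow ht.1.le hy h0)
          (Real.rpow_nonneg ht.1.le _) (Real.rpow_nonneg ht.1.le _)

theorem pl_one {f g h : ℝ → ℝ} {θ : ℝ} (h0 : 0 < θ) (h1 : θ < 1)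
    (hf : Measurable f) (hg : Measurable g) (hh : Measurable h)
    (f0 : ∀ x, 0 ≤ f x) (g0 : ∀ x, 0 ≤ g x) (k0 : ∀ x, 0 ≤ h x)
    (f1 : BddAbove (range f)) (g1 : BddAbove (range g))
    (fi : Integrable f) (gi : Integrable g) (hi : Integrable h)
    (H : ∀ x y, f x ^ (1 - θ) * g y ^ θ ≤ h ((1 - θ) * x + θ * y)) :
    (∫ x, f x) ^ (1 - θ) * (∫ x, g x) ^ θ ≤ ∫ x, h x := by
  set F := ⨆ x, f x with hF
  set G := ⨆ x, g x with hG
  have fF : ∀ x, f x ≤ F := le_ciSup f1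
  have gG : ∀ x, g x ≤ G := le_ciSup g1
  have hi0 : 0 ≤ ∫ x, h x := integral_nonneg k0
  rcases (le_trans (f0 0) (fF 0)).eq_or_lt with hF0 | hF0
  · have : f = fun _ => 0 := funext fun x => le_antisymm (by rw [hF0]; exact fF x) (f0 x)
    rw [this, integral_zero, Real.zero_rpow (by linarith), zero_mul]; exact hi0
  rcases (le_trans (g0 0) (gG 0)).eq_or_lt with hG0 | hG0
  · have : g = fun _ => 0 := funext fun x => le_antisymm (by rw [hG0]; exact gG x) (g0 x)
    rw [this, integral_zero, Real.zero_rpow (by linarith), mul_zero]; exact hi0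
  set D := F ^ (1 - θ) * G ^ θ with hD
  have hD0 : 0 < D := by positivity
  have := pl_one_norm (f := fun x => f x / F) (g := fun x => g x / G) (h := fun x => h x / D) h0 h1
    (hf.div_const _) (hg.div_const _) (hh.div_const _)
    (fun x => div_nonneg (f0 x) hF0.le) (fun x => div_nonneg (g0 x) hG0.le) (fun x => div_nonneg (k0 x) hD0.le)
    (fun x => (div_le_one hF0).2 (fF x)) (fun x => (div_le_one hG0).2 (gG x))
    (by
      intro t ht
      have : t * F < F := by nlinarith
      obtain ⟨x, hx⟩ := exists_lt_of_lt_ciSup this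
      exact ⟨x, (lt_div_iff₀ hF0).2 hx⟩)
    (by
      intro t ht
      have : t * G < G := by nlinarith
      obtain ⟨x, hx⟩ := exists_lt_of_lt_ciSup this
      exact ⟨x, (lt_div_iff₀ hG0).2 hx⟩)
    (by
      intro x y
      rw [Real.div_rpow (f0 x) hF0.le, Real.div_rpow (g0 y) hG0.le, div_mul_div_comm, ← hD]
      gcongr
      exact H x y)
  rw [← ofReal_integral_eq_lintegral_ofReal (fi.div_const _) (Filter.Eventually.of_forall fun x => div_nonneg (f0 x) hF0.le),
    ← ofReal_integral_eq_lintegral_ofReal (gi.div_const _) (Filter.Eventually.of_forall fun x => div_nonneg (g0 x) hG0.le),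
    ← ofReal_integral_eq_lintegral_ofReal (hi.div_const _) (Filter.Eventually.of_forall fun x => div_nonneg (k0 x) hD0.le),
    integral_div, integral_div, integral_div] at this
  have fi0 : 0 ≤ (∫ x, f x) := integral_nonneg f0
  have gi0 : 0 ≤ (∫ x, g x) := integral_nonneg g0
  rw [← ENNReal.ofReal_mul (by linarith), ← ENNReal.ofReal_mul (by linarith),
    ← ENNReal.ofReal_add (mul_nonneg (by linarith) (by positivity)) (by positivity), ENNReal.ofReal_le_ofReal_iff (by positivity)] at this
  have am := Real.geom_mean_le_arith_mean2_weighted (w₁ := 1 - θ) (w₂ := θ) (p₁ := (∫ x, f x) / F)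
    (p₂ := (∫ x, g x) / G) (by linarith) h0.le (by positivity) (by positivity) (by ring)
  rw [Real.div_rpow fi0 hF0.le, Real.div_rpow gi0 hG0.le, div_mul_div_comm, ← hD] at am
  exact (div_le_div_iff_of_pos_right hD0).1 (am.trans this)

/-- multiplicative Brunn-Minkowski for bounded measurable sets -/
theorem log_bm (n : ℕ) : ∀ {K L M : Set (Fin n → ℝ)} {θ : ℝ} (_ : 0 < θ) (_ : θ < 1)
    (_ : MeasurableSet K) (_ : MeasurableSet L) (_ : MeasurableSet M)
    (_ : Bornology.IsBounded K) (_ : Bornology.IsBounded L) (_ : Bornology.IsBounded M)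
    (_ : ∀ x ∈ K, ∀ y ∈ L, (1 - θ) • x + θ • y ∈ M),
    (volume K).toReal ^ (1 - θ) * (volume L).toReal ^ θ ≤ (volume M).toReal := by
  induction n with
  | zero =>
    intro K L M θ h0 h1 _ _ _ _ _ _ H
    rcases K.eq_empty_or_nonempty with rfl | hK
    · simp only [measure_empty, ENNReal.toReal_zero, Real.zero_rpow (by linarith : (1:ℝ) - θ ≠ 0), zero_mul]
      exact ENNReal.toReal_nonneg
    rcases L.eq_empty_or_nonempty with rfl | hL
    · simp only [measure_empty, ENNReal.toReal_zero, Real.zero_rpow h0.ne', mul_zero]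
      exact ENNReal.toReal_nonneg
    obtain ⟨x, hx⟩ := hK
    obtain ⟨y, hy⟩ := hL
    have e : ∀ S : Set (Fin 0 → ℝ), S.Nonempty → S = univ := fun S hS => Subsingleton.eq_univ_of_nonempty hS
    rw [e K ⟨x, hx⟩, e L ⟨y, hy⟩, e M ⟨_, H x hx y hy⟩]
    simp [volume_pi]
  | succ n ih =>
    intro K L M θ h0 h1 hK hL hM bK bL bM H
    let sl : Set (Fin (n + 1) → ℝ) → ℝ → Set (Fin n → ℝ) := fun S x => {z | Fin.cons x z ∈ S}
    have consm : Measurable fun p : ℝ × (Fin n → ℝ) => (Fin.cons p.1 p.2 : Fin (n+1) → ℝ) := by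
      rw [measurable_pi_iff]
      intro i
      refine Fin.cases ?_ (fun j => ?_) i
      · simpa using measurable_fst
      · simp only [Fin.cons_succ]
        exact (measurable_pi_apply j).comp measurable_snd
    have slm : ∀ S, MeasurableSet S → ∀ x, MeasurableSet (sl S x) := by
      intro S hS x
      exact hS.preimage (consm.comp (measurable_const.prodMk measurable_id))
    have slb : ∀ S : Set (Fin (n + 1) → ℝ), Bornology.IsBounded S → ∃ R : ℝ, 0 ≤ R ∧ (∀ x, sl S x ⊆ closedBall 0 R) ∧
        (∀ x, x ∉ Icc (-R) R → sl S x = ∅) := by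
      intro S hS
      obtain ⟨R, hR⟩ := hS.subset_closedBall 0
      have hm : ∀ x z, z ∈ sl S x → (Fin.cons x z : Fin (n+1) → ℝ) ∈ closedBall (0 : Fin (n+1) → ℝ) (max R 0) := fun x z hz =>
        closedBall_subset_closedBall (le_max_left _ _) (hR hz)
      refine ⟨max R 0, le_max_right _ _, ?_, ?_⟩
      · intro x z hz
        have h2 := hm x z hz
        rw [mem_closedBall, dist_pi_le_iff (le_max_right _ _)] at h2 ⊢
        intro i
        simpa using h2 i.succ
      · intro x hx
        by_contra hne
        obtain ⟨z, hz⟩ := Set.nonempty_iff_ne_empty.2 hne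
        have h2 := hm x z hz
        rw [mem_closedBall, dist_pi_le_iff (le_max_right _ _)] at h2
        have h3 := h2 0
        simp [Real.dist_eq] at h3
        apply hx
        rw [mem_Icc]
        rcases h3 with h3 | h3
        · have := abs_le.1 h3
          exact ⟨(neg_le_neg (le_max_left _ _)).trans this.1, this.2.trans (le_max_left _ _)⟩
        · simp [h3]
    have fub : ∀ S, MeasurableSet S → Bornology.IsBounded S →
        Measurable (fun x => (volume (sl S x)).toReal) ∧ Integrable (fun x => (volume (sl S x)).toReal) ∧
        BddAbove (range fun x => (volume (sl S x)).toReal) ∧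
        (volume S).toReal = ∫ x, (volume (sl S x)).toReal := by
      intro S hS hb
      obtain ⟨R, hR0, hR1, hR2⟩ := slb S hb
      have mp := (volume_preserving_piFinSuccAbove (fun _ : Fin (n+1) => ℝ) 0).symm
      have hpre : MeasurableSet ((MeasurableEquiv.piFinSuccAbove (fun _ => ℝ) 0).symm ⁻¹' S) :=
        mp.measurable hS
      have es : ∀ x, Prod.mk x ⁻¹' ((MeasurableEquiv.piFinSuccAbove (fun _ => ℝ) 0).symm ⁻¹' S) = sl S x := by
        intro x
        ext z
        simp [sl, MeasurableEquiv.piFinSuccAbove, Fin.insertNthEquiv]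
      have e1 : volume S = ∫⁻ x, volume (sl S x) := by
        rw [← mp.measure_preimage hS.nullMeasurableSet]
        rw [Measure.volume_eq_prod, Measure.prod_apply hpre]
        simp only [es]
      have mm : Measurable fun x => volume (sl S x) := by
        have := measurable_measure_prodMk_left (ν := (volume : Measure (Fin n → ℝ))) hpre
        simpa only [es] using this
      have bb : ∀ x, volume (sl S x) ≤ volume (closedBall (0 : Fin n → ℝ) R) := fun x => measure_mono (hR1 x)
      have fin : volume (closedBall (0 : Fin n → ℝ) R) < ∞ := measure_closedBall_lt_top
      have b2 : ∀ x, (volume (sl S x)).toReal ≤ (volume (closedBall (0 : Fin n → ℝ) R)).toReal := fun x =>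
        ENNReal.toReal_mono fin.ne (bb x)
      refine ⟨mm.ennreal_toReal, ?_, ⟨_, by rintro _ ⟨x, rfl⟩; exact b2 x⟩, ?_⟩
      · have : Integrable ((Icc (-R) R).indicator fun _ : ℝ => (volume (closedBall (0 : Fin n → ℝ) R)).toReal) :=
          (integrable_indicator_iff measurableSet_Icc).2 (integrableOn_const (by simp))
        refine this.mono' mm.ennreal_toReal.aestronglyMeasurable (Filter.Eventually.of_forall fun x => ?_)
        rw [Real.norm_of_nonneg ENNReal.toReal_nonneg]
        by_cases hx : x ∈ Icc (-R) R
        · rw [indicator_of_mem hx]; exact b2 x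
        · rw [indicator_of_notMem hx, hR2 x hx]; simp
      · rw [e1, integral_toReal mm.aemeasurable (Filter.Eventually.of_forall fun x => lt_of_le_of_lt (bb x) fin)]
    obtain ⟨Km, Ki, Kb, Ke⟩ := fub K hK bK
    obtain ⟨Lm, Li, Lb, Le⟩ := fub L hL bL
    obtain ⟨Mm, Mi, Mb, Me⟩ := fub M hM bM
    rw [Ke, Le, Me]
    refine pl_one h0 h1 Km Lm Mm (fun _ => ENNReal.toReal_nonneg) (fun _ => ENNReal.toReal_nonneg)
      (fun _ => ENNReal.toReal_nonneg) Kb Lb Ki Li Mi ?_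
    intro x y
    have bs : ∀ S x, Bornology.IsBounded S → Bornology.IsBounded (sl S x) := by
      intro S x hb
      obtain ⟨R, -, hR1, -⟩ := slb S hb
      exact isBounded_closedBall.subset (hR1 x)
    refine ih h0 h1 (slm K hK x) (slm L hL y) (slm M hM _) (bs _ _ bK) (bs _ _ bL) (bs _ _ bM) ?_
    intro z hz w hw
    have := H _ hz _ hw
    show Fin.cons _ _ ∈ M
    convert this using 1
    ext i
    refine Fin.cases ?_ (fun j => ?_) i <;> simp

end

section
set_option linter.all false

namespace Disc
variable {ι : Type*} [Fintype ι] [DecidableEq ι] {G : Type*} [AddCommGroup G] [Fintype G]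

/-- difference quotient -/
def dq (e : ι → G) (ε : ℝ) (i : ι) (h : G → ℝ) (k : G) : ℝ := (h (k + e i) - h k) / ε
/-- negative adjoint of the difference quotient -/
def ad (e : ι → G) (ε : ℝ) (p : G → ℝ) (i : ι) (h : G → ℝ) (k : G) : ℝ :=
  (h k - p (k - e i) / p k * h (k - e i)) / ε
def cc (e : ι → G) (ε : ℝ) (p : G → ℝ) (j i : ι) (k : G) : ℝ :=
  (p (k + e i - e j) / p (k + e i) - p (k - e j) / p k) / ε ^ 2

theorem ibp (e : ι → G) (ε : ℝ) {p : G → ℝ} (hp : ∀ k, 0 < p k) (i : ι) (h u : G → ℝ) :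
    ∑ k, p k * (ad e ε p i h k * u k) = - ∑ k, p k * (h k * dq e ε i u k) := by
  have e1 : ∀ k, p k * (ad e ε p i h k * u k) = p k * h k * u k / ε - p (k - e i) * h (k - e i) * u k / ε := by
    intro k; unfold ad
    have := (hp k).ne'
    field_simp
  have e2 : ∀ k, p k * (h k * dq e ε i u k) = p k * h k * u (k + e i) / ε - p k * h k * u k / ε := by
    intro k; unfold dq; ring
  simp only [e1, e2, Finset.sum_sub_distrib]
  have : ∑ k, p (k - e i) * h (k - e i) * u k / ε = ∑ k, p k * h k * u (k + e i) / ε := by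
    rw [← Equiv.sum_comp (Equiv.addRight (e i)) (fun k => p (k - e i) * h (k - e i) * u k / ε)]
    simp
  rw [this]; ring

theorem comm (e : ι → G) {ε : ℝ} (hε : ε ≠ 0) {p : G → ℝ} (i j : ι) (h : G → ℝ) (k : G) :
    dq e ε i (ad e ε p j h) k = ad e ε p j (dq e ε i h) k - cc e ε p j i k * h (k + e i - e j) := by
  have : k - e j + e i = k + e i - e j := by abel
  simp only [dq, ad, cc, this]
  field_simp
  ring

theorem bochner (e : ι → G) {ε : ℝ} (hε : ε ≠ 0) {p : G → ℝ} (hp : ∀ k, 0 < p k) (g : ι → G → ℝ) :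
    ∑ k, p k * (∑ i, ad e ε p i (g i) k) ^ 2 =
      ∑ i, ∑ j, ∑ k, p k * (dq e ε i (g j) k * dq e ε j (g i) k) +
      ∑ i, ∑ j, ∑ k, p k * (cc e ε p j i k * (g i k * g j (k + e i - e j))) := by
  have e1 : ∑ k, p k * (∑ i, ad e ε p i (g i) k) ^ 2 =
      ∑ i, ∑ j, ∑ k, p k * (ad e ε p i (g i) k * ad e ε p j (g j) k) := by
    simp_rw [sq, Finset.sum_mul_sum, Finset.mul_sum]
    rw [Finset.sum_comm]
    refine Finset.sum_congr rfl fun i _ => ?_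
    rw [Finset.sum_comm]
  rw [e1, ← Finset.sum_add_distrib]
  refine Finset.sum_congr rfl fun i _ => ?_
  rw [← Finset.sum_add_distrib]
  refine Finset.sum_congr rfl fun j _ => ?_
  rw [ibp e ε hp]
  simp_rw [comm e hε]
  have e2 : ∀ k, p k * (g i k * (ad e ε p j (dq e ε i (g j)) k - cc e ε p j i k * g j (k + e i - e j))) =
      p k * (ad e ε p j (dq e ε i (g j)) k * g i k) - p k * (cc e ε p j i k * (g i k * g j (k + e i - e j))) := by
    intro k; ring
  simp_rw [e2, Finset.sum_sub_distrib]
  rw [ibp e ε hp]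
  ring

end Disc

namespace Disc
variable {ι : Type*} [Fintype ι] [DecidableEq ι] {n : ℕ} [NeZero n]

def ee (n : ℕ) (i : ι) : ι → ZMod n := Pi.single i 1

/-- interior points of the torus (all coordinates different from the ghost value `-1`) -/
def inQ (k : ι → ZMod n) : Prop := ∀ i, k i ≠ -1

def chi (i : ι) (k : ι → ZMod n) : Prop := inQ k ∧ inQ (k + ee n i)

open Classical in
def gr (ε : ℝ) (f : (ι → ZMod n) → ℝ) (i : ι) (k : ι → ZMod n) : ℝ :=
  if chi i k then (f (k + ee n i) - f k) / ε else 0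

theorem ee_self (i : ι) : ee n i i = 1 := by simp [ee]
theorem ee_ne {i j : ι} (h : j ≠ i) : ee n i j = 0 := by simp [ee, h]

theorem chi_iff {i : ι} {k : ι → ZMod n} : chi i k ↔ inQ k ∧ k i + 1 ≠ -1 := by
  constructor
  · rintro ⟨h1, h2⟩
    refine ⟨h1, ?_⟩
    have := h2 i
    simpa [ee_self] using this
  · rintro ⟨h1, h2⟩
    refine ⟨h1, fun j => ?_⟩
    by_cases hj : j = i
    · subst hj; simpa [ee_self] using h2
    · simpa [ee_ne hj] using h1 j

theorem a_ge (ε : ℝ) (f : (ι → ZMod n) → ℝ) (i j : ι) (k : ι → ZMod n) :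
    0 ≤ dq (ee n) ε i (gr ε f j) k * dq (ee n) ε j (gr ε f i) k ∧
    (chi i k → dq (ee n) ε i (gr ε f j) k ^ 2 ≤ dq (ee n) ε i (gr ε f j) k * dq (ee n) ε j (gr ε f i) k) := by
  by_cases hij : i = j
  · subst hij
    exact ⟨mul_self_nonneg _, fun _ => (sq _).le⟩
  have hji : j ≠ i := fun h => hij h.symm
  by_cases hj : chi j k
  · by_cases hi : chi i k
    · -- all four
      rw [chi_iff] at hi hj
      have h1 : chi j (k + ee n i) := by
        rw [chi_iff]; refine ⟨(chi_iff.2 hi).2, ?_⟩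
        simpa [ee_ne hji] using hj.2
      have h2 : chi i (k + ee n j) := by
        rw [chi_iff]; refine ⟨(chi_iff.2 hj).2, ?_⟩
        simpa [ee_ne hij] using hi.2
      have : dq (ee n) ε j (gr ε f i) k = dq (ee n) ε i (gr ε f j) k := by
        unfold dq gr
        rw [if_pos h1, if_pos h2, if_pos (chi_iff.2 hi), if_pos (chi_iff.2 hj), add_right_comm k]
        ring
      rw [this]
      exact ⟨mul_self_nonneg _, fun _ => (sq _).le⟩
    · have h1 : gr ε f i k = 0 := if_neg hi
      have h2 : gr ε f i (k + ee n j) = 0 := by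
        refine if_neg fun h => hi ?_
        rw [chi_iff] at h ⊢
        refine ⟨hj.1, ?_⟩
        simpa [ee_ne hij] using h.2
      have : dq (ee n) ε j (gr ε f i) k = 0 := by unfold dq; rw [h1, h2]; simp
      rw [this]; simp [hi]
  · have h1 : gr ε f j k = 0 := if_neg hj
    by_cases hi : chi i k
    · have h2 : gr ε f j (k + ee n i) = 0 := by
        refine if_neg fun h => hj ?_
        rw [chi_iff] at h ⊢
        refine ⟨hi.1, ?_⟩
        simpa [ee_ne hji] using h.2
      have : dq (ee n) ε i (gr ε f j) k = 0 := by unfold dq; rw [h1, h2]; simp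
      rw [this]; simp
    · by_cases hk : inQ k
      · have h2 : gr ε f j (k + ee n i) = 0 := by
          refine if_neg fun h => hj ?_
          rw [chi_iff] at h ⊢
          refine ⟨hk, ?_⟩
          simpa [ee_ne hji] using h.2
        have : dq (ee n) ε i (gr ε f j) k = 0 := by unfold dq; rw [h1, h2]; simp
        rw [this]; simp
      · have h3 : gr ε f i k = 0 := if_neg hi
        -- some coordinate is -1
        obtain ⟨l, hl⟩ : ∃ l, k l = -1 := by simpa [inQ] using hk
        by_cases hli : l = i
        · subst hli
          have : gr ε f l (k + ee n j) = 0 := by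
            refine if_neg fun h => ?_
            have := h.1 l
            simp [ee_ne hij, hl] at this
          have : dq (ee n) ε j (gr ε f l) k = 0 := by unfold dq; rw [h3, this]; simp
          rw [this]; simp [hi]
        · have : gr ε f j (k + ee n i) = 0 := by
            refine if_neg fun h => ?_
            have := h.1 l
            simp [ee_ne hli, hl] at this
          have : dq (ee n) ε i (gr ε f j) k = 0 := by unfold dq; rw [h1, this]; simp
          rw [this]; simp

/-- the shifted estimate -/
theorem a_shift (ε : ℝ) (f : (ι → ZMod n) → ℝ) {i j : ι} (hij : i ≠ j) {k : ι → ZMod n} (hk : chi i k) :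
    dq (ee n) ε i (gr ε f j) (k - ee n j) ^ 2 ≤
      dq (ee n) ε i (gr ε f j) (k - ee n j) * dq (ee n) ε j (gr ε f i) (k - ee n j) := by
  by_cases hq : inQ (k - ee n j)
  · refine (a_ge ε f i j _).2 ?_
    rw [chi_iff] at hk ⊢
    refine ⟨hq, ?_⟩
    simpa [ee_ne hij] using hk.2
  · have hl : (k - ee n j) j = -1 := by
      obtain ⟨l, hl⟩ : ∃ l, (k - ee n j) l = -1 := by simpa [inQ] using hq
      by_cases hlj : l = j
      · rwa [hlj] at hl
      · exact absurd (by simpa [ee_ne hlj] using hl) (hk.1 l)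
    have h1 : gr ε f j (k - ee n j) = 0 := if_neg fun h => h.1 j hl
    have h2 : gr ε f j (k - ee n j + ee n i) = 0 := by
      refine if_neg fun h => h.1 j ?_
      simpa [ee_ne (Ne.symm hij)] using hl
    have : dq (ee n) ε i (gr ε f j) (k - ee n j) = 0 := by unfold dq; rw [h1, h2]; simp
    rw [this]; simp

/-- connectedness -/
theorem conn (f : (ι → ZMod n) → ℝ) (h : ∀ i k, chi i k → f (k + ee n i) = f k) {k : ι → ZMod n} (hk : inQ k) :
    f k = f 0 := by
  by_cases hn1 : n = 1
  · subst hn1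
    congr 1
    ext i
    exact Subsingleton.elim _ _
  have hn : 1 < n := by
    have := NeZero.ne n
    omega
  have step : ∀ i (m : ℕ) (k : ι → ZMod n), inQ k → (k i).val = m → f k = f (Function.update k i 0) := by
    intro i m
    induction m with
    | zero =>
      intro k hk hv
      have : k i = 0 := (ZMod.val_eq_zero _).1 hv
      rw [← this, Function.update_eq_self]
    | succ m ih =>
      intro k hk hv
      haveI : Fact (1 < n) := ⟨hn⟩
      have hlt := ZMod.val_lt (k i)
      have hval : (k i - 1).val = m := by
        rw [ZMod.val_sub (by rw [ZMod.val_one]; omega), ZMod.val_one]; omega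
      have hq : inQ (k - ee n i) := by
        intro l
        by_cases hl : l = i
        · subst hl
          intro hh
          have : k l = 0 := by
            have : k l - 1 = -1 := by simpa [ee_self] using hh
            linear_combination this
          rw [this] at hv; simp at hv
        · simpa [ee_ne hl] using hk l
      have h1 := h i (k - ee n i) ⟨hq, by simpa using hk⟩
      rw [sub_add_cancel] at h1
      rw [h1, ih (k - ee n i) hq (by simpa [ee_self] using hval)]
      congr 1
      ext l
      by_cases hl : l = i
      · subst hl; simp
      · simp [hl, ee_ne hl]
  have h0 : (0 : ZMod n) ≠ -1 := by
    haveI : Fact (1 < n) := ⟨hn⟩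
    intro h
    have : (1 : ZMod n) = 0 := by linear_combination h
    exact one_ne_zero this
  have : ∀ s : Finset ι, f k = f (fun i => if i ∈ s then 0 else k i) ∧ inQ (fun i => if i ∈ s then 0 else k i) := by
    intro s
    induction s using Finset.induction_on with
    | empty => simpa using hk
    | insert a s ha ih =>
      obtain ⟨ih1, ih2⟩ := ih
      have e : Function.update (fun i => if i ∈ s then 0 else k i) a 0 = fun i => if i ∈ insert a s then 0 else k i := by
        ext l
        by_cases hl : l = a
        · subst hl; simp
        · simp [hl]
      refine ⟨?_, ?_⟩
      · rw [ih1, step a _ _ ih2 rfl, e]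
      · intro l
        by_cases hl : l ∈ insert a s
        · simpa [hl] using h0
        · simpa [hl] using hk l
  rw [(this Finset.univ).1]
  congr 1
  ext i; simp

end Disc

end

section
set_option linter.all false

namespace Disc
variable {ι : Type*} [Fintype ι] [DecidableEq ι] {n : ℕ} [NeZero n]

open Classical in
def Qf (ι : Type*) [Fintype ι] (n : ℕ) [NeZero n] : Finset (ι → ZMod n) := Finset.univ.filter inQ

theorem mem_Qf {k : ι → ZMod n} : k ∈ Qf ι n ↔ inQ k := by simp [Qf]

def En (ε : ℝ) (p : (ι → ZMod n) → ℝ) (f h : (ι → ZMod n) → ℝ) : ℝ :=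
  ∑ i, ∑ k, p k * (gr ε f i k * gr ε h i k)

def Lap (ε : ℝ) (p : (ι → ZMod n) → ℝ) (f : (ι → ZMod n) → ℝ) (k : ι → ZMod n) : ℝ :=
  ∑ i, ad (ee n) ε p i (gr ε f i) k

theorem gr_congr (ε : ℝ) {f h : (ι → ZMod n) → ℝ} (H : ∀ k, inQ k → f k = h k) (i : ι) (k : ι → ZMod n) :
    gr ε f i k = gr ε h i k := by
  unfold gr
  split_ifs with hc
  · rw [H _ hc.1, H _ hc.2]
  · rfl

theorem gr_lin (ε : ℝ) (f h : (ι → ZMod n) → ℝ) (a b : ℝ) (i : ι) (k : ι → ZMod n) :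
    gr ε (fun k => a * f k + b * h k) i k = a * gr ε f i k + b * gr ε h i k := by
  unfold gr
  split_ifs with hc
  · ring
  · ring

theorem gr_sub_const (ε : ℝ) (f : (ι → ZMod n) → ℝ) (c : ℝ) (i : ι) (k : ι → ZMod n) :
    gr ε (fun k => f k - c) i k = gr ε f i k := by
  unfold gr
  split_ifs with hc
  · ring
  · ring

theorem En_nonneg (ε : ℝ) {p : (ι → ZMod n) → ℝ} (hp : ∀ k, 0 < p k) (f : (ι → ZMod n) → ℝ) : 0 ≤ En ε p f f :=
  Finset.sum_nonneg fun i _ => Finset.sum_nonneg fun k _ => mul_nonneg (hp k).le (mul_self_nonneg _)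

theorem En_lin (ε : ℝ) (p : (ι → ZMod n) → ℝ) (f h : (ι → ZMod n) → ℝ) (s : ℝ) :
    En ε p (fun k => 1 * f k + s * h k) (fun k => 1 * f k + s * h k) =
      En ε p f f + 2 * s * En ε p f h + s ^ 2 * En ε p h h := by
  unfold En
  simp_rw [gr_lin, Finset.mul_sum, ← Finset.sum_add_distrib]
  refine Finset.sum_congr rfl fun i _ => Finset.sum_congr rfl fun k _ => ?_
  ring

theorem gr_mul_dq (ε : ℝ) (f u : (ι → ZMod n) → ℝ) (i : ι) (k : ι → ZMod n) :
    gr ε f i k * dq (ee n) ε i u k = gr ε f i k * gr ε u i k := by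
  by_cases h : chi i k
  · have : gr ε u i k = dq (ee n) ε i u k := if_pos h
    rw [this]
  · have : gr ε f i k = 0 := if_neg h
    simp [this]

theorem Lap_ibp (ε : ℝ) {p : (ι → ZMod n) → ℝ} (hp : ∀ k, 0 < p k) (f u : (ι → ZMod n) → ℝ) :
    ∑ k, p k * (Lap ε p f k * u k) = - En ε p f u := by
  unfold Lap En
  simp_rw [Finset.sum_mul, Finset.mul_sum]
  rw [Finset.sum_comm, ← Finset.sum_neg_distrib]
  refine Finset.sum_congr rfl fun i _ => ?_
  rw [ibp _ _ hp]
  simp_rw [gr_mul_dq]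

theorem Lap_off (ε : ℝ) {p : (ι → ZMod n) → ℝ} (f : (ι → ZMod n) → ℝ) {k : ι → ZMod n} (hk : ¬ inQ k) :
    Lap ε p f k = 0 := by
  unfold Lap ad
  refine Finset.sum_eq_zero fun i _ => ?_
  have h1 : gr ε f i k = 0 := if_neg fun h => hk h.1
  have h2 : gr ε f i (k - ee n i) = 0 := if_neg fun h => hk (by simpa using h.2)
  simp [h1, h2]

/-- existence of the minimiser -/
theorem exists_min (ε : ℝ) {p : (ι → ZMod n) → ℝ} (hp : ∀ k, 0 < p k)
    (hne : ∃ f : (ι → ZMod n) → ℝ, ∑ k ∈ Qf ι n, p k * f k = 0 ∧ 0 < ∑ k ∈ Qf ι n, p k * f k ^ 2) :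
    ∃ f : (ι → ZMod n) → ℝ, ∑ k ∈ Qf ι n, p k * f k = 0 ∧ ∑ k ∈ Qf ι n, p k * f k ^ 2 = 1 ∧
      ∀ h : (ι → ZMod n) → ℝ, ∑ k ∈ Qf ι n, p k * h k = 0 →
        En ε p f f * ∑ k ∈ Qf ι n, p k * h k ^ 2 ≤ En ε p h h := by
  classical
  let K : Set ((ι → ZMod n) → ℝ) := {f | (∀ k, ¬ inQ k → f k = 0) ∧ ∑ k ∈ Qf ι n, p k * f k = 0 ∧
    ∑ k ∈ Qf ι n, p k * f k ^ 2 = 1}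
  have hKc : IsCompact K := by
    refine Metric.isCompact_of_isClosed_isBounded ?_ ?_
    · refine IsClosed.inter ?_ (IsClosed.inter ?_ ?_)
      · have : {f : (ι → ZMod n) → ℝ | ∀ k, ¬ inQ k → f k = 0} = ⋂ k, ⋂ (_ : ¬ inQ k), {f | f k = 0} := by
          ext f; simp
        show IsClosed {f : (ι → ZMod n) → ℝ | ∀ k, ¬ inQ k → f k = 0}
        rw [this]
        refine isClosed_iInter fun k => isClosed_iInter fun _ => ?_
        exact isClosed_eq (continuous_apply k) continuous_const
      · exact isClosed_eq (by fun_prop) continuous_const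
      · exact isClosed_eq (by fun_prop) continuous_const
    · rw [isBounded_iff_forall_norm_le]
      refine ⟨∑ k, (1 + 1 / p k), fun f hf => ?_⟩
      have hpos : ∀ k, 0 ≤ 1 + 1 / p k := fun k => by have := hp k; positivity
      rw [pi_norm_le_iff_of_nonneg (Finset.sum_nonneg fun k _ => hpos k)]
      intro k
      refine le_trans ?_ (Finset.single_le_sum (fun k _ => hpos k) (Finset.mem_univ k))
      by_cases hk : inQ k
      · have : p k * f k ^ 2 ≤ 1 := by
          rw [← hf.2.2]
          exact Finset.single_le_sum (f := fun k => p k * f k ^ 2) (fun k _ => mul_nonneg (hp k).le (sq_nonneg _)) (mem_Qf.2 hk)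
        have h2 : f k ^ 2 ≤ 1 / p k := by rw [le_div_iff₀ (hp k)]; linarith
        rw [Real.norm_eq_abs]
        nlinarith [sq_abs (f k), sq_nonneg (|f k| - 1)]
      · rw [hf.1 k hk]; simpa using hpos k
  -- reduction
  have red : ∀ h : (ι → ZMod n) → ℝ, ∑ k ∈ Qf ι n, p k * h k = 0 → 0 < ∑ k ∈ Qf ι n, p k * h k ^ 2 →
      ∃ f ∈ K, En ε p h h = En ε p f f * ∑ k ∈ Qf ι n, p k * h k ^ 2 := by
    intro h h1 h2
    set S := ∑ k ∈ Qf ι n, p k * h k ^ 2 with hS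
    have hs : 0 < √S := Real.sqrt_pos.2 h2
    have hs2 : √S ^ 2 = S := Real.sq_sqrt h2.le
    refine ⟨fun k => if inQ k then h k / √S else 0, ⟨fun k hk => by simp [hk], ?_, ?_⟩, ?_⟩
    · have : ∀ k ∈ Qf ι n, p k * (if inQ k then h k / √S else 0) = p k * h k / √S := by
        intro k hk; rw [if_pos (mem_Qf.1 hk)]; ring
      rw [Finset.sum_congr rfl this, ← Finset.sum_div, h1, zero_div]
    · have : ∀ k ∈ Qf ι n, p k * (if inQ k then h k / √S else 0) ^ 2 = p k * h k ^ 2 / S := by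
        intro k hk; rw [if_pos (mem_Qf.1 hk), div_pow, hs2]; ring
      rw [Finset.sum_congr rfl this, ← Finset.sum_div, ← hS, div_self h2.ne']
    · unfold En
      rw [Finset.sum_mul]
      refine Finset.sum_congr rfl fun i _ => ?_
      rw [Finset.sum_mul]
      refine Finset.sum_congr rfl fun k _ => ?_
      have : gr ε (fun k => if inQ k then h k / √S else 0) i k = gr ε h i k / √S := by
        unfold gr
        split_ifs with hc
        · simp only [if_pos hc.1, if_pos hc.2]; ring
        · simp
      rw [this]
      have : gr ε h i k = gr ε h i k / √S * √S := by field_simp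
      calc p k * (gr ε h i k * gr ε h i k) = p k * ((gr ε h i k / √S * √S) * (gr ε h i k / √S * √S)) := by rw [← this]
        _ = p k * (gr ε h i k / √S * (gr ε h i k / √S)) * √S ^ 2 := by ring
        _ = _ := by rw [hs2]
  have hKn : K.Nonempty := by
    obtain ⟨h, h1, h2⟩ := hne
    obtain ⟨f, hf, -⟩ := red h h1 h2
    exact ⟨f, hf⟩
  have hcont : Continuous fun f : (ι → ZMod n) → ℝ => En ε p f f := by
    unfold En
    refine continuous_finset_sum _ fun i _ => continuous_finset_sum _ fun k _ => ?_
    have : Continuous fun f : (ι → ZMod n) → ℝ => gr ε f i k := by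
      unfold gr; split_ifs
      · fun_prop
      · fun_prop
    fun_prop
  obtain ⟨f, hf, hmin⟩ := hKc.exists_isMinOn hKn hcont.continuousOn
  refine ⟨f, hf.2.1, hf.2.2, fun h h1 => ?_⟩
  rcases (Finset.sum_nonneg fun k _ => mul_nonneg (hp k).le (sq_nonneg (h k)) : 0 ≤ ∑ k ∈ Qf ι n, p k * h k ^ 2).eq_or_lt with h2 | h2
  · rw [← h2, mul_zero]; exact En_nonneg ε hp h
  · obtain ⟨f', hf', e⟩ := red h h1 h2
    rw [e]
    exact mul_le_mul_of_nonneg_right (hmin hf') h2.le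

theorem Zpos {p : (ι → ZMod n) → ℝ} (hp : ∀ k, 0 < p k) (hn : 1 < n) : 0 < ∑ k ∈ Qf ι n, p k := by
  have : Fact (1 < n) := ⟨hn⟩
  refine Finset.sum_pos (fun k _ => hp k) ⟨0, ?_⟩
  rw [mem_Qf]
  intro i h
  have h' : (0 : ZMod n) = -1 := h
  have : (1 : ZMod n) = 0 := by linear_combination h'
  exact one_ne_zero this

theorem var_eq {p : (ι → ZMod n) → ℝ} (hp : ∀ k, 0 < p k) (hn : 1 < n) (f : (ι → ZMod n) → ℝ) :
    (∑ k ∈ Qf ι n, p k * (f k - (∑ k ∈ Qf ι n, p k * f k) / ∑ k ∈ Qf ι n, p k) = 0) ∧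
    ∑ k ∈ Qf ι n, p k * (f k - (∑ k ∈ Qf ι n, p k * f k) / ∑ k ∈ Qf ι n, p k) ^ 2 =
    ∑ k ∈ Qf ι n, p k * f k ^ 2 - (∑ k ∈ Qf ι n, p k * f k) ^ 2 / ∑ k ∈ Qf ι n, p k := by
  have hZ := Zpos (ι := ι) hp hn
  set Z := ∑ k ∈ Qf ι n, p k with hZd
  set m := ∑ k ∈ Qf ι n, p k * f k with hm
  constructor
  · simp_rw [mul_sub, Finset.sum_sub_distrib, ← Finset.sum_mul, ← hZd, ← hm]
    field_simp; ring
  · have : ∀ k, p k * (f k - m / Z) ^ 2 = p k * f k ^ 2 - 2 * (m / Z) * (p k * f k) + (m / Z) ^ 2 * p k := by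
      intro k; ring
    simp_rw [this, Finset.sum_add_distrib, Finset.sum_sub_distrib, ← Finset.mul_sum, ← hZd, ← hm]
    field_simp; ring

theorem weak_form (ε : ℝ) {p : (ι → ZMod n) → ℝ} (hp : ∀ k, 0 < p k) (hn : 1 < n) {f : (ι → ZMod n) → ℝ}
    (f1 : ∑ k ∈ Qf ι n, p k * f k = 0) (f2 : ∑ k ∈ Qf ι n, p k * f k ^ 2 = 1)
    (fm : ∀ h : (ι → ZMod n) → ℝ, ∑ k ∈ Qf ι n, p k * h k = 0 →
        En ε p f f * ∑ k ∈ Qf ι n, p k * h k ^ 2 ≤ En ε p h h) (h : (ι → ZMod n) → ℝ) :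
    En ε p f h = En ε p f f * ∑ k ∈ Qf ι n, p k * (f k * h k) := by
  -- reduce to mean zero h
  have main : ∀ h : (ι → ZMod n) → ℝ, ∑ k ∈ Qf ι n, p k * h k = 0 →
      En ε p f h = En ε p f f * ∑ k ∈ Qf ι n, p k * (f k * h k) := by
    intro h h1
    set lam := En ε p f f
    have hs : ∀ s : ℝ, 0 ≤ 2 * s * (En ε p f h - lam * ∑ k ∈ Qf ι n, p k * (f k * h k)) +
        s ^ 2 * (En ε p h h - lam * ∑ k ∈ Qf ι n, p k * h k ^ 2) := by
      intro s
      have := fm (fun k => 1 * f k + s * h k) (by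
        have : ∀ k, p k * (1 * f k + s * h k) = p k * f k + s * (p k * h k) := fun k => by ring
        simp_rw [this, Finset.sum_add_distrib, ← Finset.mul_sum, f1, h1]; simp)
      rw [En_lin] at this
      have e : ∀ k, p k * (1 * f k + s * h k) ^ 2 = p k * f k ^ 2 + 2 * s * (p k * (f k * h k)) + s ^ 2 * (p k * h k ^ 2) :=
        fun k => by ring
      simp_rw [e, Finset.sum_add_distrib, ← Finset.mul_sum, f2] at this
      linarith
    set a := En ε p f h - lam * ∑ k ∈ Qf ι n, p k * (f k * h k) with ha
    set b := En ε p h h - lam * ∑ k ∈ Qf ι n, p k * h k ^ 2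
    suffices a = 0 by linarith
    by_contra hne
    have hb : 0 ≤ b := by
      have h1 := hs 1; have h2 := hs (-1); linarith
    have h3 := hs (-a / (b + 1))
    have : 2 * (-a / (b + 1)) * a + (-a / (b + 1)) ^ 2 * b = - (a ^ 2 * (b + 2)) / (b + 1) ^ 2 := by
      field_simp; ring
    rw [this] at h3
    have : 0 < a ^ 2 * (b + 2) / (b + 1) ^ 2 := by positivity
    rw [neg_div] at h3
    linarith
  have hm := main (fun k => h k - (∑ k ∈ Qf ι n, p k * h k) / ∑ k ∈ Qf ι n, p k) (var_eq hp hn h).1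
  have e1 : En ε p f (fun k => h k - (∑ k ∈ Qf ι n, p k * h k) / ∑ k ∈ Qf ι n, p k) = En ε p f h := by
    unfold En; simp_rw [gr_sub_const]
  have e2 : ∀ c, ∑ k ∈ Qf ι n, p k * (f k * (h k - c)) = ∑ k ∈ Qf ι n, p k * (f k * h k) := by
    intro c
    have : ∀ k, p k * (f k * (h k - c)) = p k * (f k * h k) - p k * f k * c := fun k => by ring
    simp_rw [this, Finset.sum_sub_distrib, ← Finset.sum_mul, f1]; simp
  rw [e1, e2] at hm
  exact hm

/-- lower bound for `‖L f‖²`. -/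
theorem lap_lower {ε : ℝ} (hε : 0 < ε) {p : (ι → ZMod n) → ℝ} (hp : ∀ k, 0 < p k)
    {C η t : ℝ} (hC : 0 ≤ C) (hη : 0 ≤ η) (W : (ι → ZMod n) → ι → ι → ℝ)
    (H1 : ∀ i j k, chi i k → |cc (ee n) ε p j i k| ≤ C)
    (H2 : ∀ j k, inQ k → p k ≤ C * p (k - ee n j))
    (H3 : ∀ i j k, chi i k → |cc (ee n) ε p j i k - W k i j| ≤ η)
    (H4 : ∀ k, inQ k → ∀ ξ : ι → ℝ, t * ∑ i, ξ i ^ 2 ≤ ∑ i, ∑ j, W k i j * (ξ i * ξ j))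
    (f : (ι → ZMod n) → ℝ) :
    (1 - C ^ 2 * (Fintype.card ι + 1) * ε) * (∑ i, ∑ j, ∑ k, p k * (dq (ee n) ε i (gr ε f j) k * dq (ee n) ε j (gr ε f i) k)) +
      (t - (C * ε + η) * Fintype.card ι) * En ε p f f ≤ ∑ k, p k * Lap ε p f k ^ 2 := by
  set a : ι → ι → (ι → ZMod n) → ℝ := fun i j k => dq (ee n) ε i (gr ε f j) k * dq (ee n) ε j (gr ε f i) k with ha
  set g := gr ε f with hg
  have a0 : ∀ i j k, 0 ≤ a i j k := fun i j k => (a_ge ε f i j k).1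
  have hb := bochner (ee n) hε.ne' hp g
  have g0 : ∀ i k, ¬ chi i k → g i k = 0 := fun i k h => if_neg h
  -- termwise bound
  have term : ∀ i j k, p k * (cc (ee n) ε p j i k * (g i k * g j k)) -
      (C * ε * (p k * (g i k * g i k)) + C ^ 2 * ε / 2 * (p (k - ee n j) * a i j (k - ee n j) + p (k - ee n j) * a j j (k - ee n j)))
      ≤ p k * (cc (ee n) ε p j i k * (g i k * g j (k + ee n i - ee n j))) := by
    intro i j k
    have q1 : 0 ≤ p (k - ee n j) * a i j (k - ee n j) := mul_nonneg (hp _).le (a0 _ _ _)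
    have q2 : 0 ≤ p (k - ee n j) * a j j (k - ee n j) := mul_nonneg (hp _).le (a0 _ _ _)
    by_cases hc : chi i k
    swap
    · rw [g0 i k hc]
      simp only [zero_mul, mul_zero]
      have : 0 ≤ C ^ 2 * ε / 2 * (p (k - ee n j) * a i j (k - ee n j) + p (k - ee n j) * a j j (k - ee n j)) := by positivity
      linarith
    by_cases hij : i = j
    · subst hij
      rw [add_sub_cancel_right]
      have : 0 ≤ C ^ 2 * ε / 2 * (p (k - ee n i) * a i i (k - ee n i) + p (k - ee n i) * a i i (k - ee n i)) := by positivity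
      have : 0 ≤ C * ε * (p k * (g i k * g i k)) := mul_nonneg (by positivity) (mul_nonneg (hp k).le (mul_self_nonneg _))
      linarith
    set x := dq (ee n) ε i (g j) (k - ee n j) with hx
    set y := dq (ee n) ε j (g j) (k - ee n j) with hy
    have hx2 : x ^ 2 ≤ a i j (k - ee n j) := a_shift ε f hij hc
    have hy2 : y ^ 2 = a j j (k - ee n j) := sq _
    have hd : g j (k + ee n i - ee n j) = g j k + ε * (x - y) := by
      rw [hx, hy]; unfold dq
      have : k - ee n j + ee n i = k + ee n i - ee n j := by abel
      rw [this, sub_add_cancel]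
      field_simp; ring
    rw [hd]
    set c := cc (ee n) ε p j i k
    have hcC : |c| ≤ C := H1 i j k hc
    have hpk := H2 j k hc.1
    have pk := hp k
    have b1 : - (C * |g i k * (x - y)|) ≤ c * (g i k * (x - y)) := by
      have h1 := neg_abs_le (c * (g i k * (x - y)))
      rw [abs_mul c] at h1
      have := mul_le_mul_of_nonneg_right hcC (abs_nonneg (g i k * (x - y)))
      linarith
    have b2 : |g i k * (x - y)| ≤ g i k * g i k + (x ^ 2 + y ^ 2) / 2 := by
      rw [abs_le]
      constructor <;> nlinarith [sq_nonneg (g i k - x), sq_nonneg (g i k + x), sq_nonneg (g i k - y), sq_nonneg (g i k + y)]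
    have b3 : p k * (x ^ 2 + y ^ 2) ≤ C * (p (k - ee n j) * a i j (k - ee n j) + p (k - ee n j) * a j j (k - ee n j)) := by
      have : p k * (x ^ 2 + y ^ 2) ≤ C * p (k - ee n j) * (x ^ 2 + y ^ 2) :=
        mul_le_mul_of_nonneg_right hpk (by positivity)
      have h5 : C * p (k - ee n j) * (x ^ 2 + y ^ 2) ≤ C * p (k - ee n j) * (a i j (k - ee n j) + a j j (k - ee n j)) := by
        refine mul_le_mul_of_nonneg_left (by linarith) ?_
        have := hp (k - ee n j)
        positivity
      linarith
    have b4 : - (p k * (C * (g i k * g i k + (x ^ 2 + y ^ 2) / 2))) ≤ p k * (c * (g i k * (x - y))) := by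
      have := mul_le_mul_of_nonneg_left b2 hC
      have h6 : -(C * (g i k * g i k + (x ^ 2 + y ^ 2) / 2)) ≤ c * (g i k * (x - y)) := by linarith
      have := mul_le_mul_of_nonneg_left h6 pk.le
      linarith
    have b5 := mul_le_mul_of_nonneg_left b4 hε.le
    have b6 := mul_le_mul_of_nonneg_left b3 (by positivity : 0 ≤ C * ε / 2)
    nlinarith
  -- the quadratic form
  have quad : ∀ k, p k * ((t - η * Fintype.card ι) * ∑ i, g i k * g i k) ≤ ∑ i, ∑ j, p k * (cc (ee n) ε p j i k * (g i k * g j k)) := by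
    intro k
    simp_rw [← Finset.mul_sum]
    refine mul_le_mul_of_nonneg_left ?_ (hp k).le
    by_cases hk : inQ k
    swap
    · have : ∀ i, g i k = 0 := fun i => g0 i k fun h => hk h.1
      simp [this]
    have h4 := H4 k hk (fun i => g i k)
    have h5 : ∑ i, ∑ j, W k i j * (g i k * g j k) - η * ∑ i, ∑ j, |g i k| * |g j k| ≤
        ∑ i, ∑ j, cc (ee n) ε p j i k * (g i k * g j k) := by
      simp_rw [Finset.mul_sum, ← Finset.sum_sub_distrib]
      refine Finset.sum_le_sum fun i _ => Finset.sum_le_sum fun j _ => ?_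
      by_cases hc : chi i k
      · have h3 := H3 i j k hc
        have := neg_abs_le ((cc (ee n) ε p j i k - W k i j) * (g i k * g j k))
        rw [abs_mul, abs_mul (g i k)] at this
        have := mul_le_mul_of_nonneg_right h3 (mul_nonneg (abs_nonneg (g i k)) (abs_nonneg (g j k)))
        nlinarith
      · rw [g0 i k hc]; simp
    have h6 : ∑ i, ∑ j, |g i k| * |g j k| ≤ Fintype.card ι * ∑ i, g i k * g i k := by
      rw [← Finset.sum_mul_sum]
      have := sq_sum_le_card_mul_sum_sq (s := (Finset.univ : Finset ι)) (f := fun i => |g i k|)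
      simp only [sq_abs, Finset.card_univ] at this
      simp_rw [← sq]
      exact this
    have h7 := mul_le_mul_of_nonneg_left h6 hη
    simp only [sq] at h4
    linarith
  have e0 : ∑ k, p k * Lap ε p f k ^ 2 = ∑ k, p k * (∑ i, ad (ee n) ε p i (g i) k) ^ 2 := rfl
  rw [e0, hb]
  set S := ∑ i, ∑ j, ∑ k, p k * (dq (ee n) ε i (g j) k * dq (ee n) ε j (g i) k) with hS
  have T : ∑ i, ∑ j, ∑ k, (p k * (cc (ee n) ε p j i k * (g i k * g j k)) -
      (C * ε * (p k * (g i k * g i k)) + C ^ 2 * ε / 2 * (p (k - ee n j) * a i j (k - ee n j) + p (k - ee n j) * a j j (k - ee n j))))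
      ≤ ∑ i, ∑ j, ∑ k, p k * (cc (ee n) ε p j i k * (g i k * g j (k + ee n i - ee n j))) :=
    Finset.sum_le_sum fun i _ => Finset.sum_le_sum fun j _ => Finset.sum_le_sum fun k _ => term i j k
  have sh : ∀ (j : ι) (F : (ι → ZMod n) → ℝ), ∑ k, F (k - ee n j) = ∑ k, F k := fun j F =>
    Equiv.sum_comp (Equiv.subRight (ee n j)) F
  simp_rw [Finset.sum_sub_distrib, Finset.sum_add_distrib, ← Finset.mul_sum, Finset.sum_add_distrib] at T
  simp_rw [fun i j => sh j (fun k => p k * a i j k)] at T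
  have t1 : ∑ i, ∑ j, ∑ k, p k * (cc (ee n) ε p j i k * (g i k * g j k)) ≥ (t - η * Fintype.card ι) * En ε p f f := by
    have : ∑ i, ∑ j, ∑ k, p k * (cc (ee n) ε p j i k * (g i k * g j k)) = ∑ k, ∑ i, ∑ j, p k * (cc (ee n) ε p j i k * (g i k * g j k)) := by
      conv_rhs => rw [Finset.sum_comm]
      refine Finset.sum_congr rfl fun i _ => ?_
      rw [Finset.sum_comm]
    rw [this]
    refine le_trans (le_of_eq ?_) (Finset.sum_le_sum fun k _ => quad k)
    unfold En
    rw [Finset.sum_comm, Finset.mul_sum]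
    refine Finset.sum_congr rfl fun k _ => ?_
    rw [← Finset.mul_sum]; ring
  have t2 : ∑ i, ∑ j : ι, ∑ k, p k * (g i k * g i k) = Fintype.card ι * En ε p f f := by
    unfold En
    simp only [Finset.sum_const, Finset.card_univ, nsmul_eq_mul]
    rw [← Finset.mul_sum]
  have t3 : ∑ i : ι, ∑ j, ∑ k, p k * a j j k ≤ Fintype.card ι * S := by
    rw [Finset.sum_const, Finset.card_univ, nsmul_eq_mul]
    refine mul_le_mul_of_nonneg_left ?_ (Nat.cast_nonneg _)
    rw [hS]
    refine Finset.sum_le_sum fun i _ => ?_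
    exact Finset.single_le_sum (f := fun j => ∑ k, p k * a i j k)
      (fun j _ => Finset.sum_nonneg fun k _ => mul_nonneg (hp k).le (a0 _ _ _)) (Finset.mem_univ i)
  have t4 : ∑ i, ∑ j, ∑ k, p k * a i j k = S := rfl
  have S0 : 0 ≤ S := Finset.sum_nonneg fun i _ => Finset.sum_nonneg fun j _ => Finset.sum_nonneg fun k _ =>
    mul_nonneg (hp k).le (a0 _ _ _)
  rw [t2, t4] at T
  have := mul_le_mul_of_nonneg_left t3 (by positivity : 0 ≤ C ^ 2 * ε / 2)
  have : 0 ≤ C ^ 2 * ε * S * (Fintype.card ι + 1) := by positivity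
  nlinarith

end Disc

end

section
set_option linter.all false

namespace Disc
variable {ι : Type*} [Fintype ι] [DecidableEq ι] {n : ℕ} [NeZero n]

set_option maxHeartbeats 1000000 in
theorem discrete_poincare (hn : 1 < n) {ε : ℝ} (hε : 0 < ε) {p : (ι → ZMod n) → ℝ} (hp : ∀ k, 0 < p k)
    {C η t α : ℝ} (hC : 0 ≤ C) (hη : 0 ≤ η) (hα : 0 ≤ α) (W : (ι → ZMod n) → ι → ι → ℝ) (X : (ι → ZMod n) → ι → ℝ)
    (H1 : ∀ i j k, chi i k → |cc (ee n) ε p j i k| ≤ C)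
    (H2 : ∀ j k, inQ k → p k ≤ C * p (k - ee n j))
    (H3 : ∀ i j k, chi i k → |cc (ee n) ε p j i k - W k i j| ≤ η)
    (H4 : ∀ k, inQ k → ∀ ξ : ι → ℝ, t * ∑ i, ξ i ^ 2 ≤ ∑ i, ∑ j, W k i j * (ξ i * ξ j))
    (H5 : ∀ i j k, chi i k → (X (k + ee n i) j - X k j) / ε = if i = j then 1 else 0)
    (H6 : ∀ v : ι → ℝ, ∑ k ∈ Qf ι n, p k * (∑ i, v i * X k i) ^ 2 -
      (∑ k ∈ Qf ι n, p k * ∑ i, v i * X k i) ^ 2 / ∑ k ∈ Qf ι n, p k ≤ α * (∑ k ∈ Qf ι n, p k) * ∑ i, v i ^ 2)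
    {e1 e2 l0 : ℝ} (he1 : C ^ 2 * (Fintype.card ι + 1) * ε ≤ e1) (he1' : e1 ≤ 1)
    (he2 : (C * ε + η) * Fintype.card ι ≤ e2)
    (hl0 : 0 ≤ l0) (hl : l0 ^ 2 * α + e1 * l0 + e2 < t)
    (f : (ι → ZMod n) → ℝ) :
    l0 * (∑ k ∈ Qf ι n, p k * f k ^ 2 - (∑ k ∈ Qf ι n, p k * f k) ^ 2 / ∑ k ∈ Qf ι n, p k) ≤ En ε p f f := by
  by_contra hcon
  push Not at hcon
  obtain ⟨v1, v2⟩ := var_eq hp hn f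
  rw [← v2] at hcon
  set f' := fun k => f k - (∑ k ∈ Qf ι n, p k * f k) / ∑ k ∈ Qf ι n, p k with hf'
  have hE : En ε p f f = En ε p f' f' := by unfold En; simp_rw [hf', gr_sub_const]
  have hV0 : 0 ≤ ∑ k ∈ Qf ι n, p k * f' k ^ 2 := Finset.sum_nonneg fun k _ => mul_nonneg (hp k).le (sq_nonneg _)
  have hV : 0 < ∑ k ∈ Qf ι n, p k * f' k ^ 2 := by
    rcases hV0.eq_or_lt with h | h
    · have h2 : ∑ k ∈ Qf ι n, p k * (f k - (∑ k ∈ Qf ι n, p k * f k) / ∑ k ∈ Qf ι n, p k) ^ 2 = 0 := h.symm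
      rw [h2, mul_zero] at hcon
      exact absurd hcon (not_lt.2 (En_nonneg ε hp f))
    · exact h
  obtain ⟨u, u1, u2, um⟩ := exists_min ε hp ⟨f', v1, hV⟩
  have wf := weak_form ε hp hn u1 u2 um
  set lam := En ε p u u with hlam
  have hlt : lam < l0 := by
    have h1 := um f' v1
    rw [← hE] at h1
    have h2 : En ε p f f < l0 * ∑ k ∈ Qf ι n, p k * f' k ^ 2 := hcon
    exact lt_of_mul_lt_mul_right (lt_of_le_of_lt h1 h2) hV0
  have hlam0 : 0 ≤ lam := En_nonneg ε hp u
  have hZ := Zpos (ι := ι) hp hn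
  set Z := ∑ k ∈ Qf ι n, p k with hZd
  -- lam positive
  have hlampos : 0 < lam := by
    rcases hlam0.eq_or_lt with h | h
    swap
    · exact h
    exfalso
    have hz : ∀ i k, gr ε u i k = 0 := by
      have h1 := (Finset.sum_eq_zero_iff_of_nonneg (fun i _ => Finset.sum_nonneg fun k _ =>
        mul_nonneg (hp k).le (mul_self_nonneg (gr ε u i k)))).1 h.symm
      intro i k
      have h2 := (Finset.sum_eq_zero_iff_of_nonneg (fun k _ =>
        mul_nonneg (hp k).le (mul_self_nonneg (gr ε u i k)))).1 (h1 i (Finset.mem_univ _)) k (Finset.mem_univ _)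
      rcases mul_eq_zero.1 h2 with h3 | h3
      · exact absurd h3 (hp k).ne'
      · exact mul_self_eq_zero.1 h3
    have hcst : ∀ k, inQ k → u k = u 0 := by
      intro k hk
      refine conn u ?_ hk
      intro i k hc
      have h1 := hz i k
      rw [gr, if_pos hc, div_eq_zero_iff] at h1
      rcases h1 with h1 | h1
      · linarith
      · exact absurd h1 hε.ne'
    have h3 : ∑ k ∈ Qf ι n, p k * u k = Z * u 0 := by
      rw [hZd, Finset.sum_mul]
      exact Finset.sum_congr rfl fun k hk => by rw [hcst k (mem_Qf.1 hk)]
    rw [u1] at h3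
    have h4 : u 0 = 0 := by
      rcases mul_eq_zero.1 h3.symm with h | h
      · exact absurd h hZ.ne'
      · exact h
    have h5 : ∑ k ∈ Qf ι n, p k * u k ^ 2 = 0 :=
      Finset.sum_eq_zero fun k hk => by rw [hcst k (mem_Qf.1 hk), h4]; simp
    linarith
  -- norm of Lap
  have hLap : ∑ k, p k * Lap ε p u k ^ 2 = lam ^ 2 := by
    have off : ∀ F : (ι → ZMod n) → ℝ, (∀ k, ¬ inQ k → F k = 0) → ∑ k ∈ Qf ι n, F k = ∑ k, F k := by
      intro F hF
      refine Finset.sum_subset (Finset.subset_univ _) fun k _ hk => hF k fun h => hk (mem_Qf.2 h)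
    have h1 := Lap_ibp ε hp u (Lap ε p u)
    have h2 := Lap_ibp ε hp u u
    have h3 := wf (Lap ε p u)
    rw [off _ (fun k hk => by rw [Lap_off ε u hk]; simp)] at h3
    have h4 : ∑ k, p k * (u k * Lap ε p u k) = - lam := by
      rw [hlam, ← h2]; exact Finset.sum_congr rfl fun k _ => by ring
    have h5 : ∑ k, p k * Lap ε p u k ^ 2 = ∑ k, p k * (Lap ε p u k * Lap ε p u k) :=
      Finset.sum_congr rfl fun k _ => by ring
    rw [h5, h1, h3, h4]; ring
  have low := lap_lower hε hp hC hη W H1 H2 H3 H4 u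
  rw [hLap, ← hlam] at low
  set S := ∑ i, ∑ j, ∑ k, p k * (dq (ee n) ε i (gr ε u j) k * dq (ee n) ε j (gr ε u i) k) with hS
  have S0 : 0 ≤ S := Finset.sum_nonneg fun i _ => Finset.sum_nonneg fun j _ => Finset.sum_nonneg fun k _ =>
    mul_nonneg (hp k).le (a_ge ε u i j k).1
  -- means
  set m : ι → ℝ := fun j => ∑ k ∈ Qf ι n, p k * gr ε u j k with hm
  have sumQ : ∀ (j : ι) (F : (ι → ZMod n) → ℝ), ∑ k ∈ Qf ι n, p k * (gr ε u j k * F k) = ∑ k, p k * (gr ε u j k * F k) := by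
    intro j F
    refine Finset.sum_subset (Finset.subset_univ _) fun k _ hk => ?_
    have : gr ε u j k = 0 := if_neg fun h => hk (mem_Qf.2 h.1)
    simp [this]
  have hSlow : lam * (lam - (∑ j, m j ^ 2) / Z) ≤ S := by
    have h1 : ∀ j, lam * (∑ k ∈ Qf ι n, p k * gr ε u j k ^ 2 - m j ^ 2 / Z) ≤
        ∑ i, ∑ k, p k * (dq (ee n) ε i (gr ε u j) k * dq (ee n) ε j (gr ε u i) k) := by
      intro j
      obtain ⟨w1, w2⟩ := var_eq hp hn (gr ε u j)
      have h2 := um _ w1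
      rw [w2] at h2
      refine h2.trans ?_
      unfold En
      refine Finset.sum_le_sum fun i _ => Finset.sum_le_sum fun k _ => ?_
      refine mul_le_mul_of_nonneg_left ?_ (hp k).le
      rw [gr_sub_const]
      by_cases hc : chi i k
      · have : gr ε (gr ε u j) i k = dq (ee n) ε i (gr ε u j) k := if_pos hc
        rw [this, ← sq]
        exact (a_ge ε u i j k).2 hc
      · have : gr ε (gr ε u j) i k = 0 := if_neg hc
        rw [this, zero_mul]
        exact (a_ge ε u i j k).1
    have h2 := Finset.sum_le_sum fun j (_ : j ∈ (Finset.univ : Finset ι)) => h1 j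
    rw [Finset.sum_comm, ← hS, ← Finset.mul_sum, Finset.sum_sub_distrib, ← Finset.sum_div] at h2
    have h3 : ∑ j, ∑ k ∈ Qf ι n, p k * gr ε u j k ^ 2 = lam := by
      rw [hlam]; unfold En
      refine Finset.sum_congr rfl fun j _ => ?_
      rw [← sumQ]
      exact Finset.sum_congr rfl fun k _ => by ring
    rwa [h3] at h2
  have hmean : ∑ j, m j ^ 2 ≤ lam ^ 2 * (α * Z) := by
    set v := m
    set Y : (ι → ZMod n) → ℝ := fun k => ∑ i, v i * X k i with hY
    have grY : ∀ i k, gr ε u i k * gr ε Y i k = gr ε u i k * v i := by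
      intro i k
      by_cases hc : chi i k
      · have : gr ε Y i k = v i := by
          rw [gr, if_pos hc, hY]
          simp only
          rw [← Finset.sum_sub_distrib, Finset.sum_div]
          have : ∀ j, (v j * X (k + ee n i) j - v j * X k j) / ε = if i = j then v j else 0 := by
            intro j
            have h5 := H5 i j k hc
            rw [← mul_sub, mul_div_assoc, h5]; split_ifs <;> simp
          simp [this]
        rw [this]
      · have : gr ε u i k = 0 := if_neg hc
        simp [this]
    have h1 : En ε p u Y = ∑ j, m j ^ 2 := by
      unfold En
      refine Finset.sum_congr rfl fun i _ => ?_
      simp_rw [grY]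
      rw [← sumQ, sq]
      simp_rw [← mul_assoc]
      rw [← Finset.sum_mul]
    rw [wf Y] at h1
    obtain ⟨w1, w2⟩ := var_eq hp hn Y
    set c := (∑ k ∈ Qf ι n, p k * Y k) / ∑ k ∈ Qf ι n, p k
    have h2 : ∑ k ∈ Qf ι n, p k * (u k * Y k) = ∑ k ∈ Qf ι n, p k * (u k * (Y k - c)) := by
      have : ∀ k, p k * (u k * (Y k - c)) = p k * (u k * Y k) - p k * u k * c := fun k => by ring
      simp_rw [this, Finset.sum_sub_distrib, ← Finset.sum_mul, u1]; simp
    have h3 : (∑ k ∈ Qf ι n, p k * (u k * (Y k - c))) ^ 2 ≤ 1 * (α * Z * ∑ j, m j ^ 2) := by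
      have cs := Finset.sum_mul_sq_le_sq_mul_sq (Qf ι n) (fun k => √(p k) * u k) (fun k => √(p k) * (Y k - c))
      have e1 : ∀ k, √(p k) * u k * (√(p k) * (Y k - c)) = p k * (u k * (Y k - c)) := by
        intro k
        have := Real.mul_self_sqrt (hp k).le
        linear_combination u k * (Y k - c) * this
      have e2 : ∀ F : ℝ, ∀ k, (√(p k) * F) ^ 2 = p k * F ^ 2 := by
        intro F k; rw [mul_pow, Real.sq_sqrt (hp k).le]
      simp_rw [e1, e2, u2, w2] at cs
      refine cs.trans ?_
      have := H6 m
      linarith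
    rw [h2] at h1
    set q := ∑ j, m j ^ 2
    have q0 : 0 ≤ q := Finset.sum_nonneg fun j _ => sq_nonneg _
    have h4 : q ^ 2 ≤ lam ^ 2 * (α * Z * q) := by
      rw [← h1, mul_pow]
      rw [h1]
      exact mul_le_mul_of_nonneg_left (by linarith) (sq_nonneg _)
    rcases q0.eq_or_lt with h | h
    · rw [← h]; positivity
    · have : q * q ≤ (lam ^ 2 * (α * Z)) * q := by rw [← sq]; linarith
      exact le_of_mul_le_mul_right this h
  have hmZ : (∑ j, m j ^ 2) / Z ≤ lam ^ 2 * α := by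
    rw [div_le_iff₀ hZ]; linarith
  have hS2 : lam * (lam - lam ^ 2 * α) ≤ S := by
    refine le_trans (mul_le_mul_of_nonneg_left ?_ hlam0) hSlow
    linarith
  -- conclude
  have l1 : (1 - e1) * S ≤ (1 - C ^ 2 * (Fintype.card ι + 1) * ε) * S := mul_le_mul_of_nonneg_right (by linarith) S0
  have l2 : (t - e2) * lam ≤ (t - (C * ε + η) * Fintype.card ι) * lam := mul_le_mul_of_nonneg_right (by linarith) hlam0
  have l3 : (1 - e1) * (lam * (lam - lam ^ 2 * α)) ≤ (1 - e1) * S := mul_le_mul_of_nonneg_left hS2 (by linarith)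
  have l4 : lam * ((1 - e1) * (lam - lam ^ 2 * α) + (t - e2)) ≤ lam * lam := by
    have e : lam * ((1 - e1) * (lam - lam ^ 2 * α) + (t - e2)) = (1 - e1) * (lam * (lam - lam ^ 2 * α)) + (t - e2) * lam := by ring
    rw [e, ← sq]; linarith
  have l5 := le_of_mul_le_mul_left l4 hlampos
  have e10 : 0 ≤ e1 := le_trans (by positivity) he1
  have l6 : lam ^ 2 * α ≤ l0 ^ 2 * α := by gcongr
  have l7 : e1 * lam ≤ e1 * l0 := by gcongr
  have l8 : 0 ≤ e1 * (lam ^ 2 * α) := by positivity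
  have e : (1 - e1) * (lam - lam ^ 2 * α) = lam - lam ^ 2 * α - e1 * lam + e1 * (lam ^ 2 * α) := by ring
  rw [e] at l5
  linarith

end Disc

end

section
set_option linter.all false
open Filter
open scoped Topology

namespace Disc
variable {ι : Type*} [Fintype ι] [DecidableEq ι]

/-- integer coordinate with ghost value -/
def gc (N : ℕ) (a : ZMod (N + 2)) : ℤ := if a = -1 then -1 else (a.val : ℤ)

theorem val_neg_one' (N : ℕ) : (-1 : ZMod (N + 2)).val = N + 1 := ZMod.val_neg_one (N + 1)

theorem gc_bd {N : ℕ} {a : ZMod (N + 2)} (h : a ≠ -1) : 0 ≤ gc N a ∧ gc N a ≤ N := by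
  rw [gc, if_neg h]
  refine ⟨by positivity, ?_⟩
  have h1 := ZMod.val_lt a
  have h2 : a.val ≠ N + 1 := fun h' => h (ZMod.val_injective _ (by rw [h', val_neg_one']))
  omega

theorem gc_cast (N : ℕ) (a : ZMod (N + 2)) : ((gc N a : ℤ) : ZMod (N + 2)) = a := by
  unfold gc
  split_ifs with h
  · simp [h]
  · simp

theorem gc_of {N : ℕ} {m : ℤ} (h0 : -1 ≤ m) (h1 : m ≤ N) : gc N (m : ZMod (N + 2)) = m := by
  rcases h0.eq_or_lt with h | h
  · rw [← h]; simp [gc]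
  · obtain ⟨l, rfl⟩ := Int.eq_ofNat_of_zero_le (by omega : 0 ≤ m)
    have hl : ((l : ℤ) : ZMod (N + 2)).val = l := by
      rw [Int.cast_natCast, ZMod.val_natCast, Nat.mod_eq_of_lt (by omega)]
    rw [gc, if_neg, hl]
    intro h'
    rw [h', val_neg_one'] at hl
    omega

theorem gc_succ {N : ℕ} {a : ZMod (N + 2)} (h : a ≠ -1) (h' : a + 1 ≠ -1) : gc N (a + 1) = gc N a + 1 := by
  have h1 := gc_bd h
  have h2 : gc N a ≠ N := by
    intro h3
    apply h'
    rw [← gc_cast N a, h3]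
    have : ((N + 2 : ℕ) : ZMod (N + 2)) = 0 := ZMod.natCast_self _
    push_cast at this ⊢
    linear_combination this
  have : ((gc N a + 1 : ℤ) : ZMod (N + 2)) = a + 1 := by push_cast; rw [gc_cast]
  rw [← this, gc_of (by omega) (by omega)]

theorem gc_pred {N : ℕ} {a : ZMod (N + 2)} (h : a ≠ -1) : gc N (a - 1) = gc N a - 1 := by
  have h1 := gc_bd h
  have : ((gc N a - 1 : ℤ) : ZMod (N + 2)) = a - 1 := by push_cast; rw [gc_cast]
  rw [← this, gc_of (by omega) (by omega)]

/-- grid spacing -/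
def ep (R : ℝ) (N : ℕ) : ℝ := 2 * R / (N + 1)
/-- grid point -/
def gx (R : ℝ) (N : ℕ) (k : ι → ZMod (N + 2)) : ι → ℝ := fun i => -R + ep R N * gc N (k i)

/-- unit vector -/
def uv (i : ι) : ι → ℝ := Pi.single i 1

theorem ep_pos {R : ℝ} (hR : 0 < R) (N : ℕ) : 0 < ep R N := by unfold ep; positivity

theorem ep_tendsto (R : ℝ) : Tendsto (ep R) atTop (𝓝 0) := by
  unfold ep
  exact tendsto_const_nhds.div_atTop (tendsto_natCast_atTop_atTop.atTop_add tendsto_const_nhds)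

theorem gx_add (R : ℝ) {N : ℕ} {i : ι} {k : ι → ZMod (N + 2)} (h : chi i k) :
    gx R N (k + ee (N + 2) i) = gx R N k + ep R N • uv i := by
  ext l
  rw [chi_iff] at h
  by_cases hl : l = i
  · subst hl
    simp only [gx, Pi.add_apply, ee_self, gc_succ (h.1 l) h.2, uv, Pi.smul_apply, Pi.single_eq_same, smul_eq_mul]
    push_cast; ring
  · simp [gx, ee_ne hl, uv, hl]

theorem gx_sub (R : ℝ) {N : ℕ} {j : ι} {k : ι → ZMod (N + 2)} (h : inQ k) :
    gx R N (k - ee (N + 2) j) = gx R N k - ep R N • uv j := by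
  ext l
  by_cases hl : l = j
  · subst hl
    simp only [gx, Pi.sub_apply, ee_self, gc_pred (h l), uv, Pi.smul_apply, Pi.single_eq_same, smul_eq_mul]
    push_cast; ring
  · simp [gx, ee_ne hl, uv, hl]

theorem gx_add_sub (R : ℝ) {N : ℕ} {i j : ι} {k : ι → ZMod (N + 2)} (h : chi i k) :
    gx R N (k + ee (N + 2) i - ee (N + 2) j) = gx R N k + ep R N • uv i - ep R N • uv j := by
  rw [gx_sub R h.2, gx_add R h]

theorem gx_mem {R : ℝ} (hR : 0 < R) {N : ℕ} {k : ι → ZMod (N + 2)} (h : inQ k) (i : ι) :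
    -R ≤ gx R N k i ∧ gx R N k i + ep R N ≤ R := by
  have h1 := gc_bd (h i)
  have h2 := ep_pos hR N
  have h3 : (0:ℝ) ≤ gc N (k i) := by exact_mod_cast h1.1
  have h4 : (gc N (k i) : ℝ) ≤ N := by exact_mod_cast h1.2
  unfold gx
  refine ⟨by nlinarith, ?_⟩
  have h5 : ep R N * (N + 1) = 2 * R := by unfold ep; field_simp
  nlinarith

/-- the box -/
def bx (ι : Type*) (R : ℝ) : Set (ι → ℝ) := Set.pi univ fun _ => Ico (-R) R

def cell (R : ℝ) (N : ℕ) (k : ι → ZMod (N + 2)) : Set (ι → ℝ) :=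
  Set.pi univ fun i => Ico (gx R N k i) (gx R N k i + ep R N)

theorem bx_eq {R : ℝ} (hR : 0 < R) (N : ℕ) : bx ι R = ⋃ k ∈ Qf ι (N + 2), cell R N k := by
  have hε := ep_pos hR N
  ext x
  simp only [mem_iUnion, exists_prop, mem_Qf]
  constructor
  · intro hx
    have hx' : ∀ i, -R ≤ x i ∧ x i < R := fun i => hx i (mem_univ i)
    have fl : ∀ i, 0 ≤ ⌊(x i + R) / ep R N⌋ ∧ ⌊(x i + R) / ep R N⌋ ≤ N := by
      intro i
      refine ⟨Int.floor_nonneg.2 (div_nonneg (by linarith [(hx' i).1]) hε.le), ?_⟩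
      have : (x i + R) / ep R N < (N : ℝ) + 1 := by
        rw [div_lt_iff₀ hε]
        have h5 : ep R N * (N + 1) = 2 * R := by unfold ep; field_simp
        linarith [(hx' i).2]
      have h6 : ⌊(x i + R) / ep R N⌋ < (N : ℤ) + 1 := by
        rw [Int.floor_lt]; push_cast; exact this
      omega
    refine ⟨fun i => ((⌊(x i + R) / ep R N⌋ : ℤ) : ZMod (N + 2)), ?_, ?_⟩
    · intro i h
      have := gc_of (N := N) (m := ⌊(x i + R) / ep R N⌋) (by linarith [(fl i).1]) (fl i).2
      simp only at h
      rw [h] at this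
      have h2 : gc N (-1) = -1 := by simp [gc]
      have h3 := (fl i).1
      omega
    · intro i _
      have := gc_of (N := N) (m := ⌊(x i + R) / ep R N⌋) (by linarith [(fl i).1]) (fl i).2
      simp only [gx, this, mem_Ico]
      have h1 := Int.floor_le ((x i + R) / ep R N)
      have h2 := Int.lt_floor_add_one ((x i + R) / ep R N)
      rw [le_div_iff₀ hε] at h1
      rw [div_lt_iff₀ hε] at h2
      constructor <;> linarith
  · rintro ⟨k, hk, hx⟩ i _
    have h1 := hx i (mem_univ i)
    have h2 := gx_mem hR hk i
    exact ⟨h2.1.trans h1.1, h1.2.trans_le h2.2⟩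

theorem cell_disj {R : ℝ} (hR : 0 < R) (N : ℕ) :
    ((Qf ι (N + 2) : Finset _) : Set (ι → ZMod (N + 2))).PairwiseDisjoint (cell R N) := by
  intro k _ l _ hkl
  rw [Function.onFun, Set.disjoint_left]
  intro x hx hy
  apply hkl
  have hε := ep_pos hR N
  ext i
  have h1 := hx i (mem_univ i)
  have h2 := hy i (mem_univ i)
  simp only [gx, mem_Ico] at h1 h2
  have : gc N (k i) = gc N (l i) := by
    have a1 : (gc N (k i) : ℝ) < gc N (l i) + 1 := by
      by_contra h; push Not at h; nlinarith
    have a2 : (gc N (l i) : ℝ) < gc N (k i) + 1 := by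
      by_contra h; push Not at h; nlinarith
    have a1' : gc N (k i) < gc N (l i) + 1 := by exact_mod_cast a1
    have a2' : gc N (l i) < gc N (k i) + 1 := by exact_mod_cast a2
    omega
  rw [← gc_cast N (k i), this, gc_cast]

theorem cell_vol {R : ℝ} (hR : 0 < R) (N : ℕ) (k : ι → ZMod (N + 2)) :
    (volume (cell R N k)).toReal = ep R N ^ Fintype.card ι := by
  unfold cell
  rw [Real.volume_pi_Ico_toReal (fun i => by simp [(ep_pos hR N).le])]
  simp

theorem cell_meas (R : ℝ) (N : ℕ) (k : ι → ZMod (N + 2)) : MeasurableSet (cell R N k) :=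
  MeasurableSet.univ_pi fun i => measurableSet_Ico

theorem bx_meas (R : ℝ) : MeasurableSet (bx ι R) := MeasurableSet.univ_pi fun i => measurableSet_Ico

def cbx (ι : Type*) (R : ℝ) : Set (ι → ℝ) := Set.pi univ fun _ => Icc (-R) R

theorem cbx_compact (R : ℝ) : IsCompact (cbx ι R) := isCompact_univ_pi fun _ => isCompact_Icc

theorem bx_sub (R : ℝ) : bx ι R ⊆ cbx ι R := Set.pi_mono fun i _ => Ico_subset_Icc_self

def RS (R : ℝ) (N : ℕ) (F : (ι → ℝ) → ℝ) : ℝ := ep R N ^ Fintype.card ι * ∑ k ∈ Qf ι (N + 2), F (gx R N k)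

theorem bx_fin (R : ℝ) : volume (bx ι R) < ∞ := lt_of_le_of_lt (measure_mono (bx_sub R)) (cbx_compact R).measure_lt_top

theorem integrableOn_bx {F : (ι → ℝ) → ℝ} (hF : Continuous F) (R : ℝ) : IntegrableOn F (bx ι R) :=
  (hF.continuousOn.integrableOn_compact (cbx_compact R)).mono_set (bx_sub R)

theorem RS_tendsto {R : ℝ} (hR : 0 < R) {F : (ι → ℝ) → ℝ} (hF : Continuous F) :
    Tendsto (fun N => RS R N F) atTop (𝓝 (∫ x in bx ι R, F x)) := by
  have huc := (cbx_compact (ι := ι) R).uniformContinuousOn_of_continuous hF.continuousOn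
  rw [Metric.uniformContinuousOn_iff] at huc
  rw [Metric.tendsto_nhds]
  intro δ hδ
  set v := (volume (bx ι R)).toReal with hv
  have hv0 : 0 ≤ v := ENNReal.toReal_nonneg
  obtain ⟨r, hr, H⟩ := huc (δ / (v + 1)) (by positivity)
  filter_upwards [(ep_tendsto R).eventually (gt_mem_nhds hr)] with N hN
  have hε := ep_pos hR N
  have e1 : ∫ x in bx ι R, F x = ∑ k ∈ Qf ι (N + 2), ∫ x in cell R N k, F x := by
    rw [bx_eq hR N]
    refine integral_biUnion_finset _ (fun k _ => cell_meas R N k) (cell_disj hR N) ?_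
    intro k hk
    refine (integrableOn_bx hF R).mono_set ?_
    rw [bx_eq hR N]
    exact Set.subset_biUnion_of_mem (u := fun k => cell R N k) hk
  have e2 : RS R N F = ∑ k ∈ Qf ι (N + 2), ∫ x in cell R N k, F (gx R N k) := by
    unfold RS
    rw [Finset.mul_sum]
    refine Finset.sum_congr rfl fun k _ => ?_
    rw [setIntegral_const, smul_eq_mul, measureReal_def, cell_vol hR]
  have hvs : v = ∑ k ∈ Qf ι (N + 2), (volume (cell R N k)).toReal := by
    rw [hv, bx_eq hR N, measure_biUnion_finset (cell_disj hR N) (fun k _ => cell_meas R N k), ENNReal.toReal_sum]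
    intro k hk
    refine ne_of_lt (lt_of_le_of_lt (measure_mono ?_) (bx_fin (ι := ι) R))
    rw [bx_eq hR N]
    exact Set.subset_biUnion_of_mem (u := fun k => cell R N k) hk
  rw [dist_comm, Real.dist_eq, e1, e2, ← Finset.sum_sub_distrib]
  refine lt_of_le_of_lt (Finset.abs_sum_le_sum_abs _ _) ?_
  have : ∀ k ∈ Qf ι (N + 2), |(∫ x in cell R N k, F x) - ∫ x in cell R N k, F (gx R N k)| ≤ δ / (v + 1) * (volume (cell R N k)).toReal := by
    intro k hk
    have hsub : cell R N k ⊆ bx ι R := by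
      rw [bx_eq hR N]
      exact Set.subset_biUnion_of_mem (u := fun k => cell R N k) hk
    have hfin : volume (cell R N k) < ∞ := lt_of_le_of_lt (measure_mono hsub) (bx_fin R)
    rw [← integral_sub ((integrableOn_bx hF R).mono_set hsub) (integrableOn_const hfin.ne)]
    have hgk : gx R N k ∈ cbx ι R := fun i _ => by
      have := gx_mem hR (mem_Qf.1 hk) i
      exact ⟨this.1, by linarith⟩
    rw [← Real.norm_eq_abs, ← measureReal_def]
    refine norm_setIntegral_le_of_norm_le_const (f := fun x => F x - F (gx R N k)) hfin fun x hx => ?_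
    have := H x (bx_sub R (hsub hx)) (gx R N k) hgk (by
      refine lt_of_le_of_lt ?_ hN
      rw [dist_pi_le_iff hε.le]
      intro i
      have := hx i (mem_univ i)
      simp only [mem_Ico] at this
      rw [Real.dist_eq, abs_le]
      constructor <;> linarith)
    rw [Real.dist_eq] at this
    exact this.le
  refine lt_of_le_of_lt (Finset.sum_le_sum this) ?_
  rw [← Finset.mul_sum, ← hvs, div_mul_eq_mul_div, div_lt_iff₀ (by positivity)]
  nlinarith

end Disc

end

section
set_option linter.all false
open Filter
open scoped Topology

namespace Disc
variable {ι : Type*} [Fintype ι] [DecidableEq ι]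

theorem dline {F : (ι → ℝ) → ℝ} {F1 : (ι → ℝ) → ℝ} {i : ι} (h : ∀ x, HasDerivAt (fun s : ℝ => F (x + s • uv i)) (F1 x) 0)
    (x : ι → ℝ) (s : ℝ) : HasDerivAt (fun s : ℝ => F (x + s • uv i)) (F1 (x + s • uv i)) s := by
  have h1 := h (x + s • uv i)
  have h2 : HasDerivAt (fun r : ℝ => r - s) 1 s := (hasDerivAt_id s).sub_const s
  have h3 := HasDerivAt.comp s (h₂ := fun s' : ℝ => F (x + s • uv i + s' • uv i)) (h := fun r : ℝ => r - s)
    (h₂' := F1 (x + s • uv i)) (by simpa using h1) h2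
  refine (h3.congr_deriv (by ring)).congr_of_eventuallyEq (Eventually.of_forall fun r => ?_)
  simp only [Function.comp]
  congr 1
  module

theorem mvt {F : (ι → ℝ) → ℝ} {F1 : (ι → ℝ) → ℝ} {i : ι} (h : ∀ x, HasDerivAt (fun s : ℝ => F (x + s • uv i)) (F1 x) 0)
    (x : ι → ℝ) {ε : ℝ} (hε : 0 < ε) : ∃ s, 0 < s ∧ s < ε ∧ F (x + ε • uv i) - F x = ε * F1 (x + s • uv i) := by
  obtain ⟨s, hs, h2⟩ := exists_hasDerivAt_eq_slope (fun s : ℝ => F (x + s • uv i)) (fun s => F1 (x + s • uv i)) hε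
    (fun s _ => (dline h x s).continuousAt.continuousWithinAt) (fun s _ => dline h x s)
  refine ⟨s, hs.1, hs.2, ?_⟩
  rw [h2]
  simp
  field_simp

theorem uv_norm (i : ι) : ‖(uv i : ι → ℝ)‖ ≤ 1 := by
  rw [pi_norm_le_iff_of_nonneg zero_le_one]
  intro j
  by_cases h : j = i
  · subst h; simp [uv]
  · simp [uv, h]

theorem cc_loc {V : (ι → ℝ) → ℝ} {V1 : ι → (ι → ℝ) → ℝ} {V2 : ι → ι → (ι → ℝ) → ℝ}
    (h1 : ∀ i x, HasDerivAt (fun s : ℝ => V (x + s • uv i)) (V1 i x) 0)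
    (h2 : ∀ i j x, HasDerivAt (fun s : ℝ => V1 i (x + s • uv j)) (V2 i j x) 0)
    (i j : ι) (y : ι → ℝ) {ε : ℝ} (hε : 0 < ε) :
    ∃ z z' : ι → ℝ, dist z y ≤ 2 * ε ∧ dist z' y ≤ 2 * ε ∧
      (Real.exp (V (y + ε • uv i) - V (y + ε • uv i - ε • uv j)) - Real.exp (V y - V (y - ε • uv j))) / ε ^ 2 =
      Real.exp (ε * V1 j z) * V2 i j z' := by
  have hd : ∀ s : ℝ, HasDerivAt (fun s : ℝ => Real.exp (V (y + s • uv i) - V ((y - ε • uv j) + s • uv i)))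
      (Real.exp (V (y + s • uv i) - V ((y - ε • uv j) + s • uv i)) * (V1 i (y + s • uv i) - V1 i ((y - ε • uv j) + s • uv i))) s :=
    fun s => ((dline (h1 i) y s).sub (dline (h1 i) _ s)).exp
  obtain ⟨s, hs, h3⟩ := exists_hasDerivAt_eq_slope _ _ hε
    (fun s _ => (hd s).continuousAt.continuousWithinAt) (fun s _ => hd s)
  obtain ⟨r, hr0, hr1, hr⟩ := mvt (h1 j) (y - ε • uv j + s • uv i) hε
  obtain ⟨r', hr0', hr1', hr'⟩ := mvt (h2 i j) (y - ε • uv j + s • uv i) hε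
  have e1 : y - ε • uv j + s • uv i + ε • uv j = y + s • uv i := by module
  rw [e1] at hr hr'
  rw [hr, hr'] at h3
  have dd : ∀ r, 0 < r → r < ε → dist (y - ε • uv j + s • uv i + r • uv j) y ≤ 2 * ε := by
    intro r h0 h1
    rw [dist_eq_norm]
    have : y - ε • uv j + s • uv i + r • uv j - y = s • uv i + (r - ε) • (uv j : ι → ℝ) := by module
    rw [this]
    refine (norm_add_le _ _).trans ?_
    rw [norm_smul, norm_smul, Real.norm_eq_abs, Real.norm_eq_abs, abs_of_pos hs.1, abs_of_neg (by linarith)]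
    have a1 := uv_norm i
    have a2 := uv_norm j
    have a3 := norm_nonneg (uv i : ι → ℝ)
    have a4 := norm_nonneg (uv j : ι → ℝ)
    nlinarith [hs.1, hs.2]
  refine ⟨_, _, dd r hr0 hr1, dd r' hr0' hr1', ?_⟩
  have e2 : y + ε • uv i - ε • uv j = y - ε • uv j + ε • uv i := by module
  rw [e2]
  simp only [zero_smul, add_zero, sub_zero] at h3
  field_simp at h3 ⊢
  linarith

theorem bdd_fam {κ : Type*} [Finite κ] (F : κ → (ι → ℝ) → ℝ) (hF : ∀ a, Continuous (F a)) (R : ℝ) :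
    ∃ M, 0 < M ∧ ∀ a, ∀ x ∈ cbx ι R, |F a x| ≤ M := by
  choose M hM using fun a => (cbx_compact (ι := ι) R).exists_bound_of_continuousOn (hF a).continuousOn
  cases nonempty_fintype κ
  refine ⟨1 + ∑ a, |M a|, by positivity, fun a x hx => ?_⟩
  have := hM a x hx
  rw [Real.norm_eq_abs] at this
  have h2 : |M a| ≤ ∑ a, |M a| := Finset.single_le_sum (f := fun a => |M a|) (fun _ _ => abs_nonneg _) (Finset.mem_univ a)
  have := le_abs_self (M a)
  linarith

theorem uc_fam {κ : Type*} [Finite κ] (F : κ → (ι → ℝ) → ℝ) (hF : ∀ a, Continuous (F a)) (R : ℝ) {η : ℝ} (hη : 0 < η) :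
    ∃ r, 0 < r ∧ ∀ a, ∀ x ∈ cbx ι R, ∀ y ∈ cbx ι R, dist x y < r → |F a x - F a y| < η := by
  have : ∀ a, ∃ r, 0 < r ∧ ∀ x ∈ cbx ι R, ∀ y ∈ cbx ι R, dist x y < r → |F a x - F a y| < η := by
    intro a
    have huc := (cbx_compact (ι := ι) R).uniformContinuousOn_of_continuous (hF a).continuousOn
    rw [Metric.uniformContinuousOn_iff] at huc
    obtain ⟨r, hr, H⟩ := huc η hη
    exact ⟨r, hr, fun x hx y hy hxy => by simpa [Real.dist_eq] using H x hx y hy hxy⟩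
  choose r hr H using this
  cases nonempty_fintype κ
  obtain ⟨r0, h0, h1⟩ : ∃ r0, 0 < r0 ∧ ∀ a, r0 ≤ r a := by
    by_cases hne : Nonempty κ
    · obtain ⟨a, ha⟩ := Finite.exists_min r
      exact ⟨r a, hr a, ha⟩
    · exact ⟨1, one_pos, fun a => (hne ⟨a⟩).elim⟩
  exact ⟨r0, h0, fun a x hx y hy hxy => H a x hx y hy (hxy.trans_le (h1 a))⟩

theorem near_mem {R : ℝ} {y z : ι → ℝ} (hy : ∀ i, -R ≤ y i ∧ y i ≤ R) (h : dist z y ≤ 1) : z ∈ cbx ι (R + 1) := by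
  intro i _
  have := (dist_le_pi_dist z y i).trans h
  rw [Real.dist_eq, abs_le] at this
  have := hy i
  constructor <;> linarith

theorem gx_mem' {R : ℝ} (hR : 0 < R) {N : ℕ} {k : ι → ZMod (N + 2)} (h : inQ k) (i : ι) :
    -R ≤ gx R N k i ∧ gx R N k i ≤ R := by
  have := gx_mem hR h i
  have := ep_pos hR N
  constructor <;> linarith

theorem cc_unif {V : (ι → ℝ) → ℝ} {V1 : ι → (ι → ℝ) → ℝ} {V2 : ι → ι → (ι → ℝ) → ℝ}
    (h1 : ∀ i x, HasDerivAt (fun s : ℝ => V (x + s • uv i)) (V1 i x) 0)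
    (h2 : ∀ i j x, HasDerivAt (fun s : ℝ => V1 i (x + s • uv j)) (V2 i j x) 0)
    (c1 : ∀ i, Continuous (V1 i)) (c2 : ∀ i j, Continuous (V2 i j)) {R : ℝ} (hR : 0 < R) {η : ℝ} (hη : 0 < η) :
    ∀ᶠ N in atTop, ∀ i j : ι, ∀ k : ι → ZMod (N + 2), chi i k →
      |cc (ee (N + 2)) (ep R N) (fun k => Real.exp (-V (gx R N k))) j i k - V2 i j (gx R N k)| ≤ η := by
  obtain ⟨M1, hM1, B1⟩ := bdd_fam V1 c1 (R + 1)
  obtain ⟨M2, hM2, B2⟩ := bdd_fam (fun a : ι × ι => V2 a.1 a.2) (fun a => c2 _ _) (R + 1)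
  obtain ⟨r, hr, U⟩ := uc_fam (fun a : ι × ι => V2 a.1 a.2) (fun a => c2 _ _) (R + 1) (half_pos hη)
  have hpos : 0 < min (min (1 / 2) (r / 2)) (min (1 / M1) (η / (4 * M1 * M2))) := by positivity
  filter_upwards [(ep_tendsto R).eventually (gt_mem_nhds hpos)] with N hN i j k hk
  have hε := ep_pos hR N
  set ε := ep R N
  rw [lt_min_iff, lt_min_iff, lt_min_iff] at hN
  obtain ⟨⟨g1, g2⟩, g3, g4⟩ := hN
  set y := gx R N k with hy
  obtain ⟨z, z', d1, d2, e⟩ := cc_loc h1 h2 i j y hε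
  have hc : cc (ee (N + 2)) ε (fun k => Real.exp (-V (gx R N k))) j i k = Real.exp (ε * V1 j z) * V2 i j z' := by
    rw [← e]
    simp only [cc]
    rw [gx_add_sub R hk, gx_add R hk, gx_sub R hk.1, ← Real.exp_sub, ← Real.exp_sub]
    congr 3 <;> exact neg_sub_neg _ _
  rw [hc]
  have hym := gx_mem' hR hk.1
  have m0 : y ∈ cbx ι (R + 1) := near_mem hym ((dist_self y).le.trans zero_le_one)
  have m1 : z ∈ cbx ι (R + 1) := near_mem hym (by linarith)
  have m2 : z' ∈ cbx ι (R + 1) := near_mem hym (by linarith)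
  have b1 := B1 j z m1
  have b2 : |V2 i j z'| ≤ M2 := B2 (i, j) z' m2
  have b3 : |V2 i j z' - V2 i j y| < η / 2 := U (i, j) z' m2 y m0 (by linarith)
  have b4 : |ε * V1 j z| ≤ ε * M1 := by rw [abs_mul, abs_of_pos hε]; gcongr
  have g3' : ε * M1 < 1 := by rwa [lt_div_iff₀ hM1] at g3
  have b5 := Real.abs_exp_sub_one_le (b4.trans g3'.le)
  have g4' : ε * (4 * M1 * M2) < η := by rwa [lt_div_iff₀ (by positivity)] at g4
  have b6 : |(Real.exp (ε * V1 j z) - 1) * V2 i j z'| ≤ 2 * (ε * M1) * M2 := by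
    rw [abs_mul]
    have := abs_nonneg (V2 i j z')
    gcongr
    linarith
  have : Real.exp (ε * V1 j z) * V2 i j z' - V2 i j y = (Real.exp (ε * V1 j z) - 1) * V2 i j z' + (V2 i j z' - V2 i j y) := by ring
  rw [this]
  refine (abs_add_le _ _).trans ?_
  linarith

theorem quad_le {v : ι → ℝ} {c : ι → ι → ℝ} {δ : ℝ} (h : ∀ i j, |c i j| ≤ δ) :
    ∑ i, ∑ j, v i * v j * c i j ≤ δ * Fintype.card ι * ∑ i, v i ^ 2 := by
  have : ∀ i j, v i * v j * c i j ≤ δ * ((v i ^ 2 + v j ^ 2) / 2) := by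
    intro i j
    have h1 := h i j
    rw [abs_le] at h1
    nlinarith [mul_nonneg (sub_nonneg.2 h1.2) (sq_nonneg (v i + v j)), mul_nonneg (by linarith [h1.1] : 0 ≤ δ + c i j) (sq_nonneg (v i - v j))]
  refine (Finset.sum_le_sum fun i _ => Finset.sum_le_sum fun j _ => this i j).trans (le_of_eq ?_)
  simp_rw [← Finset.mul_sum, ← Finset.sum_div, Finset.sum_add_distrib]
  simp
  rw [← Finset.mul_sum]
  ring

theorem RS_mono {R : ℝ} (hR : 0 < R) {N : ℕ} {F G : (ι → ℝ) → ℝ} (h : ∀ x ∈ cbx ι R, F x ≤ G x) : RS R N F ≤ RS R N G := by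
  unfold RS
  have := (ep_pos hR N).le
  gcongr with k hk
  exact h _ fun i _ => gx_mem' hR (mem_Qf.1 hk) i

theorem RS_pos {R : ℝ} (hR : 0 < R) {N : ℕ} {F : (ι → ℝ) → ℝ} (h : ∀ x, 0 < F x) : 0 < RS R N F := by
  unfold RS
  have := ep_pos hR N
  refine mul_pos (by positivity) (Finset.sum_pos (fun k _ => h _) ⟨0, mem_Qf.2 ?_⟩)
  intro i
  simp only [Pi.zero_apply, ne_eq]
  intro h
  have : (-1 : ZMod (N+2)).val = N + 1 := val_neg_one' N
  rw [← h] at this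
  simp at this

theorem bx_vol_pos {R : ℝ} (hR : 0 < R) : 0 < volume (bx ι R) := by
  refine lt_of_lt_of_le (b := volume (Set.pi univ fun _ : ι => Ioo (-R) R)) ?_ (measure_mono (Set.pi_mono fun i _ => Ioo_subset_Ico_self))
  refine (isOpen_set_pi finite_univ fun _ _ => isOpen_Ioo).measure_pos _ ⟨0, fun i _ => ?_⟩
  simp [hR]

theorem bx_int_pos {R : ℝ} (hR : 0 < R) {w : (ι → ℝ) → ℝ} (hc : Continuous w) (hw : ∀ x, 0 < w x) : 0 < ∫ x in bx ι R, w x := by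
  rw [integral_pos_iff_support_of_nonneg (fun x => (hw x).le) (integrableOn_bx hc R)]
  have : Function.support w = univ := by ext x; simp [(hw x).ne']
  rw [this, Measure.restrict_apply_univ]
  exact bx_vol_pos hR

end Disc

end

section
set_option linter.all false
open Filter
open scoped Topology

namespace Disc
variable {ι : Type*} [Fintype ι] [DecidableEq ι]

theorem quad_lin (L : ((ι → ℝ) → ℝ) → ℝ) (hL : ∀ (c : ι → ℝ) (F : ι → (ι → ℝ) → ℝ), (∀ i, Continuous (F i)) →
    L (fun x => ∑ i, c i * F i x) = ∑ i, c i * L (F i)) {w : (ι → ℝ) → ℝ} (hc : Continuous w) (Z : ℝ) (v : ι → ℝ) :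
    L (fun x => w x * (∑ i, v i * x i) ^ 2) - L (fun x => w x * ∑ i, v i * x i) ^ 2 / Z =
      ∑ i, ∑ j, v i * v j * (L (fun x => w x * (x i * x j)) - L (fun x => w x * x i) * L (fun x => w x * x j) / Z) := by
  have a1 : L (fun x => w x * (∑ i, v i * x i) ^ 2) = ∑ i, v i * ∑ j, v j * L (fun x => w x * (x i * x j)) := by
    have : (fun x : ι → ℝ => w x * (∑ i, v i * x i) ^ 2) = fun x => ∑ i, v i * ∑ j, v j * (w x * (x i * x j)) := by
      ext x
      simp_rw [sq, Finset.sum_mul_sum, Finset.mul_sum]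
      refine Finset.sum_congr rfl fun i _ => Finset.sum_congr rfl fun j _ => by ring
    rw [this, hL v (fun i x => ∑ j, v j * (w x * (x i * x j))) (fun i => by fun_prop)]
    refine Finset.sum_congr rfl fun i _ => ?_
    rw [hL v (fun j x => w x * (x i * x j)) (fun j => by fun_prop)]
  have a2 : L (fun x => w x * ∑ i, v i * x i) = ∑ i, v i * L (fun x => w x * x i) := by
    rw [← hL v (fun i x => w x * x i) (fun j => by fun_prop)]
    congr 1; ext x
    rw [Finset.mul_sum]
    refine Finset.sum_congr rfl fun i _ => by ring
  rw [a1, a2, sq, Finset.sum_mul_sum, Finset.sum_div, ← Finset.sum_sub_distrib]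
  refine Finset.sum_congr rfl fun i _ => ?_
  rw [Finset.sum_div, Finset.mul_sum, ← Finset.sum_sub_distrib]
  refine Finset.sum_congr rfl fun j _ => ?_
  ring

def IsLin (L : ((ι → ℝ) → ℝ) → ℝ) : Prop := ∀ (c : ι → ℝ) (F : ι → (ι → ℝ) → ℝ), (∀ i, Continuous (F i)) →
    L (fun x => ∑ i, c i * F i x) = ∑ i, c i * L (F i)

theorem cov_gen {w : (ι → ℝ) → ℝ} (hc : Continuous w) {LN : ℕ → ((ι → ℝ) → ℝ) → ℝ} {L : ((ι → ℝ) → ℝ) → ℝ}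
    (hLN : ∀ N, IsLin (LN N)) (hL : IsLin L) (hlim0 : ∀ F, Continuous F → Tendsto (fun N => LN N F) atTop (𝓝 (L F)))
    (Zp : 0 < L w) {α : ℝ} (hα : 0 ≤ α)
    (hcov : ∀ v : ι → ℝ, L (fun x => w x * (∑ i, v i * x i) ^ 2) - L (fun x => w x * ∑ i, v i * x i) ^ 2 / L w
      ≤ α * L w * ∑ i, v i ^ 2) {δ : ℝ} (hδ : 0 < δ) :
    ∀ᶠ N in atTop, ∀ v : ι → ℝ, LN N (fun x => w x * (∑ i, v i * x i) ^ 2) - LN N (fun x => w x * ∑ i, v i * x i) ^ 2 / LN N w ≤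
      (α + δ) * LN N w * ∑ i, v i ^ 2 := by
  set Z := L w with hZ
  set C : ι → ι → ℝ := fun i j => L (fun x => w x * (x i * x j)) - L (fun x => w x * x i) * L (fun x => w x * x j) / Z with hC
  set CN : ℕ → ι → ι → ℝ := fun N i j => LN N (fun x => w x * (x i * x j)) - LN N (fun x => w x * x i) * LN N (fun x => w x * x j) / LN N w with hCN
  have q1 : ∀ v : ι → ℝ, L (fun x => w x * (∑ i, v i * x i) ^ 2) - L (fun x => w x * ∑ i, v i * x i) ^ 2 / Z =
      ∑ i, ∑ j, v i * v j * C i j := quad_lin L hL hc Z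
  have q2 : ∀ N, ∀ v : ι → ℝ, LN N (fun x => w x * (∑ i, v i * x i) ^ 2) - LN N (fun x => w x * ∑ i, v i * x i) ^ 2 / LN N w =
      ∑ i, ∑ j, v i * v j * CN N i j := fun N => quad_lin (LN N) (hLN N) hc _
  have hlim : ∀ i j, Tendsto (fun N => CN N i j) atTop (𝓝 (C i j)) := fun i j =>
    (hlim0 _ (by fun_prop)).sub (((hlim0 _ (by fun_prop)).mul (hlim0 _ (by fun_prop))).div (hlim0 _ hc) Zp.ne')
  set D : ℝ := ((Fintype.card ι : ℕ) : ℝ) with hD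
  have hD0 : 0 ≤ D := Nat.cast_nonneg _
  set δ1 := δ * Z / (4 * (D + 1)) with hδ1
  have hδ1p : 0 < δ1 := by positivity
  have ev1 : ∀ᶠ N in atTop, ∀ i j, |CN N i j - C i j| ≤ δ1 := by
    rw [eventually_all]; intro i
    rw [eventually_all]; intro j
    have := (Metric.tendsto_nhds.1 (hlim i j)) δ1 hδ1p
    filter_upwards [this] with N hN
    rw [Real.dist_eq] at hN; exact hN.le
  have ev2 : ∀ᶠ N in atTop, (α + δ / 2) * Z < (α + δ) * LN N w := by
    have : Tendsto (fun N => (α + δ) * LN N w) atTop (𝓝 ((α + δ) * Z)) := (hlim0 _ hc).const_mul _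
    exact this.eventually (lt_mem_nhds (by nlinarith))
  filter_upwards [ev1, ev2] with N h1 h2 v
  have h3 := quad_le (v := v) h1
  have h4 := hcov v
  rw [q1] at h4
  rw [q2]
  have h5 : ∑ i, ∑ j, v i * v j * CN N i j = ∑ i, ∑ j, v i * v j * C i j + ∑ i, ∑ j, v i * v j * (CN N i j - C i j) := by
    rw [← Finset.sum_add_distrib]
    refine Finset.sum_congr rfl fun i _ => ?_
    rw [← Finset.sum_add_distrib]
    refine Finset.sum_congr rfl fun j _ => ?_
    ring
  rw [h5]
  have hs : 0 ≤ ∑ i, v i ^ 2 := Finset.sum_nonneg fun i _ => sq_nonneg _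
  have h6 : δ1 * D ≤ δ / 2 * Z := by
    rw [hδ1, div_mul_eq_mul_div, div_le_iff₀ (by positivity)]
    nlinarith [mul_pos hδ Zp, mul_nonneg (mul_pos hδ Zp).le hD0]
  calc _ ≤ α * Z * ∑ i, v i ^ 2 + δ1 * D * ∑ i, v i ^ 2 := add_le_add h4 h3
    _ = (α * Z + δ1 * D) * ∑ i, v i ^ 2 := by ring
    _ ≤ (α + δ) * LN N w * ∑ i, v i ^ 2 := by
      gcongr
      linarith

theorem isLin_int {g : (ι → ℝ) → ℝ} {S : Set (ι → ℝ)} (h : ∀ F : (ι → ℝ) → ℝ, Continuous F → IntegrableOn (fun x => g x * F x) S) :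
    IsLin (fun F : (ι → ℝ) → ℝ => ∫ x in S, g x * F x) := by
  intro c F hF
  simp only
  simp_rw [Finset.mul_sum]
  rw [integral_finset_sum _ fun i _ => ?_]
  · refine Finset.sum_congr rfl fun i _ => ?_
    rw [← integral_const_mul]
    congr 1; ext x; ring
  · have := (h _ (hF i)).const_mul (c i)
    refine this.congr (Eventually.of_forall fun x => ?_)
    simp only; ring

theorem cov_event {w : (ι → ℝ) → ℝ} (hc : Continuous w) (hw : ∀ x, 0 < w x) {R : ℝ} (hR : 0 < R) {α : ℝ} (hα : 0 ≤ α)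
    (hcov : ∀ v : ι → ℝ, (∫ x in bx ι R, w x * (∑ i, v i * x i) ^ 2) - (∫ x in bx ι R, w x * ∑ i, v i * x i) ^ 2 / (∫ x in bx ι R, w x)
      ≤ α * (∫ x in bx ι R, w x) * ∑ i, v i ^ 2) {δ : ℝ} (hδ : 0 < δ) :
    ∀ᶠ N in atTop, ∀ v : ι → ℝ, RS R N (fun x => w x * (∑ i, v i * x i) ^ 2) - RS R N (fun x => w x * ∑ i, v i * x i) ^ 2 / RS R N w ≤
      (α + δ) * RS R N w * ∑ i, v i ^ 2 := by
  refine cov_gen hc (LN := fun N => RS R N) (L := fun F => ∫ x in bx ι R, F x) (fun N c F hF => ?_) (fun c F hF => ?_)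
    (fun F hF => RS_tendsto hR hF) (bx_int_pos hR hc hw) hα hcov hδ
  · simp only [RS]
    rw [Finset.sum_comm, Finset.mul_sum]
    refine Finset.sum_congr rfl fun i _ => ?_
    rw [← Finset.mul_sum]; ring
  · beta_reduce
    rw [integral_finset_sum _ fun i _ => ((integrableOn_bx (hF i) R).const_mul _)]
    simp_rw [integral_const_mul]

set_option maxHeartbeats 2000000 in
theorem box_poincare {V : (ι → ℝ) → ℝ} {V1 : ι → (ι → ℝ) → ℝ} {V2 : ι → ι → (ι → ℝ) → ℝ}
    (h1 : ∀ i x, HasDerivAt (fun s : ℝ => V (x + s • uv i)) (V1 i x) 0)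
    (h2 : ∀ i j x, HasDerivAt (fun s : ℝ => V1 i (x + s • uv j)) (V2 i j x) 0)
    (c0 : Continuous V) (c1 : ∀ i, Continuous (V1 i)) (c2 : ∀ i j, Continuous (V2 i j)) {R t α l0 : ℝ} (hR : 0 < R)
    (hconv : ∀ (x ξ : ι → ℝ), t * ∑ i, ξ i ^ 2 ≤ ∑ i, ∑ j, V2 i j x * (ξ i * ξ j)) (hα : 0 ≤ α)
    (hcov : ∀ v : ι → ℝ, (∫ x in bx ι R, Real.exp (-V x) * (∑ i, v i * x i) ^ 2) -
      (∫ x in bx ι R, Real.exp (-V x) * ∑ i, v i * x i) ^ 2 / (∫ x in bx ι R, Real.exp (-V x))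
      ≤ α * (∫ x in bx ι R, Real.exp (-V x)) * ∑ i, v i ^ 2)
    (hl0 : 0 ≤ l0) (hl : l0 ^ 2 * α < t)
    {f : (ι → ℝ) → ℝ} {f1 : ι → (ι → ℝ) → ℝ} (hf : Continuous f) (hf1 : ∀ i, Continuous (f1 i))
    (hfd : ∀ i x, HasDerivAt (fun s : ℝ => f (x + s • uv i)) (f1 i x) 0) :
    l0 * ((∫ x in bx ι R, Real.exp (-V x) * f x ^ 2) -
      (∫ x in bx ι R, Real.exp (-V x) * f x) ^ 2 / (∫ x in bx ι R, Real.exp (-V x))) ≤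
      ∑ i, ∫ x in bx ι R, Real.exp (-V x) * f1 i x ^ 2 := by
  set w : (ι → ℝ) → ℝ := fun x => Real.exp (-V x) with hwdef
  have hw : ∀ x, 0 < w x := fun x => Real.exp_pos _
  have hwc : Continuous w := by fun_prop
  set Z := ∫ x in bx ι R, w x with hZ
  have Zp : 0 < Z := bx_int_pos hR hwc hw
  set D : ℝ := ((Fintype.card ι : ℕ) : ℝ) with hD
  have hD0 : 0 ≤ D := Nat.cast_nonneg _
  -- constants
  set δ := (t - l0 ^ 2 * α) / (2 * (l0 ^ 2 + 1)) with hδ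
  have hδp : 0 < δ := div_pos (by linarith) (by positivity)
  set τ := t - l0 ^ 2 * (α + δ) with hτ
  have hτp : 0 < τ := by
    have : l0 ^ 2 * δ ≤ (t - l0 ^ 2 * α) / 2 := by
      rw [hδ, mul_div_assoc', div_le_div_iff₀ (by positivity) (by norm_num)]
      nlinarith [sq_nonneg l0]
    have : τ = (t - l0 ^ 2 * α) - l0 ^ 2 * δ := by rw [hτ]; ring
    linarith
  set e1 := min 1 (τ / (4 * (l0 + 1))) with he1
  have he1p : 0 < e1 := lt_min one_pos (by positivity)
  have he1l : e1 * l0 ≤ τ / 4 := by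
    have : e1 * (4 * (l0 + 1)) ≤ τ := by rw [← le_div_iff₀ (by positivity)]; exact min_le_right _ _
    nlinarith
  set e2 := τ / 4 with he2
  have he2p : 0 < e2 := by positivity
  have hfinal : l0 ^ 2 * (α + δ) + e1 * l0 + e2 < t := by linarith
  set η := e2 / (2 * (D + 1)) with hη
  have hηp : 0 < η := by positivity
  obtain ⟨M1, hM1, B1⟩ := bdd_fam V1 c1 (R + 1)
  obtain ⟨M2, hM2, B2⟩ := bdd_fam (fun a : ι × ι => V2 a.1 a.2) (fun a => c2 _ _) (R + 1)
  set C := M2 + η + Real.exp M1 with hC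
  have hCp : 0 < C := by positivity
  -- the key estimate, for each error
  have key : ∀ η', 0 < η' → ∀ᶠ N in atTop,
      l0 * (RS R N (fun x => w x * f x ^ 2) - RS R N (fun x => w x * f x) ^ 2 / RS R N w) ≤
        (∑ i, RS R N (fun x => w x * f1 i x ^ 2)) + η' * D * RS R N w := by
    intro η' hη'
    obtain ⟨M3, hM3, B3⟩ := bdd_fam f1 hf1 (R + 1)
    obtain ⟨r, hr, U⟩ := uc_fam f1 hf1 (R + 1) (η := η' / (2 * M3)) (by positivity)
    have hpos : 0 < min (min 1 r) (min (e1 / (C ^ 2 * (D + 1))) (e2 / (2 * (D + 1) * C))) := by positivity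
    filter_upwards [cc_unif h1 h2 c1 c2 hR hηp, cov_event hwc hw hR hα hcov hδp,
      (ep_tendsto R).eventually (gt_mem_nhds hpos)] with N g1 g2 g3
    have hε := ep_pos hR N
    set ε := ep R N with hεd
    rw [lt_min_iff, lt_min_iff, lt_min_iff] at g3
    obtain ⟨⟨s1, s2⟩, s3, s4⟩ := g3
    have m0 : ∀ k : ι → ZMod (N + 2), inQ k → gx R N k ∈ cbx ι (R + 1) := fun k hk =>
      near_mem (gx_mem' hR hk) ((dist_self _).le.trans zero_le_one)
    have hεD : 0 < ε ^ Fintype.card ι := by positivity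
    have H := discrete_poincare (n := N + 2) (by omega) hε (p := fun k => w (gx R N k)) (fun k => hw _) hCp.le hηp.le
      (α := α + δ) (t := t) (by linarith) (fun k i j => V2 i j (gx R N k)) (fun k => gx R N k)
      (fun i j k hk => by
        have a1 := g1 i j k hk
        have a2 : |V2 i j (gx R N k)| ≤ M2 := B2 (i, j) _ (m0 k hk.1)
        have a3 := abs_sub_abs_le_abs_sub (cc (ee (N + 2)) ε (fun k => w (gx R N k)) j i k) (V2 i j (gx R N k))
        have := Real.exp_pos M1
        have a1' : |cc (ee (N + 2)) ε (fun k => w (gx R N k)) j i k - V2 i j (gx R N k)| ≤ η := a1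
        linarith)
      (fun j k hk => by
        rw [gx_sub R hk]
        obtain ⟨s, hs0, hs1, hs⟩ := mvt (h1 j) (gx R N k - ε • uv j) hε
        rw [sub_add_cancel] at hs
        have hm : gx R N k - ε • uv j + s • uv j ∈ cbx ι (R + 1) := by
          refine near_mem (gx_mem' hR hk) ?_
          have : gx R N k - ε • uv j + s • uv j - gx R N k = (s - ε) • (uv j : ι → ℝ) := by module
          rw [dist_eq_norm, this, norm_smul, Real.norm_eq_abs, abs_of_neg (by linarith)]
          have := uv_norm j
          have := norm_nonneg (uv j : ι → ℝ)
          nlinarith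
        have a1 := (abs_le.1 (B1 j _ hm)).1
        have a2 : -V (gx R N k) ≤ M1 + -V (gx R N k - ε • uv j) := by nlinarith
        calc w (gx R N k) ≤ Real.exp (M1 + -V (gx R N k - ε • uv j)) := Real.exp_le_exp.2 a2
          _ = Real.exp M1 * w (gx R N k - ε • uv j) := Real.exp_add _ _
          _ ≤ _ := by
            refine mul_le_mul_of_nonneg_right ?_ (hw _).le
            linarith)
      (fun i j k hk => g1 i j k hk)
      (fun k _ ξ => hconv _ ξ)
      (fun i j k hk => by
        rw [gx_add R hk]
        by_cases hij : i = j
        · subst hij; simp [uv, ← hεd, hε.ne']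
        · simp [uv, hij, Ne.symm hij])
      (fun v => by
        have := g2 v
        simp only [RS] at this
        rw [← hεd] at this
        have e : ∀ A B C G : ℝ, ε ^ Fintype.card ι * A - (ε ^ Fintype.card ι * B) ^ 2 / (ε ^ Fintype.card ι * C) ≤ (α + δ) * (ε ^ Fintype.card ι * C) * G →
            A - B ^ 2 / C ≤ (α + δ) * C * G := by
          intro A B C G h
          have h' : ε ^ Fintype.card ι * (A - B ^ 2 / C) ≤ ε ^ Fintype.card ι * ((α + δ) * C * G) := by
            have e : (ε ^ Fintype.card ι * B) ^ 2 / (ε ^ Fintype.card ι * C) = ε ^ Fintype.card ι * (B ^ 2 / C) := by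
              rw [mul_pow, sq (ε ^ Fintype.card ι), mul_assoc, mul_div_mul_left _ _ hεD.ne', mul_div_assoc]
            rw [e] at h
            linarith
          exact le_of_mul_le_mul_left h' hεD
        exact e _ _ _ _ this)
      (e1 := e1) (e2 := e2) (l0 := l0)
      (by rw [lt_div_iff₀ (by positivity)] at s3; linarith) (min_le_left _ _)
      (by
        rw [lt_div_iff₀ (by positivity)] at s4
        have : η * (2 * (D + 1)) = e2 := by rw [hη]; field_simp
        have hm := mul_pos hCp hε
        nlinarith) hl0 hfinal (fun k => f (gx R N k))
    have hE : ε ^ Fintype.card ι * En ε (fun k => w (gx R N k)) (fun k => f (gx R N k)) (fun k => f (gx R N k)) ≤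
        (∑ i, RS R N (fun x => w x * f1 i x ^ 2)) + η' * D * RS R N w := by
      have : ∀ i, ε ^ Fintype.card ι * ∑ k, w (gx R N k) * (gr ε (fun k => f (gx R N k)) i k * gr ε (fun k => f (gx R N k)) i k) ≤
          RS R N (fun x => w x * f1 i x ^ 2) + η' * RS R N w := by
        intro i
        have hr : RS R N (fun x => w x * f1 i x ^ 2) + η' * RS R N w = ε ^ Fintype.card ι * ∑ k ∈ Qf ι (N + 2), w (gx R N k) * (f1 i (gx R N k) ^ 2 + η') := by
          simp only [RS, mul_add, Finset.sum_add_distrib, ← Finset.sum_mul]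
          ring
        rw [hr]
        gcongr
        rw [← Finset.sum_subset (Finset.subset_univ (Qf ι (N + 2)))]
        · refine Finset.sum_le_sum fun k hk => ?_
          have hk' := mem_Qf.1 hk
          have := (hw (gx R N k)).le
          gcongr
          unfold gr
          split_ifs with hc
          · beta_reduce
            rw [gx_add R hc]
            obtain ⟨s, hs0, hs1, hs⟩ := mvt (hfd i) (gx R N k) hε
            rw [hs, mul_div_cancel_left₀ _ hε.ne']
            have hd : dist (gx R N k + s • uv i) (gx R N k) ≤ ε := by
              rw [dist_eq_norm, add_sub_cancel_left, norm_smul, Real.norm_eq_abs, abs_of_pos hs0]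
              have := uv_norm i
              have := norm_nonneg (uv i : ι → ℝ)
              nlinarith
            have hm : gx R N k + s • uv i ∈ cbx ι (R + 1) := near_mem (gx_mem' hR hk') (by linarith)
            have u1 := U i _ hm _ (m0 k hk') (by linarith)
            have u2 := B3 i _ hm
            have u3 := B3 i _ (m0 k hk')
            set a := f1 i (gx R N k + s • uv i)
            set b := f1 i (gx R N k)
            have : a * a - b ^ 2 ≤ |a - b| * |a + b| := by
              rw [← abs_mul]
              refine le_trans (le_of_eq (by ring)) (le_abs_self _)
            have u4 : |a + b| ≤ 2 * M3 := (abs_add_le a b).trans (by linarith)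
            have u5 : |a - b| * |a + b| ≤ η' / (2 * M3) * (2 * M3) := mul_le_mul u1.le u4 (abs_nonneg _) (by positivity)
            rw [div_mul_cancel₀ _ (by positivity)] at u5
            linarith
          · have := sq_nonneg (f1 i (gx R N k)); linarith
        · intro k _ hk
          have : ¬ chi i k := fun h => hk (mem_Qf.2 h.1)
          simp [gr, this]
      unfold En
      rw [Finset.mul_sum]
      refine (Finset.sum_le_sum fun i _ => this i).trans (le_of_eq ?_)
      rw [Finset.sum_add_distrib]
      simp [hD]
      ring
    refine le_trans (le_of_eq ?_) ((mul_le_mul_of_nonneg_left H hεD.le).trans hE)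
    simp only [RS]
    rw [← hεd, mul_pow, sq (ε ^ Fintype.card ι), mul_assoc (ε ^ Fintype.card ι) (ε ^ Fintype.card ι), mul_div_mul_left _ _ hεD.ne', mul_div_assoc]
    ring
  have lim1 : Tendsto (fun N => l0 * (RS R N (fun x => w x * f x ^ 2) - RS R N (fun x => w x * f x) ^ 2 / RS R N w)) atTop
      (𝓝 (l0 * ((∫ x in bx ι R, w x * f x ^ 2) - (∫ x in bx ι R, w x * f x) ^ 2 / Z))) :=
    ((RS_tendsto hR (by fun_prop)).sub (((RS_tendsto hR (by fun_prop)).pow 2).div (RS_tendsto hR hwc) Zp.ne')).const_mul _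
  have fin : ∀ η', 0 < η' → l0 * ((∫ x in bx ι R, w x * f x ^ 2) - (∫ x in bx ι R, w x * f x) ^ 2 / Z) ≤
      (∑ i, ∫ x in bx ι R, w x * f1 i x ^ 2) + η' * D * Z := by
    intro η' hη'
    have lim2 : Tendsto (fun N => (∑ i, RS R N (fun x => w x * f1 i x ^ 2)) + η' * D * RS R N w) atTop
        (𝓝 ((∑ i, ∫ x in bx ι R, w x * f1 i x ^ 2) + η' * D * Z)) :=
      (tendsto_finset_sum _ fun i _ => RS_tendsto hR (by have := hf1 i; fun_prop)).add ((RS_tendsto hR hwc).const_mul _)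
    exact le_of_tendsto_of_tendsto lim1 lim2 (key η' hη')
  refine le_of_forall_pos_le_add fun e he => ?_
  have := fin (e / (D * Z + 1)) (by positivity)
  have h3 : e / (D * Z + 1) * D * Z ≤ e := by
    rw [mul_assoc, div_mul_eq_mul_div, div_le_iff₀ (by positivity)]
    nlinarith
  linarith

end Disc

end

section
set_option linter.all false
open Filter
open scoped Topology

namespace Disc
variable {ι : Type*} [Fintype ι] [DecidableEq ι]

theorem hd_pos (n : ℕ) (u : ℝ) : HasDerivAt (fun u : ℝ => (max u 0) ^ (n + 2)) ((n + 2 : ℕ) * (max u 0) ^ (n + 1)) u := by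
  rcases lt_trichotomy u 0 with h | h | h
  · have : (fun u : ℝ => (max u 0) ^ (n + 2)) =ᶠ[𝓝 u] fun _ => 0 := by
      filter_upwards [gt_mem_nhds h] with x hx
      rw [max_eq_right hx.le]; simp
    rw [max_eq_right h.le]
    simpa using (hasDerivAt_const u (0:ℝ)).congr_of_eventuallyEq this
  · subst h
    rw [← hasDerivWithinAt_univ, ← Iic_union_Ici (a := (0:ℝ))]
    refine HasDerivWithinAt.union ?_ ?_
    · have : HasDerivWithinAt (fun _ : ℝ => (0:ℝ)) 0 (Iic 0) 0 := hasDerivWithinAt_const _ _ _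
      refine (this.congr (fun x hx => ?_) (by simp)).congr_deriv (by simp)
      rw [max_eq_right hx]; simp
    · have : HasDerivWithinAt (fun x : ℝ => x ^ (n + 2)) ((n + 2 : ℕ) * 0 ^ (n + 1)) (Ici 0) 0 := (hasDerivAt_pow (n + 2) (0:ℝ)).hasDerivWithinAt
      refine (this.congr (fun x hx => ?_) (by simp)).congr_deriv (by simp)
      rw [max_eq_left hx]
  · have : (fun u : ℝ => (max u 0) ^ (n + 2)) =ᶠ[𝓝 u] fun u => u ^ (n + 2) := by
      filter_upwards [lt_mem_nhds h] with x hx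
      rw [max_eq_left hx.le]
    rw [max_eq_left h.le]
    exact (hasDerivAt_pow (n + 2) u).congr_of_eventuallyEq this

/-- a closed convex set is a countable intersection of half spaces -/
theorem halfspaces {B : Set (ι → ℝ)} (hc : IsClosed B) (hconv : Convex ℝ B) :
    ∃ (a : ℕ → ι → ℝ) (h : ℕ → ℝ), ∀ x, x ∈ B ↔ ∀ l, ∑ i, a l i * x i ≤ h l := by
  have H : ∀ z : (Bᶜ : Set (ι → ℝ)), ∃ (a : ι → ℝ) (h : ℝ), (∀ x ∈ B, ∑ i, a i * x i ≤ h) ∧ h < ∑ i, a i * z.1 i := by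
    rintro ⟨z, hz⟩
    obtain ⟨f, u, h1, h2⟩ := geometric_hahn_banach_closed_point hconv hc hz
    have hf : ∀ x, f x = ∑ i, f (uv i) * x i := by
      intro x
      conv_lhs => rw [show x = ∑ i, x i • uv i from by ext j; simp [uv, Finset.sum_apply, Pi.single_apply]]
      rw [map_sum]
      refine Finset.sum_congr rfl fun i _ => ?_
      rw [map_smul, smul_eq_mul, mul_comm]
    refine ⟨fun i => f (uv i), u, fun x hx => ?_, ?_⟩
    · rw [← hf]; exact (h1 x hx).le
    · rw [← hf]; exact h2
  choose a h h1 h2 using H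
  obtain ⟨T, hT, hTU⟩ := TopologicalSpace.isOpen_iUnion_countable (fun z : (Bᶜ : Set (ι → ℝ)) => {x : ι → ℝ | h z < ∑ i, a z i * x i})
    (fun z => isOpen_lt continuous_const (by fun_prop))
  by_cases hne : T.Nonempty
  · obtain ⟨e, he⟩ := hT.exists_eq_range hne
    refine ⟨fun l => a (e l), fun l => h (e l), fun x => ⟨fun hx l => h1 _ x hx, fun hx => ?_⟩⟩
    by_contra hxB
    have : x ∈ ⋃ z, {x : ι → ℝ | h z < ∑ i, a z i * x i} := mem_iUnion.2 ⟨⟨x, hxB⟩, h2 ⟨x, hxB⟩⟩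
    rw [← hTU] at this
    simp only [mem_iUnion] at this
    obtain ⟨z, hz, hz2⟩ := this
    rw [he] at hz
    obtain ⟨l, rfl⟩ := hz
    exact absurd (hx l) (not_le.2 hz2)
  · rw [not_nonempty_iff_eq_empty] at hne
    refine ⟨fun _ _ => 0, fun _ => 0, fun x => ⟨fun _ l => by simp, fun _ => ?_⟩⟩
    by_contra hxB
    have : x ∈ ⋃ z, {x : ι → ℝ | h z < ∑ i, a z i * x i} := mem_iUnion.2 ⟨⟨x, hxB⟩, h2 ⟨x, hxB⟩⟩
    rw [← hTU, hne] at this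
    simp at this

variable (a : ℕ → ι → ℝ) (h : ℕ → ℝ)
/-- penalty -/
def pen (n k : ℕ) (x : ι → ℝ) : ℝ := k * ∑ l ∈ Finset.range k, (max ((∑ i, a l i * x i) - h l) 0) ^ n

def wt (y : ι → ℝ) (t : ℝ) (x : ι → ℝ) : ℝ := Real.exp ((∑ i, y i * x i) - t * (∑ i, x i ^ 2) / 2)

def pV (y : ι → ℝ) (t : ℝ) (k : ℕ) (x : ι → ℝ) : ℝ := t * (∑ i, x i ^ 2) / 2 - (∑ i, y i * x i) + pen a h 3 k x
def pV1 (y : ι → ℝ) (t : ℝ) (k : ℕ) (j : ι) (x : ι → ℝ) : ℝ :=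
  t * x j - y j + k * ∑ l ∈ Finset.range k, (3 * (max ((∑ i, a l i * x i) - h l) 0) ^ 2 * a l j)
def pV2 (t : ℝ) (k : ℕ) (j j' : ι) (x : ι → ℝ) : ℝ :=
  (if j = j' then t else 0) + k * ∑ l ∈ Finset.range k, (3 * (2 * (max ((∑ i, a l i * x i) - h l) 0) * a l j') * a l j)

theorem sum_uv (b : ι → ℝ) (x : ι → ℝ) (s : ℝ) (j : ι) : ∑ i, b i * (x + s • uv j) i = ∑ i, b i * x i + s * b j := by
  simp [uv, mul_add, Finset.sum_add_distrib, Pi.single_apply]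
  ring

theorem sq_uv (x : ι → ℝ) (s : ℝ) (j : ι) : ∑ i, (x + s • uv j) i ^ 2 = ∑ i, x i ^ 2 + 2 * s * x j + s ^ 2 := by
  have : ∀ i, (x + s • uv j) i ^ 2 = x i ^ 2 + (if i = j then 2 * s * x j + s ^ 2 else 0) := by
    intro i
    by_cases hi : i = j
    · subst hi; simp [uv]; ring
    · simp [uv, hi]
  simp_rw [this, Finset.sum_add_distrib]
  simp; ring

theorem hd_aff (c b : ℝ) : HasDerivAt (fun s : ℝ => c + s * b) b 0 := by
  simpa using ((hasDerivAt_id (0:ℝ)).mul_const b).const_add c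

theorem pV_d1 (y : ι → ℝ) (t : ℝ) (k : ℕ) (j : ι) (x : ι → ℝ) :
    HasDerivAt (fun s : ℝ => pV a h y t k (x + s • uv j)) (pV1 a h y t k j x) 0 := by
  unfold pV pV1 pen
  simp_rw [sum_uv, sq_uv]
  refine HasDerivAt.add (HasDerivAt.sub ?_ (hd_aff _ _)) (HasDerivAt.const_mul _ (HasDerivAt.fun_sum fun l _ => ?_))
  · have h1 : HasDerivAt (fun s : ℝ => t * (∑ i, x i ^ 2 + 2 * s * x j + s ^ 2) / 2) (t * ((2 * 1) * x j + 2 * 0) / 2) 0 := by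
      have := ((((hasDerivAt_id (0:ℝ)).const_mul 2).mul_const (x j)).const_add (∑ i, x i ^ 2)).add (hasDerivAt_pow 2 (0:ℝ))
      refine ((this.const_mul t).div_const 2).congr_deriv ?_
      simp
    exact h1.congr_deriv (by ring)
  · have h1 := hd_aff ((∑ i, a l i * x i) - h l) (a l j)
    have h2 := HasDerivAt.comp (0:ℝ) (h₂ := fun u : ℝ => (max u 0) ^ 3) (by simpa using hd_pos 1 _) h1
    refine (h2.congr_deriv ?_).congr_of_eventuallyEq (Eventually.of_forall fun s => ?_)
    · simp
    · simp only [Function.comp]; congr 2; ring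

theorem pV_d2 (y : ι → ℝ) (t : ℝ) (k : ℕ) (j j' : ι) (x : ι → ℝ) :
    HasDerivAt (fun s : ℝ => pV1 a h y t k j (x + s • uv j')) (pV2 a h t k j j' x) 0 := by
  unfold pV1 pV2
  simp_rw [sum_uv]
  refine HasDerivAt.add (HasDerivAt.sub_const _ ?_) (HasDerivAt.const_mul _ (HasDerivAt.fun_sum fun l _ => ?_))
  · have h1 := (hd_aff (x j) ((uv j' : ι → ℝ) j)).const_mul t
    refine (h1.congr_deriv ?_).congr_of_eventuallyEq (Eventually.of_forall fun s => ?_)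
    · simp [uv, Pi.single_apply]
    · simp
  · refine HasDerivAt.mul_const ?_ _
    have h1 := hd_aff ((∑ i, a l i * x i) - h l) (a l j')
    have h2 := HasDerivAt.comp (0:ℝ) (h₂ := fun u : ℝ => (max u 0) ^ 2) (by simpa using hd_pos 0 _) h1
    refine ((h2.const_mul 3).congr_deriv ?_).congr_of_eventuallyEq (Eventually.of_forall fun s => ?_)
    · simp
    · simp only [Function.comp]; congr 3; ring

theorem pV2_quad (t : ℝ) (k : ℕ) (x ξ : ι → ℝ) : t * ∑ i, ξ i ^ 2 ≤ ∑ i, ∑ j, pV2 a h t k i j x * (ξ i * ξ j) := by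
  have : ∀ i j, pV2 a h t k i j x * (ξ i * ξ j) = (if i = j then t * ξ i ^ 2 else 0) +
      ∑ l ∈ Finset.range k, (k * (6 * max ((∑ i, a l i * x i) - h l) 0)) * ((a l i * ξ i) * (a l j * ξ j)) := by
    intro i j
    unfold pV2
    rw [add_mul, Finset.mul_sum, Finset.sum_mul]
    congr 1
    · split_ifs with hij
      · subst hij; ring
      · ring
    · refine Finset.sum_congr rfl fun l _ => by ring
  simp_rw [this, Finset.sum_add_distrib]
  simp only [Finset.sum_ite_eq, Finset.mem_univ, if_true]
  rw [← Finset.mul_sum, le_add_iff_nonneg_right]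
  simp_rw [Finset.sum_comm (s := Finset.univ) (t := Finset.range k)]
  refine Finset.sum_nonneg fun l _ => ?_
  simp_rw [← Finset.mul_sum, ← Finset.sum_mul]
  have h1 : 0 ≤ max ((∑ i, a l i * x i) - h l) 0 := le_max_right _ _
  exact mul_nonneg (by positivity) (mul_self_nonneg _)

theorem wt_pos (y : ι → ℝ) (t : ℝ) (x : ι → ℝ) : 0 < wt y t x := Real.exp_pos _

theorem wt_cont (y : ι → ℝ) (t : ℝ) : Continuous (wt y t) := by unfold wt; fun_prop

theorem pen_cont (n k : ℕ) : Continuous (pen a h n k) := by unfold pen; fun_prop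

theorem exp_pV (y : ι → ℝ) (t : ℝ) (k : ℕ) (x : ι → ℝ) : Real.exp (-pV a h y t k x) = Real.exp (-pen a h 3 k x) * wt y t x := by
  unfold pV wt
  rw [← Real.exp_add]; congr 1; ring

theorem pen_nonneg (n k : ℕ) (x : ι → ℝ) : 0 ≤ pen a h n k x := by
  unfold pen
  refine mul_nonneg (Nat.cast_nonneg _) (Finset.sum_nonneg fun l _ => pow_nonneg (le_max_right _ _) _)

variable {a h}
theorem pen_tendsto {B : Set (ι → ℝ)} (hB : ∀ x, x ∈ B ↔ ∀ l, ∑ i, a l i * x i ≤ h l) (x : ι → ℝ) :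
    Tendsto (fun k => Real.exp (-pen a h 3 k x)) atTop (𝓝 (B.indicator (fun _ => (1:ℝ)) x)) := by
  by_cases hx : x ∈ B
  · rw [indicator_of_mem hx]
    have : ∀ k, Real.exp (-pen a h 3 k x) = 1 := by
      intro k
      have : pen a h 3 k x = 0 := by
        unfold pen
        rw [Finset.sum_eq_zero, mul_zero]
        intro l _
        rw [max_eq_right (by linarith [(hB x).1 hx l])]; norm_num
      rw [this]; simp
    simp_rw [this]
    exact tendsto_const_nhds
  · rw [indicator_of_notMem hx]
    rw [hB] at hx
    push Not at hx
    obtain ⟨l, hl⟩ := hx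
    refine Real.tendsto_exp_atBot.comp (tendsto_neg_atTop_atBot.comp ?_)
    set s := (∑ i, a l i * x i) - h l with hs
    have hs0 : 0 < s := by linarith
    have : Tendsto (fun k : ℕ => (k : ℝ) * s ^ 3) atTop atTop := tendsto_natCast_atTop_atTop.atTop_mul_const (by positivity)
    refine tendsto_atTop_mono' _ ?_ this
    filter_upwards [eventually_gt_atTop l] with k hk
    unfold pen
    gcongr
    have h2 := Finset.single_le_sum (f := fun l => (max ((∑ i, a l i * x i) - h l) 0) ^ 3) (s := Finset.range k)
      (fun l _ => pow_nonneg (le_max_right _ _) _) (Finset.mem_range.2 hk)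
    refine le_trans ?_ h2
    rw [← hs, max_eq_left hs0.le]

theorem pen_int_tendsto {B : Set (ι → ℝ)} (hBc : IsClosed B) (hB : ∀ x, x ∈ B ↔ ∀ l, ∑ i, a l i * x i ≤ h l) {R : ℝ} (hR : B ⊆ bx ι R)
    {F : (ι → ℝ) → ℝ} (hF : Continuous F) :
    Tendsto (fun k => ∫ x in bx ι R, Real.exp (-pen a h 3 k x) * F x) atTop (𝓝 (∫ x in B, F x)) := by
  have e : ∫ x in B, F x = ∫ x in bx ι R, B.indicator (fun _ => (1:ℝ)) x * F x := by
    rw [← inter_eq_self_of_subset_right hR, ← setIntegral_indicator hBc.measurableSet]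
    congr 1; ext x
    by_cases hx : x ∈ B
    · have := hR hx
      simp [hx, this]
    · simp [hx]
  rw [e]
  refine tendsto_integral_of_dominated_convergence (fun x => |F x|) (fun k => ?_) (integrableOn_bx hF R).abs (fun k => ?_) ?_
  · have := pen_cont a h 3 k
    exact Continuous.aestronglyMeasurable (by fun_prop)
  · refine Eventually.of_forall fun x => ?_
    rw [norm_mul, Real.norm_eq_abs, Real.norm_eq_abs, abs_of_pos (Real.exp_pos _)]
    have h1 : Real.exp (-pen a h 3 k x) ≤ 1 := Real.exp_le_one_iff.2 (by linarith [pen_nonneg a h 3 k x])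
    nlinarith [abs_nonneg (F x)]
  · exact Eventually.of_forall fun x => (pen_tendsto hB x).mul_const _

theorem thmL {B : Set (ι → ℝ)} (hB : IsCompact B) (hconv : Convex ℝ B) (hvol : 0 < volume B) (y : ι → ℝ) {t α l0 : ℝ} (ht : 0 < t) (hα : 0 ≤ α)
    (hcov : ∀ v : ι → ℝ, (∫ x in B, wt y t x * (∑ i, v i * x i) ^ 2) -
      (∫ x in B, wt y t x * ∑ i, v i * x i) ^ 2 / (∫ x in B, wt y t x) ≤ α * (∫ x in B, wt y t x) * ∑ i, v i ^ 2)
    (hl0 : 0 ≤ l0) (hl : l0 ^ 2 * α ≤ t)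
    {f : (ι → ℝ) → ℝ} {f1 : ι → (ι → ℝ) → ℝ} (hf : Continuous f) (hf1 : ∀ i, Continuous (f1 i))
    (hfd : ∀ i x, HasDerivAt (fun s : ℝ => f (x + s • uv i)) (f1 i x) 0) :
    l0 * ((∫ x in B, wt y t x * f x ^ 2) - (∫ x in B, wt y t x * f x) ^ 2 / (∫ x in B, wt y t x)) ≤
      ∑ i, ∫ x in B, wt y t x * f1 i x ^ 2 := by
  obtain ⟨a, h, hah⟩ := halfspaces hB.isClosed hconv
  obtain ⟨R, hRp, hR⟩ : ∃ R, 0 < R ∧ B ⊆ bx ι R := by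
    obtain ⟨r, hr⟩ := hB.isBounded.exists_norm_le
    refine ⟨|r| + 1, by positivity, fun x hx i _ => ?_⟩
    have := (norm_le_pi_norm x i).trans ((hr x hx).trans (le_abs_self r))
    rw [Real.norm_eq_abs, abs_le] at this
    exact ⟨by linarith, by linarith⟩
  have wc := wt_cont y t
  have Zp : 0 < ∫ x in B, wt y t x := by
    rw [integral_pos_iff_support_of_nonneg (fun x => (wt_pos y t x).le) (wc.continuousOn.integrableOn_compact hB)]
    have : Function.support (wt y t) = univ := by ext x; simp [(wt_pos y t x).ne']
    rw [this, Measure.restrict_apply_univ]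
    exact hvol
  have lim : ∀ F : (ι → ℝ) → ℝ, Continuous F → Tendsto (fun k => ∫ x in bx ι R, Real.exp (-pen a h 3 k x) * F x) atTop (𝓝 (∫ x in B, F x)) :=
    fun F hF => pen_int_tendsto hB.isClosed hah hR hF
  have main : ∀ l1, 0 ≤ l1 → l1 ^ 2 * α < t →
      l1 * ((∫ x in B, wt y t x * f x ^ 2) - (∫ x in B, wt y t x * f x) ^ 2 / (∫ x in B, wt y t x)) ≤ ∑ i, ∫ x in B, wt y t x * f1 i x ^ 2 := by
    intro l1 hl1 hl2
    obtain ⟨δ, hδ, hδ2⟩ : ∃ δ, 0 < δ ∧ l1 ^ 2 * (α + δ) < t := by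
      refine ⟨(t - l1 ^ 2 * α) / (2 * (l1 ^ 2 + 1)), div_pos (by linarith) (by positivity), ?_⟩
      have : l1 ^ 2 * ((t - l1 ^ 2 * α) / (2 * (l1 ^ 2 + 1))) ≤ (t - l1 ^ 2 * α) / 2 := by
        rw [mul_div_assoc', div_le_div_iff₀ (by positivity) (by norm_num)]
        nlinarith [sq_nonneg l1]
      linarith
    have ev := cov_gen wc (LN := fun k F => ∫ x in bx ι R, Real.exp (-pen a h 3 k x) * F x) (L := fun F => ∫ x in B, F x)
      (fun k => isLin_int fun F hF => integrableOn_bx (by have := pen_cont a h 3 k; fun_prop) R)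
      (fun c F hF => by
        beta_reduce
        rw [integral_finset_sum _ fun i _ => (((hF i).continuousOn.integrableOn_compact hB).const_mul _)]
        simp_rw [integral_const_mul]) lim Zp hα hcov hδ
    have key : ∀ᶠ k in atTop, l1 * ((∫ x in bx ι R, Real.exp (-pen a h 3 k x) * (wt y t x * f x ^ 2)) -
        (∫ x in bx ι R, Real.exp (-pen a h 3 k x) * (wt y t x * f x)) ^ 2 / (∫ x in bx ι R, Real.exp (-pen a h 3 k x) * wt y t x)) ≤
        ∑ i, ∫ x in bx ι R, Real.exp (-pen a h 3 k x) * (wt y t x * f1 i x ^ 2) := by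
      filter_upwards [ev] with k hk
      have c0 : Continuous (pV a h y t k) := by have := pen_cont a h 3 k; unfold pV; fun_prop
      have c1 : ∀ i, Continuous (pV1 a h y t k i) := by intro i; unfold pV1; fun_prop
      have c2 : ∀ i j, Continuous (pV2 a h t k i j) := by intro i j; unfold pV2; fun_prop
      have := box_poincare (pV_d1 a h y t k) (pV_d2 a h y t k) c0 c1 c2 hRp (pV2_quad a h t k) (α := α + δ) (by linarith)
        (fun v => by simpa only [exp_pV, mul_assoc] using hk v) hl1 hδ2 hf hf1 hfd
      simpa only [exp_pV, mul_assoc] using this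
    refine le_of_tendsto_of_tendsto ?_ (tendsto_finset_sum _ fun i _ => lim _ (by have := hf1 i; fun_prop)) key
    exact ((lim _ (by fun_prop)).sub (((lim _ (by fun_prop)).pow 2).div (lim _ wc) Zp.ne')).const_mul _
  have hs : ∀ s ∈ Ioo (0:ℝ) 1, (s * l0) * ((∫ x in B, wt y t x * f x ^ 2) - (∫ x in B, wt y t x * f x) ^ 2 / (∫ x in B, wt y t x)) ≤ ∑ i, ∫ x in B, wt y t x * f1 i x ^ 2 := by
    intro s hs
    refine main _ (mul_nonneg hs.1.le hl0) ?_
    have : s ^ 2 < 1 := by nlinarith [hs.1, hs.2]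
    have h0 : 0 ≤ l0 ^ 2 * α := by positivity
    nlinarith [sq_nonneg s]
  have hlim : Tendsto (fun s : ℝ => (s * l0) * ((∫ x in B, wt y t x * f x ^ 2) - (∫ x in B, wt y t x * f x) ^ 2 / (∫ x in B, wt y t x))) (𝓝[<] 1)
      (𝓝 ((1 * l0) * ((∫ x in B, wt y t x * f x ^ 2) - (∫ x in B, wt y t x * f x) ^ 2 / (∫ x in B, wt y t x)))) :=
    tendsto_nhdsWithin_of_tendsto_nhds (Continuous.tendsto (by fun_prop) 1)
  rw [one_mul] at hlim
  refine le_of_tendsto hlim ?_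
  filter_upwards [Ioo_mem_nhdsLT (zero_lt_one)] with s h using hs s h

end Disc

end

section
set_option linter.all false
open Filter
open scoped Topology

namespace Heat
variable {ι : Type*} [Fintype ι] [DecidableEq ι]

/-- exponential growth in the space variable, locally uniformly in time -/
def EG (h : ℝ × (ι → ℝ) → ℝ) : Prop :=
  ∀ T : ℝ, ∃ C R : ℝ, 0 ≤ C ∧ 0 ≤ R ∧
    ∀ p : ℝ × (ι → ℝ), |p.1| ≤ T → |h p| ≤ C * Real.exp (R * ∑ i, |p.2 i|)

def Dv (v : ℝ × (ι → ℝ)) (h : ℝ × (ι → ℝ) → ℝ) : ℝ × (ι → ℝ) → ℝ :=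
  fun p => fderiv ℝ h p v

def Nc : ℕ → (ℝ × (ι → ℝ) → ℝ) → Prop
  | 0, h => Continuous h ∧ EG h
  | n + 1, h => Continuous h ∧ EG h ∧ Differentiable ℝ h ∧ ∀ v, Nc n (Dv v h)

lemma Nc.cont {n : ℕ} {h : ℝ × (ι → ℝ) → ℝ} (H : Nc n h) : Continuous h := by
  cases n with
  | zero => exact H.1
  | succ n => exact H.1

lemma Nc.eg {n : ℕ} {h : ℝ × (ι → ℝ) → ℝ} (H : Nc n h) : EG h := by
  cases n with
  | zero => exact H.2
  | succ n => exact H.2.1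

lemma Nc.down {n : ℕ} : ∀ {h : ℝ × (ι → ℝ) → ℝ}, Nc (n + 1) h → Nc n h := by
  induction n with
  | zero => intro h H; exact ⟨H.1, H.2.1⟩
  | succ n ih => intro h H; exact ⟨H.1, H.2.1, H.2.2.1, fun v => ih (H.2.2.2 v)⟩

lemma sum_abs_nonneg (y : ι → ℝ) : 0 ≤ ∑ i, |y i| := Finset.sum_nonneg fun i _ => abs_nonneg _

lemma EG.add {f g : ℝ × (ι → ℝ) → ℝ} (hf : EG f) (hg : EG g) : EG (fun p => f p + g p) := by
  intro T
  obtain ⟨C, R, hC, hR, h1⟩ := hf T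
  obtain ⟨C', R', hC', hR', h2⟩ := hg T
  refine ⟨C + C', R + R', by positivity, by positivity, fun p hp => ?_⟩
  have hs := sum_abs_nonneg p.2
  have e1 : Real.exp (R * ∑ i, |p.2 i|) ≤ Real.exp ((R + R') * ∑ i, |p.2 i|) :=
    Real.exp_le_exp.2 (by nlinarith [mul_nonneg hR' hs])
  have e2 : Real.exp (R' * ∑ i, |p.2 i|) ≤ Real.exp ((R + R') * ∑ i, |p.2 i|) :=
    Real.exp_le_exp.2 (by nlinarith [mul_nonneg hR hs])
  calc |f p + g p| ≤ |f p| + |g p| := abs_add_le _ _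
    _ ≤ _ := by
      nlinarith [h1 p hp, h2 p hp, mul_le_mul_of_nonneg_left e1 hC, mul_le_mul_of_nonneg_left e2 hC']

lemma EG.mul {f g : ℝ × (ι → ℝ) → ℝ} (hf : EG f) (hg : EG g) : EG (fun p => f p * g p) := by
  intro T
  obtain ⟨C, R, hC, hR, h1⟩ := hf T
  obtain ⟨C', R', hC', hR', h2⟩ := hg T
  refine ⟨C * C', R + R', by positivity, by positivity, fun p hp => ?_⟩
  rw [abs_mul, add_mul, Real.exp_add]
  calc |f p| * |g p| ≤ (C * Real.exp (R * ∑ i, |p.2 i|)) * (C' * Real.exp (R' * ∑ i, |p.2 i|)) :=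
        mul_le_mul (h1 p hp) (h2 p hp) (abs_nonneg _) (by positivity)
    _ = _ := by ring

lemma EG.const (c : ℝ) : EG (fun _ : ℝ × (ι → ℝ) => c) := by
  intro T
  exact ⟨|c|, 0, abs_nonneg _, le_rfl, fun p _ => by simp⟩

lemma Dv_add (v : ℝ × (ι → ℝ)) {f g : ℝ × (ι → ℝ) → ℝ} (hf : Differentiable ℝ f) (hg : Differentiable ℝ g) :
    Dv v (fun p => f p + g p) = fun p => Dv v f p + Dv v g p := by
  funext p
  simp only [Dv]
  rw [fderiv_fun_add (hf p) (hg p)]; rfl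

lemma Dv_mul (v : ℝ × (ι → ℝ)) {f g : ℝ × (ι → ℝ) → ℝ} (hf : Differentiable ℝ f) (hg : Differentiable ℝ g) :
    Dv v (fun p => f p * g p) = fun p => f p * Dv v g p + Dv v f p * g p := by
  funext p
  simp only [Dv]
  rw [fderiv_fun_mul (hf p) (hg p)]; simp; ring

lemma Dv_const (v : ℝ × (ι → ℝ)) (c : ℝ) : Dv v (fun _ : ℝ × (ι → ℝ) => c) = fun _ => 0 := by
  funext p
  simp [Dv]

lemma Nc.const (n : ℕ) : ∀ c : ℝ, Nc n (fun _ : ℝ × (ι → ℝ) => c) := by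
  induction n with
  | zero => exact fun c => ⟨continuous_const, EG.const c⟩
  | succ n ih =>
    exact fun c => ⟨continuous_const, EG.const c, differentiable_const c, fun v => by
      rw [Dv_const]; exact ih 0⟩

lemma Nc.add {n : ℕ} : ∀ {f g : ℝ × (ι → ℝ) → ℝ}, Nc n f → Nc n g → Nc n (fun p => f p + g p) := by
  induction n with
  | zero => exact fun hf hg => ⟨hf.1.add hg.1, hf.2.add hg.2⟩
  | succ n ih =>
    exact fun hf hg => ⟨hf.1.add hg.1, hf.2.1.add hg.2.1, hf.2.2.1.add hg.2.2.1, fun v => by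
      rw [Dv_add v hf.2.2.1 hg.2.2.1]; exact ih (hf.2.2.2 v) (hg.2.2.2 v)⟩

lemma Nc.mul {n : ℕ} : ∀ {f g : ℝ × (ι → ℝ) → ℝ}, Nc n f → Nc n g → Nc n (fun p => f p * g p) := by
  induction n with
  | zero => exact fun hf hg => ⟨hf.1.mul hg.1, hf.2.mul hg.2⟩
  | succ n ih =>
    exact fun hf hg => ⟨hf.1.mul hg.1, hf.2.1.mul hg.2.1, hf.2.2.1.mul hg.2.2.1, fun v => by
      rw [Dv_mul v hf.2.2.1 hg.2.2.1]
      exact Nc.add (ih hf.down (hg.2.2.2 v)) (ih (hf.2.2.2 v) hg.down)⟩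

lemma Dv_inv (v : ℝ × (ι → ℝ)) {f : ℝ × (ι → ℝ) → ℝ} (hf : Differentiable ℝ f) (h0 : ∀ p, f p ≠ 0) :
    Dv v (fun p => (f p)⁻¹) = fun p => (-1) * (Dv v f p * ((f p)⁻¹ * (f p)⁻¹)) := by
  funext p
  have := ((hasDerivAt_inv (h0 p)).comp_hasFDerivAt p (hf p).hasFDerivAt)
  have e : (fun p => (f p)⁻¹) = (Inv.inv ∘ f) := rfl
  simp only [Dv]
  rw [e, this.fderiv]
  simp
  field_simp

lemma Nc.inv {n : ℕ} {f : ℝ × (ι → ℝ) → ℝ} (h0 : ∀ p, f p ≠ 0) (hE : EG (fun p => (f p)⁻¹)) :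
    Nc n f → Nc n (fun p => (f p)⁻¹) := by
  induction n with
  | zero => exact fun hf => ⟨hf.1.inv₀ h0, hE⟩
  | succ n ih =>
    intro hf
    refine ⟨hf.1.inv₀ h0, hE, hf.2.2.1.inv h0, fun v => ?_⟩
    rw [Dv_inv v hf.2.2.1 h0]
    exact (Nc.const n (-1)).mul ((hf.2.2.2 v).mul ((ih hf.down).mul (ih hf.down)))

/-- All derivatives exist and have exponential growth. -/
def Nice (h : ℝ × (ι → ℝ) → ℝ) : Prop := ∀ n, Nc n h

lemma Nice.diff {h : ℝ × (ι → ℝ) → ℝ} (H : Nice h) : Differentiable ℝ h := (H 1).2.2.1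
lemma Nice.cont {h : ℝ × (ι → ℝ) → ℝ} (H : Nice h) : Continuous h := (H 1).1
lemma Nice.eg {h : ℝ × (ι → ℝ) → ℝ} (H : Nice h) : EG h := (H 1).2.1
lemma Nice.dv {h : ℝ × (ι → ℝ) → ℝ} (H : Nice h) (v) : Nice (Dv v h) := fun n => (H (n+1)).2.2.2 v
lemma Nice.const (c : ℝ) : Nice (fun _ : ℝ × (ι → ℝ) => c) := fun n => Nc.const n c
lemma Nice.add {f g : ℝ × (ι → ℝ) → ℝ} (hf : Nice f) (hg : Nice g) : Nice (fun p => f p + g p) :=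
  fun n => (hf n).add (hg n)
lemma Nice.mul {f g : ℝ × (ι → ℝ) → ℝ} (hf : Nice f) (hg : Nice g) : Nice (fun p => f p * g p) :=
  fun n => (hf n).mul (hg n)
lemma Nice.inv {f : ℝ × (ι → ℝ) → ℝ} (hf : Nice f) (h0 : ∀ p, f p ≠ 0) (hE : EG (fun p => (f p)⁻¹)) :
    Nice (fun p => (f p)⁻¹) := fun n => (hf n).inv h0 hE
lemma Nice.sub {f g : ℝ × (ι → ℝ) → ℝ} (hf : Nice f) (hg : Nice g) : Nice (fun p => f p - g p) := by
  have := hf.add ((Nice.const (-1)).mul hg)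
  convert this using 2; ring
lemma Nice.sum {κ : Type*} (s : Finset κ) {f : κ → ℝ × (ι → ℝ) → ℝ} (hf : ∀ k, Nice (f k)) :
    Nice (fun p => ∑ k ∈ s, f k p) := by
  classical
  induction s using Finset.induction_on with
  | empty => simpa using Nice.const 0
  | insert a s ha ih =>
    simp only [Finset.sum_insert ha]
    exact (hf a).add ih

/-- unnormalised Gaussian weight -/
def rho (z : ι → ℝ) : ℝ := Real.exp (-(∑ i, z i ^ 2) / 2)

lemma rho_pos (z : ι → ℝ) : 0 < rho z := Real.exp_pos _
lemma rho_cont : Continuous (rho : (ι → ℝ) → ℝ) := by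
  unfold rho; fun_prop

lemma rho_exp_int (R : ℝ) : Integrable (fun z : ι → ℝ => rho z * Real.exp (R * ∑ i, |z i|)) := by
  have h1 : Integrable (fun z : ι → ℝ => ∏ i, Real.exp (-(1/4 : ℝ) * z i ^ 2)) :=
    Integrable.fintype_prod (f := fun _ x => Real.exp (-(1/4 : ℝ) * x ^ 2))
      (fun _ => integrable_exp_neg_mul_sq (by norm_num))
  have h2 := h1.const_mul (Real.exp (∑ i : ι, R ^ 2))
  refine h2.mono' ?_ ?_
  · exact (rho_cont.mul (by fun_prop)).aestronglyMeasurable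
  · refine Eventually.of_forall fun z => ?_
    rw [Real.norm_eq_abs, abs_of_pos (mul_pos (rho_pos z) (Real.exp_pos _))]
    unfold rho
    rw [← Real.exp_sum, ← Real.exp_add, ← Real.exp_add]
    apply Real.exp_le_exp.2
    rw [← Finset.sum_add_distrib, ← Finset.sum_neg_distrib, Finset.sum_div, Finset.mul_sum,
      ← Finset.sum_add_distrib]
    apply Finset.sum_le_sum
    intro i _
    nlinarith [sq_nonneg (|z i| / 2 - R), sq_abs (z i)]

lemma rho_int {C R : ℝ} {g : (ι → ℝ) → ℝ} (hg : Continuous g)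
    (hb : ∀ z, |g z| ≤ C * Real.exp (R * ∑ i, |z i|)) : Integrable (fun z => rho z * g z) := by
  refine ((rho_exp_int R).const_mul C).mono' (rho_cont.mul hg).aestronglyMeasurable ?_
  refine Eventually.of_forall fun z => ?_
  rw [Real.norm_eq_abs, abs_mul, abs_of_pos (rho_pos z)]
  nlinarith [mul_le_mul_of_nonneg_left (hb z) (rho_pos z).le]

/-- evaluate along the heat scaling -/
def hp (s : ℝ) (z : ι → ℝ) : ℝ × (ι → ℝ) := (s, Real.sqrt s • z)

lemma hp_cont : Continuous (fun q : ℝ × (ι → ℝ) => hp q.1 q.2) := by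
  unfold hp; fun_prop
lemma hp_cont' (s : ℝ) : Continuous (fun z : ι → ℝ => hp s z) := by
  unfold hp; fun_prop

lemma EG.hp {h : ℝ × (ι → ℝ) → ℝ} (H : EG h) (T : ℝ) (hT : 0 ≤ T) :
    ∃ C R : ℝ, 0 ≤ C ∧ 0 ≤ R ∧ ∀ s z, |s| ≤ T → |h (hp s z)| ≤ C * Real.exp (R * ∑ i, |z i|) := by
  obtain ⟨C, R, hC, hR, h1⟩ := H T
  refine ⟨C, R * Real.sqrt T, hC, by positivity, fun s z hs => ?_⟩
  refine (h1 _ hs).trans (mul_le_mul_of_nonneg_left (Real.exp_le_exp.2 ?_) hC)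
  simp only [Heat.hp, Pi.smul_apply, smul_eq_mul, abs_mul, ← Finset.mul_sum]
  rw [mul_assoc]
  refine mul_le_mul_of_nonneg_left (mul_le_mul_of_nonneg_right ?_ (sum_abs_nonneg _)) hR
  rw [abs_of_nonneg (Real.sqrt_nonneg _)]
  exact Real.sqrt_le_sqrt ((le_abs_self s).trans hs)

lemma hp_int {h : ℝ × (ι → ℝ) → ℝ} (hc : Continuous h) (H : EG h) (s : ℝ) :
    Integrable (fun z => rho z * h (hp s z)) := by
  obtain ⟨C, R, _, _, h1⟩ := H.hp |s| (abs_nonneg s)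
  exact rho_int (hc.comp (hp_cont' s)) (fun z => h1 s z le_rfl)

/-- the (unnormalised) Gaussian average -/
def Ph (h : ℝ × (ι → ℝ) → ℝ) (s : ℝ) : ℝ := ∫ z, rho z * h (hp s z)

lemma Ph_cont {h : ℝ × (ι → ℝ) → ℝ} (hc : Continuous h) (H : EG h) : Continuous (Ph h) := by
  rw [continuous_iff_continuousAt]
  intro s0
  obtain ⟨C, R, hC, hR, h1⟩ := H.hp (|s0| + 1) (by positivity)
  unfold Ph
  refine continuousAt_of_dominated (bound := fun z => C * (rho z * Real.exp (R * ∑ i, |z i|)))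
    ?_ ?_ ((rho_exp_int R).const_mul C) ?_
  · exact Eventually.of_forall fun s => (rho_cont.mul (hc.comp (hp_cont' s))).aestronglyMeasurable
  · filter_upwards [Metric.ball_mem_nhds s0 one_pos] with s hs
    refine Eventually.of_forall fun z => ?_
    rw [Real.norm_eq_abs, abs_mul, abs_of_pos (rho_pos z)]
    have : |s| ≤ |s0| + 1 := by
      rw [Metric.mem_ball, Real.dist_eq] at hs
      calc |s| = |s0 + (s - s0)| := by ring_nf
        _ ≤ _ := (abs_add_le _ _).trans (by linarith)
    nlinarith [mul_le_mul_of_nonneg_left (h1 s z this) (rho_pos z).le]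
  · refine Eventually.of_forall fun z => ?_
    refine Continuous.continuousAt ?_
    refine continuous_const.mul (hc.comp ?_)
    exact hp_cont.comp (by fun_prop : Continuous fun s : ℝ => (s, z))

abbrev et : ℝ × (ι → ℝ) := (1, 0)
abbrev ex (i : ι) : ℝ × (ι → ℝ) := (0, Pi.single i 1)

lemma vec_decomp (a : ℝ) (y : ι → ℝ) : ((a, y) : ℝ × (ι → ℝ)) = a • et + ∑ i, y i • ex i := by
  ext j
  · simp [et, ex, Prod.fst_sum]
  · simp [et, ex, Prod.snd_sum, Finset.sum_apply, Pi.single_apply]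

lemma Dv_decomp (h : ℝ × (ι → ℝ) → ℝ) (a : ℝ) (y : ι → ℝ) (p) :
    Dv (a, y) h p = a * Dv et h p + ∑ i, y i * Dv (ex i) h p := by
  unfold Dv
  conv_lhs => rw [vec_decomp a y]
  simp only [map_add, map_sum, map_smul, smul_eq_mul]

lemma abs_le_expsum (z : ι → ℝ) (i : ι) : |z i| ≤ Real.exp (∑ i, |z i|) := by
  have h1 := Finset.single_le_sum (f := fun i => |z i|) (fun i _ => abs_nonneg _) (Finset.mem_univ i)
  have h2 := Real.add_one_le_exp (∑ i, |z i|)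
  linarith

lemma rho_deriv (i : ι) (z : ι → ℝ) : HasFDerivAt (rho : (ι → ℝ) → ℝ)
    (rho z • ∑ i, -(z i) • (ContinuousLinearMap.proj (R := ℝ) (φ := fun _ : ι => ℝ) i)) z := by
  have h1 : HasFDerivAt (fun z : ι → ℝ => -(∑ i, z i ^ 2) / 2)
      (∑ i, -(z i) • (ContinuousLinearMap.proj (R := ℝ) (φ := fun _ : ι => ℝ) i)) z := by
    have h2 : HasFDerivAt (fun z : ι → ℝ => ∑ i, (-(1/2 : ℝ)) * z i ^ 2)
      (∑ i, -(z i) • (ContinuousLinearMap.proj (R := ℝ) (φ := fun _ : ι => ℝ) i)) z := by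
      refine HasFDerivAt.fun_sum fun i _ => ?_
      have := (((ContinuousLinearMap.proj (R := ℝ) (φ := fun _ : ι => ℝ) i).hasFDerivAt (x := z)).pow 2).const_mul (-(1/2 : ℝ))
      refine this.congr_fderiv ?_
      ext v; simp; ring
    refine h2.congr_of_eventuallyEq (Eventually.of_forall fun z => ?_)
    simp only [← Finset.mul_sum]; ring
  exact h1.exp

/-- Gaussian integration by parts -/
lemma gauss_ibp {h : ℝ × (ι → ℝ) → ℝ} (H : Nc 1 h) (s : ℝ) (i : ι) :
    ∫ z, rho z * (z i * h (hp s z)) = ∫ z, rho z * (Real.sqrt s * Dv (ex i) h (hp s z)) := by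
  have hd : ∀ z, HasFDerivAt (fun z => h (hp s z)) ((fderiv ℝ h (hp s z)).comp
      ((ContinuousLinearMap.inr ℝ ℝ (ι → ℝ)).comp (Real.sqrt s • ContinuousLinearMap.id ℝ (ι → ℝ)))) z := by
    intro z
    have h1 : HasFDerivAt (fun z : ι → ℝ => hp s z) ((ContinuousLinearMap.inr ℝ ℝ (ι → ℝ)).comp (Real.sqrt s • ContinuousLinearMap.id ℝ (ι → ℝ))) z := by
      have h2 : HasFDerivAt (fun z : ι → ℝ => Real.sqrt s • z) (Real.sqrt s • ContinuousLinearMap.id ℝ (ι → ℝ)) z :=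
        (hasFDerivAt_id z).const_smul (Real.sqrt s)
      have := (hasFDerivAt_const s z).prodMk h2
      refine this.congr_fderiv ?_
      ext v <;> simp
    exact (H.2.2.1 (hp s z)).hasFDerivAt.comp z h1
  have hd1 : ∀ z, fderiv ℝ (fun z => h (hp s z)) z (Pi.single i 1) = Real.sqrt s * Dv (ex i) h (hp s z) := by
    intro z
    rw [(hd z).fderiv]
    simp only [ContinuousLinearMap.comp_apply, ContinuousLinearMap.smul_apply, ContinuousLinearMap.id_apply, Dv, ex]
    have : (ContinuousLinearMap.inr ℝ ℝ (ι → ℝ)) (Real.sqrt s • (Pi.single i 1 : ι → ℝ)) = Real.sqrt s • ((0 : ℝ), (Pi.single i 1 : ι → ℝ)) := by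
      simp
    rw [this, map_smul, smul_eq_mul]
  have hr1 : ∀ z, fderiv ℝ (rho : (ι → ℝ) → ℝ) z (Pi.single i 1) = - (rho z * z i) := by
    intro z
    rw [(rho_deriv i z).fderiv]
    simp [Finset.sum_apply, Pi.single_apply, ContinuousLinearMap.sum_apply]
  have key := integral_mul_fderiv_eq_neg_fderiv_mul_of_integrable (𝕜 := ℝ) (μ := (volume : Measure (ι → ℝ)))
    (f := (rho : (ι → ℝ) → ℝ)) (g := fun z => h (hp s z)) (v := Pi.single i 1) ?_ ?_ ?_ ?_ ?_
  · simp only [hd1, hr1] at key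
    rw [key, ← integral_neg]
    congr 1; funext z; ring
  · simp only [hr1]
    obtain ⟨C, R, hC, hR, h1⟩ := H.eg.hp |s| (abs_nonneg s)
    have : Integrable (fun z => rho z * (z i * h (hp s z))) := by
      refine rho_int (C := C) (R := R + 1) ((continuous_apply i).mul (H.cont.comp (hp_cont' s))) fun z => ?_
      rw [abs_mul, add_mul, one_mul, Real.exp_add]
      have e1 := abs_le_expsum z i
      calc |z i| * |h (hp s z)| ≤ Real.exp (∑ i, |z i|) * (C * Real.exp (R * ∑ i, |z i|)) :=
            mul_le_mul e1 (h1 s z le_rfl) (abs_nonneg _) (Real.exp_pos _).le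
        _ = _ := by ring
    refine this.neg.congr (Eventually.of_forall fun z => ?_)
    simp; ring
  · simp only [hd1]
    have := (hp_int (H.2.2.2 (ex i)).cont (H.2.2.2 (ex i)).eg s).const_mul (Real.sqrt s)
    refine this.congr (Eventually.of_forall fun z => ?_)
    simp; ring
  · exact hp_int H.cont H.eg s
  · exact fun z _ => (rho_deriv i z).differentiableAt
  · exact fun z _ => (hd z).differentiableAt

/-- heat operator -/
def Ht (h : ℝ × (ι → ℝ) → ℝ) : ℝ × (ι → ℝ) → ℝ :=
  fun p => Dv et h p + (1/2) * ∑ i, Dv (ex i) (Dv (ex i) h) p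

lemma hp_hasDeriv {h : ℝ × (ι → ℝ) → ℝ} (H : Differentiable ℝ h) {s : ℝ} (hs : 0 < s) (z : ι → ℝ) :
    HasDerivAt (fun s => h (hp s z))
      (Dv et h (hp s z) + ∑ i, (1 / (2 * Real.sqrt s) * z i) * Dv (ex i) h (hp s z)) s := by
  have h1 : HasDerivAt (fun s : ℝ => hp s z) (1, (1 / (2 * Real.sqrt s)) • z) s :=
    (hasDerivAt_id s).prodMk ((Real.hasDerivAt_sqrt hs.ne').smul_const z)
  have := (H (hp s z)).hasFDerivAt.comp_hasDerivAt s h1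
  refine this.congr_deriv ?_
  have := Dv_decomp h 1 ((1 / (2 * Real.sqrt s)) • z) (hp s z)
  rw [one_mul] at this
  exact this

lemma Ph_hasDeriv {h : ℝ × (ι → ℝ) → ℝ} (H : Nc 2 h) {s : ℝ} (hs : 0 < s) :
    HasDerivAt (Ph h) (Ph (Ht h) s) s := by
  have hdiff := H.2.2.1
  obtain ⟨C0, R0, hC0, hR0, h0⟩ := (H.2.2.2 et).eg.hp (2 * s) (by positivity)
  have hb : ∀ i : ι, ∃ C R : ℝ, 0 ≤ C ∧ 0 ≤ R ∧ ∀ t z, |t| ≤ 2 * s →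
      |z i * Dv (ex i) h (hp t z)| ≤ C * Real.exp (R * ∑ i, |z i|) := by
    intro i
    obtain ⟨C, R, hC, hR, h1⟩ := (H.2.2.2 (ex i)).eg.hp (2 * s) (by positivity)
    refine ⟨C, R + 1, hC, by positivity, fun t z ht => ?_⟩
    rw [abs_mul, add_mul, one_mul, Real.exp_add]
    calc |z i| * |Dv (ex i) h (hp t z)| ≤ Real.exp (∑ i, |z i|) * (C * Real.exp (R * ∑ i, |z i|)) :=
            mul_le_mul (abs_le_expsum z i) (h1 t z ht) (abs_nonneg _) (Real.exp_pos _).le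
        _ = _ := by ring
  choose C R hC hR h1 using hb
  set κ : ℝ := 1 / (2 * Real.sqrt (s / 2)) with hκ
  have hκ0 : 0 ≤ κ := by positivity
  have main := hasDerivAt_integral_of_dominated_loc_of_deriv_le (μ := (volume : Measure (ι → ℝ)))
    (F := fun t z => rho z * h (hp t z))
    (F' := fun t z => rho z * (Dv et h (hp t z) + ∑ i, (1 / (2 * Real.sqrt t) * z i) * Dv (ex i) h (hp t z)))
    (x₀ := s) (s := Ioo (s / 2) (2 * s))
    (bound := fun z => C0 * (rho z * Real.exp (R0 * ∑ i, |z i|)) + ∑ i, κ * C i * (rho z * Real.exp (R i * ∑ i, |z i|)))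
    (Ioo_mem_nhds (by linarith) (by linarith)) ?_ ?_ ?_ ?_ ?_ ?_
  · refine main.2.congr_deriv ?_
    have hi0 := hp_int (H.2.2.2 et).cont (H.2.2.2 et).eg s
    have hii : ∀ i : ι, Integrable (fun z => rho z * (z i * Dv (ex i) h (hp s z))) := fun i =>
      rho_int ((continuous_apply i).mul ((H.2.2.2 (ex i)).cont.comp (hp_cont' s)))
        (fun z => h1 i s z (by rw [abs_of_pos hs]; linarith))
    have hij : ∀ i : ι, Integrable (fun z => rho z * (Dv (ex i) (Dv (ex i) h) (hp s z))) := fun i =>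
      hp_int ((H.2.2.2 (ex i)).2.2.2 (ex i)).cont ((H.2.2.2 (ex i)).2.2.2 (ex i)).eg s
    have e1 : ∀ z, rho z * (Dv et h (hp s z) + ∑ i, (1 / (2 * Real.sqrt s) * z i) * Dv (ex i) h (hp s z))
        = rho z * Dv et h (hp s z) + ∑ i, 1 / (2 * Real.sqrt s) * (rho z * (z i * Dv (ex i) h (hp s z))) := by
      intro z; rw [mul_add, Finset.mul_sum]; congr 1; refine Finset.sum_congr rfl fun i _ => by ring
    have e2 : ∀ z, rho z * Ht h (hp s z)
        = rho z * Dv et h (hp s z) + ∑ i, (1/2) * (rho z * Dv (ex i) (Dv (ex i) h) (hp s z)) := by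
      intro z; unfold Ht; rw [mul_add, Finset.mul_sum, Finset.mul_sum]; congr 1; refine Finset.sum_congr rfl fun i _ => by ring
    unfold Ph
    simp only [e1, e2]
    rw [integral_add hi0 (integrable_finsetSum _ fun i _ => (hii i).const_mul _),
      integral_add hi0 (integrable_finsetSum _ fun i _ => (hij i).const_mul _),
      integral_finsetSum _ (fun i _ => (hii i).const_mul _), integral_finsetSum _ (fun i _ => (hij i).const_mul _)]
    congr 1
    refine Finset.sum_congr rfl fun i _ => ?_
    rw [integral_const_mul, integral_const_mul, gauss_ibp (H.2.2.2 (ex i)) s i]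
    have : ∫ z, rho z * (Real.sqrt s * Dv (ex i) (Dv (ex i) h) (hp s z)) = Real.sqrt s * ∫ z, rho z * (Dv (ex i) (Dv (ex i) h) (hp s z)) := by
      rw [← integral_const_mul]; congr 1; funext z; ring
    rw [this]
    have : Real.sqrt s ≠ 0 := (Real.sqrt_pos.2 hs).ne'
    field_simp
  · exact Eventually.of_forall fun t => (rho_cont.mul (H.cont.comp (hp_cont' t))).aestronglyMeasurable
  · exact hp_int H.cont H.eg s
  · refine Continuous.aestronglyMeasurable (rho_cont.mul (((H.2.2.2 et).cont.comp (hp_cont' s)).add ?_))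
    exact continuous_finsetSum _ fun i _ => (continuous_const.mul (continuous_apply i)).mul ((H.2.2.2 (ex i)).cont.comp (hp_cont' s))
  · refine Eventually.of_forall fun z t ht => ?_
    have ht0 : 0 < t := by linarith [ht.1]
    have ht2 : |t| ≤ 2 * s := by rw [abs_of_pos ht0]; exact ht.2.le
    have hk : 1 / (2 * Real.sqrt t) ≤ κ := by
      apply one_div_le_one_div_of_le
      · have := Real.sqrt_pos.2 (by linarith : 0 < s / 2); positivity
      · have := Real.sqrt_le_sqrt ht.1.le; linarith
    rw [Real.norm_eq_abs, abs_mul, abs_of_pos (rho_pos z)]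
    have hr := (rho_pos z).le
    have a1 : |∑ i, (1 / (2 * Real.sqrt t) * z i) * Dv (ex i) h (hp t z)| ≤ ∑ i, κ * (C i * Real.exp (R i * ∑ i, |z i|)) := by
      refine (Finset.abs_sum_le_sum_abs _ _).trans (Finset.sum_le_sum fun i _ => ?_)
      rw [mul_assoc, abs_mul, abs_of_nonneg (by positivity : 0 ≤ 1 / (2 * Real.sqrt t))]
      exact mul_le_mul hk (h1 i t z ht2) (abs_nonneg _) hκ0
    have a2 := (abs_add_le (Dv et h (hp t z)) (∑ i, (1 / (2 * Real.sqrt t) * z i) * Dv (ex i) h (hp t z))).trans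
      (add_le_add (h0 t z ht2) a1)
    refine (mul_le_mul_of_nonneg_left a2 hr).trans (le_of_eq ?_)
    rw [mul_add]
    congr 1
    · ring
    · rw [Finset.mul_sum]
      exact Finset.sum_congr rfl fun i _ => by ring
  · exact ((rho_exp_int R0).const_mul C0).add (integrable_finsetSum _ fun i _ => (rho_exp_int (R i)).const_mul _)
  · refine Eventually.of_forall fun z t ht => ?_
    have ht0 : 0 < t := by linarith [ht.1]
    exact (hp_hasDeriv hdiff ht0 z).const_mul (rho z)
end Heat

end

section
set_option linter.all false
open Filter
open scoped Topology

namespace Heat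
open Disc
variable {ι : Type*} [Fintype ι] [DecidableEq ι]

def ell (v : ℝ × (ι → ℝ)) (x : ι → ℝ) : ℝ := (∑ i, v.2 i * x i) - v.1 * (∑ i, x i ^ 2) / 2

def ellL (x : ι → ℝ) : ℝ × (ι → ℝ) →L[ℝ] ℝ :=
  (∑ i, x i • (ContinuousLinearMap.proj (R := ℝ) (φ := fun _ : ι => ℝ) i).comp (ContinuousLinearMap.snd ℝ ℝ (ι → ℝ)))
    - ((∑ i, x i ^ 2) / 2) • ContinuousLinearMap.fst ℝ ℝ (ι → ℝ)

lemma ellL_apply (x : ι → ℝ) (v) : ellL x v = ell v x := by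
  simp [ellL, ell, ContinuousLinearMap.sum_apply, mul_comm]
  ring

lemma ellL_cont : Continuous (ellL : (ι → ℝ) → _) := by
  unfold ellL; fun_prop

lemma ell_cont (v : ℝ × (ι → ℝ)) : Continuous (ell v) := by
  unfold ell; fun_prop

lemma wt_eq (p : ℝ × (ι → ℝ)) (x : ι → ℝ) : wt p.2 p.1 x = Real.exp (ellL x p) := by
  rw [ellL_apply]; rfl

lemma wt_jcont : Continuous (fun q : (ℝ × (ι → ℝ)) × (ι → ℝ) => wt q.1.2 q.1.1 q.2) := by
  unfold wt; fun_prop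

def F (B : Set (ι → ℝ)) (g : (ι → ℝ) → ℝ) (p : ℝ × (ι → ℝ)) : ℝ := ∫ x in B, wt p.2 p.1 x * g x

lemma F_int {B : Set (ι → ℝ)} (hB : IsCompact B) {g : (ι → ℝ) → ℝ} (hg : Continuous g) (p : ℝ × (ι → ℝ)) :
    IntegrableOn (fun x => wt p.2 p.1 x * g x) B :=
  (Continuous.mul (by unfold wt; fun_prop) hg).continuousOn.integrableOn_compact hB

lemma F_hasFDeriv {B : Set (ι → ℝ)} (hB : IsCompact B) {g : (ι → ℝ) → ℝ} (hg : Continuous g)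
    (p : ℝ × (ι → ℝ)) :
    Integrable (fun x => (wt p.2 p.1 x * g x) • ellL x) (volume.restrict B) ∧
    HasFDerivAt (F B g) (∫ x in B, (wt p.2 p.1 x * g x) • ellL x) p := by
  have hjc : Continuous (fun q : (ℝ × (ι → ℝ)) × (ι → ℝ) => (wt q.1.2 q.1.1 q.2 * g q.2) • ellL q.2) := by
    exact (wt_jcont.mul (hg.comp continuous_snd)).smul (ellL_cont.comp continuous_snd)
  have hc1 : ∀ p : ℝ × (ι → ℝ), Continuous (fun x => (wt p.2 p.1 x * g x) • ellL x) := fun p =>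
    hjc.comp (by fun_prop : Continuous fun x : ι → ℝ => (p, x))
  obtain ⟨M, hM⟩ := ((isCompact_closedBall p 1).prod hB).exists_bound_of_continuousOn hjc.continuousOn
  refine ⟨(hc1 p).continuousOn.integrableOn_compact hB, ?_⟩
  have hfin : IsFiniteMeasure (volume.restrict B) := ⟨by simpa using hB.measure_lt_top⟩
  refine hasFDerivAt_integral_of_dominated_of_fderiv_le (bound := fun _ => M)
    (F' := fun p x => (wt p.2 p.1 x * g x) • ellL x) (s := closedBall p 1)
    (closedBall_mem_nhds p one_pos) ?_ (F_int hB hg p) ((hc1 p).aestronglyMeasurable) ?_ (integrable_const M) ?_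
  · exact Eventually.of_forall fun q => (F_int hB hg q).aestronglyMeasurable
  · refine (ae_restrict_iff' hB.measurableSet).2 (Eventually.of_forall fun x hx q hq => hM (q, x) ⟨hq, hx⟩)
  · refine Eventually.of_forall fun x q hq => ?_
    have h1 : HasFDerivAt (fun q : ℝ × (ι → ℝ) => wt q.2 q.1 x) (wt q.2 q.1 x • ellL x) q := by
      simp only [wt_eq]
      exact (ellL x).hasFDerivAt.exp
    refine (h1.mul_const (g x)).congr_fderiv ?_
    rw [smul_smul, mul_comm]

lemma Dv_F {B : Set (ι → ℝ)} (hB : IsCompact B) {g : (ι → ℝ) → ℝ} (hg : Continuous g) (v) :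
    Dv v (F B g) = F B (fun x => g x * ell v x) := by
  funext p
  obtain ⟨h1, h2⟩ := F_hasFDeriv hB hg p
  unfold Dv
  rw [h2.fderiv, ContinuousLinearMap.integral_apply h1]
  unfold F
  congr 1; funext x
  simp [ellL_apply]; ring

lemma bdd_of_compact {B : Set (ι → ℝ)} (hB : IsCompact B) : ∃ R : ℝ, 0 ≤ R ∧ ∀ x ∈ B, ∀ i, |x i| ≤ R := by
  obtain ⟨R, hR⟩ := hB.isBounded.exists_norm_le
  exact ⟨|R|, abs_nonneg _, fun x hx i => (norm_le_pi_norm x i).trans ((hR x hx).trans (le_abs_self R))⟩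

lemma ell_bd {R T : ℝ} (hR : 0 ≤ R) (x : ι → ℝ) (hx : ∀ i, |x i| ≤ R) (p : ℝ × (ι → ℝ)) (hp : |p.1| ≤ T) :
    |ell p x| ≤ T * (∑ i : ι, R ^ 2) / 2 + R * ∑ i, |p.2 i| := by
  unfold ell
  have h1 : |∑ i, p.2 i * x i| ≤ R * ∑ i, |p.2 i| := by
    refine (Finset.abs_sum_le_sum_abs _ _).trans ?_
    rw [Finset.mul_sum]
    refine Finset.sum_le_sum fun i _ => ?_
    rw [abs_mul, mul_comm]
    exact mul_le_mul_of_nonneg_right (hx i) (abs_nonneg _)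
  have h2 : ∑ i, x i ^ 2 ≤ ∑ i : ι, R ^ 2 := Finset.sum_le_sum fun i _ => by
    rw [← sq_abs]; exact pow_le_pow_left₀ (abs_nonneg _) (hx i) 2
  have h3 : 0 ≤ ∑ i, x i ^ 2 := Finset.sum_nonneg fun i _ => sq_nonneg _
  have h4 : |p.1 * (∑ i, x i ^ 2) / 2| ≤ T * (∑ i : ι, R ^ 2) / 2 := by
    rw [abs_div, abs_mul, abs_of_nonneg h3, abs_two]
    have := mul_le_mul hp h2 h3 ((abs_nonneg _).trans hp)
    linarith
  have := abs_sub (∑ i, p.2 i * x i) (p.1 * (∑ i, x i ^ 2) / 2)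
  linarith

lemma F_eg {B : Set (ι → ℝ)} (hB : IsCompact B) {g : (ι → ℝ) → ℝ} (hg : Continuous g) : EG (F B g) := by
  intro T
  obtain ⟨R, hR, hx⟩ := bdd_of_compact hB
  obtain ⟨M, hM⟩ := hB.exists_bound_of_continuousOn hg.continuousOn
  refine ⟨Real.exp (T * (∑ i : ι, R ^ 2) / 2) * |M| * (volume B).toReal, R, by positivity, hR, fun p hp => ?_⟩
  have := norm_setIntegral_le_of_norm_le_const (μ := volume) (s := B) (f := fun x => wt p.2 p.1 x * g x)
    (C := Real.exp (T * (∑ i : ι, R ^ 2) / 2 + R * ∑ i, |p.2 i|) * |M|) hB.measure_lt_top (fun x hx' => by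
      rw [norm_mul, wt_eq, Real.norm_eq_abs, abs_of_pos (Real.exp_pos _), ellL_apply]
      exact mul_le_mul (Real.exp_le_exp.2 ((le_abs_self _).trans (ell_bd hR x (hx x hx') p hp)))
        ((hM x hx').trans (le_abs_self M)) (norm_nonneg _) (Real.exp_pos _).le)
  rw [Real.norm_eq_abs] at this
  refine this.trans (le_of_eq ?_)
  rw [Real.exp_add, Measure.real]; ring

lemma F_nice {B : Set (ι → ℝ)} (hB : IsCompact B) {g : (ι → ℝ) → ℝ} (hg : Continuous g) : Nice (F B g) := by
  intro n
  induction n generalizing g with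
  | zero =>
    exact ⟨continuous_iff_continuousAt.2 fun p => (F_hasFDeriv hB hg p).2.continuousAt, F_eg hB hg⟩
  | succ n ih =>
    refine ⟨continuous_iff_continuousAt.2 fun p => (F_hasFDeriv hB hg p).2.continuousAt, F_eg hB hg,
      fun p => (F_hasFDeriv hB hg p).2.differentiableAt, fun v => ?_⟩
    rw [Dv_F hB hg]
    exact ih (hg.mul (ell_cont v))

abbrev one' : (ι → ℝ) → ℝ := fun _ => 1

lemma F_one_pos {B : Set (ι → ℝ)} (hB : IsCompact B) (hv : 0 < volume B) (p : ℝ × (ι → ℝ)) : 0 < F B one' p := by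
  unfold F
  rw [setIntegral_pos_iff_support_of_nonneg_ae]
  · have : Function.support (fun x => wt p.2 p.1 x * (one' x : ℝ)) = univ := by
      ext x; simp [(wt_pos p.2 p.1 x).ne']
    rw [this, univ_inter]; exact hv
  · exact Eventually.of_forall fun x => by simpa using (wt_pos p.2 p.1 x).le
  · exact F_int hB continuous_const p

lemma F_inv_eg {B : Set (ι → ℝ)} (hB : IsCompact B) (hv : 0 < volume B) : EG (fun p => (F B one' p)⁻¹) := by
  intro T
  obtain ⟨R, hR, hx⟩ := bdd_of_compact hB
  have hV : 0 < (volume B).toReal := ENNReal.toReal_pos hv.ne' hB.measure_lt_top.ne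
  refine ⟨Real.exp (T * (∑ i : ι, R ^ 2) / 2) * (volume B).toReal⁻¹, R, by positivity, hR, fun p hp => ?_⟩
  have h1 : Real.exp (-(T * (∑ i : ι, R ^ 2) / 2 + R * ∑ i, |p.2 i|)) * (volume B).toReal ≤ F B one' p := by
    have h2 : ∫ x in B, Real.exp (-(T * (∑ i : ι, R ^ 2) / 2 + R * ∑ i, |p.2 i|)) ≤ F B one' p := by
      unfold F
      refine setIntegral_mono_on (integrableOn_const hB.measure_lt_top.ne) (F_int hB continuous_const p) hB.measurableSet ?_
      intro x hx'
      rw [mul_one, wt_eq, ellL_apply]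
      exact Real.exp_le_exp.2 (by
        have := ell_bd hR x (hx x hx') p hp
        have := neg_abs_le (ell p x); linarith)
    rw [setIntegral_const, smul_eq_mul, mul_comm] at h2
    exact h2
  rw [abs_of_pos (inv_pos.2 (F_one_pos hB hv p))]
  refine (inv_anti₀ (by positivity) h1).trans (le_of_eq ?_)
  rw [mul_inv, Real.exp_neg, inv_inv, Real.exp_add]; ring

/-- expectation with respect to the tilted measure -/
def ev (B : Set (ι → ℝ)) (g : (ι → ℝ) → ℝ) (p : ℝ × (ι → ℝ)) : ℝ := F B g p * (F B one' p)⁻¹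

section
variable {B : Set (ι → ℝ)} (hB : IsCompact B) (hv : 0 < volume B)
include hB hv

lemma ev_nice {g : (ι → ℝ) → ℝ} (hg : Continuous g) : Nice (ev B g) :=
  (F_nice hB hg).mul ((F_nice hB continuous_const).inv (fun p => (F_one_pos hB hv p).ne') (F_inv_eg hB hv))

lemma F_eq_ev {g : (ι → ℝ) → ℝ} (p) : F B g p = F B one' p * ev B g p := by
  unfold ev
  have := (F_one_pos hB hv p).ne'
  field_simp

lemma Dv_ev {g : (ι → ℝ) → ℝ} (hg : Continuous g) (v) (p) :
    Dv v (ev B g) p = ev B (fun x => g x * ell v x) p - ev B g p * ev B (ell v) p := by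
  have h1 : F B g = fun p => F B one' p * ev B g p := by funext p; exact F_eq_ev hB hv p
  have h2 : Dv v (F B g) p = Dv v (fun p => F B one' p * ev B g p) p := by rw [← h1]
  rw [Dv_mul v (F_nice hB continuous_const).diff (ev_nice hB hv hg).diff, Dv_F hB hg, Dv_F hB continuous_const] at h2
  simp only [one_mul] at h2
  have h3 := F_eq_ev hB hv (g := fun x => g x * ell v x) p
  have h4 := F_eq_ev hB hv (g := ell v) p
  have h5 := (F_one_pos hB hv p).ne'
  have h4' : F B (fun x => ell v x) p = F B one' p * ev B (ell v) p := h4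
  rw [h3, h4'] at h2
  apply mul_left_cancel₀ h5
  linarith

lemma ev_add {f g : (ι → ℝ) → ℝ} (hf : Continuous f) (hg : Continuous g) (p) :
    ev B (fun x => f x + g x) p = ev B f p + ev B g p := by
  unfold ev F
  rw [← add_mul, ← integral_add (F_int hB hf p) (F_int hB hg p)]
  congr 2; funext x; ring

omit hB hv in
lemma ev_smul (c : ℝ) (g : (ι → ℝ) → ℝ) (p) : ev B (fun x => c * g x) p = c * ev B g p := by
  unfold ev F
  rw [← mul_assoc, ← integral_const_mul]
  congr 2; funext x; ring

lemma ev_sub {f g : (ι → ℝ) → ℝ} (hf : Continuous f) (hg : Continuous g) (p) :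
    ev B (fun x => f x - g x) p = ev B f p - ev B g p := by
  have := ev_add hB hv (g := fun x => (-1) * g x) hf (continuous_const.mul hg) p
  rw [ev_smul] at this
  rw [sub_eq_add_neg, ← neg_one_mul (ev B g p), ← this]
  congr 1; funext x; ring

lemma ev_one (p) : ev B (fun _ => 1) p = 1 := by
  unfold ev; exact mul_inv_cancel₀ (F_one_pos hB hv p).ne'

lemma ev_const (c : ℝ) (p) : ev B (fun _ => c) p = c := by
  have := ev_smul (B := B) c (fun _ => 1) p
  simp only [mul_one] at this
  rw [this, ev_one hB hv, mul_one]

lemma ev_sum {κ : Type*} (s : Finset κ) {f : κ → (ι → ℝ) → ℝ} (hf : ∀ k, Continuous (f k)) (p) :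
    ev B (fun x => ∑ k ∈ s, f k x) p = ∑ k ∈ s, ev B (f k) p := by
  classical
  induction s using Finset.induction_on with
  | empty => simpa using ev_const hB hv 0 p
  | insert a s ha ih =>
    simp only [Finset.sum_insert ha]
    rw [ev_add hB hv (hf a) (by fun_prop), ih]

lemma ev_mono {f g : (ι → ℝ) → ℝ} (hf : Continuous f) (hg : Continuous g) (h : ∀ x ∈ B, f x ≤ g x) (p) :
    ev B f p ≤ ev B g p := by
  unfold ev F
  refine mul_le_mul_of_nonneg_right ?_ (inv_pos.2 (F_one_pos hB hv p)).le
  refine setIntegral_mono_on (F_int hB hf p) (F_int hB hg p) hB.measurableSet fun x hx => ?_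
  exact mul_le_mul_of_nonneg_left (h x hx) (wt_pos _ _ _).le

/-- Cauchy–Schwarz -/
lemma ev_cs {f g : (ι → ℝ) → ℝ} (hf : Continuous f) (hg : Continuous g) (p) :
    (ev B (fun x => f x * g x) p) ^ 2 ≤ ev B (fun x => f x ^ 2) p * ev B (fun x => g x ^ 2) p := by
  have key : ∀ t : ℝ, 0 ≤ ev B (fun x => f x ^ 2) p * (t * t) + (2 * ev B (fun x => f x * g x) p) * t + ev B (fun x => g x ^ 2) p := by
    intro t
    have h1 := ev_mono hB hv (f := fun _ => 0) (g := fun x => (t * t) * f x ^ 2 + ((2 * t) * (f x * g x) + g x ^ 2))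
      continuous_const (by fun_prop) (fun x _ => by nlinarith [sq_nonneg (t * f x + g x)]) p
    rw [ev_const hB hv, ev_add hB hv (by fun_prop) (by fun_prop), ev_add hB hv (by fun_prop) (by fun_prop), ev_smul, ev_smul] at h1
    linarith
  have := discrim_le_zero key
  unfold discrim at this
  nlinarith

end

/-- generator -/
def Gen (B : Set (ι → ℝ)) (G : ℝ × (ι → ℝ) → ℝ) (p : ℝ × (ι → ℝ)) : ℝ :=
  Ht G p + ∑ i, ev B (fun x => x i) p * Dv (ex i) G p

lemma ell_ex (i : ι) : ell (ex i) = fun x : ι → ℝ => x i := by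
  funext x; simp [ell, ex, Pi.single_apply]
lemma ell_et : ell (et : ℝ × (ι → ℝ)) = fun x : ι → ℝ => - (∑ i, x i ^ 2) / 2 := by
  funext x; simp [ell, et]; ring

lemma Ht_mul {f g : ℝ × (ι → ℝ) → ℝ} (hf : Nice f) (hg : Nice g) (p) :
    Ht (fun p => f p * g p) p = f p * Ht g p + g p * Ht f p + ∑ i, Dv (ex i) f p * Dv (ex i) g p := by
  unfold Ht
  have h1 : ∀ i : ι, Dv (ex i) (Dv (ex i) (fun p => f p * g p)) p = f p * Dv (ex i) (Dv (ex i) g) p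
      + g p * Dv (ex i) (Dv (ex i) f) p + 2 * (Dv (ex i) f p * Dv (ex i) g p) := by
    intro i
    rw [Dv_mul _ hf.diff hg.diff, Dv_add _ (hf.mul (hg.dv _)).diff ((hf.dv _).mul hg).diff,
      Dv_mul _ hf.diff (hg.dv _).diff, Dv_mul _ (hf.dv _).diff hg.diff]
    ring
  simp only [h1, Finset.sum_add_distrib, ← Finset.mul_sum]
  rw [Dv_mul _ hf.diff hg.diff]
  ring

section
variable {B : Set (ι → ℝ)} (hB : IsCompact B) (hv : 0 < volume B)
include hB

lemma Ht_F {g : (ι → ℝ) → ℝ} (hg : Continuous g) (p) : Ht (F B g) p = 0 := by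
  unfold Ht
  have h1 : ∀ i : ι, Dv (ex i) (Dv (ex i) (F B g)) p = F B (fun x => g x * x i * x i) p := by
    intro i
    rw [Dv_F hB hg, Dv_F hB (by have := ell_cont (ex i); fun_prop)]; simp only [ell_ex]
  simp only [h1]
  rw [Dv_F hB hg, ell_et]
  unfold F
  rw [← integral_finsetSum _ (fun i _ => F_int hB (by fun_prop) p), ← integral_const_mul, ← integral_add]
  · rw [← integral_zero (ι → ℝ) ℝ (μ := volume.restrict B)]
    congr 1; funext x
    rw [← Finset.mul_sum]
    simp only [mul_assoc, ← Finset.mul_sum, ← pow_two]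
    ring
  · exact F_int hB (by fun_prop) p
  · exact (integrable_finsetSum _ (fun i _ => F_int hB (by fun_prop) p)).const_mul _

include hv

lemma Ht_FG {G : ℝ × (ι → ℝ) → ℝ} (hG : Nice G) (p) :
    Ht (fun p => F B one' p * G p) p = F B one' p * Gen B G p := by
  rw [Ht_mul (F_nice hB continuous_const) hG, Ht_F hB continuous_const]
  unfold Gen
  rw [mul_add, Finset.mul_sum, mul_zero, add_zero]
  congr 1
  refine Finset.sum_congr rfl fun i _ => ?_
  rw [Dv_F hB continuous_const, ell_ex]
  simp only [one_mul]
  rw [F_eq_ev hB hv]; ring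

lemma Gen_ev {g : (ι → ℝ) → ℝ} (hg : Continuous g) (p) : Gen B (ev B g) p = 0 := by
  have h1 := Ht_FG hB hv (ev_nice hB hv hg) p
  have h2 : (fun p => F B one' p * ev B g p) = F B g := by funext p; exact (F_eq_ev hB hv p).symm
  rw [h2, Ht_F hB hg] at h1
  exact (mul_eq_zero.1 h1.symm).resolve_left (F_one_pos hB hv p).ne'

omit hB hv in
lemma Gen_mul {f g : ℝ × (ι → ℝ) → ℝ} (hf : Nice f) (hg : Nice g) (p) :
    Gen B (fun p => f p * g p) p = f p * Gen B g p + g p * Gen B f p + ∑ i, Dv (ex i) f p * Dv (ex i) g p := by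
  unfold Gen
  rw [Ht_mul hf hg]
  have : ∀ i : ι, ev B (fun x => x i) p * Dv (ex i) (fun p => f p * g p) p
      = f p * (ev B (fun x => x i) p * Dv (ex i) g p) + g p * (ev B (fun x => x i) p * Dv (ex i) f p) := by
    intro i; rw [Dv_mul _ hf.diff hg.diff]; ring
  simp only [this, Finset.sum_add_distrib, ← Finset.mul_sum]
  ring

omit hB hv in
lemma Gen_add {f g : ℝ × (ι → ℝ) → ℝ} (hf : Nice f) (hg : Nice g) (p) :
    Gen B (fun p => f p + g p) p = Gen B f p + Gen B g p := by
  unfold Gen Ht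
  have h1 : ∀ i : ι, Dv (ex i) (Dv (ex i) (fun p => f p + g p)) p
      = Dv (ex i) (Dv (ex i) f) p + Dv (ex i) (Dv (ex i) g) p := by
    intro i; rw [Dv_add _ hf.diff hg.diff, Dv_add _ (hf.dv _).diff (hg.dv _).diff]
  have h2 : ∀ v, Dv v (fun p => f p + g p) p = Dv v f p + Dv v g p := fun v => by
    rw [Dv_add _ hf.diff hg.diff]
  simp only [h1, h2, mul_add, Finset.sum_add_distrib]
  ring

omit hB hv in
lemma Gen_const (c : ℝ) (p) : Gen B (fun _ => c) p = 0 := by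
  unfold Gen Ht
  simp [Dv_const]

omit hB hv in
lemma Gen_smul (c : ℝ) {f : ℝ × (ι → ℝ) → ℝ} (hf : Nice f) (p) :
    Gen B (fun p => c * f p) p = c * Gen B f p := by
  rw [Gen_mul (Nice.const c) hf, Gen_const]
  simp [Dv_const]

omit hB hv in
lemma Gen_sub {f g : ℝ × (ι → ℝ) → ℝ} (hf : Nice f) (hg : Nice g) (p) :
    Gen B (fun p => f p - g p) p = Gen B f p - Gen B g p := by
  have := Gen_add (B := B) hf ((Nice.const (-1)).mul hg) p
  rw [Gen_smul _ hg] at this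
  rw [sub_eq_add_neg, ← neg_one_mul (Gen B g p), ← this]
  congr 1; funext x; ring

omit hB hv in
lemma Gen_sum {κ : Type*} (s : Finset κ) {f : κ → ℝ × (ι → ℝ) → ℝ} (hf : ∀ k, Nice (f k)) (p) :
    Gen B (fun p => ∑ k ∈ s, f k p) p = ∑ k ∈ s, Gen B (f k) p := by
  classical
  induction s using Finset.induction_on with
  | empty => simpa using Gen_const (B := B) 0 p
  | insert a s ha ih =>
    simp only [Finset.sum_insert ha]
    rw [Gen_add (hf a) (Nice.sum s hf), ih]

omit hB hv in
lemma Dv_sum {κ : Type*} (s : Finset κ) {f : κ → ℝ × (ι → ℝ) → ℝ} (hf : ∀ k, Nice (f k)) (v p) :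
    Dv v (fun p => ∑ k ∈ s, f k p) p = ∑ k ∈ s, Dv v (f k) p := by
  classical
  induction s using Finset.induction_on with
  | empty => simp [Dv_const]
  | insert a s ha ih =>
    simp only [Finset.sum_insert ha]
    rw [Dv_add _ (hf a).diff (Nice.sum s hf).diff]
    beta_reduce
    rw [ih]

omit hB hv in
lemma Dv_sub (v : ℝ × (ι → ℝ)) {f g : ℝ × (ι → ℝ) → ℝ} (hf : Nice f) (hg : Nice g) (p) :
    Dv v (fun p => f p - g p) p = Dv v f p - Dv v g p := by
  unfold Dv
  rw [fderiv_fun_sub (hf.diff p) (hg.diff p)]; rfl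

omit hB hv in
/-- generator of an inverse -/
lemma Gen_inv_le {f : ℝ × (ι → ℝ) → ℝ} (hf : Nice f) (h0 : ∀ p, 0 < f p) (hE : EG (fun p => (f p)⁻¹)) (p) :
    - (Gen B f p) * ((f p)⁻¹) ^ 2 ≤ Gen B (fun p => (f p)⁻¹) p := by
  have hi := hf.inv (fun p => (h0 p).ne') hE
  have h1 := Gen_mul (B := B) hf hi p
  have h2 : (fun p => f p * (f p)⁻¹) = fun _ => 1 := by
    funext p; exact mul_inv_cancel₀ (h0 p).ne'
  rw [h2, Gen_const] at h1
  have h3 : ∑ i, Dv (ex i) f p * Dv (ex i) (fun p => (f p)⁻¹) p ≤ 0 := by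
    refine Finset.sum_nonpos fun i _ => ?_
    rw [Dv_inv _ hf.diff (fun p => (h0 p).ne')]
    nlinarith [mul_nonneg (sq_nonneg (Dv (ex i) f p)) (sq_nonneg ((f p)⁻¹))]
  have hp := h0 p
  have h4 : f p * (f p)⁻¹ = 1 := mul_inv_cancel₀ hp.ne'
  have h5 : 0 ≤ f p * Gen B (fun p => (f p)⁻¹) p + (f p)⁻¹ * Gen B f p := by linarith
  have h6 : 0 ≤ (f p)⁻¹ * (f p * Gen B (fun p => (f p)⁻¹) p + (f p)⁻¹ * Gen B f p) :=
    mul_nonneg (inv_pos.2 hp).le h5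
  have h7 : (f p)⁻¹ * (f p * Gen B (fun p => (f p)⁻¹) p + (f p)⁻¹ * Gen B f p)
    = (f p * (f p)⁻¹) * Gen B (fun p => (f p)⁻¹) p + Gen B f p * ((f p)⁻¹) ^ 2 := by ring
  rw [h7, h4] at h6
  linarith

/-- averaged quantity -/
lemma E_hasDeriv {G : ℝ × (ι → ℝ) → ℝ} (hG : Nice G) {s : ℝ} (hs : 0 < s) :
    HasDerivAt (Ph (fun p => F B one' p * G p)) (∫ z, rho z * (F B one' (hp s z) * Gen B G (hp s z))) s := by
  have := Ph_hasDeriv ((F_nice hB (g := one') continuous_const).mul hG 2) hs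
  refine this.congr_deriv ?_
  unfold Ph
  congr 1; funext z
  rw [Ht_FG hB hv hG]

end

omit [DecidableEq ι] in
lemma Ph_zero (h : ℝ × (ι → ℝ) → ℝ) : Ph h 0 = (∫ z : ι → ℝ, rho z) * h (0, 0) := by
  unfold Ph hp
  simp [integral_mul_const]
end Heat

end

section
set_option linter.all false
open Filter
open scoped Topology

namespace Heat
open Matrix
variable {ι : Type*} [Fintype ι] [DecidableEq ι]

/-- spectral data -/
lemma spec_exists {A : Matrix ι ι ℝ} (hs : ∀ i j, A i j = A j i) (hp : ∀ u : ι → ℝ, 0 ≤ ∑ i, ∑ j, u i * A i j * u j) :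
    ∃ (U : Matrix ι ι ℝ) (l : ι → ℝ), Uᵀ * U = 1 ∧ U * Uᵀ = 1 ∧ A = U * diagonal l * Uᵀ ∧ ∀ i, 0 ≤ l i := by
  have hA : A.IsHermitian := by
    ext i j; simp [conjTranspose_apply, hs i j]
  have h1 := hA.spectral_theorem
  set U : Matrix ι ι ℝ := (hA.eigenvectorUnitary : Matrix ι ι ℝ) with hU
  have hU1 : Uᵀ * U = 1 := by
    have := Unitary.coe_star_mul_self hA.eigenvectorUnitary
    rw [star_eq_conjTranspose, conjTranspose_eq_transpose_of_trivial] at this; exact this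
  have hU2 : U * Uᵀ = 1 := mul_eq_one_comm.1 hU1
  have hA1 : A = U * diagonal hA.eigenvalues * Uᵀ := by
    rw [Unitary.conjStarAlgAut_apply] at h1
    rw [star_eq_conjTranspose, conjTranspose_eq_transpose_of_trivial] at h1
    exact h1
  refine ⟨U, hA.eigenvalues, hU1, hU2, hA1, fun i => ?_⟩
  have h2 : Uᵀ * A * U = diagonal hA.eigenvalues := by
    conv_lhs => rw [hA1]
    calc Uᵀ * (U * diagonal hA.eigenvalues * Uᵀ) * U = (Uᵀ * U) * diagonal hA.eigenvalues * (Uᵀ * U) := by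
          simp only [Matrix.mul_assoc]
      _ = _ := by rw [hU1]; simp
  have h3 : (Uᵀ * A * U) i i = hA.eigenvalues i := by rw [h2]; simp
  rw [← h3]
  have := hp (fun j => U j i)
  simp only [Matrix.mul_apply, transpose_apply, Finset.sum_mul]
  rw [Finset.sum_comm]
  exact this

lemma spec_pow {A U : Matrix ι ι ℝ} {l : ι → ℝ} (h1 : Uᵀ * U = 1) (h2 : U * Uᵀ = 1) (hA : A = U * diagonal l * Uᵀ) (n : ℕ) :
    A ^ n = U * diagonal (fun i => l i ^ n) * Uᵀ := by
  induction n with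
  | zero => simp [h2]
  | succ n ih =>
    rw [pow_succ, ih]
    conv_lhs => rw [hA]
    calc U * diagonal (fun i => l i ^ n) * Uᵀ * (U * diagonal l * Uᵀ)
        = U * diagonal (fun i => l i ^ n) * (Uᵀ * U) * diagonal l * Uᵀ := by simp only [Matrix.mul_assoc]
      _ = U * (diagonal (fun i => l i ^ n) * diagonal l) * Uᵀ := by rw [h1]; simp only [Matrix.mul_assoc, Matrix.one_mul]
      _ = _ := by rw [diagonal_mul_diagonal]; simp only [pow_succ]

lemma trace_diag_mul (l : ι → ℝ) (m : Matrix ι ι ℝ) : trace (diagonal l * m) = ∑ i, l i * m i i := by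
  simp [trace, diagonal_mul]

lemma trace_conj (U X : Matrix ι ι ℝ) (l : ι → ℝ) : trace (U * diagonal l * Uᵀ * X) = trace (diagonal l * (Uᵀ * X * U)) := by
  calc trace (U * diagonal l * Uᵀ * X) = trace (U * (diagonal l * Uᵀ * X)) := by simp only [Matrix.mul_assoc]
    _ = trace (diagonal l * Uᵀ * X * U) := trace_mul_comm _ _
    _ = _ := by simp only [Matrix.mul_assoc]

lemma pow_mul_pow_le {x y : ℝ} (hx : 0 ≤ x) (hy : 0 ≤ y) (a b : ℕ) : x ^ a * y ^ b ≤ x ^ (a + b) + y ^ (a + b) := by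
  rcases le_total x y with h | h
  · have : x ^ a * y ^ b ≤ y ^ a * y ^ b := mul_le_mul_of_nonneg_right (pow_le_pow_left₀ hx h a) (by positivity)
    rw [← pow_add] at this
    have : 0 ≤ x ^ (a + b) := by positivity
    linarith
  · have : x ^ a * y ^ b ≤ x ^ a * x ^ b := mul_le_mul_of_nonneg_left (pow_le_pow_left₀ hy h b) (by positivity)
    rw [← pow_add] at this
    have : 0 ≤ y ^ (a + b) := by positivity
    linarith

section
variable {A : Matrix ι ι ℝ} (hs : ∀ i j, A i j = A j i) (hp : ∀ u : ι → ℝ, 0 ≤ ∑ i, ∑ j, u i * A i j * u j)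
include hs hp

lemma trace_pow_nonneg (n : ℕ) : 0 ≤ trace (A ^ n) := by
  obtain ⟨U, l, h1, h2, hA, hl⟩ := spec_exists hs hp
  rw [spec_pow h1 h2 hA, ← Matrix.mul_one (U * _ * Uᵀ), trace_conj, Matrix.mul_one, h1, trace_diag_mul]
  exact Finset.sum_nonneg fun i _ => by simpa using pow_nonneg (hl i) n

lemma trace_two {M : Matrix ι ι ℝ} (hM : Mᵀ = M) (a b : ℕ) :
    trace (A ^ a * M * A ^ b * M) ≤ 2 * trace (A ^ (a + b) * (M * M)) := by
  obtain ⟨U, l, h1, h2, hA, hl⟩ := spec_exists hs hp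
  set m := Uᵀ * M * U with hm
  have hmT : mᵀ = m := by rw [hm]; simp [Matrix.transpose_mul, hM, Matrix.mul_assoc]
  have hms : ∀ i j, m j i = m i j := fun i j => by
    conv_lhs => rw [← hmT]
    rfl
  have e1 : trace (A ^ a * M * A ^ b * M) = ∑ i, ∑ j, l i ^ a * l j ^ b * m i j ^ 2 := by
    rw [spec_pow h1 h2 hA, spec_pow h1 h2 hA]
    have : U * diagonal (fun i => l i ^ a) * Uᵀ * M * (U * diagonal (fun i => l i ^ b) * Uᵀ) * M
      = U * diagonal (fun i => l i ^ a) * Uᵀ * (M * (U * diagonal (fun i => l i ^ b) * Uᵀ) * M) := by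
      simp only [Matrix.mul_assoc]
    rw [this, trace_conj]
    have : Uᵀ * (M * (U * diagonal (fun i => l i ^ b) * Uᵀ) * M) * U = m * diagonal (fun i => l i ^ b) * m := by
      rw [hm]; simp only [Matrix.mul_assoc]
    rw [this, trace_diag_mul]
    refine Finset.sum_congr rfl fun i _ => ?_
    rw [Matrix.mul_apply, Finset.mul_sum]
    refine Finset.sum_congr rfl fun j _ => ?_
    rw [mul_diagonal, hms i j]; ring
  have e2 : trace (A ^ (a + b) * (M * M)) = ∑ i, ∑ j, l i ^ (a + b) * m i j ^ 2 := by
    rw [spec_pow h1 h2 hA, trace_conj]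
    have : Uᵀ * (M * M) * U = m * m := by
      rw [hm]
      calc Uᵀ * (M * M) * U = Uᵀ * M * 1 * M * U := by simp only [Matrix.mul_assoc, Matrix.mul_one, Matrix.one_mul]
        _ = _ := by rw [← h2]; simp only [Matrix.mul_assoc]
    rw [this, trace_diag_mul]
    refine Finset.sum_congr rfl fun i _ => ?_
    rw [Matrix.mul_apply, Finset.mul_sum]
    refine Finset.sum_congr rfl fun j _ => ?_
    rw [hms i j]; ring
  have e3 : ∑ i, ∑ j, l j ^ (a + b) * m i j ^ 2 = ∑ i, ∑ j, l i ^ (a + b) * m i j ^ 2 := by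
    rw [Finset.sum_comm]
    refine Finset.sum_congr rfl fun i _ => Finset.sum_congr rfl fun j _ => ?_
    rw [hms]
  rw [e1, e2, two_mul]
  nth_rw 2 [← e3]
  rw [← Finset.sum_add_distrib]
  refine Finset.sum_le_sum fun i _ => ?_
  rw [← Finset.sum_add_distrib]
  refine Finset.sum_le_sum fun j _ => ?_
  rw [← add_mul]
  exact mul_le_mul_of_nonneg_right (pow_mul_pow_le (hl i) (hl j) a b) (sq_nonneg _)

lemma trace_W {W : Matrix ι ι ℝ} {c : ℝ} (hc : 0 ≤ c)
    (hW : ∀ u : ι → ℝ, ∑ i, ∑ j, u i * W i j * u j ≤ c * ∑ i, ∑ j, u i * A i j * u j) (n : ℕ) :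
    trace (A ^ n * W) ≤ c * (Fintype.card ι + trace (A ^ (n + 2))) := by
  obtain ⟨U, l, h1, h2, hA, hl⟩ := spec_exists hs hp
  have hd : ∀ X : Matrix ι ι ℝ, ∀ i, (Uᵀ * X * U) i i = ∑ j, ∑ k, U j i * X j k * U k i := by
    intro X i
    simp only [Matrix.mul_apply, transpose_apply, Finset.sum_mul]
    rw [Finset.sum_comm]
  have hAd : Uᵀ * A * U = diagonal l := by
    conv_lhs => rw [hA]
    calc Uᵀ * (U * diagonal l * Uᵀ) * U = (Uᵀ * U) * diagonal l * (Uᵀ * U) := by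
          simp only [Matrix.mul_assoc]
      _ = _ := by rw [h1]; simp
  have h3 : ∀ i, (Uᵀ * W * U) i i ≤ c * l i := by
    intro i
    have := hW (fun j => U j i)
    rw [← hd, ← hd, hAd] at this
    simpa using this
  have e1 : trace (A ^ (n+2)) = ∑ i, l i ^ (n+2) := by
    rw [spec_pow h1 h2 hA, ← Matrix.mul_one (U * _ * Uᵀ), trace_conj, Matrix.mul_one, h1, trace_diag_mul]
    simp
  have e2 : trace (A ^ n * W) = ∑ i, l i ^ n * (Uᵀ * W * U) i i := by
    rw [spec_pow h1 h2 hA, trace_conj, trace_diag_mul]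
  rw [e1, e2]
  have : (Fintype.card ι : ℝ) = ∑ i : ι, (1 : ℝ) := by simp
  rw [this, ← Finset.sum_add_distrib, Finset.mul_sum]
  refine Finset.sum_le_sum fun i _ => ?_
  have h4 : l i ^ (n + 1) * 1 ^ 1 ≤ l i ^ (n + 1 + 1) + 1 ^ (n + 1 + 1) := pow_mul_pow_le (hl i) zero_le_one (n+1) 1
  simp only [one_pow, mul_one] at h4
  calc l i ^ n * (Uᵀ * W * U) i i ≤ l i ^ n * (c * l i) := mul_le_mul_of_nonneg_left (h3 i) (pow_nonneg (hl i) n)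
    _ = c * l i ^ (n + 1) := by ring
    _ ≤ _ := mul_le_mul_of_nonneg_left (by linarith) hc

lemma norm_le_of_trace {α : ℝ} {q : ℕ} (hq : q ≠ 0) (hα : 0 ≤ α) (h : trace (A ^ q) ≤ α ^ q) (u : ι → ℝ) :
    ∑ i, ∑ j, u i * A i j * u j ≤ α * ∑ i, u i ^ 2 := by
  obtain ⟨U, l, h1, h2, hA, hl⟩ := spec_exists hs hp
  have e1 : trace (A ^ q) = ∑ i, l i ^ q := by
    rw [spec_pow h1 h2 hA, ← Matrix.mul_one (U * _ * Uᵀ), trace_conj, Matrix.mul_one, h1, trace_diag_mul]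
    simp
  have hla : ∀ i, l i ≤ α := by
    intro i
    have : l i ^ q ≤ α ^ q := by
      refine le_trans ?_ h
      rw [e1]
      exact Finset.single_le_sum (f := fun i => l i ^ q) (fun j _ => pow_nonneg (hl j) q) (Finset.mem_univ i)
    exact le_of_pow_le_pow_left₀ hq hα this
  set w := Uᵀ *ᵥ u with hw
  have e2 : ∑ i, ∑ j, u i * A i j * u j = ∑ i, l i * w i ^ 2 := by
    have : ∑ i, ∑ j, u i * A i j * u j = u ⬝ᵥ (A *ᵥ u) := by
      simp only [dotProduct, mulVec, Finset.mul_sum, mul_assoc]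
    rw [this, hA, ← Matrix.mulVec_mulVec, ← Matrix.mulVec_mulVec, dotProduct_mulVec, ← mulVec_transpose, ← hw]
    simp only [dotProduct, mulVec_diagonal]
    refine Finset.sum_congr rfl fun i _ => by ring
  have e3 : ∑ i, w i ^ 2 = ∑ i, u i ^ 2 := by
    have a1 : ∑ i, w i ^ 2 = w ⬝ᵥ w := by simp only [dotProduct, pow_two]
    have a2 : ∑ i, u i ^ 2 = u ⬝ᵥ u := by simp only [dotProduct, pow_two]
    rw [a1, a2]
    nth_rw 1 [hw]
    rw [mulVec_transpose, ← dotProduct_mulVec, hw, Matrix.mulVec_mulVec, h2, one_mulVec]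
  rw [e2, ← e3, Finset.mul_sum]
  exact Finset.sum_le_sum fun i _ => mul_le_mul_of_nonneg_right (hla i) (sq_nonneg _)
end
end Heat

end

section
set_option linter.all false
open Filter
open scoped Topology

namespace Heat
open Matrix
variable {ι : Type*} [Fintype ι] [DecidableEq ι]

def MN (X : ℝ × (ι → ℝ) → Matrix ι ι ℝ) : Prop := ∀ i j, Nice (fun p => X p i j)
def DM (k : ι) (X : ℝ × (ι → ℝ) → Matrix ι ι ℝ) (p : ℝ × (ι → ℝ)) : Matrix ι ι ℝ :=
  Matrix.of fun i j => Dv (ex k) (fun p => X p i j) p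
def GM (B : Set (ι → ℝ)) (X : ℝ × (ι → ℝ) → Matrix ι ι ℝ) (p : ℝ × (ι → ℝ)) : Matrix ι ι ℝ :=
  Matrix.of fun i j => Gen B (fun p => X p i j) p

lemma MN.mul {X Y : ℝ × (ι → ℝ) → Matrix ι ι ℝ} (hX : MN X) (hY : MN Y) : MN (fun p => X p * Y p) := by
  intro i j
  simp only [Matrix.mul_apply]
  exact Nice.sum _ fun k => (hX i k).mul (hY k j)

lemma MN.pow {X : ℝ × (ι → ℝ) → Matrix ι ι ℝ} (hX : MN X) (n : ℕ) : MN (fun p => X p ^ n) := by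
  induction n with
  | zero => intro i j; simp only [pow_zero]; exact Nice.const _
  | succ n ih => simp only [pow_succ]; exact ih.mul hX

lemma DM_mul (k : ι) {X Y : ℝ × (ι → ℝ) → Matrix ι ι ℝ} (hX : MN X) (hY : MN Y) (p) :
    DM k (fun p => X p * Y p) p = DM k X p * Y p + X p * DM k Y p := by
  ext i j
  simp only [DM, Matrix.mul_apply, Matrix.of_apply, Matrix.add_apply]
  rw [Dv_sum _ (fun l => (hX i l).mul (hY l j)), ← Finset.sum_add_distrib]
  refine Finset.sum_congr rfl fun l _ => ?_
  rw [Dv_mul _ (hX i l).diff (hY l j).diff]; ring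

lemma GM_mul {B : Set (ι → ℝ)} {X Y : ℝ × (ι → ℝ) → Matrix ι ι ℝ} (hX : MN X) (hY : MN Y) (p) :
    GM B (fun p => X p * Y p) p = GM B X p * Y p + X p * GM B Y p + ∑ k, DM k X p * DM k Y p := by
  ext i j
  simp only [GM, DM, Matrix.mul_apply, Matrix.of_apply, Matrix.add_apply, Matrix.sum_apply]
  rw [Gen_sum _ (fun l => (hX i l).mul (hY l j)), Finset.sum_comm, ← Finset.sum_add_distrib, ← Finset.sum_add_distrib]
  refine Finset.sum_congr rfl fun l _ => ?_
  rw [Gen_mul (hX i l) (hY l j)]; ring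

lemma DM_pow (k : ι) {X : ℝ × (ι → ℝ) → Matrix ι ι ℝ} (hX : MN X) (n : ℕ) (p) :
    DM k (fun p => X p ^ n) p = ∑ a ∈ Finset.range n, X p ^ a * DM k X p * X p ^ (n - 1 - a) := by
  induction n with
  | zero =>
    ext i j
    simp [DM, Dv_const]
  | succ n ih =>
    simp only [pow_succ]
    rw [DM_mul k (hX.pow n) hX, ih, Finset.sum_range_succ, Finset.sum_mul]
    congr 1
    · refine Finset.sum_congr rfl fun a ha => ?_
      have : n + 1 - 1 - a = (n - 1 - a) + 1 := by have := Finset.mem_range.1 ha; omega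
      rw [this, pow_succ]; simp only [Matrix.mul_assoc]
    · simp

section
variable {B : Set (ι → ℝ)} 

lemma GM_trace {X : ℝ × (ι → ℝ) → Matrix ι ι ℝ} (hX : MN X) (p) :
    Gen B (fun p => trace (X p)) p = trace (GM B X p) := by
  simp only [trace, diag_apply, GM, Matrix.of_apply]
  exact Gen_sum _ (fun i => hX i i) p

lemma trace_gen_bound {X : ℝ × (ι → ℝ) → Matrix ι ι ℝ} (hX : MN X) (p)
    (hs : ∀ i j, X p i j = X p j i) (hp : ∀ u : ι → ℝ, 0 ≤ ∑ i, ∑ j, u i * X p i j * u j)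
    (hDs : ∀ k, (DM k X p)ᵀ = DM k X p) (hG : GM B X p = - (X p * X p)) (r : ℕ) (n : ℕ) :
    ∀ m, n + m = r + 2 → trace (GM B (fun p => X p ^ n) p * X p ^ m)
      ≤ (n : ℝ) ^ 2 * ∑ k, trace (X p ^ r * (DM k X p * DM k X p)) := by
  induction n with
  | zero =>
    intro m hm
    have : GM B (fun p => X p ^ 0) p = 0 := by
      ext i j
      simp only [GM, pow_zero, Matrix.of_apply]
      exact Gen_const _ _
    rw [this]; simp
  | succ n ih =>
    intro m hm
    set S := ∑ k, trace (X p ^ r * (DM k X p * DM k X p)) with hS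
    have h0 := ih (m + 1) (by omega)
    have e1 : GM B (fun p => X p ^ (n + 1)) p * X p ^ m = GM B (fun p => X p ^ n) p * X p ^ (m + 1)
        - X p ^ (r + 3) + ∑ k, ∑ a ∈ Finset.range n, X p ^ a * DM k X p * X p ^ (n - 1 - a) * DM k X p * X p ^ m := by
      simp only [pow_succ _ n]
      rw [GM_mul (hX.pow n) hX, hG]
      simp only [DM_pow _ hX]
      rw [add_mul, add_mul, Finset.sum_mul]
      simp only [Finset.sum_mul]
      congr 1
      rw [sub_eq_add_neg]
      congr 1
      · rw [pow_succ' _ m, Matrix.mul_assoc]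
      · rw [Matrix.mul_neg, Matrix.neg_mul]
        congr 1
        rw [← pow_two, ← pow_add, ← pow_add]
        congr 1; omega
    rw [e1, trace_add, trace_sub]
    have h1 := trace_pow_nonneg hs hp (r + 3)
    have h2 : trace (∑ k, ∑ a ∈ Finset.range n, X p ^ a * DM k X p * X p ^ (n - 1 - a) * DM k X p * X p ^ m) ≤ 2 * n * S := by
      rw [trace_sum, hS, Finset.mul_sum]
      refine Finset.sum_le_sum fun k _ => ?_
      rw [trace_sum]
      have : ∀ a ∈ Finset.range n, trace (X p ^ a * DM k X p * X p ^ (n - 1 - a) * DM k X p * X p ^ m)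
          ≤ 2 * trace (X p ^ r * (DM k X p * DM k X p)) := by
        intro a ha
        have := Finset.mem_range.1 ha
        rw [trace_mul_comm]
        have e : X p ^ m * (X p ^ a * DM k X p * X p ^ (n - 1 - a) * DM k X p)
            = X p ^ (m + a) * DM k X p * X p ^ (n - 1 - a) * DM k X p := by
          rw [pow_add]; simp only [Matrix.mul_assoc]
        have := trace_two hs hp (hDs k) (m + a) (n - 1 - a)
        rw [e]
        have e2 : m + a + (n - 1 - a) = r := by omega
        rw [e2] at this
        exact this
      refine (Finset.sum_le_sum this).trans (le_of_eq ?_)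
      rw [Finset.sum_const, Finset.card_range, nsmul_eq_mul]; ring
    have hS0 : 0 ≤ S := by
      refine Finset.sum_nonneg fun k _ => ?_
      obtain ⟨U, l, u1, u2, hA, hl⟩ := spec_exists hs hp
      rw [spec_pow u1 u2 hA, trace_conj, trace_diag_mul]
      refine Finset.sum_nonneg fun i _ => mul_nonneg (pow_nonneg (hl i) r) ?_
      set D := DM k X p with hD
      have hDT : Dᵀ = D := hDs k
      have : Uᵀ * (D * D) * U = (D * U)ᵀ * (D * U) := by
        rw [transpose_mul, hDT]; simp only [Matrix.mul_assoc]
      rw [this, Matrix.mul_apply]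
      exact Finset.sum_nonneg fun j _ => by rw [transpose_apply]; exact mul_self_nonneg _
    push_cast
    nlinarith

variable (hB : IsCompact B) (hv : 0 < volume B)

def Ac (B : Set (ι → ℝ)) (p : ℝ × (ι → ℝ)) : Matrix ι ι ℝ :=
  Matrix.of fun i j => ev B (fun x => x i * x j) p - ev B (fun x => x i) p * ev B (fun x => x j) p

include hB hv

lemma Ac_MN : MN (Ac B) := by
  intro i j
  simp only [Ac, Matrix.of_apply]
  exact (ev_nice hB hv (by fun_prop)).sub ((ev_nice hB hv (by fun_prop)).mul (ev_nice hB hv (by fun_prop)))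

lemma Dv_ev_ex {g : (ι → ℝ) → ℝ} (hg : Continuous g) (k : ι) (p) :
    Dv (ex k) (ev B g) p = ev B (fun x => g x * x k) p - ev B g p * ev B (fun x => x k) p := by
  rw [Dv_ev hB hv hg, ell_ex]

omit hB hv in
lemma Ac_symm (p) (i j : ι) : Ac B p i j = Ac B p j i := by
  simp only [Ac, Matrix.of_apply]
  congr 1
  · congr 1; funext x; ring
  · ring

lemma GM_Ac (p) : GM B (Ac B) p = -(Ac B p * Ac B p) := by
  ext i j
  simp only [GM, Matrix.of_apply, Matrix.neg_apply, Matrix.mul_apply, Ac]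
  have hc : ∀ i : ι, Nice (ev B (fun x => x i)) := fun i => ev_nice hB hv (by fun_prop)
  have := Gen_sub (B := B) (ev_nice hB hv (by fun_prop : Continuous fun x : ι → ℝ => x i * x j)) ((hc i).mul (hc j)) p
  rw [this, Gen_ev hB hv (by fun_prop), Gen_mul (hc i) (hc j), Gen_ev hB hv (by fun_prop), Gen_ev hB hv (by fun_prop)]
  simp only [mul_zero, add_zero, zero_add, zero_sub]
  congr 1
  refine Finset.sum_congr rfl fun k _ => ?_
  rw [Dv_ev_ex hB hv (by fun_prop), Dv_ev_ex hB hv (by fun_prop)]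
  congr 1
  congr 1
  · congr 1; funext x; ring
  · ring

/-- covariance in a direction -/
lemma Ac_quad (p) (u : ι → ℝ) : ∑ i, ∑ j, u i * Ac B p i j * u j
    = ev B (fun x => (∑ i, u i * x i) ^ 2) p - (ev B (fun x => ∑ i, u i * x i) p) ^ 2 := by
  have h1 : ev B (fun x => (∑ i, u i * x i) ^ 2) p = ∑ i, ∑ j, u i * u j * ev B (fun x => x i * x j) p := by
    have : (fun x : ι → ℝ => (∑ i, u i * x i) ^ 2) = fun x => ∑ i, ∑ j, (u i * u j) * (x i * x j) := by
      funext x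
      rw [pow_two, Finset.sum_mul_sum]
      refine Finset.sum_congr rfl fun i _ => Finset.sum_congr rfl fun j _ => by ring
    rw [this, ev_sum hB hv _ (fun i => by fun_prop)]
    refine Finset.sum_congr rfl fun i _ => ?_
    rw [ev_sum hB hv _ (fun i => by fun_prop)]
    refine Finset.sum_congr rfl fun j _ => ?_
    rw [ev_smul]
  have h2 : ev B (fun x => ∑ i, u i * x i) p = ∑ i, u i * ev B (fun x => x i) p := by
    rw [ev_sum hB hv _ (fun i => by fun_prop)]
    exact Finset.sum_congr rfl fun i _ => ev_smul _ _ _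
  rw [h1, h2, pow_two, Finset.sum_mul_sum, ← Finset.sum_sub_distrib]
  refine Finset.sum_congr rfl fun i _ => ?_
  rw [← Finset.sum_sub_distrib]
  refine Finset.sum_congr rfl fun j _ => ?_
  simp only [Ac, Matrix.of_apply]; ring

lemma ev_var {g : (ι → ℝ) → ℝ} (hg : Continuous g) (c : ℝ) (p) :
    ev B (fun x => (g x - ev B g p) ^ 2) p = ev B (fun x => g x ^ 2) p - (ev B g p) ^ 2 := by
  have : (fun x => (g x - ev B g p) ^ 2) = fun x => (g x ^ 2 + (-2 * ev B g p) * g x) + (ev B g p) ^ 2 := by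
    funext x; ring
  rw [this, ev_add hB hv (by fun_prop) continuous_const, ev_add hB hv (by fun_prop) (by fun_prop), ev_smul,
    ev_const hB hv]
  ring

lemma ev_nonneg {g : (ι → ℝ) → ℝ} (hg : Continuous g) (h : ∀ x ∈ B, 0 ≤ g x) (p) : 0 ≤ ev B g p := by
  have := ev_mono hB hv continuous_const hg h p
  rwa [ev_const hB hv] at this

lemma Ac_psd (p) (u : ι → ℝ) : 0 ≤ ∑ i, ∑ j, u i * Ac B p i j * u j := by
  rw [Ac_quad hB hv, ← ev_var hB hv (by fun_prop) 0]
  exact ev_nonneg hB hv (by fun_prop) (fun x _ => sq_nonneg _) p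

lemma DM_Ac (k : ι) (p) (i j : ι) : DM k (Ac B) p i j =
    ev B (fun x => (x i - ev B (fun x => x i) p) * (x j - ev B (fun x => x j) p) * (x k - ev B (fun x => x k) p)) p := by
  have hc : ∀ i : ι, Nice (ev B (fun x => x i)) := fun i => ev_nice hB hv (by fun_prop)
  simp only [DM, Ac, Matrix.of_apply]
  rw [Dv_sub _ (ev_nice hB hv (by fun_prop)) ((hc i).mul (hc j)), Dv_mul _ (hc i).diff (hc j).diff,
    Dv_ev_ex hB hv (by fun_prop)]
  beta_reduce
  rw [Dv_ev_ex hB hv (by fun_prop), Dv_ev_ex hB hv (by fun_prop)]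
  generalize hi : ev B (fun x => x i) p = ai
  generalize hj : ev B (fun x => x j) p = aj
  generalize hk : ev B (fun x => x k) p = ak
  have e : (fun x : ι → ℝ => (x i - ai) * (x j - aj) * (x k - ak)) = fun x =>
      ((((((x i * x j * x k + (-ak) * (x i * x j)) + (-aj) * (x i * x k)) + (-ai) * (x j * x k)) + (aj * ak) * x i)
        + (ai * ak) * x j) + (ai * aj) * x k) + (- (ai * aj * ak)) := by
    funext x; ring
  rw [e]
  repeat rw [ev_add hB hv (by fun_prop) (by fun_prop)]
  simp only [ev_smul, ev_const hB hv, hi, hj, hk]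
  ring
end
end Heat

end

section
set_option linter.all false
open Filter
open scoped Topology

namespace Heat
open Matrix Disc
variable {ι : Type*} [Fintype ι] [DecidableEq ι]
variable {B : Set (ι → ℝ)} (hB : IsCompact B) (hconv : Convex ℝ B) (hv : 0 < volume B)
include hB hconv hv

lemma poin (p : ℝ × (ι → ℝ)) (hs : 0 < p.1) {α l0 : ℝ} (hα : 0 ≤ α)
    (hcov : ∀ v : ι → ℝ, ∑ i, ∑ j, v i * Ac B p i j * v j ≤ α * ∑ i, v i ^ 2) (hl0 : 0 ≤ l0) (hl : l0 ^ 2 * α ≤ p.1)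
    {f : (ι → ℝ) → ℝ} {f1 : ι → (ι → ℝ) → ℝ} (hf : Continuous f) (hf1 : ∀ i, Continuous (f1 i))
    (hfd : ∀ i x, HasDerivAt (fun s : ℝ => f (x + s • uv i)) (f1 i x) 0) :
    l0 * (ev B (fun x => f x ^ 2) p - (ev B f p) ^ 2) ≤ ∑ i, ev B (fun x => f1 i x ^ 2) p := by
  have hZ := F_one_pos hB hv p
  have hZe : (∫ x in B, wt p.2 p.1 x) = F B one' p := by unfold F; simp
  have hFe : ∀ g : (ι → ℝ) → ℝ, (∫ x in B, wt p.2 p.1 x * g x) = F B one' p * ev B g p := fun g => F_eq_ev hB hv p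
  have := thmL hB hconv hv p.2 hs hα (fun v => ?_) hl0 hl hf hf1 hfd
  · rw [hFe, hZe, hFe] at this
    simp only [hFe] at this
    rw [← Finset.mul_sum] at this
    have e : (F B one' p * ev B f p) ^ 2 / F B one' p = F B one' p * (ev B f p) ^ 2 := by field_simp
    rw [e] at this
    refine le_of_mul_le_mul_left ?_ hZ
    linarith
  · rw [hFe, hFe, hZe]
    have h1 := hcov v
    rw [Ac_quad hB hv] at h1
    have e : (F B one' p * ev B (fun x => ∑ i, v i * x i) p) ^ 2 / F B one' p = F B one' p * (ev B (fun x => ∑ i, v i * x i) p) ^ 2 := by field_simp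
    rw [e]
    have := mul_le_mul_of_nonneg_left h1 hZ.le
    linarith

lemma tau_bound (p : ℝ × (ι → ℝ)) (hs : 0 < p.1) {α l0 : ℝ} (hα : 0 ≤ α)
    (hcov : ∀ v : ι → ℝ, ∑ i, ∑ j, v i * Ac B p i j * v j ≤ α * ∑ i, v i ^ 2) (hl0 : 0 ≤ l0) (hl : l0 ^ 2 * α ≤ p.1)
    (u : ι → ℝ) :
    l0 * ∑ i, ∑ j, u i * (∑ k, DM k (Ac B) p * DM k (Ac B) p) i j * u j ≤ 4 * α * ∑ i, ∑ j, u i * Ac B p i j * u j := by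
  set a : ι → ℝ := fun i => ev B (fun x => x i) p with ha
  have hcen : ∀ i, ev B (fun x => x i - a i) p = 0 := by
    intro i
    rw [ev_sub hB hv (by fun_prop) (by fun_prop), ev_const hB hv]; simp [ha]
  set U : (ι → ℝ) → ℝ := fun x => ∑ i, u i * (x i - a i) with hU
  have hUc : Continuous U := by rw [hU]; fun_prop
  set T : ι → ι → ℝ := fun j k => ∑ i, u i * DM k (Ac B) p i j with hT
  have hM : ∀ k i j, DM k (Ac B) p i j = ev B (fun x => (x i - a i) * (x j - a j) * (x k - a k)) p :=
    fun k i j => DM_Ac hB hv k p i j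
  have hTe : ∀ j k, T j k = ev B (fun x => U x * ((x j - a j) * (x k - a k))) p := by
    intro j k
    rw [hT]
    simp only [hM, ← ev_smul]
    rw [← ev_sum hB hv _ (fun i => by fun_prop)]
    congr 1; funext x
    rw [hU]; simp only [Finset.sum_mul]
    refine Finset.sum_congr rfl fun i _ => by ring
  have hTs : ∀ j k, T j k = T k j := by
    intro j k; rw [hTe, hTe]; congr 1; funext x; ring
  set τ : ℝ := ∑ j, ∑ k, T j k ^ 2 with hτ
  have hτ0 : 0 ≤ τ := Finset.sum_nonneg fun j _ => Finset.sum_nonneg fun k _ => sq_nonneg _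
  have e1 : ∑ i, ∑ j, u i * (∑ k, DM k (Ac B) p * DM k (Ac B) p) i j * u j = τ := by
    have hsym : ∀ k i j, DM k (Ac B) p i j = DM k (Ac B) p j i := by
      intro k i j; rw [hM, hM]; congr 1; funext x; ring
    have : ∀ k, ∑ j, T j k ^ 2 = ∑ i, ∑ j, u i * (DM k (Ac B) p * DM k (Ac B) p) i j * u j := by
      intro k
      simp only [hT, pow_two, Finset.sum_mul_sum, Matrix.mul_apply, Finset.sum_mul, Finset.mul_sum]
      rw [Finset.sum_comm]
      refine Finset.sum_congr rfl fun i _ => ?_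
      rw [Finset.sum_comm]
      refine Finset.sum_congr rfl fun j _ => Finset.sum_congr rfl fun l _ => ?_
      rw [hsym k l j]; ring
    have hτ2 : τ = ∑ k, ∑ i, ∑ j, u i * (DM k (Ac B) p * DM k (Ac B) p) i j * u j := by
      rw [hτ, Finset.sum_comm]
      exact Finset.sum_congr rfl fun k _ => this k
    rw [hτ2]
    simp only [Matrix.sum_apply, Finset.mul_sum, Finset.sum_mul]
    symm
    rw [Finset.sum_comm]
    refine Finset.sum_congr rfl fun i _ => ?_
    rw [Finset.sum_comm]
  have hAu : ∑ i, ∑ j, u i * Ac B p i j * u j = ev B (fun x => U x ^ 2) p := by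
    rw [Ac_quad hB hv, ← ev_var hB hv (by fun_prop) 0]
    congr 1; funext x
    congr 1
    rw [ev_sum hB hv _ (fun i => by fun_prop), ← Finset.sum_sub_distrib]
    refine Finset.sum_congr rfl fun i _ => ?_
    rw [ev_smul, mul_sub]
  have hUm : ev B U p = 0 := by
    rw [hU, ev_sum hB hv _ (fun i => by fun_prop)]
    refine Finset.sum_eq_zero fun i _ => ?_
    rw [ev_smul, hcen, mul_zero]
  set f : (ι → ℝ) → ℝ := fun x => ∑ j, ∑ k, T j k * ((x j - a j) * (x k - a k)) with hf
  set f1 : ι → (ι → ℝ) → ℝ := fun i x => 2 * ∑ k, T i k * (x k - a k) with hf1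
  have hfc : Continuous f := by rw [hf]; fun_prop
  have hf1c : ∀ i, Continuous (f1 i) := fun i => by rw [hf1]; fun_prop
  have hfd : ∀ i x, HasDerivAt (fun s : ℝ => f (x + s • uv i)) (f1 i x) 0 := by
    intro i x
    have h1 : ∀ j, HasDerivAt (fun s : ℝ => (x + s • (uv i : ι → ℝ)) j - a j) ((uv i : ι → ℝ) j) 0 := by
      intro j
      have := (((hasDerivAt_id (0:ℝ)).mul_const ((uv i : ι → ℝ) j)).const_add (x j)).sub_const (a j)
      simpa using this
    have h2 : HasDerivAt (fun s : ℝ => f (x + s • uv i)) (∑ j, ∑ k, T j k * ((uv i : ι → ℝ) j * ((x + (0:ℝ) • (uv i : ι → ℝ)) k - a k)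
        + ((x + (0:ℝ) • (uv i : ι → ℝ)) j - a j) * (uv i : ι → ℝ) k)) 0 := by
      rw [hf]
      exact HasDerivAt.fun_sum fun j _ => HasDerivAt.fun_sum fun k _ => ((h1 j).mul (h1 k)).const_mul (T j k)
    refine h2.congr_deriv ?_
    simp only [zero_smul, add_zero, mul_add, Finset.sum_add_distrib, uv]
    rw [Finset.sum_comm (f := fun j k => T j k * ((x j - a j) * (Pi.single i 1 : ι → ℝ) k))]
    simp [Pi.single_apply, hf1, two_mul]
    refine Finset.sum_congr rfl fun j _ => ?_
    rw [hTs]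
  have hgrad : ∑ i, ev B (fun x => f1 i x ^ 2) p ≤ 4 * α * τ := by
    have : ∀ i, ev B (fun x => f1 i x ^ 2) p ≤ 4 * (α * ∑ k, T i k ^ 2) := by
      intro i
      have h1 := hcov (T i)
      rw [Ac_quad hB hv, ← ev_var hB hv (by fun_prop) 0] at h1
      have e : (fun x : ι → ℝ => f1 i x ^ 2) = fun x => 4 * (∑ i_1, T i i_1 * x i_1 - ev B (fun x => ∑ i_1, T i i_1 * x i_1) p) ^ 2 := by
        funext x
        rw [ev_sum hB hv _ (fun i => by fun_prop), ← Finset.sum_sub_distrib]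
        simp only [ev_smul, ← mul_sub]
        rw [hf1]; ring
      rw [e, ev_smul]
      linarith
    refine (Finset.sum_le_sum fun i _ => this i).trans (le_of_eq ?_)
    rw [← Finset.mul_sum, ← Finset.mul_sum]; ring
  have hp := poin hB hconv hv p hs hα hcov hl0 hl hfc hf1c hfd
  have hτe : τ = ev B (fun x => U x * (f x - ev B f p)) p := by
    have e : (fun x => U x * (f x - ev B f p)) = fun x => (U x * f x) + (- ev B f p) * U x := by funext x; ring
    rw [e, ev_add hB hv (f := fun x => U x * f x) (g := fun x => - ev B f p * U x) (hUc.mul hfc) (continuous_const.mul hUc), ev_smul, hUm, mul_zero, add_zero]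
    have e2 : (fun x => U x * f x) = fun x => ∑ j, ∑ k, T j k * (U x * ((x j - a j) * (x k - a k))) := by
      funext x
      rw [hf]; simp only [Finset.mul_sum]
      refine Finset.sum_congr rfl fun j _ => Finset.sum_congr rfl fun k _ => by ring
    rw [e2, ev_sum hB hv _ (fun i => by fun_prop), hτ]
    refine Finset.sum_congr rfl fun j _ => ?_
    rw [ev_sum hB hv _ (fun i => by fun_prop)]
    refine Finset.sum_congr rfl fun k _ => ?_
    rw [ev_smul, ← hTe, pow_two]
  have hcs := ev_cs hB hv (g := fun x => f x - ev B f p) hUc (hfc.sub continuous_const) p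
  rw [ev_var hB hv hfc 0] at hcs
  have hcs' : τ ^ 2 ≤ ev B (fun x => U x ^ 2) p * (ev B (fun x => f x ^ 2) p - ev B f p ^ 2) := by
    rw [hτe]; exact hcs
  rw [e1, hAu]
  have hU0 : 0 ≤ ev B (fun x => U x ^ 2) p := ev_nonneg hB hv (by fun_prop) (fun x _ => sq_nonneg _) p
  rcases hτ0.eq_or_lt with h0 | h0
  · rw [← h0]; nlinarith [mul_nonneg hα hU0]
  · have h1 : l0 * τ ^ 2 ≤ ev B (fun x => U x ^ 2) p * (4 * α * τ) := by
      calc l0 * τ ^ 2 ≤ l0 * (ev B (fun x => U x ^ 2) p * (ev B (fun x => f x ^ 2) p - ev B f p ^ 2)) :=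
            mul_le_mul_of_nonneg_left hcs' hl0
        _ = ev B (fun x => U x ^ 2) p * (l0 * (ev B (fun x => f x ^ 2) p - ev B f p ^ 2)) := by ring
        _ ≤ _ := mul_le_mul_of_nonneg_left (hp.trans hgrad) hU0
    refine le_of_mul_le_mul_right ?_ h0
    nlinarith

/-- generator bound for the trace of a power of the covariance -/
lemma Gen_trace_bound (p : ℝ × (ι → ℝ)) (hs : 0 < p.1) {α l0 : ℝ} (hα : 0 ≤ α)
    (hcov : ∀ v : ι → ℝ, ∑ i, ∑ j, v i * Ac B p i j * v j ≤ α * ∑ i, v i ^ 2) (hl0 : 0 < l0) (hl : l0 ^ 2 * α ≤ p.1) (r : ℕ) :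
    Gen B (fun p => trace (Ac B p ^ (r + 2))) p ≤ ((r + 2 : ℕ) : ℝ) ^ 2 * (4 * α / l0 * (Fintype.card ι + trace (Ac B p ^ (r + 2)))) := by
  rw [GM_trace ((Ac_MN hB hv).pow (r + 2))]
  have hDs : ∀ k, (DM k (Ac B) p)ᵀ = DM k (Ac B) p := by
    intro k; ext i j
    rw [transpose_apply, DM_Ac hB hv, DM_Ac hB hv]
    congr 1; funext x; ring
  have h1 := trace_gen_bound (Ac_MN hB hv) p (Ac_symm p) (Ac_psd hB hv p) hDs (GM_Ac hB hv p) r (r + 2) 0 rfl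
  rw [pow_zero, Matrix.mul_one] at h1
  refine h1.trans (mul_le_mul_of_nonneg_left ?_ (by positivity))
  have h2 := trace_W (Ac_symm p) (Ac_psd hB hv p) (W := ∑ k, DM k (Ac B) p * DM k (Ac B) p) (c := 4 * α / l0) (by positivity)
    (fun u => by
      have := tau_bound hB hconv hv p hs hα hcov hl0.le hl u
      rw [div_mul_eq_mul_div, le_div_iff₀ hl0]; linarith) r
  rw [Finset.mul_sum, trace_sum] at h2
  exact h2
end Heat

end

section
set_option linter.all false
open Filter
open scoped Topology

namespace Heat
open Matrix Disc

lemma gron {Φ Φ' : ℝ → ℝ} (hc : Continuous Φ) {t c : ℝ} (ht : 0 ≤ t)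
    (hd : ∀ s, 0 < s → HasDerivAt Φ (Φ' s) s) (hb : ∀ s, 0 < s → Φ' s ≤ c / Real.sqrt s * Φ s) :
    Φ t ≤ Φ 0 * Real.exp (2 * c * Real.sqrt t) := by
  have hD : ∀ s, 0 < s → HasDerivAt (fun s => Φ s * Real.exp (-(2 * c * Real.sqrt s)))
      (Φ' s * Real.exp (-(2 * c * Real.sqrt s)) + Φ s * (Real.exp (-(2 * c * Real.sqrt s)) * -(2 * c * (1 / (2 * Real.sqrt s))))) s := by
    intro s hs
    exact (hd s hs).mul (((Real.hasDerivAt_sqrt hs.ne').const_mul (2 * c)).neg.exp)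
  have hanti : AntitoneOn (fun s => Φ s * Real.exp (-(2 * c * Real.sqrt s))) (Icc 0 t) := by
    refine antitoneOn_of_deriv_nonpos (convex_Icc 0 t) (by fun_prop) ?_ ?_
    · intro s hs
      rw [interior_Icc] at hs
      exact (hD s hs.1).differentiableAt.differentiableWithinAt
    · intro s hs
      rw [interior_Icc] at hs
      rw [(hD s hs.1).deriv]
      have h1 := hb s hs.1
      have h2 : 0 < Real.sqrt s := Real.sqrt_pos.2 hs.1
      have e : Φ' s * Real.exp (-(2 * c * Real.sqrt s)) + Φ s * (Real.exp (-(2 * c * Real.sqrt s)) * -(2 * c * (1 / (2 * Real.sqrt s))))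
        = Real.exp (-(2 * c * Real.sqrt s)) * (Φ' s - c / Real.sqrt s * Φ s) := by field_simp; ring
      rw [e]
      exact mul_nonpos_of_nonneg_of_nonpos (Real.exp_pos _).le (by linarith)
  have := hanti (left_mem_Icc.2 ht) (right_mem_Icc.2 ht) ht
  simp only [Real.sqrt_zero, mul_zero, neg_zero, Real.exp_zero, mul_one] at this
  rw [Real.exp_neg, ← div_eq_mul_inv, div_le_iff₀ (Real.exp_pos _)] at this
  exact this

lemma gron2 {Φ Φ' : ℝ → ℝ} (hc : Continuous Φ) {t c : ℝ} (ht : 0 ≤ t)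
    (hd : ∀ s, 0 < s → HasDerivAt Φ (Φ' s) s) (hb : ∀ s, 0 < s → s < t → Φ' s ≤ c / Real.sqrt s) :
    Φ t ≤ Φ 0 + 2 * c * Real.sqrt t := by
  have hD : ∀ s, 0 < s → HasDerivAt (fun s => Φ s - 2 * c * Real.sqrt s)
      (Φ' s - (2 * c * (1 / (2 * Real.sqrt s)))) s := by
    intro s hs
    exact (hd s hs).sub ((Real.hasDerivAt_sqrt hs.ne').const_mul (2 * c))
  have hanti : AntitoneOn (fun s => Φ s - 2 * c * Real.sqrt s) (Icc 0 t) := by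
    refine antitoneOn_of_deriv_nonpos (convex_Icc 0 t) (by fun_prop) ?_ ?_
    · intro s hs
      rw [interior_Icc] at hs
      exact (hD s hs.1).differentiableAt.differentiableWithinAt
    · intro s hs
      rw [interior_Icc] at hs
      rw [(hD s hs.1).deriv]
      have h1 := hb s hs.1 hs.2
      have h2 : 0 < Real.sqrt s := Real.sqrt_pos.2 hs.1
      have e : 2 * c * (1 / (2 * Real.sqrt s)) = c / Real.sqrt s := by field_simp
      rw [e]; linarith
  have := hanti (left_mem_Icc.2 ht) (right_mem_Icc.2 ht) ht
  simp only [Real.sqrt_zero, mul_zero, sub_zero] at this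
  linarith

variable {ι : Type*} [Fintype ι] [DecidableEq ι]
variable {B : Set (ι → ℝ)} (hB : IsCompact B) (hconv : Convex ℝ B) (hv : 0 < volume B)
include hB hconv hv

lemma radius (h1 : ∀ i, ∫ x in B, x i = 0) (h2 : ∀ i j, ∫ x in B, x i * x j = if i = j then (volume B).toReal else 0)
    {d : ℕ} (hd : Fintype.card ι = d) (hd1 : 1 ≤ d) {y : ι → ℝ} (hy : y ∈ B) : ∑ i, y i ^ 2 ≤ (4 * d : ℝ) ^ 2 := by
  set v := (volume B).toReal with hvd
  have hvp : 0 < v := ENNReal.toReal_pos hv.ne' hB.measure_lt_top.ne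
  set S := ∑ i, y i ^ 2 with hS
  have hS0 : 0 ≤ S := Finset.sum_nonneg fun i _ => sq_nonneg _
  have hdp : (1:ℝ) ≤ d := by exact_mod_cast hd1
  set c : ℝ := 1 - 1 / (2 * d) with hc
  have hc1 : 1 / (2 * (d:ℝ)) ≤ 1 / 2 := by
    apply one_div_le_one_div_of_le <;> linarith
  have hc0 : 0 < c := by rw [hc]; linarith
  set l : (ι → ℝ) → ℝ := fun x => ∑ i, y i * x i with hl
  have hlc : Continuous l := by rw [hl]; fun_prop
  have hly : l y = S := by simp [hl, hS, pow_two]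
  have ii : ∀ g : (ι → ℝ) → ℝ, Continuous g → IntegrableOn g B := fun g hg => hg.continuousOn.integrableOn_compact hB
  have hl1 : ∫ x in B, l x = 0 := by
    rw [hl, integral_finsetSum _ (fun i _ => ii _ (by fun_prop))]
    simp [integral_const_mul, h1]
  have hl2 : ∫ x in B, l x ^ 2 = S * v := by
    have : (fun x => l x ^ 2) = fun x => ∑ i, ∑ j, (y i * y j) * (x i * x j) := by
      funext x; rw [hl, pow_two, Finset.sum_mul_sum]
      refine Finset.sum_congr rfl fun i _ => Finset.sum_congr rfl fun j _ => by ring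
    rw [this, integral_finsetSum _ (fun i _ => ii _ (by fun_prop))]
    have : ∀ i, ∫ x in B, ∑ j, (y i * y j) * (x i * x j) = y i ^ 2 * v := by
      intro i
      rw [integral_finsetSum _ (fun i _ => ii _ (by fun_prop))]
      simp only [integral_const_mul, h2]
      simp [pow_two]
    simp only [this]
    rw [← Finset.sum_mul]
  set b : ι → ℝ := (1 / (2 * (d:ℝ))) • y with hb
  set G : (ι → ℝ) → ℝ := B.indicator (fun x => l x ^ 2) with hG
  have hGi : Integrable G := (ii _ (by fun_prop)).integrable_indicator hB.measurableSet
  have e1 : ∫ x, G x = S * v := by rw [hG, integral_indicator hB.measurableSet, hl2]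
  have e2 : ∫ x, G (c • x + b) = (c ^ d)⁻¹ * (S * v) := by
    have := Measure.integral_comp_smul (μ := (volume : Measure (ι → ℝ))) (fun x => G (x + b)) c
    rw [this, integral_add_right_eq_self G b, e1]
    simp [hd, abs_of_pos (pow_pos hc0 d)]
  have e3 : ∫ x in B, l (c • x + b) ^ 2 ≤ ∫ x, G (c • x + b) := by
    rw [← integral_indicator hB.measurableSet]
    refine integral_mono ((ii _ (by fun_prop)).integrable_indicator hB.measurableSet) ?_ ?_
    · exact (hGi.comp_add_right b).comp_smul hc0.ne'
    · intro x
      by_cases hx : x ∈ B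
      · rw [indicator_of_mem hx]
        have : c • x + b ∈ B := by
          rw [hb]
          exact hconv hx hy hc0.le (by positivity) (by rw [hc]; ring)
        rw [hG]; beta_reduce; rw [indicator_of_mem this]
      · rw [indicator_of_notMem hx, hG]
        exact indicator_nonneg (fun x _ => sq_nonneg _) _
  have e4 : ∫ x in B, l (c • x + b) ^ 2 = c ^ 2 * (S * v) + (S / (2 * d)) ^ 2 * v := by
    have : (fun x => l (c • x + b) ^ 2) = fun x => c ^ 2 * l x ^ 2 + (2 * c * (S / (2 * d))) * l x + (S / (2 * d)) ^ 2 := by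
      funext x
      have : l (c • x + b) = c * l x + S / (2 * d) := by
        rw [← hly, hl, hb]
        simp only [Pi.add_apply, Pi.smul_apply, smul_eq_mul, mul_add, Finset.sum_add_distrib, Finset.mul_sum, Finset.sum_div]
        congr 1
        · exact Finset.sum_congr rfl fun i _ => by ring
        · exact Finset.sum_congr rfl fun i _ => by ring
      rw [this]; ring
    rw [this, integral_add (ii _ (by fun_prop)) (ii _ (by fun_prop)), integral_add (ii _ (by fun_prop)) (ii _ (by fun_prop)),
      integral_const_mul, integral_const_mul, hl1, hl2]
    simp [Measure.real, hvd, mul_comm]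
  have hcd : 1 / 2 ≤ c ^ d := by
    have := one_add_mul_le_pow (a := -(1 / (2 * (d:ℝ)))) (by linarith) d
    have e : 1 + (d:ℝ) * -(1 / (2 * (d:ℝ))) = 1 / 2 := by field_simp; norm_num
    rw [e] at this
    rw [hc, sub_eq_add_neg]; exact this
  rw [e4, e2] at e3
  have h5 : (c ^ d)⁻¹ * (S * v) ≤ 2 * (S * v) := by
    refine mul_le_mul_of_nonneg_right ?_ (by positivity)
    rw [inv_le_comm₀ (by positivity) (by norm_num)]; linarith
  have h6 : (S / (2 * d)) ^ 2 * v ≤ 2 * S * v := by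
    have : 0 ≤ c ^ 2 * (S * v) := by positivity
    linarith
  have h7 := le_of_mul_le_mul_right h6 hvp
  rcases hS0.eq_or_lt with h0 | h0
  · rw [← h0]; positivity
  · rw [div_pow, div_le_iff₀ (by positivity)] at h7
    have : S * S ≤ S * (4 * d)^2 := by nlinarith
    exact le_of_mul_le_mul_left this h0
end Heat

end

section
set_option linter.all false
open Filter
open scoped Topology

namespace Heat
open Matrix Disc
variable {ι : Type*} [Fintype ι] [DecidableEq ι]

def xf (B : Set (ι → ℝ)) (r : ℕ) (p : ℝ × (ι → ℝ)) : ℝ := Fintype.card ι + trace (Ac B p ^ (r + 2))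
def KK (r : ℕ) : ℝ := 20 ^ (2 * (r + 2))
def phf (B : Set (ι → ℝ)) (r : ℕ) (p : ℝ × (ι → ℝ)) : ℝ := 1 - KK r * (KK r + xf B r p)⁻¹

variable {B : Set (ι → ℝ)} (hB : IsCompact B) (hconv : Convex ℝ B) (hv : 0 < volume B)

omit [DecidableEq ι] in
lemma KK_pos (r : ℕ) : 0 < KK r := by unfold KK; positivity

include hB hv
lemma xf_nonneg (r : ℕ) (p) : 0 ≤ xf B r p := by
  have := trace_pow_nonneg (Ac_symm (B := B) p) (Ac_psd hB hv p) (r + 2)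
  unfold xf; positivity

lemma tr_nice (r : ℕ) : Nice (fun p => trace (Ac B p ^ (r + 2))) := by
  unfold trace
  refine Nice.sum _ fun i => ?_
  exact ((Ac_MN hB hv).pow (r + 2)) i i

lemma xf_nice (r : ℕ) : Nice (xf B r) := (Nice.const _).add (tr_nice hB hv r)

lemma inv_eg (r : ℕ) : EG (fun p => (KK r + xf B r p)⁻¹) := by
  intro T
  refine ⟨(KK r)⁻¹, 0, (inv_pos.2 (KK_pos r)).le, le_rfl, fun p _ => ?_⟩
  have h0 := xf_nonneg hB hv r p
  have hK := KK_pos r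
  rw [abs_of_pos (by positivity)]
  simp only [zero_mul, Real.exp_zero, mul_one]
  exact inv_anti₀ hK (by linarith)

lemma hh_nice (r : ℕ) : Nice (fun p => KK r + xf B r p) := (Nice.const _).add (xf_nice hB hv r)
lemma hh_pos (r : ℕ) (p) : 0 < KK r + xf B r p := by
  have h0 := xf_nonneg hB hv r p
  have hK := KK_pos r
  linarith

lemma hi_nice (r : ℕ) : Nice (fun p => (KK r + xf B r p)⁻¹) :=
  (hh_nice hB hv r).inv (fun p => (hh_pos hB hv r p).ne') (inv_eg hB hv r)

lemma phf_nice (r : ℕ) : Nice (phf B r) := (Nice.const _).sub ((Nice.const _).mul (hi_nice hB hv r))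

lemma phf_eq (r : ℕ) (p) : phf B r p = xf B r p / (KK r + xf B r p) := by
  have := (hh_pos hB hv r p).ne'
  unfold phf; field_simp; ring

lemma phf_nonneg (r : ℕ) (p) : 0 ≤ phf B r p := by
  rw [phf_eq hB hv]; exact div_nonneg (xf_nonneg hB hv r p) (hh_pos hB hv r p).le

/-- the working bound for the covariance -/
def wf (B : Set (ι → ℝ)) (r : ℕ) (p : ℝ × (ι → ℝ)) : ℝ := Real.sqrt (1 + xf B r p / KK r)

lemma wf_sq (r : ℕ) (p) : wf B r p ^ 2 = 1 + xf B r p / KK r := by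
  have h0 := xf_nonneg hB hv r p
  have hK := KK_pos r
  exact Real.sq_sqrt (by positivity)

lemma wf_one (r : ℕ) (p) : 1 ≤ wf B r p := by
  have h0 := xf_nonneg hB hv r p
  have hK := KK_pos r
  unfold wf
  rw [Real.one_le_sqrt]
  have : 0 ≤ xf B r p / KK r := by positivity
  linarith

lemma cov_wf (r : ℕ) (p) (u : ι → ℝ) :
    ∑ i, ∑ j, u i * Ac B p i j * u j ≤ (400 * wf B r p) * ∑ i, u i ^ 2 := by
  have hw := wf_one hB hv r p
  refine norm_le_of_trace (Ac_symm p) (Ac_psd hB hv p) (q := r + 2) (by omega) (by positivity) ?_ u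
  have h1 : wf B r p ^ 2 ≤ wf B r p ^ (r + 2) := pow_le_pow_right₀ hw (by omega)
  have hK := KK_pos r
  have e : (400 * wf B r p) ^ (r + 2) = KK r * wf B r p ^ (r + 2) := by
    rw [mul_pow, KK, pow_mul]; norm_num
  rw [e]
  calc trace (Ac B p ^ (r + 2)) ≤ KK r + xf B r p := by
        unfold xf
        have : (0:ℝ) ≤ Fintype.card ι := by positivity
        linarith
    _ = KK r * wf B r p ^ 2 := by rw [wf_sq hB hv]; field_simp
    _ ≤ _ := mul_le_mul_of_nonneg_left h1 hK.le

lemma cov_R {R : ℝ} (hR : ∀ x ∈ B, ∑ i, x i ^ 2 ≤ R ^ 2) (p) (u : ι → ℝ) :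
    ∑ i, ∑ j, u i * Ac B p i j * u j ≤ R ^ 2 * ∑ i, u i ^ 2 := by
  rw [Ac_quad hB hv]
  have : ev B (fun x => (∑ i, u i * x i) ^ 2) p ≤ ev B (fun _ => R ^ 2 * ∑ i, u i ^ 2) p := by
    refine ev_mono hB hv (by fun_prop) continuous_const (fun x hx => ?_) p
    refine (Finset.sum_mul_sq_le_sq_mul_sq _ _ _).trans ?_
    rw [mul_comm]
    exact mul_le_mul_of_nonneg_right (hR x hx) (Finset.sum_nonneg fun i _ => sq_nonneg _)
  rw [ev_const hB hv] at this
  have h2 := sq_nonneg (ev B (fun x => ∑ i, u i * x i) p)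
  linarith

lemma Gen_nice {G : ℝ × (ι → ℝ) → ℝ} (hG : Nice G) : Nice (Gen B G) :=
  ((hG.dv et).add ((Nice.const (1/2)).mul (Nice.sum _ fun i => (hG.dv (ex i)).dv (ex i)))).add
    (Nice.sum _ fun i => (ev_nice hB hv (by fun_prop)).mul (hG.dv (ex i)))

include hconv
lemma Gen_phf (r : ℕ) (p : ℝ × (ι → ℝ)) (hs : 0 < p.1) :
    Gen B (phf B r) p ≤ (32000 * ((r + 2 : ℕ) : ℝ) ^ 2) / Real.sqrt p.1 * phf B r p := by
  have hw := wf_one hB hv r p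
  have hK := KK_pos r
  have hh := hh_pos hB hv r p
  have hx := xf_nonneg hB hv r p
  have hss : 0 < Real.sqrt p.1 := Real.sqrt_pos.2 hs
  have h1 := Gen_trace_bound hB hconv hv p hs (α := 400 * wf B r p) (l0 := Real.sqrt p.1 / (20 * wf B r p)) (by positivity)
    (cov_wf hB hv r p) (by positivity) (by
      rw [div_pow, Real.sq_sqrt hs.le, div_mul_eq_mul_div, div_le_iff₀ (by positivity)]
      nlinarith [mul_pos hs (lt_of_lt_of_le one_pos hw)]) r
  have e0 : Gen B (phf B r) p = - (KK r * Gen B (fun p => (KK r + xf B r p)⁻¹) p) := by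
    unfold phf
    rw [Gen_sub (Nice.const 1) ((Nice.const (KK r)).mul (hi_nice hB hv r)), Gen_const, Gen_smul _ (hi_nice hB hv r)]
    ring
  have h2 := Gen_inv_le (B := B) (hh_nice hB hv r) (hh_pos hB hv r) (inv_eg hB hv r) p
  have e1 : Gen B (fun p => KK r + xf B r p) p = Gen B (fun p => trace (Ac B p ^ (r + 2))) p := by
    rw [Gen_add (Nice.const _) (xf_nice hB hv r), Gen_const, zero_add]
    unfold xf
    rw [Gen_add (Nice.const _) (tr_nice hB hv r), Gen_const, zero_add]
  rw [e1] at h2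
  have e2 : 4 * (400 * wf B r p) / (Real.sqrt p.1 / (20 * wf B r p)) = 32000 * (KK r + xf B r p) / (KK r * Real.sqrt p.1) := by
    have : 4 * (400 * wf B r p) / (Real.sqrt p.1 / (20 * wf B r p)) = 32000 * wf B r p ^ 2 / Real.sqrt p.1 := by
      field_simp; norm_num
    rw [this, wf_sq hB hv]; field_simp
  rw [e2] at h1
  rw [e0, phf_eq hB hv]
  change Gen B (fun p => trace (Ac B p ^ (r + 2))) p ≤ ((r + 2 : ℕ) : ℝ) ^ 2 * (32000 * (KK r + xf B r p) / (KK r * Real.sqrt p.1) * xf B r p) at h1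
  have h3 : 0 ≤ KK r * ((KK r + xf B r p)⁻¹) ^ 2 := by positivity
  have h4 := mul_le_mul_of_nonneg_left h1 h3
  have h5 := mul_le_mul_of_nonneg_left h2 hK.le
  have e3 : KK r * ((KK r + xf B r p)⁻¹) ^ 2 * (((r + 2 : ℕ) : ℝ) ^ 2 * (32000 * (KK r + xf B r p) / (KK r * Real.sqrt p.1) * xf B r p))
     = (32000 * ((r + 2 : ℕ) : ℝ) ^ 2) / Real.sqrt p.1 * (xf B r p / (KK r + xf B r p)) := by
    field_simp
  rw [e3] at h4
  linarith

lemma Psi_bound (r : ℕ) {t : ℝ} (ht : 0 ≤ t) :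
    Ph (fun p => F B one' p * phf B r p) t ≤ Ph (fun p => F B one' p * phf B r p) 0
      * Real.exp (2 * (32000 * ((r + 2 : ℕ) : ℝ) ^ 2) * Real.sqrt t) := by
  have hN := (F_nice hB (g := one') continuous_const).mul (phf_nice hB hv r)
  refine gron (Ph_cont hN.cont hN.eg) ht (fun s hs => E_hasDeriv hB hv (phf_nice hB hv r) hs) (fun s hs => ?_)
  unfold Ph
  rw [← integral_const_mul]
  have hG := (F_nice hB (g := one') continuous_const).mul (Gen_nice hB hv (phf_nice hB hv r))
  refine integral_mono (hp_int hG.cont hG.eg s) ((hp_int hN.cont hN.eg s).const_mul _) (fun z => ?_)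
  beta_reduce
  have h1 := Gen_phf hB hconv hv r (hp s z) hs
  have h2 := mul_le_mul_of_nonneg_left h1 (mul_pos (rho_pos z) (F_one_pos hB hv (hp s z))).le
  have e : (hp s z).1 = s := rfl
  rw [e] at h2
  linarith

/-- pointwise variance and gradient bound -/
lemma pt_bound (r : ℕ) {R : ℝ} (hR0 : 0 < R) (hR : ∀ x ∈ B, ∑ i, x i ^ 2 ≤ R ^ 2) (p : ℝ × (ι → ℝ)) (hs : 0 < p.1)
    {f : (ι → ℝ) → ℝ} {f1 : ι → (ι → ℝ) → ℝ} (hf : Continuous f) (hf1 : ∀ i, Continuous (f1 i))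
    (hfd : ∀ i x, HasDerivAt (fun s : ℝ => f (x + s • uv i)) (f1 i x) 0) (hf2 : ∀ x, ∑ i, f1 i x ^ 2 ≤ 1) :
    ev B (fun x => f x ^ 2) p - (ev B f p) ^ 2 ≤ (40 + 2 * R * phf B r p) / Real.sqrt p.1 ∧
    ∑ i, Dv (ex i) (ev B f) p ^ 2 ≤ (16000 + 2 * R ^ 3 * phf B r p) / Real.sqrt p.1 := by
  have hw := wf_one hB hv r p
  have hK := KK_pos r
  have hh := hh_pos hB hv r p
  have hx := xf_nonneg hB hv r p
  have hph := phf_nonneg hB hv r p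
  have hss : 0 < Real.sqrt p.1 := Real.sqrt_pos.2 hs
  have hgr : ∑ i, ev B (fun x => f1 i x ^ 2) p ≤ 1 := by
    rw [← ev_sum hB hv _ (fun i => by have := hf1 i; fun_prop)]
    refine (ev_mono hB hv (continuous_finsetSum _ fun i _ => (hf1 i).pow 2) continuous_const (fun x _ => hf2 x) p).trans (ev_one hB hv p).le
  set V := ev B (fun x => f x ^ 2) p - (ev B f p) ^ 2 with hV
  have hV0 : 0 ≤ V := by
    rw [hV, ← ev_var hB hv hf 0]; exact ev_nonneg hB hv (by fun_prop) (fun x _ => sq_nonneg _) p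
  set D := ∑ i, Dv (ex i) (ev B f) p ^ 2 with hD
  have hD0 : 0 ≤ D := Finset.sum_nonneg fun i _ => sq_nonneg _
  have key : ∀ α : ℝ, 0 ≤ α → (∀ u : ι → ℝ, ∑ i, ∑ j, u i * Ac B p i j * u j ≤ α * ∑ i, u i ^ 2) → D ≤ α * V := by
    intro α hα hc
    set u : ι → ℝ := fun i => Dv (ex i) (ev B f) p with hu
    have h1 : D = ev B (fun x => (∑ i, u i * x i - ev B (fun x => ∑ i, u i * x i) p) * (f x - ev B f p)) p := by
      have e1 : (fun x => (∑ i, u i * x i - ev B (fun x => ∑ i, u i * x i) p) * (f x - ev B f p))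
          = fun x => (∑ i, u i * (f x * x i)) - ((ev B f p) * (∑ i, u i * x i) + (ev B (fun x => ∑ i, u i * x i) p) * (f x - ev B f p)) := by
        funext x
        have : ∑ i, u i * (f x * x i) = f x * ∑ i, u i * x i := by
          rw [Finset.mul_sum]; exact Finset.sum_congr rfl fun i _ => by ring
        rw [this]; ring
      rw [e1, ev_sub hB hv (by fun_prop) (by fun_prop), ev_add hB hv (by fun_prop) (by fun_prop), ev_smul, ev_smul,
        ev_sub hB hv hf continuous_const, ev_const hB hv, sub_self, mul_zero, add_zero,
        ev_sum hB hv _ (fun i => by fun_prop), ev_sum hB hv _ (fun i => by fun_prop), Finset.mul_sum, ← Finset.sum_sub_distrib, hD]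
      refine Finset.sum_congr rfl fun i _ => ?_
      rw [ev_smul, ev_smul, pow_two]
      conv_lhs => rw [Dv_ev hB hv hf, ell_ex]
      rw [hu]; beta_reduce
      rw [Dv_ev hB hv hf, ell_ex]; ring
    have h2 := ev_cs hB hv (f := fun x => ∑ i, u i * x i - ev B (fun x => ∑ i, u i * x i) p) (g := fun x => f x - ev B f p)
      (by fun_prop) (by fun_prop) p
    rw [← h1, ev_var hB hv hf 0, ev_var hB hv (by fun_prop) 0, ← Ac_quad hB hv] at h2
    have h3 : D ^ 2 ≤ (α * D) * V := h2.trans (mul_le_mul_of_nonneg_right (hc u) hV0)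
    rcases hD0.eq_or_lt with h0 | h0
    · rw [← h0]; positivity
    · refine le_of_mul_le_mul_left ?_ h0
      nlinarith
  rcases le_or_gt (xf B r p) (KK r) with hle | hgt
  · have hw2 : wf B r p ^ 2 ≤ 2 := by
      rw [wf_sq hB hv]
      have : xf B r p / KK r ≤ 1 := (div_le_one hK).2 hle
      linarith
    have hw3 : wf B r p ≤ 2 := by nlinarith
    have h1 := poin hB hconv hv p hs (α := 400 * wf B r p) (l0 := Real.sqrt p.1 / (20 * wf B r p)) (by positivity)
      (cov_wf hB hv r p) (by positivity) (by
        rw [div_pow, Real.sq_sqrt hs.le, div_mul_eq_mul_div, div_le_iff₀ (by positivity)]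
        nlinarith [mul_pos hs (lt_of_lt_of_le one_pos hw)]) hf hf1 hfd
    have h2 : V ≤ 20 * wf B r p / Real.sqrt p.1 := by
      have := h1.trans hgr
      rw [div_mul_eq_mul_div, div_le_one (by positivity)] at this
      rw [le_div_iff₀ hss]; linarith
    refine ⟨h2.trans ?_, ?_⟩
    · gcongr
      have : 0 ≤ 2 * R * phf B r p := by positivity
      linarith
    · refine (key _ (by positivity) (cov_wf hB hv r p)).trans ?_
      refine (mul_le_mul_of_nonneg_left h2 (by positivity)).trans ?_
      rw [← mul_div_assoc]
      gcongr
      have : 0 ≤ 2 * R ^ 3 * phf B r p := by positivity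
      nlinarith
  · have hph2 : 1 / 2 ≤ phf B r p := by
      rw [phf_eq hB hv, le_div_iff₀ hh]; linarith
    have h1 := poin hB hconv hv p hs (α := R ^ 2) (l0 := Real.sqrt p.1 / R) (by positivity)
      (cov_R hB hv hR p) (by positivity) (by
        rw [div_pow, Real.sq_sqrt hs.le, div_mul_cancel₀ _ (by positivity)]) hf hf1 hfd
    have h2 : V ≤ R / Real.sqrt p.1 := by
      have := h1.trans hgr
      rw [div_mul_eq_mul_div, div_le_one (by positivity)] at this
      rw [le_div_iff₀ hss]; linarith
    refine ⟨h2.trans ?_, ?_⟩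
    · gcongr
      nlinarith
    · refine (key _ (by positivity) (cov_R hB hv hR p)).trans ?_
      refine (mul_le_mul_of_nonneg_left h2 (by positivity)).trans ?_
      rw [← mul_div_assoc]
      gcongr
      nlinarith [pow_pos hR0 3]
end Heat

end

section
set_option linter.all false
open Filter
open scoped Topology

namespace Heat
open Matrix Disc
variable {ι : Type*} [Fintype ι] [DecidableEq ι]
variable {B : Set (ι → ℝ)} (hB : IsCompact B) (hconv : Convex ℝ B) (hv : 0 < volume B)

include hB hv
lemma Ph_conserve {G : ℝ × (ι → ℝ) → ℝ} (hG : Nice G) (h0 : ∀ p, Gen B G p = 0) {s : ℝ} (hs : 0 ≤ s) :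
    Ph (fun p => F B one' p * G p) s = Ph (fun p => F B one' p * G p) 0 := by
  have hN := (F_nice hB (g := one') continuous_const).mul hG
  have hd : ∀ s, 0 < s → HasDerivAt (Ph (fun p => F B one' p * G p)) 0 s := by
    intro s hs
    have := E_hasDeriv hB hv hG hs
    simpa [h0] using this
  have h1 := gron2 (Ph_cont hN.cont hN.eg) (Φ' := fun _ => 0) (c := 0) hs hd (by simp)
  have h2 := gron2 (Ph_cont hN.cont hN.eg).neg (Φ' := fun _ => 0) (c := 0) hs (fun s hs => by simpa using (hd s hs).neg) (by simp)
  simp only [Pi.neg_apply, mul_zero, zero_mul, add_zero] at h1 h2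
  linarith

lemma ev_zero (g : (ι → ℝ) → ℝ) : ev B g (0, 0) = (∫ x in B, g x) / (volume B).toReal := by
  unfold ev F wt
  simp [Measure.real, div_eq_mul_inv]

include hconv
theorem MT_q (h1 : ∀ i, ∫ x in B, x i = 0) (h2 : ∀ i j, ∫ x in B, x i * x j = if i = j then (volume B).toReal else 0)
    (r : ℕ) (hd1 : 1 ≤ Fintype.card ι) (hdq : Fintype.card ι ≤ 2 ^ (r + 2))
    {f : (ι → ℝ) → ℝ} {f1 : ι → (ι → ℝ) → ℝ} (hf : Continuous f) (hf1 : ∀ i, Continuous (f1 i))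
    (hfd : ∀ i x, HasDerivAt (fun s : ℝ => f (x + s • uv i)) (f1 i x) 0) (hf2 : ∀ x, ∑ i, f1 i x ^ 2 ≤ 1) :
    (∫ x in B, f x ^ 2) / (volume B).toReal - ((∫ x in B, f x) / (volume B).toReal) ^ 2 ≤ 3000000 * ((r + 2 : ℕ) : ℝ) := by
  set v := (volume B).toReal with hvd
  have hvp : 0 < v := ENNReal.toReal_pos hv.ne' hB.measure_lt_top.ne
  set d : ℝ := (Fintype.card ι : ℝ) with hdd
  have hd : 1 ≤ d := by rw [hdd]; exact_mod_cast hd1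
  set q : ℝ := ((r + 2 : ℕ) : ℝ) with hq
  have hq2 : 2 ≤ q := by rw [hq]; push_cast; linarith [Nat.cast_nonneg (α := ℝ) r]
  have hdq' : d ≤ 2 ^ (r + 2) := by rw [hdd]; exact_mod_cast hdq
  set R : ℝ := 4 * d with hRd
  have hR : ∀ x ∈ B, ∑ i, x i ^ 2 ≤ R ^ 2 := fun x hx => radius hB hconv hv h1 h2 rfl hd1 hx
  have hR0 : 0 < R := by positivity
  have hR1 : 1 ≤ R := by linarith
  have hK := KK_pos r
  -- one-function
  have hN1 : Nice (fun p : ℝ × (ι → ℝ) => F B one' p * 1) := (F_nice hB (g := one') continuous_const).mul (Nice.const 1)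
  set N := Ph (fun p => F B one' p * 1) 0 with hN
  have hNs : ∀ s, 0 ≤ s → Ph (fun p => F B one' p * 1) s = N := fun s hs =>
    Ph_conserve hB hv (Nice.const 1) (fun p => Gen_const 1 p) hs
  have hN0 : 0 < N := by
    rw [hN]; unfold Ph
    have hc : Continuous (fun z => rho z * (F B one' (hp 0 z) * 1) : (ι → ℝ) → ℝ) := rho_cont.mul (hN1.cont.comp (hp_cont' 0))
    have hpos : ∀ z : ι → ℝ, 0 < rho z * (F B one' (hp 0 z) * 1) := fun z => mul_pos (rho_pos z) (by rw [mul_one]; exact F_one_pos hB hv _)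
    rw [integral_pos_iff_support_of_nonneg (fun z => (hpos z).le) (hp_int hN1.cont hN1.eg 0)]
    have : Function.support (fun z => rho z * (F B one' (hp 0 z) * 1) : (ι → ℝ) → ℝ) = univ := by
      ext z; simp only [Function.mem_support, mem_univ, iff_true]; exact (hpos z).ne'
    rw [this]
    exact isOpen_univ.measure_pos _ univ_nonempty
  have hPz : ∀ G : ℝ × (ι → ℝ) → ℝ, Ph (fun p => F B one' p * G p) 0 = N * G (0, 0) := by
    intro G
    rw [hN, Ph_zero, Ph_zero]; ring
  -- phi at zero
  have hph0 : phf B r (0, 0) ≤ 2 * d / KK r := by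
    have hA : Ac B (0, 0) = 1 := by
      ext i j
      simp only [Ac, Matrix.of_apply]
      rw [ev_zero hB hv, ev_zero hB hv, ev_zero hB hv, h1, h1, h2, Matrix.one_apply]
      split_ifs
      · rw [← hvd]; field_simp; simp
      · simp
    have hx : xf B r (0, 0) = 2 * d := by
      unfold xf; rw [hA, one_pow, Matrix.trace_one, hdd]; ring
    rw [phf_eq hB hv, hx]
    gcongr
    linarith
  set st : ℝ := 1 / (64000 * q) with hst
  have hst0 : 0 < st := by positivity
  set t : ℝ := st ^ 2 with ht
  have ht0 : 0 < t := by positivity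
  have hsq : Real.sqrt t = st := Real.sqrt_sq hst0.le
  set Ψ := Ph (fun p => F B one' p * phf B r p) with hΨ
  have hratio : R ^ 3 * (2 * d / KK r * 3 ^ (r + 2)) ≤ 2 := by
    have e : R ^ 3 * (2 * d / KK r * 3 ^ (r + 2)) = 2 * (64 * d ^ 4 * 3 ^ (r + 2)) / KK r := by rw [hRd]; ring
    rw [e, div_le_iff₀ hK]
    have h4 : d ^ 4 ≤ 16 ^ (r + 2) := by
      calc d ^ 4 ≤ ((2:ℝ) ^ (r + 2)) ^ 4 := by gcongr
        _ = 16 ^ (r + 2) := by rw [← pow_mul, mul_comm, pow_mul]; norm_num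
    have h8 : (64:ℝ) ≤ 8 ^ (r + 2) := by
      calc (64:ℝ) = 8 ^ 2 := by norm_num
        _ ≤ 8 ^ (r + 2) := pow_le_pow_right₀ (by norm_num) (by omega)
    have : 64 * d ^ 4 * 3 ^ (r + 2) ≤ KK r := by
      calc 64 * d ^ 4 * 3 ^ (r + 2) ≤ 8 ^ (r + 2) * 16 ^ (r + 2) * 3 ^ (r + 2) := by gcongr
        _ = 384 ^ (r + 2) := by rw [← mul_pow, ← mul_pow]; norm_num
        _ ≤ 400 ^ (r + 2) := by gcongr; norm_num
        _ = KK r := by rw [KK, pow_mul]; norm_num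
    linarith
  have hratio1 : R * (2 * d / KK r * 3 ^ (r + 2)) ≤ 2 := by
    refine le_trans ?_ hratio
    gcongr
    exact le_self_pow₀ hR1 (by norm_num)
  have hΨb : ∀ s, 0 ≤ s → s ≤ t → Ψ s ≤ N * (2 * d / KK r * 3 ^ (r + 2)) := by
    intro s hs0 hst'
    have h := Psi_bound hB hconv hv r hs0
    rw [hPz] at h
    have hsq' : Real.sqrt s ≤ st := by rw [← hsq]; exact Real.sqrt_le_sqrt hst'
    have hE : Real.exp (2 * (32000 * q ^ 2) * Real.sqrt s) ≤ 3 ^ (r + 2) := by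
      calc Real.exp (2 * (32000 * q ^ 2) * Real.sqrt s) ≤ Real.exp ((r + 2 : ℕ) * 1) := by
            rw [Real.exp_le_exp]
            calc 2 * (32000 * q ^ 2) * Real.sqrt s ≤ 2 * (32000 * q ^ 2) * st := by gcongr
              _ = q := by rw [hst]; field_simp; norm_num
              _ = _ := by rw [hq, mul_one]
        _ = Real.exp 1 ^ (r + 2) := by rw [Real.exp_nat_mul]
        _ ≤ 3 ^ (r + 2) := by gcongr; exact Real.exp_one_lt_three.le
    refine h.trans ?_
    have := phf_nonneg hB hv r (0, 0)
    calc N * phf B r (0, 0) * Real.exp (2 * (32000 * q ^ 2) * Real.sqrt s)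
        ≤ N * (2 * d / KK r) * 3 ^ (r + 2) := by gcongr
      _ = _ := by ring
  -- general integral comparison
  have cmp : ∀ (G : ℝ × (ι → ℝ) → ℝ), Nice G → ∀ a b : ℝ, ∀ s, 0 < s → (∀ z, G (hp s z) ≤ (a + b * phf B r (hp s z)) / Real.sqrt s) →
      Ph (fun p => F B one' p * G p) s ≤ (a * N + b * Ψ s) / Real.sqrt s := by
    intro G hG a b s hs hb
    have hNG := (F_nice hB (g := one') continuous_const).mul hG
    have hNφ := (F_nice hB (g := one') continuous_const).mul (phf_nice hB hv r)
    have i1 := hp_int hN1.cont hN1.eg s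
    have i2 := hp_int hNφ.cont hNφ.eg s
    rw [← hNs s hs.le, hΨ]
    unfold Ph
    rw [← integral_const_mul, ← integral_const_mul, ← integral_add (i1.const_mul a) (i2.const_mul b), ← integral_div]
    refine integral_mono (hp_int hNG.cont hNG.eg s) (((i1.const_mul a).add (i2.const_mul b)).div_const _) (fun z => ?_)
    beta_reduce
    have h2 := mul_le_mul_of_nonneg_left (hb z) (mul_pos (rho_pos z) (F_one_pos hB hv (hp s z))).le
    calc _ = rho z * F B one' (hp s z) * G (hp s z) := by ring
      _ ≤ _ := h2
      _ = _ := by ring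
  have hen := ev_nice hB hv hf
  have hee : Nice (fun p => ev B f p * ev B f p) := hen.mul hen
  have hGee : ∀ p, Gen B (fun p => ev B f p * ev B f p) p = ∑ i, Dv (ex i) (ev B f) p ^ 2 := by
    intro p
    rw [Gen_mul hen hen, Gen_ev hB hv hf]; simp [pow_two]
  have hpt := fun (s : ℝ) (hs : 0 < s) (z : ι → ℝ) => pt_bound hB hconv hv r hR0 hR (hp s z) hs hf hf1 hfd hf2
  have hNe := (F_nice hB (g := one') continuous_const).mul hee
  have hV := gron2 (Ph_cont hNe.cont hNe.eg) (t := t) (c := 16004 * N) ht0.le (fun s hs => E_hasDeriv hB hv hee hs) (fun s hs hst' => by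
    have hc := cmp (Gen B (fun p => ev B f p * ev B f p)) (Gen_nice hB hv hee) 16000 (2 * R ^ 3) s hs (fun z => by
      rw [hGee]; exact (hpt s hs z).2)
    refine hc.trans ?_
    have h := hΨb s hs.le hst'.le
    gcongr
    have : R ^ 3 * Ψ s ≤ N * 2 := by
      calc R ^ 3 * Ψ s ≤ R ^ 3 * (N * (2 * d / KK r * 3 ^ (r + 2))) := by gcongr
        _ = N * (R ^ 3 * (2 * d / KK r * 3 ^ (r + 2))) := by ring
        _ ≤ N * 2 := by gcongr
    linarith)
  rw [hPz, hsq] at hV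
  have hf2n := ev_nice hB hv (hf.pow 2)
  have hf2n' : Nice (ev B (fun x => f x ^ 2)) := hf2n
  have hcons := Ph_conserve hB hv hf2n' (fun p => Gen_ev hB hv (hf.pow 2) p) ht0.le
  rw [hPz] at hcons
  have hvar := cmp (fun p => ev B (fun x => f x ^ 2) p - ev B f p * ev B f p) (hf2n'.sub hee) 40 (2 * R) t ht0 (fun z => by
    have := (hpt t ht0 z).1
    rw [pow_two (ev B f _)] at this
    exact this)
  have hsplit : Ph (fun p => F B one' p * (ev B (fun x => f x ^ 2) p - ev B f p * ev B f p)) t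
      = Ph (fun p => F B one' p * ev B (fun x => f x ^ 2) p) t - Ph (fun p => F B one' p * (ev B f p * ev B f p)) t := by
    have hNg := (F_nice hB (g := one') continuous_const).mul hf2n'
    unfold Ph
    rw [← integral_sub (hp_int hNg.cont hNg.eg t) (hp_int hNe.cont hNe.eg t)]
    congr 1; funext z; ring
  rw [hsplit, hcons, hsq] at hvar
  have hΨt : R * Ψ t ≤ N * 2 := by
    calc R * Ψ t ≤ R * (N * (2 * d / KK r * 3 ^ (r + 2))) := by gcongr; exact hΨb t ht0.le le_rfl
      _ = N * (R * (2 * d / KK r * 3 ^ (r + 2))) := by ring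
      _ ≤ N * 2 := by gcongr
  have hvar2 : N * ev B (fun x => f x ^ 2) (0, 0) - Ph (fun p => F B one' p * (ev B f p * ev B f p)) t ≤ 44 * N / st := by
    refine hvar.trans ?_
    gcongr
    linarith
  rw [ev_zero hB hv] at hvar2 hV
  have e1 : 44 * N / st = N * (44 * (64000 * q)) := by rw [hst]; field_simp
  rw [e1] at hvar2
  have e2 : st ≤ 1 / 64000 := by
    rw [hst]; apply one_div_le_one_div_of_le <;> linarith
  have e3 : 2 * (16004 * N) * st ≤ N * 1 := by nlinarith
  refine le_of_mul_le_mul_left ?_ hN0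
  nlinarith

theorem MT (h1 : ∀ i, ∫ x in B, x i = 0) (h2 : ∀ i j, ∫ x in B, x i * x j = if i = j then (volume B).toReal else 0)
    (hd : 2 ≤ Fintype.card ι)
    {f : (ι → ℝ) → ℝ} {f1 : ι → (ι → ℝ) → ℝ} (hf : Continuous f) (hf1 : ∀ i, Continuous (f1 i))
    (hfd : ∀ i x, HasDerivAt (fun s : ℝ => f (x + s • uv i)) (f1 i x) 0) (hf2 : ∀ x, ∑ i, f1 i x ^ 2 ≤ 1) :
    (∫ x in B, f x ^ 2) / (volume B).toReal - ((∫ x in B, f x) / (volume B).toReal) ^ 2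
      ≤ 15000000 * Real.log (Fintype.card ι) := by
  set d := Fintype.card ι with hdd
  have hq := MT_q hB hconv hv h1 h2 (Nat.log 2 d) (by omega)
    ((Nat.lt_pow_succ_log_self (by norm_num) d).le.trans (Nat.pow_le_pow_right (by norm_num) (by omega))) hf hf1 hfd hf2
  refine hq.trans ?_
  have hl2 : (0.69:ℝ) < Real.log 2 := lt_trans (by norm_num) Real.log_two_gt_d9
  have h3 : Real.log 2 ≤ Real.log d := Real.log_le_log (by norm_num) (by exact_mod_cast hd)
  have h4 : (Nat.log 2 d : ℝ) * Real.log 2 ≤ Real.log d := by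
    rw [← Real.log_pow]
    refine Real.log_le_log (by positivity) ?_
    exact_mod_cast Nat.pow_log_le_self 2 (by omega)
  push_cast
  have h5 : (0:ℝ) ≤ Nat.log 2 d := by positivity
  nlinarith
end Heat

end

section
set_option linter.all false
open Filter
open scoped Topology

namespace Poly
open Disc
variable {n : ℕ} {κ : Type} [Fintype κ]

def dt (a x : Fin n → ℝ) : ℝ := ∑ k, a k * x k
def Pol (ν : κ → Fin n → ℝ) (b : κ → ℝ) (t : ℝ) : Set (Fin n → ℝ) := {x | ∀ i, dt (ν i) x ≤ b i + t}

lemma dt_cont (a : Fin n → ℝ) : Continuous (dt a) := by unfold dt; fun_prop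
lemma dt_comb (a x y : Fin n → ℝ) (s t : ℝ) : dt a (s • x + t • y) = s * dt a x + t * dt a y := by
  unfold dt; simp [mul_add, Finset.sum_add_distrib, Finset.mul_sum]
  congr 1 <;> exact Finset.sum_congr rfl fun i _ => by ring

lemma Pol_closed (ν : κ → Fin n → ℝ) (b : κ → ℝ) (t : ℝ) : IsClosed (Pol ν b t) := by
  have : Pol ν b t = ⋂ i, {x | dt (ν i) x ≤ b i + t} := by ext x; simp [Pol]
  rw [this]
  exact isClosed_iInter fun i => isClosed_le (dt_cont _) continuous_const

def lse (ν : κ → Fin n → ℝ) (b : κ → ℝ) (β : ℝ) (x : Fin n → ℝ) : ℝ :=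
  β⁻¹ * Real.log (∑ i, Real.exp (β * (dt (ν i) x - b i)))
def lseg (ν : κ → Fin n → ℝ) (b : κ → ℝ) (β : ℝ) (k : Fin n) (x : Fin n → ℝ) : ℝ :=
  (∑ i, Real.exp (β * (dt (ν i) x - b i)) * ν i k) / (∑ i, Real.exp (β * (dt (ν i) x - b i)))

variable [Nonempty κ]
lemma lse_pos (ν : κ → Fin n → ℝ) (b : κ → ℝ) (β : ℝ) (x : Fin n → ℝ) :
    0 < ∑ i, Real.exp (β * (dt (ν i) x - b i)) := Finset.sum_pos (fun i _ => Real.exp_pos _) Finset.univ_nonempty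

lemma lse_cont (ν : κ → Fin n → ℝ) (b : κ → ℝ) (β : ℝ) : Continuous (lse ν b β) := by
  unfold lse
  have := fun i => dt_cont (ν i)
  exact continuous_const.mul ((by fun_prop : Continuous fun x => ∑ i, Real.exp (β * (dt (ν i) x - b i))).log
    fun x => (lse_pos ν b β x).ne')

lemma lseg_cont (ν : κ → Fin n → ℝ) (b : κ → ℝ) (β : ℝ) (k) : Continuous (lseg ν b β k) := by
  unfold lseg
  have := fun i => dt_cont (ν i)
  exact (by fun_prop : Continuous fun x => ∑ i, Real.exp (β * (dt (ν i) x - b i)) * ν i k).div (by fun_prop)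
    fun x => (lse_pos ν b β x).ne'

lemma lse_deriv (ν : κ → Fin n → ℝ) (b : κ → ℝ) {β : ℝ} (hβ : 0 < β) (k : Fin n) (x : Fin n → ℝ) :
    HasDerivAt (fun s : ℝ => lse ν b β (x + s • uv k)) (lseg ν b β k x) 0 := by
  have e : ∀ i, ∀ s : ℝ, dt (ν i) (x + s • uv k) = dt (ν i) x + s * ν i k := by
    intro i s
    have := dt_comb (ν i) x (uv k) 1 s
    rw [one_smul, one_mul] at this
    rw [this]; congr 2
    simp [dt, uv, Pi.single_apply]
  have h1 : ∀ i, HasDerivAt (fun s : ℝ => Real.exp (β * (dt (ν i) (x + s • uv k) - b i)))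
      (Real.exp (β * (dt (ν i) x - b i)) * (β * ν i k)) 0 := by
    intro i
    simp only [e]
    have : HasDerivAt (fun s : ℝ => β * (dt (ν i) x + s * ν i k - b i)) (β * ν i k) 0 := by
      have := ((((hasDerivAt_id (0:ℝ)).mul_const (ν i k)).const_add (dt (ν i) x)).sub_const (b i)).const_mul β
      simpa using this
    have := this.exp
    simpa using this
  have h2 := (HasDerivAt.fun_sum (u := Finset.univ) fun i _ => h1 i)
  have hne : (∑ i, Real.exp (β * (dt (ν i) (x + (0:ℝ) • uv k) - b i))) ≠ 0 := (lse_pos ν b β _).ne'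
  have h3 := (h2.log hne).const_mul β⁻¹
  unfold lse
  refine h3.congr_deriv ?_
  rw [zero_smul, add_zero]
  unfold lseg
  have : ∑ i, Real.exp (β * (dt (ν i) x - b i)) * (β * ν i k) = β * ∑ i, Real.exp (β * (dt (ν i) x - b i)) * ν i k := by
    rw [Finset.mul_sum]; exact Finset.sum_congr rfl fun i _ => by ring
  rw [this]
  field_simp

lemma lseg_le (ν : κ → Fin n → ℝ) (hν : ∀ i, ∑ k, ν i k ^ 2 = 1) (b : κ → ℝ) (β : ℝ) (x : Fin n → ℝ) :
    ∑ k, lseg ν b β k x ^ 2 ≤ 1 := by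
  have hp := lse_pos ν b β x
  unfold lseg
  simp only [div_pow]
  rw [← Finset.sum_div, div_le_one (by positivity)]
  set w : κ → ℝ := fun i => Real.exp (β * (dt (ν i) x - b i)) with hw
  have hw0 : ∀ i, 0 < w i := fun i => Real.exp_pos _
  have h1 : ∀ k, (∑ i, w i * ν i k) ^ 2 ≤ (∑ i, w i) * ∑ i, w i * ν i k ^ 2 := by
    intro k
    have := Finset.sum_mul_sq_le_sq_mul_sq Finset.univ (fun i => Real.sqrt (w i)) (fun i => Real.sqrt (w i) * ν i k)
    have e1 : ∀ i, Real.sqrt (w i) * (Real.sqrt (w i) * ν i k) = w i * ν i k := fun i => by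
      rw [← mul_assoc, Real.mul_self_sqrt (hw0 i).le]
    have e2 : ∀ i, (Real.sqrt (w i) * ν i k) ^ 2 = w i * ν i k ^ 2 := fun i => by
      rw [mul_pow, Real.sq_sqrt (hw0 i).le]
    simp only [e1, e2, Real.sq_sqrt (hw0 _).le] at this
    exact this
  refine (Finset.sum_le_sum fun k _ => h1 k).trans ?_
  rw [← Finset.mul_sum, Finset.sum_comm]
  simp only [← Finset.mul_sum, hν, mul_one]
  rw [pow_two]

lemma lse_ge (ν : κ → Fin n → ℝ) (b : κ → ℝ) {β : ℝ} (hβ : 0 < β) (x : Fin n → ℝ) (i : κ) :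
    dt (ν i) x - b i ≤ lse ν b β x := by
  unfold lse
  rw [← mul_le_mul_iff_right₀ hβ, ← mul_assoc, mul_inv_cancel₀ hβ.ne', one_mul]
  rw [Real.le_log_iff_exp_le (lse_pos ν b β x)]
  exact Finset.single_le_sum (f := fun i => Real.exp (β * (dt (ν i) x - b i))) (fun i _ => (Real.exp_pos _).le) (Finset.mem_univ i)

lemma lse_le (ν : κ → Fin n → ℝ) (b : κ → ℝ) {β : ℝ} (hβ : 0 < β) (x : Fin n → ℝ) {t : ℝ} (ht : ∀ i, dt (ν i) x - b i ≤ t) :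
    lse ν b β x ≤ t + β⁻¹ * Real.log (Fintype.card κ) := by
  unfold lse
  have hc : (0:ℝ) < Fintype.card κ := by exact_mod_cast Fintype.card_pos
  have : Real.log (∑ i, Real.exp (β * (dt (ν i) x - b i))) ≤ Real.log (Fintype.card κ) + β * t := by
    rw [Real.log_le_iff_le_exp (lse_pos ν b β x), Real.exp_add, Real.exp_log hc]
    calc _ ≤ ∑ i : κ, Real.exp (β * t) := Finset.sum_le_sum fun i _ => Real.exp_le_exp.2 (by have := ht i; gcongr)
      _ = _ := by simp
  calc _ ≤ β⁻¹ * (Real.log (Fintype.card κ) + β * t) := by gcongr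
    _ = _ := by field_simp; ring
end Poly

end

section
set_option linter.all false
open Filter
open scoped Topology

namespace Poly
open Disc
variable {n : ℕ} {κ : Type} [Fintype κ]

def gv (B : Set (Fin n → ℝ)) (ν : κ → Fin n → ℝ) (b : κ → ℝ) (t : ℝ) : ℝ := (volume (B ∩ Pol ν b t)).toReal

variable {B : Set (Fin n → ℝ)} (hB : IsCompact B) (hconv : Convex ℝ B) (hv : 0 < volume B)

lemma Pol_mono (ν : κ → Fin n → ℝ) (b : κ → ℝ) {s t : ℝ} (h : s ≤ t) : Pol ν b s ⊆ Pol ν b t :=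
  fun x hx i => (hx i).trans (by linarith)

include hB in
lemma gv_mono (ν : κ → Fin n → ℝ) (b : κ → ℝ) {s t : ℝ} (h : s ≤ t) : gv B ν b s ≤ gv B ν b t :=
  ENNReal.toReal_mono (measure_ne_top_of_subset inter_subset_left hB.measure_lt_top.ne)
    (measure_mono (inter_subset_inter_right _ (Pol_mono ν b h)))

include hB hconv in
lemma gv_log (ν : κ → Fin n → ℝ) (b : κ → ℝ) {s t θ : ℝ} (h0 : 0 < θ) (h1 : θ < 1) :
    gv B ν b s ^ (1 - θ) * gv B ν b t ^ θ ≤ gv B ν b ((1 - θ) * s + θ * t) := by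
  have hm : ∀ t, MeasurableSet (B ∩ Pol ν b t) := fun t => (hB.isClosed.inter (Pol_closed ν b t)).measurableSet
  have hb : ∀ t, Bornology.IsBounded (B ∩ Pol ν b t) := fun t => hB.isBounded.subset inter_subset_left
  refine log_bm n h0 h1 (hm _) (hm _) (hm _) (hb _) (hb _) (hb _) ?_
  rintro x ⟨hx, hx'⟩ y ⟨hy, hy'⟩
  refine ⟨hconv hx hy (by linarith) h0.le (by ring), fun i => ?_⟩
  rw [dt_comb]
  nlinarith [hx' i, hy' i]

include hB hconv in
lemma gv_concave (ν : κ → Fin n → ℝ) (b : κ → ℝ) {p q : ℝ} (h0 : 0 < gv B ν b p) :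
    ConcaveOn ℝ (Icc p q) (fun t => Real.log (gv B ν b t)) := by
  refine ⟨convex_Icc _ _, ?_⟩
  intro x hx y hy s θ hs hθ hsθ
  have hgx : 0 < gv B ν b x := h0.trans_le (gv_mono hB ν b hx.1)
  have hgy : 0 < gv B ν b y := h0.trans_le (gv_mono hB ν b hy.1)
  have es : s = 1 - θ := by linarith
  subst es
  simp only [smul_eq_mul]
  rcases hθ.eq_or_lt with rfl | hθ
  · simp
  rcases hs.eq_or_lt with h | hs
  · have : θ = 1 := by linarith
    subst this; simp
  rw [← Real.log_rpow hgx, ← Real.log_rpow hgy, ← Real.log_mul (by positivity) (by positivity)]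
  exact Real.log_le_log (by positivity) (gv_log hB hconv ν b hθ (by linarith))

include hB hconv hv in
/-- bulk estimate from two levels -/
lemma bulk_of_levels (ν : κ → Fin n → ℝ) (b : κ → ℝ) {M r δ : ℝ} (hr : 1 ≤ r) (hδ : 0 < δ) (hδ1 : δ ≤ 1)
    (hM1 : gv B ν b (M - 2 * r) ≤ (volume B).toReal / 8) (hM2 : 7 * (volume B).toReal / 8 ≤ gv B ν b (M + r))
    (h34 : gv B ν b 0 ≤ 3 * (volume B).toReal / 4) :
    gv B ν b (-δ) ≤ (1 - δ / (42 * r)) * gv B ν b 0 := by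
  set v := (volume B).toReal with hvd
  have hvp : 0 < v := ENNReal.toReal_pos hv.ne' hB.measure_lt_top.ne
  have hg0 : ∀ t, 0 ≤ gv B ν b t := fun t => ENNReal.toReal_nonneg
  have hθ : δ / (42 * r) ≤ 1 := by rw [div_le_one (by positivity)]; linarith
  rcases (hg0 (-δ)).eq_or_lt with h | h
  · rw [← h]; exact mul_nonneg (by linarith) (hg0 0)
  have hT2 : 0 < M + r := by
    by_contra hh
    push Not at hh
    have := gv_mono hB ν b hh
    linarith
  have hcc := gv_concave (q := M + r) hB hconv ν b h
  have hl0 := h.trans_le (gv_mono hB ν b (by linarith : -δ ≤ 0))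
  set f := fun t => Real.log (gv B ν b t) with hf
  have hlog : (1:ℝ)/7 ≤ Real.log (7/6) := by
    have := Real.one_sub_inv_le_log_of_pos (by norm_num : (0:ℝ) < 7/6)
    norm_num at this ⊢; linarith
  -- slope
  have key : (1/7) / (3 * r) ≤ (f 0 - f (-δ)) / (0 - (-δ)) := by
    rcases le_or_gt (M - 2 * r) 0 with hc | hc
    · have h1 := hcc.slope_anti_adjacent (x := -δ) (y := 0) (z := M + r) ⟨le_rfl, by linarith⟩ ⟨by linarith, le_rfl⟩ (by linarith) hT2
      refine le_trans ?_ h1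
      have : Real.log (7/6) ≤ f (M + r) - f 0 := by
        rw [hf]; simp only
        rw [← Real.log_div (by linarith) hl0.ne']
        refine Real.log_le_log (by norm_num) ?_
        rw [le_div_iff₀ hl0]; linarith
      rw [sub_zero]
      refine div_le_div₀ ?_ ?_ hT2 ?_ <;> linarith
    · have hgT := hl0.trans_le (gv_mono hB ν b hc.le)
      have h1 := hcc.slope_anti_adjacent (x := -δ) (y := 0) (z := M - 2 * r) ⟨le_rfl, by linarith⟩ ⟨by linarith, by linarith⟩ (by linarith) hc
      have h2 := hcc.slope_anti_adjacent (x := 0) (y := M - 2 * r) (z := M + r) ⟨by linarith, by linarith⟩ ⟨by linarith, le_rfl⟩ hc (by linarith)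
      refine le_trans ?_ (h2.trans h1)
      have : Real.log (7/6) ≤ f (M + r) - f (M - 2 * r) := by
        rw [hf]; simp only
        rw [← Real.log_div (by linarith) hgT.ne']
        refine Real.log_le_log (by norm_num) ?_
        rw [le_div_iff₀ hgT]; linarith
      refine div_le_div₀ ?_ ?_ ?_ ?_ <;> linarith
  have key2 : δ / (21 * r) ≤ f 0 - f (-δ) := by
    rw [le_div_iff₀ (by linarith)] at key
    calc _ = 1/7/(3*r) * (0 - -δ) := by field_simp; ring
      _ ≤ _ := key
  have h5 : gv B ν b (-δ) ≤ Real.exp (-(δ / (21 * r))) * gv B ν b 0 := by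
    have : f (-δ) ≤ -(δ / (21 * r)) + f 0 := by linarith
    have := Real.exp_le_exp.2 this
    rw [Real.exp_add, hf] at this
    simp only [Real.exp_log h, Real.exp_log hl0] at this
    exact this
  refine h5.trans (mul_le_mul_of_nonneg_right ?_ (hg0 0))
  have hx0 : 0 ≤ δ / (21 * r) := by positivity
  have hx1 : δ / (21 * r) ≤ 1 := by rw [div_le_one (by positivity)]; linarith
  have e : δ / (42 * r) = (δ / (21 * r)) / 2 := by field_simp; norm_num
  rw [e]
  set x := δ / (21 * r)
  rw [Real.exp_neg, inv_le_comm₀ (Real.exp_pos _) (by linarith)]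
  have := Real.add_one_le_exp x
  refine le_trans ?_ this
  rw [inv_le_iff_one_le_mul₀ (by linarith)]
  nlinarith

def rr (n : ℕ) : ℝ := Real.sqrt (8 * 15000000 * Real.log n)
lemma rr_ge {n : ℕ} (hn : 2 ≤ n) : 1 ≤ rr n := by
  have hl2 : (0.69:ℝ) < Real.log 2 := lt_trans (by norm_num) Real.log_two_gt_d9
  have h3 : Real.log 2 ≤ Real.log n := Real.log_le_log (by norm_num) (by exact_mod_cast hn)
  rw [rr, Real.one_le_sqrt]; linarith

include hB hconv hv in
lemma levels [Nonempty κ] (hn : 2 ≤ n) (h1 : ∀ i, ∫ x in B, x i = 0)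
    (h2 : ∀ i j, ∫ x in B, x i * x j = if i = j then (volume B).toReal else 0)
    (ν : κ → Fin n → ℝ) (hν : ∀ i, ∑ k, ν i k ^ 2 = 1) (b : κ → ℝ) :
    ∃ M, gv B ν b (M - 2 * rr n) ≤ (volume B).toReal / 8 ∧ 7 * (volume B).toReal / 8 ≤ gv B ν b (M + rr n) := by
  set v := (volume B).toReal with hvd
  have hvp : 0 < v := ENNReal.toReal_pos hv.ne' hB.measure_lt_top.ne
  have hr := rr_ge hn
  set r := rr n with hrd
  have hr2 : r ^ 2 = 8 * 15000000 * Real.log n := by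
    rw [hrd, rr, Real.sq_sqrt]
    have := Real.log_natCast_nonneg n
    positivity
  set β : ℝ := Real.log (Fintype.card κ) + 1 with hβd
  have hl0 := Real.log_natCast_nonneg (Fintype.card κ)
  have hβ : 0 < β := by linarith
  have hβ1 : β⁻¹ * Real.log (Fintype.card κ) ≤ r := by
    refine le_trans ?_ hr
    rw [inv_mul_le_iff₀ hβ]; linarith
  set f := lse ν b β with hf
  have hfc : Continuous f := lse_cont ν b β
  have hMT := Heat.MT hB hconv hv h1 h2 (by simpa using hn) hfc (lseg_cont ν b β) (lse_deriv ν b hβ) (lseg_le ν hν b β)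
  set M := (∫ x in B, f x) / v with hM
  have hi1 : IntegrableOn f B := hfc.continuousOn.integrableOn_compact hB
  have hi2 : IntegrableOn (fun x => f x ^ 2) B := (hfc.pow 2).continuousOn.integrableOn_compact hB
  have hi3 : IntegrableOn (fun x => (f x - M) ^ 2) B := ((hfc.sub continuous_const).pow 2).continuousOn.integrableOn_compact hB
  have hvar : ∫ x in B, (f x - M) ^ 2 ≤ v * (15000000 * Real.log n) := by
    have e1 : ∫ x in B, (f x - M) ^ 2 = (∫ x in B, f x ^ 2) - 2 * M * (∫ x in B, f x) + M ^ 2 * v := by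
      have : ∀ x, (f x - M) ^ 2 = f x ^ 2 - 2 * M * f x + M ^ 2 := fun x => by ring
      simp only [this]
      have hi4 : IntegrableOn (fun x => 2 * M * f x) B := hi1.const_mul _
      have hi5 : IntegrableOn (fun x => f x ^ 2 - 2 * M * f x) B := hi2.sub hi4
      have hi6 : IntegrableOn (fun _ => M ^ 2) B := continuous_const.continuousOn.integrableOn_compact hB
      rw [integral_add hi5 hi6,
        integral_sub hi2 hi4, integral_const_mul, setIntegral_const]
      simp [Measure.real, hvd, mul_comm]
    rw [Fintype.card_fin] at hMT
    have e2 : ∫ x in B, f x = v * M := by rw [hM]; field_simp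
    rw [e1, e2]
    have := mul_le_mul_of_nonneg_left hMT hvp.le
    rw [mul_sub, mul_div_cancel₀ _ hvp.ne'] at this
    nlinarith
  have hcheb := mul_meas_ge_le_integral_of_nonneg (μ := volume.restrict B) (f := fun x => (f x - M) ^ 2)
    (Eventually.of_forall fun x => sq_nonneg _) hi3 (r ^ 2)
  have hmS : MeasurableSet {x | r ^ 2 ≤ (f x - M) ^ 2} :=
    (isClosed_le continuous_const ((hfc.sub continuous_const).pow 2)).measurableSet
  set S := {x | r ^ 2 ≤ (f x - M) ^ 2} with hS
  have hS8 : (volume (S ∩ B)).toReal ≤ v / 8 := by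
    have : r ^ 2 * (volume (S ∩ B)).toReal ≤ v * (15000000 * Real.log n) := by
      refine le_trans ?_ hvar
      refine le_trans (le_of_eq ?_) hcheb
      rw [Measure.real, Measure.restrict_apply hmS]
    have hr2p : 0 < r ^ 2 := by positivity
    have e : r ^ 2 * (v / 8) = v * (15000000 * Real.log n) := by rw [hr2]; ring
    rw [← e] at this
    exact le_of_mul_le_mul_left this hr2p
  have hfin : volume (S ∩ B) ≠ ⊤ := measure_ne_top_of_subset inter_subset_right hB.measure_lt_top.ne
  have hcm : ∀ t, volume (B ∩ Pol ν b t) ≠ ⊤ := fun t => measure_ne_top_of_subset inter_subset_left hB.measure_lt_top.ne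
  refine ⟨M, ?_, ?_⟩
  · refine le_trans (ENNReal.toReal_mono hfin (measure_mono ?_)) hS8
    rintro x ⟨hx, hx'⟩
    refine ⟨?_, hx⟩
    have := lse_le ν b hβ x (t := M - 2 * r) fun i => by linarith [hx' i]
    show r ^ 2 ≤ (f x - M) ^ 2
    have : f x - M ≤ - r := by rw [hf]; linarith
    nlinarith
  · have : v ≤ (volume (S ∩ B)).toReal + gv B ν b (M + r) := by
      rw [gv, ← ENNReal.toReal_add hfin (hcm _), hvd]
      refine ENNReal.toReal_mono (ENNReal.add_ne_top.2 ⟨hfin, hcm _⟩) (le_trans (measure_mono ?_) (measure_union_le _ _))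
      intro x hx
      by_cases hxS : x ∈ S
      · exact Or.inl ⟨hxS, hx⟩
      · refine Or.inr ⟨hx, fun i => ?_⟩
        have h3 := lse_ge ν b hβ x i
        have h4 : (f x - M) ^ 2 < r ^ 2 := not_le.1 hxS
        have h5 : f x - M < r := by nlinarith
        rw [hf] at h5; linarith
    linarith

include hB hconv hv in
theorem bulk [Nonempty κ] (hn : 2 ≤ n) (h1 : ∀ i, ∫ x in B, x i = 0)
    (h2 : ∀ i j, ∫ x in B, x i * x j = if i = j then (volume B).toReal else 0)
    (ν : κ → Fin n → ℝ) (hν : ∀ i, ∑ k, ν i k ^ 2 = 1) (b : κ → ℝ) {δ : ℝ} (hδ : 0 < δ) (hδ1 : δ ≤ 1)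
    (h34 : gv B ν b 0 ≤ 3 * (volume B).toReal / 4) :
    gv B ν b (-δ) ≤ (1 - δ / (42 * rr n)) * gv B ν b 0 := by
  obtain ⟨M, hM1, hM2⟩ := levels hB hconv hv hn h1 h2 ν hν b
  exact bulk_of_levels hB hconv hv ν b (rr_ge hn) hδ hδ1 hM1 hM2 h34
end Poly

end

section
set_option linter.all false
open Filter
open scoped Topology

namespace Poly
open Disc
variable {n : ℕ} {κ : Type} [Fintype κ]

lemma four_pt {a : ℝ → ℝ} (h0 : ∀ t, 0 ≤ a t)
    (hl : ∀ s t θ, 0 < θ → θ < 1 → a s ^ (1 - θ) * a t ^ θ ≤ a ((1 - θ) * s + θ * t))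
    {τ δ : ℝ} (hτ : τ ≤ 0) (hδ : 0 < δ) : a (τ - δ) * a 0 ≤ a τ * a (-δ) := by
  rcases hτ.eq_or_lt with rfl | hτ
  · rw [zero_sub, mul_comm]
  set θ := δ / (δ - τ) with hθ
  have hp : 0 < δ - τ := by linarith
  have h1 : 0 < θ := by positivity
  have h2 : θ < 1 := by rw [hθ, div_lt_one hp]; linarith
  have e1 := hl (τ - δ) 0 θ h1 h2
  have e2 := hl (τ - δ) 0 (1 - θ) (by linarith) (by linarith)
  have f1 : (1 - θ) * (τ - δ) + θ * 0 = τ := by rw [hθ]; field_simp; ring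
  have f2 : (1 - (1 - θ)) * (τ - δ) + (1 - θ) * 0 = -δ := by rw [hθ]; field_simp; ring
  rw [f1] at e1; rw [f2] at e2
  refine le_trans (le_of_eq ?_) (mul_le_mul e1 e2 ?_ (h0 _))
  · have g : ∀ x : ℝ, 0 ≤ x → x ^ (1 - θ) * x ^ (1 - (1 - θ)) = x := by
      intro x hx
      rw [← Real.rpow_add_of_nonneg hx (by linarith) (by linarith)]; simp
    have g' : ∀ x : ℝ, 0 ≤ x → x ^ θ * x ^ (1 - θ) = x := by
      intro x hx
      rw [← Real.rpow_add_of_nonneg hx (by linarith) (by linarith)]; simp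
    have e3 := g _ (h0 (τ - δ))
    have e4 := g' _ (h0 0)
    linear_combination (-(a 0)) * e3 - (a (τ - δ) ^ (1 - θ) * a (τ - δ) ^ (1 - (1 - θ))) * e4
  · exact mul_nonneg (Real.rpow_nonneg (h0 _) _) (Real.rpow_nonneg (h0 _) _)

lemma dt_add (a x y : Fin n → ℝ) : dt a (x + y) = dt a x + dt a y := by
  have := dt_comb a x y 1 1; simpa using this
lemma dt_smul (a x : Fin n → ℝ) (s : ℝ) : dt a (s • x) = s * dt a x := by
  have := dt_comb a x 0 s 0; simpa [dt] using this
lemma dt_comm (a x : Fin n → ℝ) : dt a x = dt x a := by simp [dt, mul_comm]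
lemma dt_sub (a x y : Fin n → ℝ) : dt a (x - y) = dt a x - dt a y := by
  simp [dt, mul_sub]
lemma dt_self (a : Fin n → ℝ) : dt a a = ∑ k, a k ^ 2 := by simp [dt, pow_two]
lemma dt_sub_left (a x y : Fin n → ℝ) : dt (x - y) a = dt x a - dt y a := by
  simp [dt, sub_mul]

lemma hyper_null {a : Fin n → ℝ} (ha : a ≠ 0) (p : ℝ) : volume {x | dt a x = p} = 0 := by
  have hs : 0 < dt a a := by
    rw [dt_self]
    obtain ⟨k, hk⟩ := Function.ne_iff.1 ha
    exact Finset.sum_pos' (fun i _ => sq_nonneg _) ⟨k, Finset.mem_univ _, by have : a k ≠ 0 := hk; positivity⟩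
  by_cases hne : ∃ x0, dt a x0 = p
  swap
  · push Not at hne
    have : {x | dt a x = p} = ∅ := by ext x; simp [hne x]
    rw [this]; simp
  obtain ⟨x0, hx0⟩ := hne
  let L : (Fin n → ℝ) →ₗ[ℝ] ℝ := { toFun := dt a, map_add' := dt_add a, map_smul' := fun s x => by simp [dt_smul] }
  have hL : LinearMap.ker L ≠ ⊤ := by
    intro h
    have : a ∈ LinearMap.ker L := by rw [h]; trivial
    exact hs.ne' this
  have h0 := Measure.addHaar_submodule (volume : Measure (Fin n → ℝ)) (LinearMap.ker L) hL
  have e : {x | dt a x = p} = (fun x => x + -x0) ⁻¹' (LinearMap.ker L : Set (Fin n → ℝ)) := by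
    ext x
    simp only [mem_setOf_eq, mem_preimage, SetLike.mem_coe, LinearMap.mem_ker]
    show _ ↔ dt a (x + -x0) = 0
    rw [← sub_eq_add_neg, dt_sub, hx0, sub_eq_zero]
  rw [e, measure_preimage_add_right, h0]

lemma two_slab_aux {B : Set (Fin n → ℝ)} (hB : IsCompact B) {a a' w w' : Fin n → ℝ}
    (h1 : dt a w = 1) (h2 : dt a w' = 0) (h3 : dt a' w = 0) (h4 : dt a' w' = 1) (p p' : ℝ) :
    ∃ C : ℝ, 0 ≤ C ∧ ∀ h, 0 < h → h ≤ 1 →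
      (volume (B ∩ {x | p < dt a x ∧ dt a x ≤ p + h ∧ p' < dt a' x ∧ dt a' x ≤ p' + h})).toReal ≤ C * h ^ 2 := by
  set U : Set (Fin n → ℝ) := (fun z : (Fin n → ℝ) × ℝ × ℝ => z.1 + (z.2.1 • w + z.2.2 • w')) '' (B ×ˢ (Icc 0 1 ×ˢ Icc 0 1)) with hU
  have hUc : IsCompact U := (hB.prod (isCompact_Icc.prod isCompact_Icc)).image (by fun_prop)
  set V0 := (volume U).toReal with hV0
  refine ⟨4 * V0, by positivity, fun h hh hh1 => ?_⟩
  set S := B ∩ {x | p < dt a x ∧ dt a x ≤ p + h ∧ p' < dt a' x ∧ dt a' x ≤ p' + h} with hS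
  have hSm : MeasurableSet S := by
    refine hB.isClosed.measurableSet.inter ?_
    have ha := (dt_cont a).measurable
    have ha' := (dt_cont a').measurable
    exact (measurableSet_lt measurable_const ha).inter ((measurableSet_le ha measurable_const).inter
      ((measurableSet_lt measurable_const ha').inter (measurableSet_le ha' measurable_const)))
  set M := ⌊1 / h⌋₊ with hM
  have hM1 : (M:ℝ) * h ≤ 1 := by
    have := Nat.floor_le (by positivity : 0 ≤ 1 / h)
    rwa [le_div_iff₀ hh] at this
  have hM2 : 1 ≤ 2 * (M * h) := by
    have h5 := Nat.lt_floor_add_one (1 / h)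
    rw [div_lt_iff₀ hh] at h5
    have h6 : 1 ≤ M := by rw [hM, Nat.one_le_floor_iff, le_div_iff₀ hh]; linarith
    have h7 : (1:ℝ) ≤ M := by exact_mod_cast h6
    nlinarith
  let T : Fin M × Fin M → Set (Fin n → ℝ) := fun q => (fun x => x + (-(((q.1:ℕ):ℝ) * h) • w + -(((q.2:ℕ):ℝ) * h) • w')) ⁻¹' S
  have hTm : ∀ q, MeasurableSet (T q) := fun q => hSm.preimage (by fun_prop)
  have hTv : ∀ q, volume (T q) = volume S := fun q => measure_preimage_add_right _ _ _
  have hd1 : ∀ (x : Fin n → ℝ) (s t : ℝ), dt a (x + (-s • w + -t • w')) = dt a x - s := by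
    intro x s t; rw [dt_add, dt_add, dt_smul, dt_smul, h1, h2]; ring
  have hd2 : ∀ (x : Fin n → ℝ) (s t : ℝ), dt a' (x + (-s • w + -t • w')) = dt a' x - t := by
    intro x s t; rw [dt_add, dt_add, dt_smul, dt_smul, h3, h4]; ring
  have hnat : ∀ (k l : ℕ) (p y : ℝ), p < y - k * h → y - k * h ≤ p + h → p < y - l * h → y - l * h ≤ p + h → k = l := by
    intro k l p y a1 a2 a3 a4
    have b1 : (k:ℝ) < l + 1 := by nlinarith
    have b2 : (l:ℝ) < k + 1 := by nlinarith
    have b1' : k < l + 1 := by exact_mod_cast b1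
    have b2' : l < k + 1 := by exact_mod_cast b2
    omega
  have hTd : Pairwise (Function.onFun Disjoint T) := by
    intro q q' hq
    rw [Function.onFun, Set.disjoint_left]
    rintro x ⟨_, hx⟩ ⟨_, hx'⟩
    simp only [mem_setOf_eq, hd1, hd2] at hx hx'
    apply hq
    refine Prod.ext (Fin.ext ?_) (Fin.ext ?_)
    · exact hnat _ _ p (dt a x) hx.1 hx.2.1 hx'.1 hx'.2.1
    · exact hnat _ _ p' (dt a' x) hx.2.2.1 hx.2.2.2 hx'.2.2.1 hx'.2.2.2
  have hTU : (⋃ q, T q) ⊆ U := by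
    refine iUnion_subset fun q x hx => ?_
    have hb : ∀ k : Fin M, ((k:ℕ):ℝ) * h ∈ Icc (0:ℝ) 1 := by
      intro k
      refine ⟨by positivity, le_trans ?_ hM1⟩
      have : ((k:ℕ):ℝ) ≤ M := by exact_mod_cast k.2.le
      gcongr
    refine ⟨(_, (((q.1:ℕ):ℝ) * h), (((q.2:ℕ):ℝ) * h)), ⟨hx.1, hb _, hb _⟩, ?_⟩
    simp only [neg_smul]; abel
  have hsum : ((M:ℝ≥0∞) * M) * volume S ≤ volume U := by
    calc _ = ∑ q : Fin M × Fin M, volume (T q) := by simp [hTv]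
      _ = volume (⋃ q, T q) := by rw [measure_iUnion hTd hTm, tsum_fintype]
      _ ≤ _ := measure_mono hTU
  have hsum' := ENNReal.toReal_mono hUc.measure_lt_top.ne hsum
  rw [ENNReal.toReal_mul, ENNReal.toReal_mul, ENNReal.toReal_natCast] at hsum'
  have hs0 : 0 ≤ (volume S).toReal := ENNReal.toReal_nonneg
  set s := (volume S).toReal
  have h8 : 1 ≤ (2 * (M * h)) ^ 2 := by nlinarith
  calc s ≤ (2 * (M * h)) ^ 2 * s := le_mul_of_one_le_left hs0 h8
    _ = 4 * h ^ 2 * (M * M * s) := by ring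
    _ ≤ 4 * h ^ 2 * V0 := by gcongr
    _ = _ := by ring

lemma two_slab {B : Set (Fin n → ℝ)} (hB : IsCompact B) {a a' : Fin n → ℝ} (ha : ∑ k, a k ^ 2 = 1) (ha' : ∑ k, a' k ^ 2 = 1)
    (hne : a ≠ a') (p p' : ℝ) :
    ∃ C h0 : ℝ, 0 ≤ C ∧ 0 < h0 ∧ ∀ h, 0 < h → h ≤ h0 →
      (volume (B ∩ {x | p < dt a x ∧ dt a x ≤ p + h ∧ p' < dt a' x ∧ dt a' x ≤ p' + h})).toReal ≤ C * h ^ 2 := by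
  set c := dt a a' with hc
  rw [← dt_self] at ha ha'
  by_cases hcc : c ^ 2 = 1
  · have hc1 : c = -1 := by
      rcases (by have : (c - 1) * (c + 1) = 0 := by linarith
                 rcases mul_eq_zero.1 this with h | h
                 · left; linarith
                 · right; linarith : c = 1 ∨ c = -1) with h | h
      · exfalso; apply hne
        have e : dt (a - a') (a - a') = 0 := by
          rw [dt_sub, dt_sub_left, dt_sub_left, ha, ha', dt_comm a' a, ← hc, h]; ring
        rw [dt_self, Finset.sum_eq_zero_iff_of_nonneg (fun i _ => sq_nonneg _)] at e
        ext k
        have := e k (Finset.mem_univ _)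
        simp at this; linarith
      · exact h
    have hsum : ∀ x, dt a x + dt a' x = 0 := by
      have e : dt (a + a') (a + a') = 0 := by
        rw [dt_add, dt_comm (a+a'), dt_add, dt_comm (a+a') a', dt_add, ha, ha', dt_comm a' a, ← hc, hc1]; ring
      rw [dt_self, Finset.sum_eq_zero_iff_of_nonneg (fun i _ => sq_nonneg _)] at e
      have e0 : a + a' = 0 := by
        ext k
        have := e k (Finset.mem_univ _)
        simp at this; simp; linarith
      intro x
      rw [dt_comm a, dt_comm a', ← dt_add, e0]; simp [dt]
    refine ⟨0, if p + p' < 0 then -(p + p') / 4 else 1, le_rfl, ?_, ?_⟩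
    · split_ifs with h <;> linarith
    · intro h hh hh0
      have : (B ∩ {x | p < dt a x ∧ dt a x ≤ p + h ∧ p' < dt a' x ∧ dt a' x ≤ p' + h}) = ∅ := by
        rw [eq_empty_iff_forall_notMem]
        rintro x ⟨_, h1, h2, h3, h4⟩
        have := hsum x
        split_ifs at hh0 with h5 <;> linarith
      rw [this]; simp
  · have hd : (1 - c ^ 2) ≠ 0 := fun h => hcc (by linarith)
    obtain ⟨C, hC, hC2⟩ := two_slab_aux hB (a := a) (a' := a') (w := (1 - c^2)⁻¹ • (a - c • a')) (w' := (1 - c^2)⁻¹ • (a' - c • a))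
      (by rw [dt_smul, dt_sub, dt_smul, ha, ← hc]; field_simp) (by rw [dt_smul, dt_sub, dt_smul, ha, ← hc]; ring)
      (by rw [dt_smul, dt_sub, dt_smul, ha', dt_comm a' a, ← hc]; ring) (by rw [dt_smul, dt_sub, dt_smul, ha', dt_comm a' a, ← hc]; field_simp) p p'
    exact ⟨C, 1, hC, one_pos, hC2⟩
end Poly

end

section
set_option linter.all false
open Filter
open scoped Topology

namespace Poly
open Disc
variable {n : ℕ} {κ : Type} [Fintype κ]

def cell (ν : κ → Fin n → ℝ) (b : κ → ℝ) (i : κ) : Set (Fin n → ℝ) := {x | ∀ j, dt (ν j) x - b j ≤ dt (ν i) x - b i}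
def slb (ν : κ → Fin n → ℝ) (b : κ → ℝ) (i : κ) (s t : ℝ) : Set (Fin n → ℝ) :=
  {x | s < dt (ν i) x - b i ∧ dt (ν i) x - b i ≤ t}
def sl (B : Set (Fin n → ℝ)) (ν : κ → Fin n → ℝ) (b : κ → ℝ) (i : κ) (s t : ℝ) : ℝ :=
  (volume.restrict B).real (cell ν b i ∩ slb ν b i s t)

lemma cell_meas (ν : κ → Fin n → ℝ) (b : κ → ℝ) (i : κ) : MeasurableSet (cell ν b i) := by
  have : cell ν b i = ⋂ j, {x | dt (ν j) x - b j ≤ dt (ν i) x - b i} := by ext x; simp [cell]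
  rw [this]
  exact MeasurableSet.iInter fun j => measurableSet_le ((dt_cont _).measurable.sub_const _) ((dt_cont _).measurable.sub_const _)
lemma slb_meas (ν : κ → Fin n → ℝ) (b : κ → ℝ) (i : κ) (s t : ℝ) : MeasurableSet (slb ν b i s t) :=
  (measurableSet_lt measurable_const ((dt_cont _).measurable.sub_const _)).inter
    (measurableSet_le ((dt_cont _).measurable.sub_const _) measurable_const)

variable {B : Set (Fin n → ℝ)} (hB : IsCompact B) (hconv : Convex ℝ B) (hv : 0 < volume B)

lemma finB (hB : IsCompact B) : IsFiniteMeasure (volume.restrict B) := ⟨by simpa using hB.measure_lt_top⟩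

include hB in
lemma gv_eq (ν : κ → Fin n → ℝ) (b : κ → ℝ) (t : ℝ) : gv B ν b t = (volume.restrict B).real (Pol ν b t) := by
  rw [gv, Measure.real, Measure.restrict_apply' hB.isClosed.measurableSet, inter_comm]

lemma sl_nonneg (ν : κ → Fin n → ℝ) (b : κ → ℝ) (i : κ) (s t : ℝ) : 0 ≤ sl B ν b i s t := ENNReal.toReal_nonneg

include hB in
lemma sl_add (ν : κ → Fin n → ℝ) (b : κ → ℝ) (i : κ) {s t u : ℝ} (h1 : s ≤ t) (h2 : t ≤ u) :
    sl B ν b i s u = sl B ν b i s t + sl B ν b i t u := by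
  haveI := finB hB
  unfold sl
  rw [← measureReal_union ?_ ((cell_meas ν b i).inter (slb_meas ν b i t u)), ← inter_union_distrib_left]
  · congr 2
    ext x; simp only [slb, mem_setOf_eq, mem_union]
    constructor
    · rintro ⟨a, c⟩
      rcases le_or_gt (dt (ν i) x - b i) t with h | h
      · exact Or.inl ⟨a, h⟩
      · exact Or.inr ⟨h, c⟩
    · rintro (⟨a, c⟩ | ⟨a, c⟩)
      · exact ⟨a, c.trans h2⟩
      · exact ⟨h1.trans_lt a, c⟩
  · rw [Set.disjoint_left]
    rintro x ⟨_, _, a⟩ ⟨_, c, _⟩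
    linarith

include hB in
lemma sl_sum (ν : κ → Fin n → ℝ) (b : κ → ℝ) (i : κ) (s : ℝ) {h : ℝ} (hh : 0 ≤ h) (M : ℕ) :
    sl B ν b i s (s + M * h) = ∑ j ∈ Finset.range M, sl B ν b i (s + j * h) (s + j * h + h) := by
  induction M with
  | zero =>
    have : cell ν b i ∩ slb ν b i s (s + (0:ℕ) * h) = ∅ := by
      rw [eq_empty_iff_forall_notMem]; rintro x ⟨_, h1, h2⟩; simp at h2; linarith
    simp only [sl, this, Finset.range_zero, Finset.sum_empty]; simp
  | succ M ih =>
    rw [Finset.sum_range_succ, ← ih, sl_add hB ν b i (t := s + M * h) (by have : (0:ℝ) ≤ M * h := by positivity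
                                                                          linarith) (by push_cast; nlinarith)]
    push_cast; ring_nf

include hB hconv in
lemma sl_log (ν : κ → Fin n → ℝ) (b : κ → ℝ) (i : κ) (h : ℝ) (s t θ : ℝ) (h0 : 0 < θ) (h1 : θ < 1) :
    sl B ν b i s (s + h) ^ (1 - θ) * sl B ν b i t (t + h) ^ θ ≤
      sl B ν b i ((1 - θ) * s + θ * t) ((1 - θ) * s + θ * t + h) := by
  have e : ∀ s t, sl B ν b i s t = (volume (cell ν b i ∩ slb ν b i s t ∩ B)).toReal := fun s t => by
    rw [sl, Measure.real, Measure.restrict_apply' hB.isClosed.measurableSet]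
  simp only [e]
  have hm : ∀ s t, MeasurableSet (cell ν b i ∩ slb ν b i s t ∩ B) := fun s t =>
    ((cell_meas ν b i).inter (slb_meas ν b i s t)).inter hB.isClosed.measurableSet
  have hb : ∀ s t, Bornology.IsBounded (cell ν b i ∩ slb ν b i s t ∩ B) := fun s t => hB.isBounded.subset inter_subset_right
  refine log_bm n h0 h1 (hm _ _) (hm _ _) (hm _ _) (hb _ _) (hb _ _) (hb _ _) ?_
  rintro x ⟨⟨hx1, hx2⟩, hx⟩ y ⟨⟨hy1, hy2⟩, hy⟩
  refine ⟨⟨fun j => ?_, ?_, ?_⟩, hconv hx hy (by linarith) h0.le (by ring)⟩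
  · rw [dt_comb, dt_comb]; nlinarith [hx1 j, hy1 j]
  · rw [dt_comb]; nlinarith [hx2.1, hy2.1]
  · rw [dt_comb]; nlinarith [hx2.2, hy2.2]

include hB hconv in
lemma sl_step (ν : κ → Fin n → ℝ) (b : κ → ℝ) (i : κ) {δ ρ : ℝ} (hδ : 0 < δ) {M : ℕ} (hM : 0 < M)
    (h1 : sl B ν b i (-δ) (-δ + δ / M) ≤ ρ * sl B ν b i 0 (0 + δ / M)) (h2 : 0 < sl B ν b i 0 (0 + δ / M))
    {s : ℝ} (hs : s ≤ -δ) : sl B ν b i (s - δ) s ≤ ρ * sl B ν b i s (s + δ) := by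
  set h := δ / M with hh
  have hMp : (0:ℝ) < M := by exact_mod_cast hM
  have hhp : 0 < h := by positivity
  have e : δ = M * h := by rw [hh]; field_simp
  have key : ∀ τ ≤ 0, sl B ν b i (τ - δ) (τ - δ + h) ≤ ρ * sl B ν b i τ (τ + h) := by
    intro τ hτ
    have := four_pt (a := fun t => sl B ν b i t (t + h)) (fun t => sl_nonneg _ _ _ _ _) (fun s t θ => sl_log hB hconv ν b i h s t θ) hτ hδ
    beta_reduce at this
    have h3 := mul_le_mul_of_nonneg_left h1 (sl_nonneg (B := B) ν b i τ (τ + h))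
    have : sl B ν b i (τ - δ) (τ - δ + h) * sl B ν b i 0 (0 + h) ≤ (ρ * sl B ν b i τ (τ + h)) * sl B ν b i 0 (0 + h) := by linarith
    exact le_of_mul_le_mul_right this h2
  have e1 := sl_sum hB ν b i (s - δ) hhp.le M
  have e2 := sl_sum hB ν b i s hhp.le M
  rw [← e] at e1 e2
  rw [sub_add_cancel] at e1
  rw [e1, e2, Finset.mul_sum]
  refine Finset.sum_le_sum fun j hj => ?_
  have hj' : (j:ℝ) ≤ M := by exact_mod_cast (Finset.mem_range.1 hj).le
  have := key (s + j * h) (by nlinarith)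
  rw [show s + j * h - δ = s - δ + j * h by ring] at this
  exact this

include hB in
lemma layer (ν : κ → Fin n → ℝ) (hinj : Function.Injective ν) [Nonempty κ] (b : κ → ℝ) {s t : ℝ} (hst : s ≤ t) :
    gv B ν b t - gv B ν b s = ∑ i, sl B ν b i s t := by
  haveI := finB hB
  rw [gv_eq hB, gv_eq hB, ← measureReal_diff (Pol_mono ν b hst) (Pol_closed ν b s).measurableSet]
  have e : Pol ν b t \ Pol ν b s = ⋃ i ∈ (Finset.univ : Finset κ), (cell ν b i ∩ slb ν b i s t) := by
    ext x
    simp only [mem_diff, Finset.mem_univ, iUnion_true, mem_iUnion]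
    constructor
    · rintro ⟨h1, h2⟩
      obtain ⟨i, -, hi⟩ := Finset.exists_max_image Finset.univ (fun i => dt (ν i) x - b i) Finset.univ_nonempty
      refine ⟨i, fun j => hi j (Finset.mem_univ _), ?_, by linarith [h1 i]⟩
      by_contra hc
      push Not at hc
      exact h2 fun j => by linarith [hi j (Finset.mem_univ _)]
    · rintro ⟨i, hi, h1, h2⟩
      exact ⟨fun j => by linarith [hi j], fun h => by linarith [h i]⟩
  rw [e, measureReal_biUnion_finset₀ ?_ (fun i _ => ((cell_meas ν b i).inter (slb_meas ν b i s t)).nullMeasurableSet)]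
  · rfl
  · intro i _ j _ hij
    have hz := hyper_null (sub_ne_zero.2 (hinj.ne hij)) (b i - b j)
    refine measure_mono_null ?_ (Measure.absolutelyContinuous_of_le Measure.restrict_le_self hz)
    rintro x ⟨⟨h1, _⟩, h2, _⟩
    have := h1 j
    have := h2 i
    show dt (ν i - ν j) x = _
    rw [dt_sub_left]; linarith

include hB in
lemma gv_cont (ν : κ → Fin n → ℝ) (hν : ∀ i, ∑ k, ν i k ^ 2 = 1) (t : ℝ) : Continuous fun b => gv B ν b t := by
  haveI := finB hB
  have e : ∀ b, gv B ν b t = ∫ x, (Pol ν b t).indicator (fun _ => (1:ℝ)) x ∂(volume.restrict B) := by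
    intro b
    rw [gv_eq hB, integral_indicator (Pol_closed ν b t).measurableSet]
    simp
  simp only [e]
  refine continuous_iff_continuousAt.2 fun b => ?_
  refine continuousAt_of_dominated (bound := fun _ => 1) ?_ ?_ (integrable_const _) ?_
  · exact Eventually.of_forall fun b => (measurable_const.indicator (Pol_closed ν b t).measurableSet).aestronglyMeasurable
  · refine Eventually.of_forall fun b => Eventually.of_forall fun x => ?_
    by_cases h : x ∈ Pol ν b t <;> simp [h]
  · have : ∀ᵐ x ∂(volume.restrict B), ∀ i, dt (ν i) x ≠ b i + t := by
      rw [ae_all_iff]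
      intro i
      refine ae_restrict_of_ae ?_
      have hne : ν i ≠ 0 := by
        intro h; have := hν i; rw [h] at this; simp at this
      have := hyper_null hne (b i + t)
      rw [ae_iff]; simpa using this
    filter_upwards [this] with x hx
    by_cases hxP : ∀ i, dt (ν i) x < b i + t
    · have : ∀ᶠ b' : κ → ℝ in 𝓝 b, ∀ i, dt (ν i) x < b' i + t := by
        rw [eventually_all]; intro i
        exact (continuousAt_const.eventually_lt (((continuous_apply i).add continuous_const).continuousAt : ContinuousAt (fun b' : κ → ℝ => b' i + t) b) (hxP i))
      refine ContinuousAt.congr (f := fun _ => (1:ℝ)) continuousAt_const ?_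
      filter_upwards [this] with b' hb'
      rw [indicator_of_mem (show x ∈ Pol ν b' t from fun i => (hb' i).le)]
    · push Not at hxP
      obtain ⟨i, hi⟩ := hxP
      have hi' : b i + t < dt (ν i) x := lt_of_le_of_ne hi (hx i).symm
      have : ∀ᶠ b' : κ → ℝ in 𝓝 b, b' i + t < dt (ν i) x :=
        ((((continuous_apply i).add continuous_const).continuousAt : ContinuousAt (fun b' : κ → ℝ => b' i + t) b).eventually_lt continuousAt_const hi')
      refine ContinuousAt.congr (f := fun _ => (0:ℝ)) continuousAt_const ?_
      filter_upwards [this] with b' hb'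
      rw [indicator_of_notMem (show x ∉ Pol ν b' t from fun h => by linarith [h i])]

section upd
variable [DecidableEq κ]
include hB in
lemma upd_upper (ν : κ → Fin n → ℝ) (b : κ → ℝ) (i : κ) {h : ℝ} (hh : 0 < h) :
    gv B ν (Function.update b i (b i + h)) 0 - gv B ν b 0 ≤ sl B ν b i 0 (0 + h) := by
  haveI := finB hB
  rw [gv_eq hB, gv_eq hB, sub_le_iff_le_add']
  refine le_trans (measureReal_mono ?_) (measureReal_union_le _ _)
  intro x hx
  by_cases hc : x ∈ Pol ν b 0
  · exact Or.inl hc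
  right
  have h1 : ∀ j, j ≠ i → dt (ν j) x ≤ b j := fun j hj => by have := hx j; simpa [Function.update_of_ne hj] using this
  have h2 : dt (ν i) x ≤ b i + h := by have := hx i; simpa using this
  have h3 : b i < dt (ν i) x := by
    by_contra h3
    push Not at h3
    refine hc fun j => ?_
    rw [add_zero]
    by_cases hj : j = i
    · rw [hj]; exact h3
    · exact h1 j hj
  refine ⟨fun j => ?_, by linarith, by linarith⟩
  by_cases hj : j = i
  · rw [hj]
  · linarith [h1 j hj]

include hB in
lemma upd_lower (ν : κ → Fin n → ℝ) (b : κ → ℝ) (i : κ) {t h : ℝ} (hh : 0 < h) :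
    sl B ν b i t (t + h) - ∑ j ∈ Finset.univ.erase i,
      (volume (B ∩ {x | b i + t < dt (ν i) x ∧ dt (ν i) x ≤ b i + t + h ∧ b j + t < dt (ν j) x ∧ dt (ν j) x ≤ b j + t + h})).toReal
    ≤ gv B ν (Function.update b i (b i + h)) t - gv B ν b t := by
  haveI := finB hB
  have e : ∀ S : Set (Fin n → ℝ), (volume (B ∩ S)).toReal = (volume.restrict B).real S := fun S => by
    rw [Measure.real, Measure.restrict_apply' hB.isClosed.measurableSet, inter_comm]
  simp only [e]
  have hsub : Pol ν b t ⊆ Pol ν (Function.update b i (b i + h)) t := by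
    intro x hx j
    by_cases hj : j = i
    · subst hj; simp; linarith [hx j]
    · rw [Function.update_of_ne hj]; exact hx j
  rw [gv_eq hB, gv_eq hB, ← measureReal_diff hsub (Pol_closed ν b t).measurableSet, sub_le_iff_le_add]
  refine le_trans (measureReal_mono ?_) ((measureReal_union_le _ _).trans (add_le_add_right (measureReal_biUnion_finset_le (Finset.univ.erase i) _) _))
  rintro x ⟨h1, h2, h3⟩
  by_cases hc : ∀ j, j ≠ i → dt (ν j) x ≤ b j + t
  · left
    refine ⟨fun j => ?_, fun hx => by linarith [hx i]⟩
    by_cases hj : j = i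
    · subst hj; simp; linarith
    · rw [Function.update_of_ne hj]; exact hc j hj
  · right
    push Not at hc
    obtain ⟨j, hj, hj2⟩ := hc
    simp only [mem_iUnion]
    exact ⟨j, Finset.mem_erase.2 ⟨hj, Finset.mem_univ _⟩, by linarith, by linarith, hj2, by linarith [h1 j]⟩
end upd

lemma two_slab_ev {B : Set (Fin n → ℝ)} (hB : IsCompact B) {a a' : Fin n → ℝ} (ha : ∑ k, a k ^ 2 = 1) (ha' : ∑ k, a' k ^ 2 = 1)
    (hne : a ≠ a') (p p' : ℝ) {η : ℝ} (hη : 0 < η) :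
    ∀ᶠ h in 𝓝[>] (0:ℝ),
      (volume (B ∩ {x | p < dt a x ∧ dt a x ≤ p + h ∧ p' < dt a' x ∧ dt a' x ≤ p' + h})).toReal ≤ η * h := by
  obtain ⟨C, h0, hC, hh0, H⟩ := two_slab hB ha ha' hne p p'
  have h1 : Ioc 0 (min h0 (η / (C + 1))) ∈ 𝓝[>] (0:ℝ) := Ioc_mem_nhdsGT (by positivity)
  filter_upwards [h1] with h hh
  have h2 : h ≤ η / (C + 1) := hh.2.trans (min_le_right _ _)
  rw [le_div_iff₀ (by positivity)] at h2
  refine (H h hh.1 (hh.2.trans (min_le_left _ _))).trans ?_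
  nlinarith [hh.1]
end Poly

end

section
set_option linter.all false
open Filter
open scoped Topology

namespace Poly
open Disc
variable {n : ℕ} {κ : Type} [Fintype κ]
variable {B : Set (Fin n → ℝ)} (hB : IsCompact B) (hconv : Convex ℝ B) (hv : 0 < volume B)

lemma gv_shift (ν : κ → Fin n → ℝ) (b : κ → ℝ) (s t : ℝ) : gv B ν (fun i => b i + s) t = gv B ν b (s + t) := by
  simp only [gv, Pol, add_assoc]

include hB in
/-- existence of the minimiser and the first order conditions -/
lemma exists_min (ν : κ → Fin n → ℝ) (hν : ∀ i, ∑ k, ν i k ^ 2 = 1) (hinj : Function.Injective ν)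
    (b : κ → ℝ) {δ ρ v w R0 : ℝ} (hδ : 0 < δ) (hb : w ≤ gv B ν b 0)
    (hJ : v - gv B ν b (-δ) - ρ * (v - gv B ν b 0) < 0) (hρ : 0 < ρ) :
    ∃ R', R0 ≤ R' ∧ ∃ c : κ → ℝ, (∀ i, c i ≤ R') ∧ w ≤ gv B ν c 0 ∧ v - gv B ν c (-δ) - ρ * (v - gv B ν c 0) < 0 ∧
      ∀ i, c i < R' → ∀ᶠ h in 𝓝[>] (0:ℝ), sl B ν c i (-δ) (-δ + h) ≤ ρ * sl B ν c i 0 (0 + h) ∧ 0 < sl B ν c i 0 (0 + h) := by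
  classical
  set R' := |R0| + ∑ i, |b i| with hR'
  have hbR : ∀ i, |b i| ≤ R' := fun i => by
    have := Finset.single_le_sum (f := fun i => |b i|) (fun i _ => abs_nonneg _) (Finset.mem_univ i)
    have h2 := abs_nonneg R0
    linarith
  have hR0 : 0 ≤ R' := by positivity
  set J : (κ → ℝ) → ℝ := fun c => v - gv B ν c (-δ) - ρ * (v - gv B ν c 0) with hJd
  have hJc : Continuous J := by
    have h1 := gv_cont hB ν hν (-δ)
    have h2 := gv_cont hB ν hν 0
    rw [hJd]; fun_prop
  set N : ℝ := ∑ i, (R' - b i) with hN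
  have hN0 : 0 ≤ N := Finset.sum_nonneg fun i _ => by linarith [(abs_le.1 (hbR i)).2]
  have hJb : J b < 0 := hJ
  set ε := - J b / (2 * (N + 1)) with hε
  have hεp : 0 < ε := by
    have : 0 < - J b := by linarith
    positivity
  have hεN : ε * N < - J b := by
    have h1 : ε * (N + 1) = - J b / 2 := by rw [hε]; field_simp
    nlinarith
  set Je : (κ → ℝ) → ℝ := fun c => J c + ε * ∑ i, (R' - c i) with hJe
  have hJec : Continuous Je := by rw [hJe]; fun_prop
  set K : Set (κ → ℝ) := Icc (fun _ => -R') (fun _ => R') ∩ {c | w ≤ gv B ν c 0} with hK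
  have hKc : IsCompact K := isCompact_Icc.inter_right (isClosed_le continuous_const (gv_cont hB ν hν 0))
  have hbK : b ∈ K := ⟨⟨fun i => (abs_le.1 (hbR i)).1, fun i => (abs_le.1 (hbR i)).2⟩, hb⟩
  obtain ⟨c, hcK, hcm⟩ := hKc.exists_isMinOn ⟨b, hbK⟩ hJec.continuousOn
  have hcb : Je c ≤ Je b := hcm hbK
  have hSc : 0 ≤ ε * ∑ i, (R' - c i) := mul_nonneg hεp.le (Finset.sum_nonneg fun i _ => by linarith [hcK.1.2 i])
  refine ⟨R', by have := le_abs_self R0; have : 0 ≤ ∑ i, |b i| := by positivity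
                 linarith, c, hcK.1.2, hcK.2, ?_, ?_⟩
  · have : J c < 0 := by
      simp only [hJe] at hcb
      rw [← hN] at hcb; linarith
    exact this
  intro i hi
  have hE1 : ∀ᶠ h in 𝓝[>] (0:ℝ), h ∈ Ioc 0 (R' - c i) := Ioc_mem_nhdsGT (by linarith)
  set η := ε / (2 * (Fintype.card κ + 1)) with hη
  have hηp : 0 < η := by positivity
  have hE2 : ∀ᶠ h in 𝓝[>] (0:ℝ), ∀ j, j ≠ i → (volume (B ∩ {x | c i + -δ < dt (ν i) x ∧ dt (ν i) x ≤ c i + -δ + h ∧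
      c j + -δ < dt (ν j) x ∧ dt (ν j) x ≤ c j + -δ + h})).toReal ≤ η * h := by
    rw [eventually_all]; intro j
    by_cases hj : j = i
    · exact Eventually.of_forall fun h hh => absurd hj hh
    · filter_upwards [two_slab_ev hB (hν i) (hν j) (hinj.ne (Ne.symm hj)) (c i + -δ) (c j + -δ) hηp] with h hh _
      exact hh
  filter_upwards [hE1, hE2] with h hh1 hh2
  have hhp := hh1.1
  set u := Function.update c i (c i + h) with hu
  have hu0 : sl B ν c i 0 (0 + h) ≥ gv B ν u 0 - gv B ν c 0 := upd_upper hB ν c i hhp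
  have hcu : gv B ν c 0 ≤ gv B ν u 0 := by
    haveI := finB hB
    rw [gv_eq hB, gv_eq hB]
    refine measureReal_mono ?_
    intro x hx j
    by_cases hj : j = i
    · subst hj; rw [hu]; simp; linarith [hx j]
    · rw [hu, Function.update_of_ne hj]; exact hx j
  have huK : u ∈ K := by
    refine ⟨⟨fun j => ?_, fun j => ?_⟩, le_trans hcK.2 hcu⟩
    · by_cases hj : j = i
      · subst hj; rw [hu]; simp; linarith [hcK.1.1 j]
      · rw [hu, Function.update_of_ne hj]; exact hcK.1.1 j
    · by_cases hj : j = i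
      · subst hj; rw [hu]; simp; linarith [hh1.2]
      · rw [hu, Function.update_of_ne hj]; exact hcK.1.2 j
  have hmin : Je c ≤ Je u := hcm huK
  have hsum : ∑ j, (R' - u j) = ∑ j, (R' - c j) - h := by
    have : ∀ j, R' - u j = (R' - c j) - (if j = i then h else 0) := by
      intro j
      by_cases hj : j = i
      · subst hj; rw [hu]; simp; ring
      · rw [hu, Function.update_of_ne hj]; simp [hj]
    simp only [this, Finset.sum_sub_distrib]; simp
  have hmin2 : (gv B ν u (-δ) - gv B ν c (-δ)) + ε * h ≤ ρ * (gv B ν u 0 - gv B ν c 0) := by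
    simp only [hJe, hJd, hsum] at hmin
    linarith
  have hlow := upd_lower hB ν c i (t := -δ) hhp
  have hsl : ∑ j ∈ Finset.univ.erase i,
      (volume (B ∩ {x | c i + -δ < dt (ν i) x ∧ dt (ν i) x ≤ c i + -δ + h ∧ c j + -δ < dt (ν j) x ∧ dt (ν j) x ≤ c j + -δ + h})).toReal
      ≤ ε * h / 2 := by
    calc _ ≤ ∑ j ∈ Finset.univ.erase i, η * h := Finset.sum_le_sum fun j hj => hh2 j (Finset.ne_of_mem_erase hj)
      _ ≤ ∑ j : κ, η * h := Finset.sum_le_sum_of_subset_of_nonneg (Finset.erase_subset _ _) fun _ _ _ => by positivity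
      _ = (Fintype.card κ : ℝ) * (η * h) := by simp
      _ ≤ (Fintype.card κ + 1) * (η * h) := by gcongr; linarith
      _ = _ := by rw [hη]; field_simp
  have hfin : sl B ν c i (-δ) (-δ + h) + ε * h / 2 ≤ ρ * sl B ν c i 0 (0 + h) := by
    have := mul_le_mul_of_nonneg_left hu0 hρ.le
    linarith
  have hεh : 0 < ε * h := by positivity
  refine ⟨by linarith, ?_⟩
  by_contra hneg
  have h0 := sl_nonneg (B := B) ν c i (-δ) (-δ + h)
  push Not at hneg
  have := mul_nonpos_of_nonneg_of_nonpos hρ.le hneg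
  linarith

lemma exists_radius (hB : IsCompact B) (ν : κ → Fin n → ℝ) : ∃ R : ℝ, 0 < R ∧ ∀ x ∈ B, ∀ i, |dt (ν i) x| ≤ R := by
  have : ∀ i, ∃ R, ∀ x ∈ B, |dt (ν i) x| ≤ R := by
    intro i
    obtain ⟨R, hR⟩ := hB.exists_bound_of_continuousOn (dt_cont (ν i)).continuousOn
    exact ⟨R, fun x hx => by simpa using hR x hx⟩
  choose R hR using this
  refine ⟨1 + ∑ i, |R i|, by positivity, fun x hx i => ?_⟩
  have h1 := Finset.single_le_sum (f := fun i => |R i|) (fun i _ => abs_nonneg _) (Finset.mem_univ i)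
  have h2 := hR i x hx
  have h3 := le_abs_self (R i)
  linarith

include hB hconv hv in
theorem ct_small [Nonempty κ] (hn : 2 ≤ n) (h1 : ∀ i, ∫ x in B, x i = 0)
    (h2 : ∀ i j, ∫ x in B, x i * x j = if i = j then (volume B).toReal else 0)
    (ν : κ → Fin n → ℝ) (hν : ∀ i, ∑ k, ν i k ^ 2 = 1) (hinj : Function.Injective ν) (b : κ → ℝ) {δ : ℝ} (hδ : 0 < δ) (hδ1 : δ ≤ 1)
    (hb : (volume B).toReal / 2 ≤ gv B ν b 0) :
    (1 + δ / (42 * rr n)) * ((volume B).toReal - gv B ν b 0) ≤ (volume B).toReal - gv B ν b (-δ) := by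
  set v := (volume B).toReal with hvd
  have hvp : 0 < v := ENNReal.toReal_pos hv.ne' hB.measure_lt_top.ne
  have hr := rr_ge hn
  set c0 := δ / (42 * rr n) with hc0
  have hc0p : 0 < c0 := by positivity
  have hc01 : c0 ≤ 1 := by rw [hc0, div_le_one (by positivity)]; linarith
  by_contra hcon
  push Not at hcon
  obtain ⟨R, hR, hRB⟩ := exists_radius hB ν
  obtain ⟨R', hR', c, hcR, hcv, hJ, hfo⟩ := exists_min (R0 := 5 * R + 5) hB ν hν hinj b (v := v) (w := v / 2) (ρ := 1 + c0) hδ hb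
    (by linarith) (by positivity)
  -- choose a common slab width
  have hall : ∀ᶠ h in 𝓝[>] (0:ℝ), ∀ i, c i < R' → sl B ν c i (-δ) (-δ + h) ≤ (1 + c0) * sl B ν c i 0 (0 + h) ∧ 0 < sl B ν c i 0 (0 + h) := by
    rw [eventually_all]; intro i
    by_cases hi : c i < R'
    · filter_upwards [hfo i hi] with h hh _ using hh
    · exact Eventually.of_forall fun h hh => absurd hh hi
  have htend : Tendsto (fun M : ℕ => δ / ((M + 1 : ℕ) : ℝ)) atTop (𝓝[>] 0) := by
    refine tendsto_nhdsWithin_iff.2 ⟨?_, Eventually.of_forall fun M => mem_Ioi.2 (div_pos hδ (Nat.cast_pos.2 (Nat.succ_pos M)))⟩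
    exact (tendsto_const_div_atTop_nhds_zero_nat δ).comp (tendsto_add_atTop_nat 1)
  obtain ⟨M, hM⟩ := (htend.eventually hall).exists
  have hgle : ∀ t, gv B ν c t ≤ v := fun t => ENNReal.toReal_mono hB.measure_lt_top.ne (measure_mono inter_subset_left)
  set G : ℕ → ℝ := fun k => v - gv B ν c (-(k * δ)) with hG
  have hG0 : G 0 ≤ v / 2 := by simp only [hG]; simp; linarith
  have hJ0 : G 1 - (1 + c0) * G 0 < 0 := by simp only [hG]; simpa using hJ
  -- layers
  have hL : ∀ k : ℕ, G (k + 1) - G k = ∑ i, sl B ν c i (-((k + 1) * δ)) (-(k * δ)) := by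
    intro k
    rw [← layer hB ν hinj c (by nlinarith)]
    simp only [hG]; push_cast; ring
  have hstep : ∀ k : ℕ, ((k + 2) * δ ≤ R' - R) → G (k + 2) - G (k + 1) ≤ (1 + c0) * (G (k + 1) - G k) := by
    intro k hk
    have e1 := hL (k + 1)
    rw [show k + 1 + 1 = k + 2 from rfl] at e1
    rw [e1, hL k, Finset.mul_sum]
    refine Finset.sum_le_sum fun i _ => ?_
    rcases lt_or_ge (c i) R' with hi | hi
    · have := sl_step hB hconv ν c i hδ (Nat.succ_pos M) (hM i hi).1 (hM i hi).2 (s := -((k + 1) * δ)) (by nlinarith [Nat.cast_nonneg (α := ℝ) k])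
      have ea : -((k + 1) * δ) - δ = -((((k + 1 : ℕ):ℝ) + 1) * δ) := by push_cast; ring
      have eb : -((k + 1) * δ) + δ = -(k * δ) := by ring
      rw [ea, eb] at this
      push_cast at this ⊢
      exact this
    · have : sl B ν c i (-((((k + 1 : ℕ):ℝ) + 1) * δ)) (-(((k + 1 : ℕ):ℝ) * δ)) = 0 := by
        rw [sl, Measure.real, Measure.restrict_apply' hB.isClosed.measurableSet]
        have : cell ν c i ∩ slb ν c i (-((((k + 1 : ℕ):ℝ) + 1) * δ)) (-(((k + 1 : ℕ):ℝ) * δ)) ∩ B = ∅ := by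
          rw [eq_empty_iff_forall_notMem]
          rintro x ⟨⟨_, hx, _⟩, hxB⟩
          have h3 := (abs_le.1 (hRB x hxB i)).2
          push_cast at hx
          linarith
        rw [this]; simp
      rw [this]
      exact mul_nonneg (by linarith) (sl_nonneg _ _ _ _ _)
  have hind : ∀ k : ℕ, ((k + 1) * δ ≤ R' - R) → G (k + 1) - (1 + c0) * G k < 0 := by
    intro k
    induction k with
    | zero => intro _; exact hJ0
    | succ k ih =>
      intro hk
      push_cast at hk
      have h3 := ih (by linarith)
      have h4 := hstep k (by linarith)
      rw [show k + 1 + 1 = k + 2 from rfl]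
      linarith
  -- find the crossing
  have hGk : 0 < G 0 := by
    by_contra h
    push Not at h
    have h5 : G 0 = 0 := le_antisymm h (by simp only [hG]; linarith [hgle (-((0:ℕ) * δ))])
    have h6 : 0 ≤ G 1 := by simp only [hG]; linarith [hgle (-((1:ℕ) * δ))]
    rw [h5] at hJ0; linarith
  have hex : ∃ i, c i < R := by
    by_contra h
    push Not at h
    have : B ∩ Pol ν c (-((0:ℕ) * δ)) = B := by
      refine inter_eq_left.2 fun x hx i => ?_
      have h3 := (abs_le.1 (hRB x hx i)).2
      simp; linarith [h i]
    simp only [hG, gv, this] at hGk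
    linarith
  obtain ⟨i0, hi0⟩ := hex
  set K := ⌈2 * R / δ⌉₊ with hK
  have hK1 : 2 * R ≤ K * δ := by
    have := Nat.le_ceil (2 * R / δ)
    rwa [div_le_iff₀ hδ] at this
  have hK2 : K * δ ≤ 2 * R + 1 := by
    have := Nat.ceil_lt_add_one (by positivity : 0 ≤ 2 * R / δ)
    rw [← hK] at this
    have h7 := mul_le_mul_of_nonneg_right this.le hδ.le
    rw [add_mul, div_mul_cancel₀ _ hδ.ne'] at h7
    linarith
  have hGK : G K = v := by
    have : B ∩ Pol ν c (-(K * δ)) = ∅ := by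
      rw [eq_empty_iff_forall_notMem]
      rintro x ⟨hx, hx'⟩
      have h3 := (abs_le.1 (hRB x hx i0)).1
      linarith [hx' i0]
    simp only [hG, gv, this]; simp
  have hPex : ∃ k, v / 2 < G k := ⟨K, by rw [hGK]; linarith⟩
  classical
  set k1 := Nat.find hPex with hk1
  have hk1s : v / 2 < G k1 := Nat.find_spec hPex
  have hk1K : k1 ≤ K := Nat.find_min' hPex (by rw [hGK]; linarith)
  have hk10 : k1 ≠ 0 := by
    intro h; rw [h] at hk1s; linarith
  obtain ⟨k, hk⟩ := Nat.exists_eq_succ_of_ne_zero hk10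
  have hGkk : G k ≤ v / 2 := by
    have := Nat.find_min hPex (show k < Nat.find hPex by rw [← hk1, hk]; exact Nat.lt_succ_self k)
    linarith
  rw [hk] at hk1s hk1K
  have hkK : ((k:ℝ) + 1) * δ ≤ R' - R := by
    have : ((k.succ:ℕ):ℝ) ≤ K := by exact_mod_cast hk1K
    push_cast at this
    nlinarith
  have hfin := hind k hkK
  have hk1s' : v / 2 < G (k + 1) := hk1s
  have hG4 : v / 4 ≤ G k := by nlinarith [hgle 0]
  have hbulk := bulk hB hconv hv hn h1 h2 ν hν (fun i => c i + -(k * δ)) hδ hδ1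
    (by rw [gv_shift, add_zero, ← hvd]; simp only [hG] at hG4; linarith)
  rw [gv_shift, gv_shift, add_zero, ← hc0, show -(k * δ) + -δ = -(((k + 1 : ℕ):ℝ) * δ) by push_cast; ring] at hbulk
  have e1 : gv B ν c (-(k * δ)) = v - G k := by simp only [hG]; ring
  have e2 : gv B ν c (-(((k + 1 : ℕ):ℝ) * δ)) = v - G (k + 1) := by simp only [hG]; ring
  rw [e1, e2] at hbulk
  nlinarith

include hB hconv hv in
/-- Polytope version of isoperimetry: layer estimate. -/
theorem CT [Nonempty κ] (hn : 2 ≤ n) (h1 : ∀ i, ∫ x in B, x i = 0)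
    (h2 : ∀ i j, ∫ x in B, x i * x j = if i = j then (volume B).toReal else 0)
    (ν : κ → Fin n → ℝ) (hν : ∀ i, ∑ k, ν i k ^ 2 = 1) (hinj : Function.Injective ν) (b : κ → ℝ) {δ : ℝ} (hδ : 0 < δ) (hδ1 : δ ≤ 1) :
    δ / (42 * rr n) * min (gv B ν b 0) ((volume B).toReal - gv B ν b 0) ≤ gv B ν b 0 - gv B ν b (-δ) := by
  have hr := rr_ge hn
  have hc0p : 0 < δ / (42 * rr n) := by positivity
  rcases le_total ((volume B).toReal / 2) (gv B ν b 0) with h | h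
  · have := ct_small hB hconv hv hn h1 h2 ν hν hinj b hδ hδ1 h
    have h3 := mul_le_mul_of_nonneg_left (min_le_right (gv B ν b 0) ((volume B).toReal - gv B ν b 0)) hc0p.le
    linarith
  · have hvp : 0 ≤ (volume B).toReal := ENNReal.toReal_nonneg
    have := bulk hB hconv hv hn h1 h2 ν hν b hδ hδ1 (by linarith)
    have h3 := mul_le_mul_of_nonneg_left (min_le_left (gv B ν b 0) ((volume B).toReal - gv B ν b 0)) hc0p.le
    linarith
end Poly

end

section
set_option linter.all false
open Filter
open scoped Topology

namespace Geo
open Measure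

/-- The prism over a subset of a hyperplane. -/
def prism {m : ℕ} (ν : EuclideanSpace ℝ (Fin (m+1))) (c : ℝ) (S : Set (EuclideanSpace ℝ (Fin (m+1)))) (a b : ℝ) :
    Set (EuclideanSpace ℝ (Fin (m+1))) :=
  {x | x - (⟪ν, x⟫ - c) • ν ∈ S ∧ ⟪ν, x⟫ - c ∈ Ioc a b}

lemma meas_prism {m : ℕ} (ν : EuclideanSpace ℝ (Fin (m+1))) (c : ℝ) {S : Set (EuclideanSpace ℝ (Fin (m+1)))}
    (hS : MeasurableSet S) (a b : ℝ) : MeasurableSet (prism ν c S a b) := by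
  have h1 : Measurable (fun x : EuclideanSpace ℝ (Fin (m+1)) => x - (⟪ν, x⟫ - c) • ν) := by
    apply Continuous.measurable; fun_prop
  have h2 : Measurable (fun x : EuclideanSpace ℝ (Fin (m+1)) => ⟪ν, x⟫ - c) := by
    apply Continuous.measurable; fun_prop
  exact (h1 hS).inter (h2 measurableSet_Ioc)

theorem vol_prism {m : ℕ} (ν : EuclideanSpace ℝ (Fin (m+1))) (hν : ‖ν‖ = 1) (c : ℝ)
    {S : Set (EuclideanSpace ℝ (Fin (m+1)))}
    (hS : MeasurableSet S) (hSc : ∀ z ∈ S, ⟪ν, z⟫ = c) (a b : ℝ) :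
    volume (prism ν c S a b) = ENNReal.ofReal (b - a) * μHE[m] S := by
  classical
  obtain ⟨B, hB⟩ := Orthonormal.exists_orthonormalBasis_extension_of_card_eq (𝕜 := ℝ)
    (E := EuclideanSpace ℝ (Fin (m+1))) (ι := Fin (m+1)) (by simp) (v := fun _ => ν) (s := {0}) (by
      rw [orthonormal_iff_ite]
      rintro ⟨i, hi⟩ ⟨j, hj⟩
      simp only [mem_singleton_iff] at hi hj
      subst hi; subst hj
      simp [hν])
  have hB0 : B 0 = ν := hB 0 rfl
  let e1 : ℝ × EuclideanSpace ℝ (Fin m) → ℝ × (Fin m → ℝ) := Prod.map (fun s => c + s) WithLp.ofLp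
  have he1 : MeasurePreserving e1 volume volume :=
    (measurePreserving_add_left volume c).prod (PiLp.volume_preserving_ofLp (Fin m))
  let e2 := (MeasurableEquiv.piFinSuccAbove (fun _ : Fin (m+1) => ℝ) 0).symm
  have he2 : MeasurePreserving e2 volume volume :=
    (volume_preserving_piFinSuccAbove (fun _ : Fin (m+1) => ℝ) 0).symm _
  have he3 := PiLp.volume_preserving_toLp (Fin (m+1))
  have he4 := B.measurePreserving_repr_symm
  let Ψ : ℝ × EuclideanSpace ℝ (Fin m) → EuclideanSpace ℝ (Fin (m+1)) :=
    fun p => B.repr.symm (WithLp.toLp 2 (e2 (e1 p)))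
  have hΨ : MeasurePreserving Ψ volume volume := he4.comp (he3.comp (he2.comp he1))
  have hrep : ∀ p, B.repr (Ψ p) = WithLp.toLp 2 (Fin.cons (c + p.1) p.2.ofLp) := by
    intro p
    simp only [Ψ, LinearIsometryEquiv.apply_symm_apply]
    congr 1
    simp only [e2, e1, MeasurableEquiv.piFinSuccAbove, Prod.map]
    ext i
    refine Fin.cases ?_ (fun i => ?_) i <;> simp
  have hin : ∀ p, ⟪ν, Ψ p⟫ = c + p.1 := by
    intro p
    rw [← hB0, ← B.repr_apply_apply, hrep]; simp
  have hpr : ∀ s y, Ψ (s, y) - s • ν = Ψ (0, y) := by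
    intro s y
    apply B.repr.injective
    rw [map_sub, map_smul, hrep, hrep, ← hB0, B.repr_self]
    ext i
    refine Fin.cases ?_ (fun i => ?_) i <;> simp
  have hiso : Isometry (fun y => Ψ (0, y)) := by
    apply Isometry.of_dist_eq
    intro y y'
    rw [← B.repr.dist_map, hrep, hrep, EuclideanSpace.dist_eq, EuclideanSpace.dist_eq]
    simp [Fin.sum_univ_succ]
  have hsub : S ⊆ range (fun y => Ψ (0, y)) := by
    intro z hz
    refine ⟨WithLp.toLp 2 (fun i => B.repr z i.succ), ?_⟩
    apply B.repr.injective
    beta_reduce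
    rw [hrep]
    ext i
    refine Fin.cases ?_ (fun i => ?_) i
    · simp only [B.repr_apply_apply, hB0, hSc z hz]; simp
    · simp
  rw [← hΨ.measure_preimage (meas_prism ν c hS a b).nullMeasurableSet]
  have : Ψ ⁻¹' (prism ν c S a b) = Ioc a b ×ˢ ((fun y => Ψ (0, y)) ⁻¹' S) := by
    ext ⟨s, y⟩
    simp only [prism, mem_preimage, mem_setOf_eq, hin, mem_prod, add_sub_cancel_left, hpr]
    tauto
  rw [this, Measure.volume_eq_prod, Measure.prod_prod, Real.volume_Ioc,
    ← EuclideanSpace.euclideanHausdorffMeasure_eq_volume, hiso.euclideanHausdorffMeasure_preimage,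
    inter_eq_self_of_subset_left hsub]

/-- nearest point projection does not increase Hausdorff measure -/
theorem proj_le {V : Type*} [NormedAddCommGroup V] [InnerProductSpace ℝ V] [MeasurableSpace V] [BorelSpace V]
    {m : ℕ} {P S W : Set V} (hS : S ⊆ P)
    (h : ∀ z ∈ S, ∃ w ∈ W, ∀ p ∈ P, ⟪w - z, p - z⟫ ≤ 0) : μHE[m] S ≤ μHE[m] W := by
  classical
  let W' : Set V := {w ∈ W | ∃ z ∈ S, ∀ p ∈ P, ⟪w - z, p - z⟫ ≤ 0}
  let f : V → V := fun w => if hw : ∃ z ∈ S, ∀ p ∈ P, ⟪w - z, p - z⟫ ≤ 0 then hw.choose else 0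
  have hf : ∀ w ∈ W', f w ∈ S ∧ ∀ p ∈ P, ⟪w - f w, p - f w⟫ ≤ 0 := by
    intro w hw
    have := hw.2
    simp only [f, dif_pos this]
    exact this.choose_spec
  have key : ∀ w w' z z' : V, ⟪w - z, z' - z⟫ ≤ 0 → ⟪w' - z', z - z'⟫ ≤ 0 → ‖z - z'‖ ≤ ‖w - w'‖ := by
    intro w w' z z' h1 h2
    have h3 : ‖z - z'‖ * ‖z - z'‖ ≤ ‖w - w'‖ * ‖z - z'‖ := by
      refine le_trans ?_ (real_inner_le_norm (w - w') (z - z'))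
      rw [← real_inner_self_eq_norm_mul_norm]
      have e1 : w - w' = (w - z) - (w' - z') + (z - z') := by abel
      have e2 : z' - z = -(z - z') := by abel
      rw [e2, inner_neg_right] at h1
      rw [e1, inner_add_left, inner_sub_left (w - z) (w' - z')]
      linarith
    by_contra hc
    push Not at hc
    nlinarith [norm_nonneg (w - w')]
  have hlip : LipschitzOnWith 1 f W' := by
    apply LipschitzOnWith.of_dist_le_mul
    intro w hw w' hw'
    rw [dist_eq_norm, dist_eq_norm, NNReal.coe_one, one_mul]
    exact key _ _ _ _ ((hf w hw).2 _ (hS (hf w' hw').1)) ((hf w' hw').2 _ (hS (hf w hw).1))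
  have hSim : S ⊆ f '' W' := by
    intro z hz
    obtain ⟨w, hw, hp⟩ := h z hz
    have hw' : w ∈ W' := ⟨hw, z, hz, hp⟩
    refine ⟨w, hw', ?_⟩
    have := key w w z (f w) (hp _ (hS (hf w hw').1)) ((hf w hw').2 _ (hS hz))
    rw [sub_self, norm_zero] at this
    have := norm_le_zero_iff.1 this
    exact (sub_eq_zero.1 this).symm
  have hh := hlip.hausdorffMeasure_image_le (d := (m:ℝ)) (by positivity)
  simp only [ENNReal.coe_one, ENNReal.one_rpow, one_mul] at hh
  have h2 : μH[(m:ℝ)] S ≤ μH[(m:ℝ)] W :=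
    (measure_mono hSim).trans (hh.trans (measure_mono (fun w hw => hw.1)))
  rw [euclideanHausdorffMeasure_def]
  simp only [Measure.smul_apply]
  gcongr
end Geo

end

section
set_option linter.all false
open Filter
open scoped Topology

namespace Geo
open Measure

section
variable {V : Type*} [NormedAddCommGroup V] [InnerProductSpace ℝ V] [FiniteDimensional ℝ V]

/-- The polyhedron `{x | ⟪ν i, x⟫ ≤ b i}`. -/
def PolE {κ : Type*} (ν : κ → V) (b : κ → ℝ) : Set V := {x | ∀ i, ⟪ν i, x⟫ ≤ b i}

lemma closed_PolE {κ : Type*} (ν : κ → V) (b : κ → ℝ) : IsClosed (PolE ν b) := by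
  simp only [PolE, setOf_forall]
  exact isClosed_iInter (fun i => isClosed_le (by fun_prop) (by fun_prop))

lemma exit_pt {E : Set V} {z u : V} (hz : z ∈ E) {T : ℝ} (hT : 0 ≤ T) (hx : z + T • u ∉ E) :
    ∃ s, 0 ≤ s ∧ s ≤ T ∧ z + s • u ∈ frontier E := by
  have hpc : IsPreconnected ((fun s : ℝ => z + s • u) '' Icc 0 T) :=
    isPreconnected_Icc.image _ (by fun_prop)
  by_contra hcon
  push Not at hcon
  have hno : ∀ s ∈ Icc 0 T, z + s • u ∈ interior E ∨ z + s • u ∈ (closure E)ᶜ := by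
    intro s hs
    have h1 := hcon s hs.1 hs.2
    by_contra h2
    push Not at h2
    exact h1 ⟨not_not.1 h2.2, h2.1⟩
  obtain ⟨y, hy, h1, h2⟩ := hpc (interior E) (closure E)ᶜ isOpen_interior isClosed_closure.isOpen_compl
    (by rintro _ ⟨s, hs, rfl⟩; exact hno s hs)
    ⟨z, ⟨0, ⟨le_rfl, hT⟩, by simp⟩, by
      have := hno 0 ⟨le_rfl, hT⟩
      simp only [zero_smul, add_zero] at this
      exact this.resolve_right (fun h => h (subset_closure hz))⟩
    ⟨_, ⟨T, ⟨hT, le_rfl⟩, rfl⟩, (hno T ⟨hT, le_rfl⟩).resolve_left (fun h => hx (interior_subset h))⟩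
  exact h2 (subset_closure (interior_subset h1))

/-- unit supporting normal -/
lemma support {E : Set V} (hc : Convex ℝ E) (hi : (interior E).Nonempty) {y : V} (hy : y ∉ interior E) :
    ∃ u : V, ‖u‖ = 1 ∧ ∀ x ∈ E, ⟪u, x⟫ ≤ ⟪u, y⟫ := by
  obtain ⟨f, hf⟩ := geometric_hahn_banach_open_point hc.interior isOpen_interior hy
  let w := (InnerProductSpace.toDual ℝ V).symm f
  have hw : ∀ x, ⟪w, x⟫ = f x := fun x => InnerProductSpace.toDual_symm_apply
  have hw0 : w ≠ 0 := by
    intro h0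
    obtain ⟨a, ha⟩ := hi
    have := hf a ha
    rw [← hw, ← hw, h0] at this
    simp at this
  have hle : ∀ x ∈ E, f x ≤ f y := by
    intro x hx
    have hx' : x ∈ closure (interior E) := by
      rw [hc.closure_interior_eq_closure_of_nonempty_interior hi]; exact subset_closure hx
    have : closure (interior E) ⊆ {x | f x ≤ f y} :=
      closure_minimal (fun a ha => (hf a ha).le) (isClosed_le f.continuous continuous_const)
    exact this hx'
  refine ⟨‖w‖⁻¹ • w, ?_, ?_⟩
  · rw [norm_smul, norm_inv, norm_norm, inv_mul_cancel₀ (norm_ne_zero_iff.2 hw0)]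
  · intro x hx
    rw [real_inner_smul_left, real_inner_smul_left, hw, hw]
    have := hle x hx
    gcongr

lemma frontier_ne [Nontrivial V] {E : Set V} (hE : IsCompact E) (hne : E.Nonempty) : (frontier E).Nonempty := by
  rw [nonempty_iff_ne_empty]
  intro h
  have : IsClopen E := isClopen_iff_frontier_eq_empty.2 h
  rcases isClopen_iff.1 this with h | h
  · exact hne.ne_empty h
  · exact (noncompact_univ V) (h ▸ hE)

theorem poly_approx [Nontrivial V] {E : Set V} (hE : IsCompact E) (hc : Convex ℝ E) {ρ : ℝ} (hρ : 0 < ρ)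
    (hb : ball 0 ρ ⊆ E) {η : ℝ} (hη : 0 < η) :
    ∃ (s : Finset V) (b : s → ℝ), Nonempty s ∧ (∀ i : s, ‖(i : V)‖ = 1) ∧
      (∀ i, ρ ≤ (1 + η) * b i) ∧
      PolE (fun i : s => (i : V)) b ⊆ E ∧ (∀ x ∈ E, ∀ i : s, ⟪(i : V), x⟫ ≤ (1 + η) * b i) ∧
      ∀ i : s, ∃ x ∈ E, ⟪(i : V), x⟫ = (1 + η) * b i := by
  classical
  have h0i : (0 : V) ∈ interior E := interior_maximal hb isOpen_ball (mem_ball_self hρ)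
  have hi : (interior E).Nonempty := ⟨0, h0i⟩
  let h : V → ℝ := fun u => sSup ((fun x => ⟪u, x⟫) '' E)
  have hbd : ∀ u, BddAbove ((fun x => ⟪u, x⟫) '' E) := fun u =>
    (hE.image (by fun_prop)).bddAbove
  have hle : ∀ u, ∀ x ∈ E, ⟪u, x⟫ ≤ h u := fun u x hx => le_csSup (hbd u) ⟨x, hx, rfl⟩
  have hρh : ∀ u : V, ‖u‖ = 1 → ρ ≤ h u := by
    intro u hu
    apply le_of_forall_lt
    intro r hr
    by_cases hr0 : r < 0
    · refine hr0.trans_le ?_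
      have := hle u 0 (interior_subset h0i)
      simpa using this
    · push Not at hr0
      have hr2 : (r + ρ) / 2 < ρ := by linarith
      have := hle u (((r + ρ) / 2) • u) (hb (by
        rw [mem_ball_zero_iff, norm_smul, hu, mul_one, Real.norm_eq_abs, abs_of_nonneg (by linarith)]
        exact hr2))
      rw [real_inner_smul_right, real_inner_self_eq_norm_sq, hu] at this
      linarith
  have hK : IsCompact (frontier E) := hE.of_isClosed_subset isClosed_frontier hE.isClosed.frontier_subset
  obtain ⟨s, hs⟩ := hK.elim_finite_subcover
    (fun u : {u : V // ‖u‖ = 1} => {x : V | h u < (1 + η) * ⟪(u : V), x⟫})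
    (fun u => isOpen_lt (by fun_prop) (by fun_prop)) (by
      intro y hy
      obtain ⟨u, hu, hux⟩ := support hc hi (y := y) hy.2
      have h1 : h u = ⟪u, y⟫ := le_antisymm
        (csSup_le ⟨_, ⟨0, interior_subset h0i, rfl⟩⟩ (by rintro _ ⟨x, hx, rfl⟩; exact hux x hx))
        (hle u y (hE.isClosed.frontier_subset hy))
      simp only [mem_iUnion, mem_setOf_eq]
      refine ⟨⟨u, hu⟩, ?_⟩
      have := hρh u hu
      simp only
      rw [h1] at this ⊢
      nlinarith)
  have hs1 : ∀ i ∈ s.image Subtype.val, ‖i‖ = 1 := by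
    intro i hi
    obtain ⟨u, _, rfl⟩ := Finset.mem_image.1 hi
    exact u.2
  refine ⟨s.image Subtype.val, fun i => h i / (1 + η), ?_, fun i => hs1 i i.2, ?_, ?_, ?_, ?_⟩
  · obtain ⟨y, hy⟩ := frontier_ne hE ⟨0, interior_subset h0i⟩
    have := hs hy
    simp only [mem_iUnion] at this
    obtain ⟨u, hu, _⟩ := this
    exact ⟨⟨u, Finset.mem_image_of_mem _ hu⟩⟩
  · intro i
    rw [mul_div_cancel₀ _ (by linarith)]
    exact hρh i (hs1 i i.2)
  · intro x hx
    by_contra hxE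
    obtain ⟨l, hl0, hl1, hl⟩ := exit_pt (E := E) (z := 0) (u := x) (T := 1) (interior_subset h0i) zero_le_one
      (by simpa using hxE)
    rw [zero_add] at hl
    have := hs hl
    simp only [mem_iUnion, mem_setOf_eq] at this
    obtain ⟨u, hu, hu2⟩ := this
    have h3 := hx ⟨u, Finset.mem_image_of_mem _ hu⟩
    simp only at h3
    rw [le_div_iff₀ (by linarith)] at h3
    rw [real_inner_smul_right] at hu2
    have h4 := hρh u u.2
    have h5 : 0 < (1 + η) * ⟪(u : V), x⟫ := by
      by_contra hcon
      push Not at hcon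
      have := mul_nonpos_of_nonneg_of_nonpos hl0 hcon
      linarith
    nlinarith
  · intro x hx i
    rw [mul_div_cancel₀ _ (by linarith)]
    exact hle i x hx
  · intro i
    rw [mul_div_cancel₀ _ (by linarith)]
    exact (hE.image (f := fun x => ⟪(i : V), x⟫) (by fun_prop)).sSup_mem ⟨_, 0, interior_subset h0i, rfl⟩
end
end Geo

end

section
set_option linter.all false
open Filter
open scoped Topology

namespace Geo
open Measure

lemma pow_lim {n : ℕ} {A v : ℝ} (h : ∀ s : ℝ, 0 < s → s * A ≤ ((1 + s)^n - 1) * v) : A ≤ n * v := by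
  have h2 : ∀ s : ℝ, 0 < s → A ≤ (∑ k ∈ Finset.range n, (1 + s)^k) * v := by
    intro s hs
    have := h s hs
    rw [← geom_sum_mul, add_sub_cancel_left] at this
    have h3 : s * A ≤ s * ((∑ k ∈ Finset.range n, (1 + s)^k) * v) := by linarith
    exact le_of_mul_le_mul_left h3 hs
  have hc : Tendsto (fun s : ℝ => (∑ k ∈ Finset.range n, (1 + s)^k) * v) (𝓝[>] 0)
      (𝓝 ((∑ k ∈ Finset.range n, (1 + (0:ℝ))^k) * v)) := by
    apply tendsto_nhdsWithin_of_tendsto_nhds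
    apply Continuous.tendsto (f := fun s : ℝ => (∑ k ∈ Finset.range n, (1 + s)^k) * v)
    fun_prop
  have := ge_of_tendsto hc (eventually_nhdsWithin_of_forall (fun s hs => h2 s hs))
  simpa using this

variable {m : ℕ}

/-- facets -/
def Fc {κ : Type*} (ν : κ → EuclideanSpace ℝ (Fin (m+1))) (b : κ → ℝ) (i : κ) :
    Set (EuclideanSpace ℝ (Fin (m+1))) := {z ∈ PolE ν b | ⟪ν i, z⟫ = b i}

lemma meas_Fc {κ : Type*} (ν : κ → EuclideanSpace ℝ (Fin (m+1))) (b : κ → ℝ) (i : κ) :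
    MeasurableSet (Fc ν b i) :=
  ((closed_PolE ν b).inter (isClosed_eq (f := fun z => ⟪ν i, z⟫) (g := fun _ => b i) (by fun_prop) (by fun_prop))).measurableSet

lemma inner_le_one {V : Type*} [NormedAddCommGroup V] [InnerProductSpace ℝ V] {u v : V} (hu : ‖u‖ = 1) (hv : ‖v‖ = 1) : ⟪u, v⟫ ≤ 1 := by
  have := real_inner_le_norm u v
  rwa [hu, hv, mul_one] at this

lemma frontier_PolE {κ : Type*} [Finite κ] (ν : κ → EuclideanSpace ℝ (Fin (m+1))) (b : κ → ℝ) :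
    frontier (PolE ν b) ⊆ ⋃ i, Fc ν b i := by
  intro z hz
  have hzP := (closed_PolE ν b).frontier_subset hz
  by_contra hcon
  simp only [mem_iUnion, not_exists] at hcon
  apply hz.2
  have ho : IsOpen {x : EuclideanSpace ℝ (Fin (m+1)) | ∀ i, ⟪ν i, x⟫ < b i} := by
    simp only [setOf_forall]
    exact isOpen_iInter_of_finite (fun i => isOpen_lt (by fun_prop) (by fun_prop))
  exact interior_maximal (fun x hx i => (hx i).le) ho (fun i => lt_of_le_of_ne (hzP i) (fun h => hcon i ⟨hzP, h⟩))

theorem facet_sum (s : Finset (EuclideanSpace ℝ (Fin (m+1)))) (b : s → ℝ)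
    (h1 : ∀ i : s, ‖(i : EuclideanSpace ℝ (Fin (m+1)))‖ = 1) {ρ : ℝ} (hρ : 0 < ρ) (hb : ∀ i, ρ ≤ b i)
    (hfin : volume (PolE (fun i : s => (i : EuclideanSpace ℝ (Fin (m+1)))) b) ≠ ⊤) :
    ∑ i, μHE[m] (Fc (fun i : s => (i : EuclideanSpace ℝ (Fin (m+1)))) b i) ≤
      ENNReal.ofReal ((m+1) / ρ * (volume (PolE (fun i : s => (i : EuclideanSpace ℝ (Fin (m+1)))) b)).toReal) := by
  classical
  set ν : s → EuclideanSpace ℝ (Fin (m+1)) := fun i => i with hν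
  set Q := PolE ν b with hQ
  set M := ∑ i, μHE[m] (Fc ν b i) with hM
  have hνi : ∀ i, ‖ν i‖ = 1 := h1
  have prop : ∀ i, ∀ t x, x ∈ prism (ν i) (b i) (Fc ν b i) 0 t → ∃ σ, 0 < σ ∧ σ ≤ t ∧ ⟪ν i, x⟫ = b i + σ ∧
      x - σ • ν i ∈ Q := by
    intro i t x hx
    exact ⟨⟪ν i, x⟫ - b i, hx.2.1, hx.2.2, by ring, hx.1.1⟩
  have hdisj : ∀ t, Pairwise (Function.onFun Disjoint (fun i => prism (ν i) (b i) (Fc ν b i) 0 t)) := by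
    intro t i j hij
    rw [Function.onFun, Set.disjoint_left]
    intro x hx hy
    obtain ⟨σ, hσ, _, e1, q1⟩ := prop i t x hx
    obtain ⟨τ, hτ, _, e2, q2⟩ := prop j t x hy
    have a1 := q1 j
    have a2 := q2 i
    rw [inner_sub_right, real_inner_smul_right] at a1 a2
    have hlt : ⟪ν i, ν j⟫ < 1 := by
      refine lt_of_le_of_ne (inner_le_one (hνi i) (hνi j)) ?_
      intro h
      have := (inner_eq_one_iff_of_norm_eq_one (hνi i) (hνi j)).1 h
      exact hij (Subtype.ext this)
    rw [real_inner_comm (ν i) (ν j)] at a1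
    nlinarith [mul_pos (add_pos hσ hτ) (sub_pos.2 hlt)]
  have main : ∀ t : ℝ, 0 < t → volume Q + ENNReal.ofReal t * M ≤ ENNReal.ofReal ((1 + t/ρ)^(m+1)) * volume Q := by
    intro t ht
    have hU : volume (⋃ i, prism (ν i) (b i) (Fc ν b i) 0 t) = ENNReal.ofReal t * M := by
      rw [measure_iUnion (hdisj t) (fun i => meas_prism _ _ (meas_Fc ν b i) _ _), tsum_fintype, hM, Finset.mul_sum]
      refine Finset.sum_congr rfl fun i _ => ?_
      rw [vol_prism (ν i) (hνi i) (b i) (meas_Fc ν b i) (fun z hz => hz.2), sub_zero]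
    rw [← hU, ← measure_union (by
      rw [Set.disjoint_left]
      intro x hx hx2
      obtain ⟨i, hi⟩ := mem_iUnion.1 hx2
      obtain ⟨σ, hσ, _, e1, q1⟩ := prop i t x hi
      have := hx i
      linarith) (MeasurableSet.iUnion (fun i => meas_prism _ _ (meas_Fc ν b i) _ _))]
    have hr : 0 < 1 + t/ρ := by positivity
    have : ENNReal.ofReal ((1 + t/ρ)^(m+1)) * volume Q = volume ((1 + t/ρ) • Q) := by
      rw [Measure.addHaar_smul]; simp [abs_of_pos hr]
    rw [this]
    apply measure_mono
    intro x hx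
    rw [mem_smul_set_iff_inv_smul_mem₀ hr.ne']
    have hxx : ∀ j, ⟪ν j, x⟫ ≤ b j + t := by
      intro j
      rcases hx with hx | hx
      · have := hx j; linarith
      · obtain ⟨i, hi⟩ := mem_iUnion.1 hx
        obtain ⟨σ, hσ, hσt, e1, q1⟩ := prop i t x hi
        have a1 := q1 j
        rw [inner_sub_right, real_inner_smul_right] at a1
        nlinarith [inner_le_one (hνi j) (hνi i)]
    intro j
    rw [real_inner_smul_right, inv_mul_le_iff₀ hr]
    refine (hxx j).trans ?_
    have : t ≤ t / ρ * b j := by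
      rw [div_mul_eq_mul_div, le_div_iff₀ hρ]
      nlinarith [hb j]
    linarith
  have hMf : M ≠ ⊤ := by
    intro h
    have := main 1 one_pos
    rw [h] at this
    simp only [ENNReal.ofReal_one, one_mul, _root_.add_top, top_le_iff] at this
    exact (ENNReal.mul_ne_top ENNReal.ofReal_ne_top hfin) this
  have hR : ∀ r : ℝ, 0 < r → r * (ρ * M.toReal) ≤ ((1 + r)^(m+1) - 1) * (volume Q).toReal := by
    intro r hr
    have h := main (r * ρ) (by positivity)
    have h2 := ENNReal.toReal_mono (ENNReal.mul_ne_top ENNReal.ofReal_ne_top hfin) h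
    rw [ENNReal.toReal_add hfin (ENNReal.mul_ne_top ENNReal.ofReal_ne_top hMf), ENNReal.toReal_mul,
      ENNReal.toReal_mul, ENNReal.toReal_ofReal (by positivity), ENNReal.toReal_ofReal (by positivity),
      mul_div_cancel_right₀ _ hρ.ne'] at h2
    linarith
  have := pow_lim hR
  rw [← ENNReal.ofReal_toReal hMf]
  apply ENNReal.ofReal_le_ofReal
  rw [div_mul_eq_mul_div, le_div_iff₀ hρ]
  push_cast at this
  linarith

theorem upper {C : Set (EuclideanSpace ℝ (Fin (m+1)))} (hC : IsCompact C) (hc : Convex ℝ C)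
    {ρ : ℝ} (hρ : 0 < ρ) (hb : ball 0 ρ ⊆ C) :
    μHE[m] (frontier C) ≤ ENNReal.ofReal ((m+1) / ρ * (volume C).toReal) := by
  have hvf : volume C ≠ ⊤ := hC.measure_lt_top.ne
  have hi : (interior C).Nonempty := ⟨0, interior_maximal hb isOpen_ball (mem_ball_self hρ)⟩
  have step : ∀ η : ℝ, 0 < η → μHE[m] (frontier C) ≤
      ENNReal.ofReal ((m+1) / ρ * ((1 + η)^(m+1) * (volume C).toReal)) := by
    intro η hη
    obtain ⟨s, b, hne, h1, hρb, hPC, hCQ, _⟩ := poly_approx hC hc hρ hb hη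
    have hη1 : 0 < 1 + η := by linarith
    set Q := PolE (fun i : s => (i : EuclideanSpace ℝ (Fin (m+1)))) (fun i => (1 + η) * b i) with hQ
    have hQC : Q ⊆ (1 + η) • C := by
      intro x hx
      rw [mem_smul_set_iff_inv_smul_mem₀ hη1.ne']
      apply hPC
      intro i
      rw [real_inner_smul_right, inv_mul_le_iff₀ hη1]
      exact hx i
    have hQv : volume Q ≤ ENNReal.ofReal ((1 + η)^(m+1)) * volume C := by
      refine (measure_mono hQC).trans (le_of_eq ?_)
      rw [Measure.addHaar_smul]; simp [abs_of_pos hη1]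
    have hQf : volume Q ≠ ⊤ := ne_top_of_le_ne_top (ENNReal.mul_ne_top ENNReal.ofReal_ne_top hvf) hQv
    have hbdd : Bornology.IsBounded Q := (hC.smul (1 + η)).isBounded.subset hQC
    have hsub : C ⊆ Q := fun x hx i => hCQ x hx i
    have p1 : μHE[m] (frontier C) ≤ μHE[m] (frontier Q) := by
      apply proj_le (P := C) hC.isClosed.frontier_subset
      intro z hz
      have hzC := hC.isClosed.frontier_subset hz
      obtain ⟨u, hu, hux⟩ := support hc hi (y := z) hz.2
      obtain ⟨R, hR⟩ := hbdd.subset_closedBall z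
      obtain ⟨σ, hσ, _, hw⟩ := exit_pt (E := Q) (z := z) (u := u) (T := |R| + 1) (hsub hzC) (by positivity) (by
        intro h
        have := hR h
        rw [mem_closedBall, dist_eq_norm, add_sub_cancel_left, norm_smul, hu, mul_one, Real.norm_eq_abs,
          abs_of_nonneg (by positivity)] at this
        have := le_abs_self R
        linarith)
      refine ⟨_, hw, fun p hp => ?_⟩
      rw [add_sub_cancel_left, real_inner_smul_left, inner_sub_right]
      have := hux p hp
      nlinarith
    have p2 : μHE[m] (frontier Q) ≤ ∑ i : s, μHE[m] (Fc (fun i : s => (i : EuclideanSpace ℝ (Fin (m+1)))) (fun i => (1 + η) * b i) i) :=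
      (measure_mono (frontier_PolE _ _)).trans (measure_iUnion_fintype_le _ _)
    refine p1.trans (p2.trans ((facet_sum s _ h1 hρ hρb hQf).trans (ENNReal.ofReal_le_ofReal ?_)))
    have := ENNReal.toReal_mono (ENNReal.mul_ne_top ENNReal.ofReal_ne_top hvf) hQv
    rw [ENNReal.toReal_mul, ENNReal.toReal_ofReal (by positivity)] at this
    gcongr
  have hc : Tendsto (fun η : ℝ => ENNReal.ofReal ((m+1) / ρ * ((1 + η)^(m+1) * (volume C).toReal))) (𝓝[>] 0)
      (𝓝 (ENNReal.ofReal ((m+1) / ρ * ((1 + (0:ℝ))^(m+1) * (volume C).toReal)))) := by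
    apply tendsto_nhdsWithin_of_tendsto_nhds
    refine ENNReal.tendsto_ofReal ?_
    apply Continuous.tendsto (f := fun η : ℝ => (m+1) / ρ * ((1 + η)^(m+1) * (volume C).toReal))
    fun_prop
  have := ge_of_tendsto hc (eventually_nhdsWithin_of_forall (fun s hs => step s hs))
  simpa using this

lemma frontier_finite {C : Set (EuclideanSpace ℝ (Fin (m+1)))} (hC : IsCompact C) (hc : Convex ℝ C)
    (hi : (interior C).Nonempty) : μHE[m] (frontier C) ≠ ⊤ := by
  obtain ⟨x, hx⟩ := hi
  obtain ⟨ρ, hρ, hb⟩ := Metric.isOpen_iff.1 isOpen_interior x hx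
  have hiso := (IsometryEquiv.addRight (-x)).isometry
  have hfr : (IsometryEquiv.addRight (-x)) '' frontier C = frontier ((IsometryEquiv.addRight (-x)) '' C) :=
    (IsometryEquiv.addRight (-x)).toHomeomorph.image_frontier C
  rw [← hiso.euclideanHausdorffMeasure_image, hfr]
  refine ne_top_of_le_ne_top ENNReal.ofReal_ne_top (upper (hC.image hiso.continuous) ?_ hρ ?_)
  · have : (IsometryEquiv.addRight (-x)) '' C = (fun y => y + -x) '' C := rfl
    rw [this]
    simpa only [add_comm] using hc.translate (-x)
  · intro y hy
    refine ⟨y + x, interior_subset (hb ?_), by change y + x + -x = y; abel⟩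
    simpa [dist_eq_norm] using hy
end Geo

end

section
set_option linter.all false
open Filter
open scoped Topology

namespace Geo
open Measure
variable {m : ℕ}

theorem approx2 {E : Set (EuclideanSpace ℝ (Fin (m+1)))} (hE : IsCompact E) (hc : Convex ℝ E)
    (hi : (interior E).Nonempty) {η : ℝ} (hη : 0 < η) :
    ∃ (s : Finset (EuclideanSpace ℝ (Fin (m+1)))) (b : s → ℝ), Nonempty s ∧
      (∀ i : s, ‖(i : EuclideanSpace ℝ (Fin (m+1)))‖ = 1) ∧
      PolE (fun i : s => (i : EuclideanSpace ℝ (Fin (m+1)))) b ⊆ E ∧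
      (∀ x ∈ E, ∀ i : s, ⟪(i : EuclideanSpace ℝ (Fin (m+1))), x⟫ ≤ b i + η) ∧
      (volume E).toReal - η ≤ (volume (PolE (fun i : s => (i : EuclideanSpace ℝ (Fin (m+1)))) b)).toReal := by
  obtain ⟨x, hx⟩ := hi
  obtain ⟨ρ, hρ, hb⟩ := Metric.isOpen_iff.1 isOpen_interior x hx
  have hEf : volume E ≠ ⊤ := hE.measure_lt_top.ne
  set E0 : Set (EuclideanSpace ℝ (Fin (m+1))) := (fun y => y + -x) '' E with hE0
  have hE0c : IsCompact E0 := hE.image (by fun_prop)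
  have hE0v : Convex ℝ E0 := by simpa only [add_comm] using hc.translate (-x)
  have hb0 : ball 0 ρ ⊆ E0 := by
    intro y hy
    refine ⟨y + x, interior_subset (hb ?_), by change y + x + -x = y; abel⟩
    simpa [dist_eq_norm] using hy
  obtain ⟨R, hR⟩ := hE0c.isBounded.subset_closedBall 0
  have hvol0 : volume E0 = volume E := by
    have : E0 = (fun y => y + x) ⁻¹' E := by
      ext y; constructor
      · rintro ⟨z, hz, rfl⟩; simpa using hz
      · intro h; exact ⟨y + x, h, by change y + x + -x = y; abel⟩
    rw [this, measure_preimage_add_right]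
  have ev1 : ∀ᶠ e : ℝ in 𝓝[>] 0, e * |R| < η := by
    have : Tendsto (fun e : ℝ => e * |R|) (𝓝[>] 0) (𝓝 (0 * |R|)) :=
      tendsto_nhdsWithin_of_tendsto_nhds (Continuous.tendsto (by fun_prop) 0)
    exact this.eventually (gt_mem_nhds (by simpa using hη))
  have ev2 : ∀ᶠ e : ℝ in 𝓝[>] 0, (volume E).toReal - η < ((1 + e)⁻¹)^(m+1) * (volume E).toReal := by
    have : Tendsto (fun e : ℝ => ((1 + e)⁻¹)^(m+1) * (volume E).toReal) (𝓝[>] 0)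
        (𝓝 (((1 + (0:ℝ))⁻¹)^(m+1) * (volume E).toReal)) := by
      apply tendsto_nhdsWithin_of_tendsto_nhds
      have : ContinuousAt (fun e : ℝ => (1 + e)⁻¹) 0 := ContinuousAt.inv₀ (by fun_prop) (by norm_num)
      exact ((this.pow (m+1)).mul continuousAt_const).tendsto
    refine this.eventually (lt_mem_nhds ?_)
    simp; linarith
  obtain ⟨e, he1, he2, he0⟩ := (ev1.and (ev2.and self_mem_nhdsWithin)).exists
  have he0 : 0 < e := he0
  have he10 : 0 < 1 + e := by linarith
  obtain ⟨s, b, hne, h1, hρb, hPE, hEQ, hatt⟩ := poly_approx hE0c hE0v hρ hb0 he0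
  set P0 := PolE (fun i : s => (i : EuclideanSpace ℝ (Fin (m+1)))) b with hP0
  have hpe : PolE (fun i : s => (i : EuclideanSpace ℝ (Fin (m+1)))) (fun i => b i + ⟪(i : EuclideanSpace ℝ (Fin (m+1))), x⟫)
      = (fun y => y + -x) ⁻¹' P0 := by
    ext y
    simp only [PolE, hP0, mem_preimage, mem_setOf_eq]
    refine forall_congr' fun i => ?_
    rw [inner_add_right, inner_neg_right]
    constructor <;> intro h <;> linarith
  refine ⟨s, fun i => b i + ⟪(i : EuclideanSpace ℝ (Fin (m+1))), x⟫, hne, h1, ?_, ?_, ?_⟩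
  · rw [hpe]
    intro y hy
    obtain ⟨z, hz, hzy⟩ := hPE hy
    have : z = y := by simpa using hzy
    exact this ▸ hz
  · intro y hy i
    have h2 := hEQ (y + -x) ⟨y, hy, rfl⟩ i
    rw [inner_add_right, inner_neg_right] at h2
    obtain ⟨w, hw, hwe⟩ := hatt i
    have h3 : ‖w‖ ≤ R := by simpa using hR hw
    have h4 := real_inner_le_norm (i : EuclideanSpace ℝ (Fin (m+1))) w
    rw [h1 i, one_mul, hwe] at h4
    have hbp : 0 < b i := by
      have := hρb i
      by_contra hcon
      push Not at hcon
      have := mul_nonpos_of_nonneg_of_nonpos he10.le hcon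
      linarith
    have : e * b i ≤ e * |R| := by
      have := le_abs_self R
      apply mul_le_mul_of_nonneg_left _ he0.le
      nlinarith
    linarith
  · rw [hpe, measure_preimage_add_right]
    have hsub : (1 + e)⁻¹ • E0 ⊆ P0 := by
      rintro _ ⟨y, hy, rfl⟩ i
      simp only
      rw [real_inner_smul_right, inv_mul_le_iff₀ he10]
      exact hEQ y hy i
    have hPf : volume P0 ≠ ⊤ := ne_top_of_le_ne_top hE0c.measure_lt_top.ne (measure_mono hPE)
    have := ENNReal.toReal_mono hPf (measure_mono (μ := volume) hsub)
    rw [Measure.addHaar_smul, ENNReal.toReal_mul, hvol0] at this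
    refine le_trans he2.le (le_trans (le_of_eq ?_) this)
    congr 1
    rw [ENNReal.toReal_ofReal (abs_nonneg _), finrank_euclideanSpace_fin, abs_of_nonneg (by positivity)]

/-- relatively open facets -/
def Fo {κ : Type*} (ν : κ → EuclideanSpace ℝ (Fin (m+1))) (b : κ → ℝ) (i : κ) :
    Set (EuclideanSpace ℝ (Fin (m+1))) := {z | ⟪ν i, z⟫ = b i ∧ ∀ j, j ≠ i → ⟪ν j, z⟫ < b j}

lemma meas_Fo {κ : Type*} [Finite κ] (ν : κ → EuclideanSpace ℝ (Fin (m+1))) (b : κ → ℝ) (i : κ) :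
    MeasurableSet (Fo ν b i) := by
  have h1 : MeasurableSet {z | ⟪ν i, z⟫ = b i} :=
    (isClosed_eq (f := fun z => ⟪ν i, z⟫) (g := fun _ => b i) (by fun_prop) (by fun_prop)).measurableSet
  have h2 : MeasurableSet {z | ∀ j, j ≠ i → ⟪ν j, z⟫ < b j} := by
    have : {z | ∀ j, j ≠ i → ⟪ν j, z⟫ < b j} = ⋂ j, ⋂ (_ : j ≠ i), {z | ⟪ν j, z⟫ < b j} := by
      ext z; simp
    rw [this]
    exact MeasurableSet.iInter fun j => MeasurableSet.iInter fun _ =>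
      (isOpen_lt (f := fun z => ⟪ν j, z⟫) (g := fun _ => b j) (by fun_prop) (by fun_prop)).measurableSet
  exact h1.inter h2

lemma hyp_null {ν : EuclideanSpace ℝ (Fin (m+1))} (hν : ‖ν‖ = 1) (c : ℝ) : volume {x | ⟪ν, x⟫ = c} = 0 := by
  have : ({x | ⟪ν, x⟫ = c} : Set (EuclideanSpace ℝ (Fin (m+1)))) = (AffineSubspace.mk' (c • ν) (LinearMap.ker (innerₛₗ ℝ ν)) : AffineSubspace ℝ _) := by
    ext x
    simp only [mem_setOf_eq, SetLike.mem_coe, AffineSubspace.mem_mk', vsub_eq_sub, LinearMap.mem_ker, innerₛₗ_apply_apply, inner_sub_right, real_inner_smul_right, real_inner_self_eq_norm_sq, hν]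
    constructor <;> intro h <;> linarith
  rw [this]
  apply Measure.addHaar_affineSubspace
  intro htop
  have h2 : c • ν + ν ∈ ({x | ⟪ν, x⟫ = c} : Set (EuclideanSpace ℝ (Fin (m+1)))) := by
    rw [this, htop]; trivial
  simp only [mem_setOf_eq, inner_add_right, real_inner_smul_right, real_inner_self_eq_norm_sq, hν] at h2
  linarith
end Geo

end

section
set_option linter.all false
open Filter
open scoped Topology

namespace Geo
open Measure
variable {m : ℕ}

lemma add_mem_smul {B : Set (EuclideanSpace ℝ (Fin (m+1)))} (hc : Convex ℝ B) (hb : closedBall 0 1 ⊆ B)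
    {r t : ℝ} (hr : 0 ≤ r) (ht : 0 ≤ t) {x y : EuclideanSpace ℝ (Fin (m+1))} (hx : x ∈ r • B) (hy : ‖y‖ ≤ t) :
    x + y ∈ (r + t) • B := by
  rw [hc.add_smul hr ht]
  refine add_mem_add hx (smul_set_mono hb ?_)
  rw [smul_unitClosedBall_of_nonneg ht]
  simpa using hy

lemma smul_int {B : Set (EuclideanSpace ℝ (Fin (m+1)))} (hc : Convex ℝ B) (hb : closedBall 0 1 ⊆ B)
    {r : ℝ} (hr : 0 ≤ r) (hr1 : r < 1) : r • B ⊆ interior B := by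
  intro x hx
  rw [mem_interior]
  refine ⟨ball x (1 - r), ?_, isOpen_ball, mem_ball_self (by linarith)⟩
  intro y hy
  rw [mem_ball, dist_eq_norm] at hy
  have := add_mem_smul hc hb hr (sub_nonneg.2 hr1.le) hx hy.le
  simpa using this

theorem layer_le {B E : Set (EuclideanSpace ℝ (Fin (m+1)))} (hB : IsCompact B) (hc : Convex ℝ B)
    (hb : closedBall 0 1 ⊆ B) (hE : IsCompact E)
    (s : Finset (EuclideanSpace ℝ (Fin (m+1)))) (b : s → ℝ) (hne : Nonempty s)
    (h1 : ∀ i : s, ‖(i : EuclideanSpace ℝ (Fin (m+1)))‖ = 1)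
    (hPE : PolE (fun i : s => (i : EuclideanSpace ℝ (Fin (m+1)))) b ⊆ E) {η h l : ℝ}
    (hEP : ∀ x ∈ E, ∀ i : s, ⟪(i : EuclideanSpace ℝ (Fin (m+1))), x⟫ ≤ b i + η)
    (hη : 0 ≤ η) (hh : 0 < h) (hl : 0 < l) (hlt : l + h + η < 1) :
    volume ((l • B ∩ PolE (fun i : s => (i : EuclideanSpace ℝ (Fin (m+1)))) b) \
      PolE (fun i : s => (i : EuclideanSpace ℝ (Fin (m+1)))) (fun i => b i - h)) ≤
    ENNReal.ofReal h * μHE[m] (frontier E ∩ interior B) := by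
  classical
  set ν : s → EuclideanSpace ℝ (Fin (m+1)) := fun i => i with hν
  have hνi : ∀ i, ‖ν i‖ = 1 := h1
  have hlt1 : ∀ i j, i ≠ j → ⟪ν i, ν j⟫ < 1 := by
    intro i j hij
    refine lt_of_le_of_ne (inner_le_one (hνi i) (hνi j)) ?_
    intro h
    have := (inner_eq_one_iff_of_norm_eq_one (hνi i) (hνi j)).1 h
    exact hij (Subtype.ext this)
  set S : s → Set (EuclideanSpace ℝ (Fin (m+1))) := fun i => Fo ν b i ∩ (l + h) • B with hS
  have hSm : ∀ i, MeasurableSet (S i) := fun i =>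
    (meas_Fo ν b i).inter (hB.smul (l + h)).isClosed.measurableSet
  have hcov : ((l • B ∩ PolE ν b) \ PolE ν (fun i => b i - h)) ⊆
      (⋃ i, {x | ⟪ν i, x⟫ = b i}) ∪ ⋃ i, prism (ν i) (b i) (S i) (-h) 0 := by
    rintro x ⟨⟨hxB, hxP⟩, hxn⟩
    obtain ⟨i, hi⟩ := Finite.exists_max (fun i => ⟪ν i, x⟫ - b i)
    have hle : ⟪ν i, x⟫ - b i ≤ 0 := by have := hxP i; linarith
    rcases hle.eq_or_lt with he | hlt0
    · left
      exact mem_iUnion.2 ⟨i, by simp only [mem_setOf_eq]; linarith⟩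
    · right
      refine mem_iUnion.2 ⟨i, ?_, ?_⟩
      · refine ⟨⟨?_, ?_⟩, ?_⟩
        · rw [inner_sub_right, real_inner_smul_right, real_inner_self_eq_norm_sq, hνi]; ring
        · intro j hj
          rw [inner_sub_right, real_inner_smul_right]
          have a1 := hi j
          have a2 := hlt1 j i hj
          beta_reduce at a1
          nlinarith
        · rw [sub_eq_add_neg]
          refine add_mem_smul hc hb hl.le hh.le hxB ?_
          rw [norm_neg, norm_smul, hνi, mul_one, Real.norm_eq_abs, abs_of_neg hlt0]
          by_contra hcon
          push Not at hcon
          refine hxn (fun j => ?_)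
          have := hi j
          beta_reduce at this
          linarith
      · refine ⟨?_, hle⟩
        by_contra hcon
        push Not at hcon
        refine hxn (fun j => ?_)
        have := hi j
        beta_reduce at this
        linarith
  have hnull : volume (⋃ i, {x | ⟪ν i, x⟫ = b i}) = 0 :=
    measure_iUnion_null (fun i => hyp_null (hνi i) (b i))
  have hdisj : Pairwise (Function.onFun Disjoint S) := by
    intro i j hij
    rw [Function.onFun, Set.disjoint_left]
    intro x hx hy
    have a1 := hx.1.1
    have a2 := hy.1.2 i hij
    linarith
  have hproj : μHE[m] (⋃ i, S i) ≤ μHE[m] (frontier E ∩ interior B) := by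
    apply proj_le (P := PolE ν b)
    · intro x hx j
      obtain ⟨i, hi⟩ := mem_iUnion.1 hx
      by_cases hji : j = i
      · subst hji; exact hi.1.1.le
      · exact (hi.1.2 j hji).le
    · intro z hz
      obtain ⟨i, hi⟩ := mem_iUnion.1 hz
      have hzP : z ∈ PolE ν b := by
        intro j
        by_cases hji : j = i
        · subst hji; exact hi.1.1.le
        · exact (hi.1.2 j hji).le
      obtain ⟨σ, hσ, _, hw⟩ := exit_pt (E := E) (z := z) (u := ν i) (T := η + 1) (hPE hzP) (by linarith) (by
        intro hcon
        have := hEP _ hcon i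
        rw [inner_add_right, real_inner_smul_right] at this
        have e1 : ⟪(i : EuclideanSpace ℝ (Fin (m+1))), ν i⟫ = 1 := by
          change ⟪ν i, ν i⟫ = 1
          rw [real_inner_self_eq_norm_sq, hνi]; norm_num
        have e2 : ⟪(i : EuclideanSpace ℝ (Fin (m+1))), z⟫ = b i := hi.1.1
        rw [e1, e2] at this
        linarith)
      have hση : σ ≤ η := by
        have := hEP _ (hE.isClosed.frontier_subset hw) i
        rw [inner_add_right, real_inner_smul_right] at this
        have e1 : ⟪(i : EuclideanSpace ℝ (Fin (m+1))), ν i⟫ = 1 := by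
          change ⟪ν i, ν i⟫ = 1
          rw [real_inner_self_eq_norm_sq, hνi]; norm_num
        have e2 : ⟪(i : EuclideanSpace ℝ (Fin (m+1))), z⟫ = b i := hi.1.1
        rw [e1, e2] at this
        linarith
      refine ⟨_, ⟨hw, ?_⟩, ?_⟩
      · refine smul_int hc hb (r := l + h + η) (by linarith) hlt (add_mem_smul hc hb (by linarith) hη hi.2 ?_)
        rw [norm_smul, hνi, mul_one, Real.norm_eq_abs, abs_of_nonneg hσ]
        exact hση
      · intro p hp
        rw [add_sub_cancel_left, real_inner_smul_left, inner_sub_right, hi.1.1]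
        have := hp i
        nlinarith
  calc _ ≤ volume ((⋃ i, {x | ⟪ν i, x⟫ = b i}) ∪ ⋃ i, prism (ν i) (b i) (S i) (-h) 0) := measure_mono hcov
    _ ≤ volume (⋃ i, prism (ν i) (b i) (S i) (-h) 0) := by
        refine (measure_union_le _ _).trans ?_
        rw [hnull, zero_add]
    _ ≤ ∑ i, volume (prism (ν i) (b i) (S i) (-h) 0) := measure_iUnion_fintype_le _ _
    _ = ENNReal.ofReal h * ∑ i, μHE[m] (S i) := by
        rw [Finset.mul_sum]
        refine Finset.sum_congr rfl fun i _ => ?_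
        rw [vol_prism (ν i) (hνi i) (b i) (hSm i) (fun z hz => hz.1.1), sub_neg_eq_add, zero_add]
    _ = ENNReal.ofReal h * μHE[m] (⋃ i, S i) := by
        rw [measure_iUnion hdisj hSm, tsum_fintype]
    _ ≤ _ := by gcongr

theorem lower {B E : Set (EuclideanSpace ℝ (Fin (m+1)))} (hB : IsCompact B) (hc : Convex ℝ B)
    (hb : closedBall 0 1 ⊆ B) (hE : IsCompact E) (hEc : Convex ℝ E) (hEi : (interior E).Nonempty) {c : ℝ} (hc0 : 0 ≤ c)
    (hCT : ∀ (s : Finset (EuclideanSpace ℝ (Fin (m+1)))) (b : s → ℝ), Nonempty s →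
      (∀ i : s, ‖(i : EuclideanSpace ℝ (Fin (m+1)))‖ = 1) → ∀ δ, 0 < δ → δ ≤ 1 →
      δ * c * min (volume (B ∩ PolE (fun i : s => (i : EuclideanSpace ℝ (Fin (m+1)))) b)).toReal
        ((volume B).toReal - (volume (B ∩ PolE (fun i : s => (i : EuclideanSpace ℝ (Fin (m+1)))) b)).toReal) ≤
      (volume (B ∩ PolE (fun i : s => (i : EuclideanSpace ℝ (Fin (m+1)))) b)).toReal -
        (volume (B ∩ PolE (fun i : s => (i : EuclideanSpace ℝ (Fin (m+1)))) (fun i => b i - δ))).toReal) :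
    c * min (volume (E ∩ B)).toReal ((volume B).toReal - (volume (E ∩ B)).toReal) ≤
      (μHE[m] (frontier E ∩ interior B)).toReal := by
  have hBf : volume B ≠ ⊤ := hB.measure_lt_top.ne
  have hEf : volume E ≠ ⊤ := hE.measure_lt_top.ne
  have hHf : μHE[m] (frontier E ∩ interior B) ≠ ⊤ :=
    ne_top_of_le_ne_top (frontier_finite hE hEc hEi) (measure_mono inter_subset_left)
  set H := (μHE[m] (frontier E ∩ interior B)).toReal with hH
  set v := (volume B).toReal with hv
  set mm := (volume (E ∩ B)).toReal with hmm
  have step : ∀ e : ℝ, 0 < e → e < 1/8 → c * (min mm (v - mm) - e - (1 - (1 - 4*e)^(m+1)) * v) ≤ H := by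
    intro e he he1
    obtain ⟨s, b, hne, h1, hPE, hEP, hvol⟩ := approx2 hE hEc hEi he
    set l := 1 - 4 * e with hl
    have hl0 : 0 < l := by linarith
    have hl1 : l ≤ 1 := by linarith
    have hsc : ∀ t, volume (l • B ∩ PolE (fun i : s => (i : EuclideanSpace ℝ (Fin (m+1)))) (fun i => b i - t)) =
        ENNReal.ofReal (l^(m+1)) * volume (B ∩ PolE (fun i : s => (i : EuclideanSpace ℝ (Fin (m+1)))) (fun i => b i / l - t / l)) := by
      intro t
      have : l • B ∩ PolE (fun i : s => (i : EuclideanSpace ℝ (Fin (m+1)))) (fun i => b i - t) =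
          l • (B ∩ PolE (fun i : s => (i : EuclideanSpace ℝ (Fin (m+1)))) (fun i => b i / l - t / l)) := by
        rw [smul_set_inter₀ hl0.ne']
        congr 1
        ext x
        rw [mem_smul_set_iff_inv_smul_mem₀ hl0.ne']
        refine forall_congr' fun i => ?_
        rw [real_inner_smul_right, inv_mul_le_iff₀ hl0, mul_sub, mul_div_cancel₀ _ hl0.ne', mul_div_cancel₀ _ hl0.ne']
      rw [this, Measure.addHaar_smul, finrank_euclideanSpace_fin, abs_of_nonneg (by positivity)]
    set P := PolE (fun i : s => (i : EuclideanSpace ℝ (Fin (m+1)))) b with hP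
    have hsc0 := hsc 0
    simp only [sub_zero, zero_div] at hsc0
    have hct := hCT s (fun i => b i / l) hne h1 (e / l) (by positivity) (by rw [div_le_one hl0]; linarith)
    have hlay := layer_le hB hc hb hE s b hne h1 hPE hEP he.le he hl0 (h := e) (by linarith)
    have hfin : volume (l • B) ≠ ⊤ := (hB.smul l).measure_lt_top.ne
    have hAf : ∀ A : Set (EuclideanSpace ℝ (Fin (m+1))), volume (l • B ∩ A) ≠ ⊤ := fun A =>
      ne_top_of_le_ne_top hfin (measure_mono inter_subset_left)
    have hlB : l • B ⊆ B := (smul_int hc hb hl0.le (by linarith)).trans interior_subset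
    have hln : 0 < l^(m+1) := by positivity
    have hvl : (volume (l • B)).toReal = l^(m+1) * v := by
      rw [Measure.addHaar_smul, finrank_euclideanSpace_fin, abs_of_nonneg hln.le, ENNReal.toReal_mul,
        ENNReal.toReal_ofReal hln.le]
    have hp := congrArg ENNReal.toReal hsc0
    have hp' := congrArg ENNReal.toReal (hsc e)
    rw [ENNReal.toReal_mul, ENNReal.toReal_ofReal hln.le] at hp hp'
    set G := (volume (B ∩ PolE (fun i : s => (i : EuclideanSpace ℝ (Fin (m+1)))) (fun i => b i / l))).toReal with hG
    set G' := (volume (B ∩ PolE (fun i : s => (i : EuclideanSpace ℝ (Fin (m+1)))) (fun i => b i / l - e / l))).toReal with hG'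
    have hpP : (volume (l • B ∩ P)).toReal = l^(m+1) * G := hp
    set Q := PolE (fun i : s => (i : EuclideanSpace ℝ (Fin (m+1)))) (fun i => b i - e) with hQ
    have hl2 := ENNReal.toReal_mono (ENNReal.mul_ne_top ENNReal.ofReal_ne_top hHf) hlay
    rw [ENNReal.toReal_mul, ENNReal.toReal_ofReal he.le, ← hH] at hl2
    have h3 : (volume (l • B ∩ P)).toReal ≤ (volume ((l • B ∩ P) \ Q)).toReal + (volume (l • B ∩ Q)).toReal := by
      have hsub : l • B ∩ P ⊆ ((l • B ∩ P) \ Q) ∪ (l • B ∩ Q) := by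
        intro x hx
        by_cases hxQ : x ∈ Q
        · exact Or.inr ⟨hx.1, hxQ⟩
        · exact Or.inl ⟨hx, hxQ⟩
      have hf1 : volume ((l • B ∩ P) \ Q) ≠ ⊤ := ne_top_of_le_ne_top (hAf P) (measure_mono diff_subset)
      rw [← ENNReal.toReal_add hf1 (hAf Q)]
      exact ENNReal.toReal_mono (ENNReal.add_ne_top.2 ⟨hf1, hAf Q⟩) ((measure_mono hsub).trans (measure_union_le _ _))
    rw [hpP, hp'] at h3
    have h4 : c * min (l^(m+1) * G) (l^(m+1) * v - l^(m+1) * G) ≤ H := by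
      have e1 : min (l^(m+1) * G) (l^(m+1) * v - l^(m+1) * G) = l^(m+1) * min G (v - G) := by
        rw [← mul_sub, mul_min_of_nonneg _ _ hln.le]
      rw [e1]
      have h5 : l^(m+1) * (e / l * c * min G (v - G)) ≤ e * H := by
        refine (mul_le_mul_of_nonneg_left hct hln.le).trans ?_
        rw [mul_sub]; linarith
      have h6 : e * (c * (l^(m+1) * min G (v - G))) ≤ e * (l * H) := by
        have := mul_le_mul_of_nonneg_left h5 hl0.le
        have e2 : l * (l^(m+1) * (e / l * c * min G (v - G))) = e * (c * (l^(m+1) * min G (v - G))) := by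
          field_simp
        rw [e2] at this
        linarith
      have h7 := le_of_mul_le_mul_left h6 he
      have hH0 : 0 ≤ H := ENNReal.toReal_nonneg
      nlinarith
    refine le_trans (mul_le_mul_of_nonneg_left ?_ hc0) h4
    have q1 : l^(m+1) * G ≤ mm := by
      rw [← hpP]
      refine ENNReal.toReal_mono (ne_top_of_le_ne_top hBf (measure_mono inter_subset_right)) (measure_mono ?_)
      exact fun x hx => ⟨hPE hx.2, hlB hx.1⟩
    have q2 : mm ≤ l^(m+1) * G + e + (1 - l^(m+1)) * v := by
      have hsub : E ∩ B ⊆ (l • B ∩ P) ∪ ((E \ P) ∪ (B \ (l • B))) := by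
        intro x hx
        by_cases h1 : x ∈ P
        · by_cases h2 : x ∈ l • B
          · exact Or.inl ⟨h2, h1⟩
          · exact Or.inr (Or.inr ⟨hx.2, h2⟩)
        · exact Or.inr (Or.inl ⟨hx.1, h1⟩)
      have d1 : (volume (E \ P)).toReal ≤ e := by
        have := measureReal_sdiff (μ := volume) hPE (closed_PolE _ b).measurableSet hEf
        simp only [measureReal_def] at this
        linarith
      have d2 : (volume (B \ (l • B))).toReal = v - l^(m+1) * v := by
        have := measureReal_sdiff (μ := volume) hlB (hB.smul l).isClosed.measurableSet hBf
        simp only [measureReal_def] at this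
        rw [this, hvl]
      have f1 : volume (E \ P) ≠ ⊤ := ne_top_of_le_ne_top hEf (measure_mono diff_subset)
      have f2 : volume (B \ (l • B)) ≠ ⊤ := ne_top_of_le_ne_top hBf (measure_mono diff_subset)
      have f12 := ENNReal.add_ne_top.2 ⟨f1, f2⟩
      have := ENNReal.toReal_mono (ENNReal.add_ne_top.2 ⟨hAf P, f12⟩)
        ((measure_mono hsub).trans ((measure_union_le _ _).trans (add_le_add le_rfl (measure_union_le _ _))))
      rw [ENNReal.toReal_add (hAf P) f12, ENNReal.toReal_add f1 f2, d2, hpP] at this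
      linarith
    have hm1 := min_le_left mm (v - mm)
    have hm2 := min_le_right mm (v - mm)
    apply le_min <;> linarith
  have hT : Tendsto (fun e : ℝ => c * (min mm (v - mm) - e - (1 - (1 - 4*e)^(m+1)) * v)) (𝓝[>] 0)
      (𝓝 (c * (min mm (v - mm) - 0 - (1 - (1 - 4*(0:ℝ))^(m+1)) * v))) := by
    apply tendsto_nhdsWithin_of_tendsto_nhds
    apply Continuous.tendsto (f := fun e : ℝ => c * (min mm (v - mm) - e - (1 - (1 - 4*e)^(m+1)) * v))
    fun_prop
  have hev : ∀ᶠ e : ℝ in 𝓝[>] 0, c * (min mm (v - mm) - e - (1 - (1 - 4*e)^(m+1)) * v) ≤ H := by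
    filter_upwards [Ioo_mem_nhdsGT (show (0:ℝ) < 1/8 by norm_num)] with e he
    exact step e he.1 he.2
  have := le_of_tendsto hT hev
  simpa using this
end Geo

end

section
set_option linter.all false
open Filter
open scoped Topology

namespace Geo
open Measure
variable {m : ℕ}

lemma ball_sub {B : Set (EuclideanSpace ℝ (Fin (m+1)))} (hB : IsCompact B) (hc : Convex ℝ B)
    (hi : (interior B).Nonempty) (hsym : B = -B) (hv : 0 < volume B)
    (h2 : ∀ u : EuclideanSpace ℝ (Fin (m+1)), ‖u‖ = 1 → (∫ x in B, ⟪x, u⟫ ^ 2) = (volume B).toReal) :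
    closedBall 0 1 ⊆ B := by
  have hvf : volume B ≠ ⊤ := hB.measure_lt_top.ne
  have hvp : 0 < (volume B).toReal := ENNReal.toReal_pos hv.ne' hvf
  have hball : ball (0 : EuclideanSpace ℝ (Fin (m+1))) 1 ⊆ B := by
    intro x hx
    by_contra hxB
    obtain ⟨u, hu, hux⟩ := support hc hi (y := x) (fun h => hxB (interior_subset h))
    set r := ⟪u, x⟫ with hr
    have hr1 : r < 1 := by
      have h1 := real_inner_le_norm u x
      have h2 : ‖x‖ < 1 := by simpa using hx
      rw [hu, one_mul] at h1
      linarith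
    have hneg : ∀ y ∈ B, -r ≤ ⟪u, y⟫ := by
      intro y hy
      have : -y ∈ B := by rw [hsym]; simpa using hy
      have := hux _ this
      rw [inner_neg_right] at this
      linarith
    have hr0 : 0 ≤ r := by
      obtain ⟨y, hy⟩ := hi
      have a := hux y (interior_subset hy)
      have b := hneg y (interior_subset hy)
      linarith
    have hle : ∫ x in B, ⟪x, u⟫ ^ 2 ≤ ∫ x in B, r^2 := by
      apply setIntegral_mono_on
      · exact (ContinuousOn.integrableOn_compact hB (Continuous.continuousOn (by fun_prop)))
      · exact integrableOn_const hvf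
      · exact hB.isClosed.measurableSet
      · intro y hy
        rw [real_inner_comm]
        have a := hux y hy
        have b := hneg y hy
        exact sq_le_sq' b a
    rw [h2 u hu, setIntegral_const, smul_eq_mul, measureReal_def] at hle
    have hr2 : r ^ 2 < 1 := by nlinarith
    nlinarith
  calc closedBall (0 : EuclideanSpace ℝ (Fin (m+1))) 1 = closure (ball 0 1) := (closure_ball _ one_ne_zero).symm
    _ ⊆ B := closure_minimal hball hB.isClosed

theorem CTE {B : Set (EuclideanSpace ℝ (Fin (m+1)))} (hm : 2 ≤ m + 1) (hB : IsCompact B) (hc : Convex ℝ B) (hv : 0 < volume B)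
    (h1 : (∫ x in B, x) = 0)
    (h2 : ∀ u : EuclideanSpace ℝ (Fin (m+1)), ‖u‖ = 1 → (∫ x in B, ⟪x, u⟫ ^ 2) = (volume B).toReal)
    (s : Finset (EuclideanSpace ℝ (Fin (m+1)))) (b : s → ℝ) (hne : Nonempty s)
    (hs : ∀ i : s, ‖(i : EuclideanSpace ℝ (Fin (m+1)))‖ = 1) (δ : ℝ) (hδ : 0 < δ) (hδ1 : δ ≤ 1) :
      δ * (1 / (42 * Poly.rr (m+1))) * min (volume (B ∩ PolE (fun i : s => (i : EuclideanSpace ℝ (Fin (m+1)))) b)).toReal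
        ((volume B).toReal - (volume (B ∩ PolE (fun i : s => (i : EuclideanSpace ℝ (Fin (m+1)))) b)).toReal) ≤
      (volume (B ∩ PolE (fun i : s => (i : EuclideanSpace ℝ (Fin (m+1)))) b)).toReal -
        (volume (B ∩ PolE (fun i : s => (i : EuclideanSpace ℝ (Fin (m+1)))) (fun i => b i - δ))).toReal := by
  classical
  have hT := PiLp.volume_preserving_toLp (Fin (m+1))
  have hemb : MeasurableEmbedding (WithLp.toLp 2 : (Fin (m+1) → ℝ) → EuclideanSpace ℝ (Fin (m+1))) :=
    (MeasurableEquiv.toLp 2 (Fin (m+1) → ℝ)).measurableEmbedding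
  set B' : Set (Fin (m+1) → ℝ) := WithLp.toLp 2 ⁻¹' B with hB'
  have hBB : B' = (WithLp.ofLp : EuclideanSpace ℝ (Fin (m+1)) → _) '' B := by
    ext x; constructor
    · intro h; exact ⟨_, h, rfl⟩
    · rintro ⟨y, hy, rfl⟩; exact hy
  have hB'c : IsCompact B' := by rw [hBB]; exact hB.image (PiLp.continuous_ofLp 2 _)
  have hB'v : Convex ℝ B' := hc.linear_preimage (WithLp.linearEquiv 2 ℝ (Fin (m+1) → ℝ)).symm.toLinearMap
  have hvol : ∀ A : Set (EuclideanSpace ℝ (Fin (m+1))), volume (WithLp.toLp 2 ⁻¹' A : Set (Fin (m+1) → ℝ)) = volume A :=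
    fun A => hT.measure_preimage_emb hemb A
  have hintr : ∀ g : EuclideanSpace ℝ (Fin (m+1)) → ℝ, ∫ x in B', g (WithLp.toLp 2 x) = ∫ y in B, g y :=
    fun g => hT.setIntegral_preimage_emb hemb g B
  have hcI : ∀ g : EuclideanSpace ℝ (Fin (m+1)) → ℝ, Continuous g → IntegrableOn g B := fun g hg =>
    ContinuousOn.integrableOn_compact hB hg.continuousOn
  have hq : ∀ w : EuclideanSpace ℝ (Fin (m+1)), (∫ x in B, ⟪x, w⟫ ^ 2) = ‖w‖^2 * (volume B).toReal := by
    intro w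
    by_cases hw : w = 0
    · subst hw; simp
    · have hn : ‖w‖ ≠ 0 := norm_ne_zero_iff.2 hw
      have := h2 (‖w‖⁻¹ • w) (by rw [norm_smul, norm_inv, norm_norm, inv_mul_cancel₀ hn])
      rw [← this, ← integral_const_mul]
      congr 1
      ext x
      rw [real_inner_smul_right]
      field_simp
  have e1 : ∀ i, ∫ x in B', x i = 0 := by
    intro i
    rw [hintr (fun y => y i)]
    have := (EuclideanSpace.proj i : EuclideanSpace ℝ (Fin (m+1)) →L[ℝ] ℝ).integral_comp_comm (μ := volume.restrict B) (φ := fun x => x)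
      (ContinuousOn.integrableOn_compact hB continuousOn_id)
    rw [h1, map_zero] at this
    exact this
  have hcoord : ∀ i, ∀ x : EuclideanSpace ℝ (Fin (m+1)), ⟪x, EuclideanSpace.single i (1:ℝ)⟫ = x i := by
    intro i x; rw [EuclideanSpace.inner_single_right]; simp
  have hdiag : ∀ i, ∫ x in B, x i ^ 2 = (volume B).toReal := by
    intro i
    have := hq (EuclideanSpace.single i (1:ℝ))
    simpa only [hcoord, EuclideanSpace.norm_single, norm_one, one_pow, one_mul] using this
  have e2 : ∀ i j, ∫ x in B', x i * x j = if i = j then (volume B').toReal else 0 := by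
    intro i j
    rw [hintr (fun y => y i * y j), hvol]
    split_ifs with hij
    · subst hij
      rw [← hdiag i]
      simp only [sq]
    · have := hq (EuclideanSpace.single i (1:ℝ) + EuclideanSpace.single j (1:ℝ))
      rw [norm_add_sq_real] at this
      simp only [inner_add_right, hcoord, EuclideanSpace.norm_single, norm_one] at this
      have hs1 : (EuclideanSpace.single i (1:ℝ) : EuclideanSpace ℝ (Fin (m+1))) j = 0 := by
        simp [Ne.symm hij]
      rw [hs1] at this
      have hexp : ∀ x : EuclideanSpace ℝ (Fin (m+1)), (x i + x j)^2 = x i ^ 2 + x j ^ 2 + 2 * (x i * x j) := fun x => by ring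
      simp only [hexp] at this
      rw [integral_add, integral_add, hdiag, hdiag, integral_const_mul] at this
      · linarith
      · exact hcI _ (by fun_prop)
      · exact hcI _ (by fun_prop)
      · exact hcI (fun x => x i ^ 2 + x j ^ 2) (by fun_prop)
      · exact hcI _ (by fun_prop)
  have hdt : ∀ a x : EuclideanSpace ℝ (Fin (m+1)), Poly.dt a.ofLp x.ofLp = ⟪a, x⟫ := by
    intro a x
    simp only [Poly.dt, PiLp.inner_apply]
    refine Finset.sum_congr rfl fun k _ => ?_
    simp [mul_comm]
  have hgv : ∀ t, Poly.gv B' (fun i : s => (i : EuclideanSpace ℝ (Fin (m+1))).ofLp) b t =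
      (volume (B ∩ PolE (fun i : s => (i : EuclideanSpace ℝ (Fin (m+1)))) (fun i => b i + t))).toReal := by
    intro t
    rw [Poly.gv, ← hvol]
    congr 2
    ext x
    simp only [hB', Poly.Pol, PolE, mem_inter_iff, mem_preimage, mem_setOf_eq, ← hdt]
  have := Poly.CT hB'c hB'v (by rw [hvol]; exact hv) hm e1 e2 (fun i : s => (i : EuclideanSpace ℝ (Fin (m+1))).ofLp)
    (by
      intro i
      have := hs i
      rw [EuclideanSpace.norm_eq, Real.sqrt_eq_one] at this
      simpa using this)
    (by
      intro i j hij
      exact Subtype.ext (WithLp.ofLp_injective 2 hij)) b hδ hδ1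
  rw [hgv, hgv, hvol] at this
  simp only [add_zero] at this
  simp only [sub_eq_add_neg] at this ⊢
  rwa [mul_one_div]

theorem frontier_pos {B : Set (EuclideanSpace ℝ (Fin (m+1)))} (hB : IsCompact B) (hc : Convex ℝ B)
    (hb : closedBall 0 1 ⊆ B) {c : ℝ} (hcp : 0 < c) (hv : 0 < volume B)
    (hlow : ∀ E : Set (EuclideanSpace ℝ (Fin (m+1))), IsCompact E → Convex ℝ E → (interior E).Nonempty →
      c * min (volume (E ∩ B)).toReal ((volume B).toReal - (volume (E ∩ B)).toReal) ≤
      (μHE[m] (frontier E ∩ interior B)).toReal) : 0 < (μHE[m] (frontier B)).toReal := by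
  have hvf : volume B ≠ ⊤ := hB.measure_lt_top.ne
  have hvp : 0 < (volume B).toReal := ENNReal.toReal_pos hv.ne' hvf
  have h0 : (0 : EuclideanSpace ℝ (Fin (m+1))) ∈ interior B :=
    interior_maximal (ball_subset_closedBall.trans hb) isOpen_ball (mem_ball_self one_pos)
  have hi : (interior B).Nonempty := ⟨0, h0⟩
  have h2 : (2⁻¹ : ℝ) ≠ 0 := by norm_num
  have hintr : (interior ((2⁻¹ : ℝ) • B)).Nonempty := by
    rw [interior_smul₀ h2]; exact hi.smul_set
  have h := hlow ((2⁻¹ : ℝ) • B) (hB.smul _) (hc.smul _) hintr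
  have hsub : (2⁻¹ : ℝ) • B ⊆ B := (smul_int hc hb (by norm_num) (by norm_num)).trans interior_subset
  have hp : (volume ((2⁻¹ : ℝ) • B)).toReal = (2⁻¹ : ℝ)^(m+1) * (volume B).toReal := by
    rw [Measure.addHaar_smul, finrank_euclideanSpace_fin, abs_of_nonneg (by positivity), ENNReal.toReal_mul,
        ENNReal.toReal_ofReal (by positivity)]
  rw [inter_eq_self_of_subset_left hsub, hp] at h
  have hpow : (2⁻¹ : ℝ)^(m+1) < 1 := pow_lt_one₀ (by norm_num) (by norm_num) (by simp)
  have hpos : 0 < c * min ((2⁻¹ : ℝ)^(m+1) * (volume B).toReal) ((volume B).toReal - (2⁻¹ : ℝ)^(m+1) * (volume B).toReal) := by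
    apply mul_pos hcp
    apply lt_min
    · positivity
    · nlinarith
  have h3 := hpos.trans_le h
  have hfr : frontier ((2⁻¹ : ℝ) • B) = (2⁻¹ : ℝ) • frontier B :=
    ((Homeomorph.smulOfNeZero (2⁻¹ : ℝ) h2).image_frontier B).symm
  apply ENNReal.toReal_pos
  · intro hz
    have h4 : μHE[m] (frontier ((2⁻¹ : ℝ) • B) ∩ interior B) = 0 := by
      apply measure_mono_null inter_subset_left
      rw [hfr, euclideanHausdorffMeasure_smul₀ m h2, hz, smul_zero]
    rw [h4] at h3
    simp at h3
  · exact frontier_finite hB hc hi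

theorem final {B E : Set (EuclideanSpace ℝ (Fin (m+1)))} (hm : 2 ≤ m + 1) (hB : IsCompact B) (hc : Convex ℝ B)
    (hi : (interior B).Nonempty) (hE : IsCompact E) (hEc : Convex ℝ E) (hEi : (interior E).Nonempty)
    (hsym : B = -B) (hv : 0 < volume B) (h1 : (∫ x in B, x) = 0)
    (h2 : ∀ u : EuclideanSpace ℝ (Fin (m+1)), ‖u‖ = 1 → (∫ x in B, ⟪x, u⟫ ^ 2) = (volume B).toReal) :
    (μH[((m+1 : ℕ) : ℝ) - 1] (frontier E ∩ interior B)).toReal / (μH[((m+1 : ℕ) : ℝ) - 1] (frontier B)).toReal ≥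
      (1 / (42 * Real.sqrt (8 * 15000000))) / (((m+1 : ℕ) : ℝ) * Real.sqrt (Real.log ((m+1 : ℕ) : ℝ))) *
        min ((volume (E ∩ B)).toReal / (volume B).toReal) (1 - (volume (E ∩ B)).toReal / (volume B).toReal) := by
  have hb := ball_sub hB hc hi hsym hv h2
  have hvf : volume B ≠ ⊤ := hB.measure_lt_top.ne
  have hvp : 0 < (volume B).toReal := ENNReal.toReal_pos hv.ne' hvf
  have hrr := Poly.rr_ge hm
  have hcp : 0 < 1 / (42 * Poly.rr (m+1)) := by positivity
  have hlow : ∀ E : Set (EuclideanSpace ℝ (Fin (m+1))), IsCompact E → Convex ℝ E → (interior E).Nonempty →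
      1 / (42 * Poly.rr (m+1)) * min (volume (E ∩ B)).toReal ((volume B).toReal - (volume (E ∩ B)).toReal) ≤
      (μHE[m] (frontier E ∩ interior B)).toReal := fun E a1 a2 a3 =>
    lower hB hc hb a1 a2 a3 hcp.le (CTE hm hB hc hv h1 h2)
  have hpos := frontier_pos hB hc hb hcp hv hlow
  have hup := upper hB hc one_pos (ball_subset_closedBall.trans hb)
  have hlo := hlow E hE hEc hEi
  have hup' := ENNReal.toReal_mono ENNReal.ofReal_ne_top hup
  rw [ENNReal.toReal_ofReal (by positivity), div_one] at hup'
  have hcast : ((m+1 : ℕ) : ℝ) - 1 = (m : ℝ) := by push_cast; ring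
  have hk0 : addHaarScalarFactor (volume : Measure (EuclideanSpace ℝ (Fin m))) μH[m] ≠ 0 :=
    addHaarScalarFactor_volume_hausdorffMeasure_ne_zero m
  have hconv : ∀ A : Set (EuclideanSpace ℝ (Fin (m+1))), (μHE[m] A).toReal =
      (addHaarScalarFactor (volume : Measure (EuclideanSpace ℝ (Fin m))) μH[m] : ℝ) * (μH[(m:ℝ)] A).toReal := by
    intro A
    rw [euclideanHausdorffMeasure_def, Measure.smul_apply, ENNReal.smul_def, smul_eq_mul, ENNReal.toReal_mul,
      ENNReal.coe_toReal]
  have hratio : (μH[((m+1 : ℕ) : ℝ) - 1] (frontier E ∩ interior B)).toReal / (μH[((m+1 : ℕ) : ℝ) - 1] (frontier B)).toReal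
      = (μHE[m] (frontier E ∩ interior B)).toReal / (μHE[m] (frontier B)).toReal := by
    rw [hcast, hconv, hconv, mul_div_mul_left _ _ (by exact_mod_cast hk0)]
  rw [hratio, ge_iff_le]
  set v := (volume B).toReal with hvdef
  set mm := (volume (E ∩ B)).toReal with hmm
  have hmmv : mm ≤ v := ENNReal.toReal_mono hvf (measure_mono inter_subset_right)
  have hmm0 : 0 ≤ mm := ENNReal.toReal_nonneg
  have hrr2 : Poly.rr (m+1) = Real.sqrt (8 * 15000000) * Real.sqrt (Real.log ((m+1 : ℕ) : ℝ)) := by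
    rw [Poly.rr, Real.sqrt_mul (by norm_num)]
  have hmin : min (mm / v) (1 - mm / v) = min mm (v - mm) / v := by
    rw [← min_div_div_right hvp.le, sub_div, div_self hvp.ne']
  have hmin0 : 0 ≤ min mm (v - mm) := le_min hmm0 (by linarith)
  calc _ = 1 / (42 * Poly.rr (m+1)) * min mm (v - mm) / ((m+1) * v) := by
        rw [hmin, hrr2]
        push_cast
        simp only [div_eq_mul_inv, mul_inv]
        ring
    _ ≤ (μHE[m] (frontier E ∩ interior B)).toReal / (μHE[m] (frontier B)).toReal := by
        gcongr
end Geo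

end

/-- Euclidean relative isoperimetry for isotropic symmetric bodies. -/
theorem euclidean_relative_isoperimetry :
    ∃ ce : ℝ, 0 < ce ∧ ∀ d : ℕ, 2 ≤ d →
      ∀ B E : Set (Euc d), IsConvexBody B → IsConvexBody E → B = -B →
        (∫ x in B, x) = 0 →
        (∀ u : Euc d, ‖u‖ = 1 → (∫ x in B, ⟪x, u⟫ ^ 2) = (volume B).toReal) →
        0 < volume (E ∩ B) → volume (E ∩ B) < volume B →
        (μH[(d : ℝ) - 1] (frontier E ∩ interior B)).toReal /
            (μH[(d : ℝ) - 1] (frontier B)).toReal ≥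
          ce / ((d : ℝ) * Real.sqrt (Real.log d)) *
            min ((volume (E ∩ B)).toReal / (volume B).toReal)
              (1 - (volume (E ∩ B)).toReal / (volume B).toReal) := by
  refine ⟨1 / (42 * Real.sqrt (8 * 15000000)), by positivity, ?_⟩
  intro d hd B E hB hE hsym h1 h2 hpos hlt
  obtain ⟨m, rfl⟩ : ∃ m, d = m + 1 := ⟨d - 1, by omega⟩
  exact Geo.final hd hB.1 hB.2.1 hB.2.2 hE.1 hE.2.1 hE.2.2 hsym
    (hpos.trans hlt) h1 h2
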